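/- Let γ be a generic smooth closed curve in ℝ³ with graphic α ⊂ X₂, let v be the number of valence-four vertices of α, let r be the number of connected components of X₂ \ α, and let f be the number of simply connected components of X₂ \ α. Then v = f, and either r = f + 1 or r = f + 2; the latter occurs exactly when one component of X₂ \ α is homeomorphic to a Möbius band. -/

import Mathlib

open Real Set

noncomputable section

namespace KWidth

/-! ### Lines in the plane (equivalently, planes in `ℝ³` perpendicular to the `xy`-plane).
A triple `L = (a, b, c)` with `(a,b) ≠ (0,0)` represents the line `{a x + b y = c}` in `ℝ²`,
equivalently the vertical plane `{a x + b y = c}` in `ℝ³`. -/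

def IsLine (L : ℝ × ℝ × ℝ) : Prop := (L.1, L.2.1) ≠ (0, 0)

def lineSet (L : ℝ × ℝ × ℝ) : Set (ℝ × ℝ) := {p | L.1 * p.1 + L.2.1 * p.2 = L.2.2}

/-- The affine function whose zero set cuts out the line, evaluated along the curve. -/
def hFun (γ : ℝ → ℝ × ℝ) (L : ℝ × ℝ × ℝ) : ℝ → ℝ :=
  fun t => L.1 * (γ t).1 + L.2.1 * (γ t).2 - L.2.2

/-- Parameters (in one period) at which the curve meets the line. -/
def memParams (γ : ℝ → ℝ × ℝ) (L : ℝ × ℝ × ℝ) : Set ℝ :=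
  {t | t ∈ Ico (0 : ℝ) 1 ∧ γ t ∈ lineSet L}

/-- The width of a line: the number of intersection points with the closed curve `γ`
(of period one). -/
def lineWidth (γ : ℝ → ℝ × ℝ) (L : ℝ × ℝ × ℝ) : ℕ := Nat.card (memParams γ L)

/-- The line is transverse to the curve: at every intersection point the tangent line of the
curve is not contained in it. -/
def TransverseLine (γ : ℝ → ℝ × ℝ) (L : ℝ × ℝ × ℝ) : Prop :=
  IsLine L ∧ ∀ t : ℝ, γ t ∈ lineSet L → deriv (hFun γ L) t ≠ 0

/-- The line `L` is tangent to the curve at the parameter `t`. -/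
def TangentAt (γ : ℝ → ℝ × ℝ) (L : ℝ × ℝ × ℝ) (t : ℝ) : Prop :=
  IsLine L ∧ γ t ∈ lineSet L ∧ deriv (hFun γ L) t = 0

/-! ### Curvature of plane curves -/

def speed (γ : ℝ → ℝ × ℝ) (t : ℝ) : ℝ :=
  Real.sqrt ((deriv (fun s => (γ s).1) t) ^ 2 + (deriv (fun s => (γ s).2) t) ^ 2)

/-- Signed curvature of a regular plane curve (in an arbitrary regular parametrization). -/
def signedCurv (γ : ℝ → ℝ × ℝ) (t : ℝ) : ℝ :=
  (deriv (fun s => (γ s).1) t * deriv (deriv fun s => (γ s).2) t -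
      deriv (fun s => (γ s).2) t * deriv (deriv fun s => (γ s).1) t) / speed γ t ^ 3

/-- Total curvature of a closed plane curve of period one: the integral of the absolute value of
the curvature with respect to arc length. -/
def totalCurv (γ : ℝ → ℝ × ℝ) : ℝ := ∫ t in (0:ℝ)..1, |signedCurv γ t| * speed γ t

/-! ### Crossings, inflection points, double tangent lines -/

/-- `p` is a self-intersection (crossing) point of the closed curve `γ`. -/
def CrossingPt (γ : ℝ → ℝ × ℝ) (p : ℝ × ℝ) : Prop :=
  ∃ s ∈ Ico (0:ℝ) 1, ∃ t ∈ Ico (0:ℝ) 1, s ≠ t ∧ γ s = p ∧ γ t = p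

def crossingCount (γ : ℝ → ℝ × ℝ) : ℕ := Nat.card {p | CrossingPt γ p}

def inflectionParams (γ : ℝ → ℝ × ℝ) : Set ℝ := {t | t ∈ Ico (0:ℝ) 1 ∧ signedCurv γ t = 0}

def inflectionCount (γ : ℝ → ℝ × ℝ) : ℕ := Nat.card (inflectionParams γ)

/-- The set of points at which a given line is tangent to the curve. -/
def tangencyPts (γ : ℝ → ℝ × ℝ) (L : ℝ × ℝ × ℝ) : Set (ℝ × ℝ) :=
  {p | ∃ t ∈ Ico (0:ℝ) 1, TangentAt γ L t ∧ γ t = p}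

/-- `L` is a double tangent line: it is tangent to the curve at exactly two points. -/
def IsDoubleTangent (γ : ℝ → ℝ × ℝ) (L : ℝ × ℝ × ℝ) : Prop :=
  IsLine L ∧ ∃ p q : ℝ × ℝ, p ≠ q ∧ tangencyPts γ L = {p, q}

/-- A subset `ℓ ⊆ ℝ²` is a double tangent line of `γ`. -/
def IsDoubleTangentLine (γ : ℝ → ℝ × ℝ) (ℓ : Set (ℝ × ℝ)) : Prop :=
  ∃ L, lineSet L = ℓ ∧ IsDoubleTangent γ L

/-- An exterior double tangent line: the curve lies locally on the same side of the line at its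
two points of tangency. -/
def IsExtDoubleTangentLine (γ : ℝ → ℝ × ℝ) (ℓ : Set (ℝ × ℝ)) : Prop :=
  ∃ L, lineSet L = ℓ ∧ IsDoubleTangent γ L ∧
    ∃ s ∈ Ico (0:ℝ) 1, ∃ t ∈ Ico (0:ℝ) 1, γ s ≠ γ t ∧ TangentAt γ L s ∧ TangentAt γ L t ∧
      0 < deriv (deriv (hFun γ L)) s * deriv (deriv (hFun γ L)) t

/-- An interior double tangent line: the curve lies locally on opposite sides of the line at its
two points of tangency (the line separates neighborhoods of the tangency points). -/
def IsIntDoubleTangentLine (γ : ℝ → ℝ × ℝ) (ℓ : Set (ℝ × ℝ)) : Prop :=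
  ∃ L, lineSet L = ℓ ∧ IsDoubleTangent γ L ∧
    ∃ s ∈ Ico (0:ℝ) 1, ∃ t ∈ Ico (0:ℝ) 1, γ s ≠ γ t ∧ TangentAt γ L s ∧ TangentAt γ L t ∧
      deriv (deriv (hFun γ L)) s * deriv (deriv (hFun γ L)) t < 0

/-! ### Generic plane curves -/

/-- A generic (`C²`, immersed, closed) plane curve: finitely many self-intersections, all of them
transverse double points, finitely many inflection points, finitely many double tangent lines,
all of them nondegenerate, no line tangent to the curve at more than two points, and no tangent
line at an inflection point or double tangency passing through a crossing. -/
structure GenericPlane (γ : ℝ → ℝ × ℝ) : Prop where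
  contDiff : ContDiff ℝ 2 γ
  periodic : Function.Periodic γ 1
  immersed : ∀ t, deriv γ t ≠ 0
  selfint_finite : {p : ℝ × ℝ | CrossingPt γ p}.Finite
  crossings_transverse : ∀ s ∈ Ico (0:ℝ) 1, ∀ t ∈ Ico (0:ℝ) 1, s ≠ t → γ s = γ t →
    (deriv γ s).1 * (deriv γ t).2 - (deriv γ s).2 * (deriv γ t).1 ≠ 0
  no_triple_point : ∀ s ∈ Ico (0:ℝ) 1, ∀ t ∈ Ico (0:ℝ) 1, ∀ u ∈ Ico (0:ℝ) 1,
    γ s = γ t → γ t = γ u → s = t ∨ t = u ∨ s = u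
  inflections_finite : (inflectionParams γ).Finite
  dbltangents_finite : {ℓ : Set (ℝ × ℝ) | IsDoubleTangentLine γ ℓ}.Finite
  no_triple_tangent : ∀ L : ℝ × ℝ × ℝ, IsLine L → ∀ p ∈ tangencyPts γ L, ∀ q ∈ tangencyPts γ L,
    ∀ r ∈ tangencyPts γ L, p = q ∨ q = r ∨ p = r
  dbltangent_nondeg : ∀ L : ℝ × ℝ × ℝ, IsDoubleTangent γ L → ∀ t, TangentAt γ L t →
    deriv (deriv (hFun γ L)) t ≠ 0
  tangent_at_inflection_avoids_crossings : ∀ L : ℝ × ℝ × ℝ, ∀ t : ℝ, TangentAt γ L t →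
    signedCurv γ t = 0 → ∀ p : ℝ × ℝ, CrossingPt γ p → p ∉ lineSet L
  dbltangent_avoids_crossings : ∀ L : ℝ × ℝ × ℝ, IsDoubleTangent γ L →
    ∀ p : ℝ × ℝ, CrossingPt γ p → p ∉ lineSet L

/-! ### Equivalence classes of transverse lines and the 2-width -/

/-- Two lines are connected by a path of lines transverse to the curve `γ`. -/
def LineHomotopic (γ : ℝ → ℝ × ℝ) (L₀ L₁ : ℝ × ℝ × ℝ) : Prop :=
  ∃ P : ℝ → ℝ × ℝ × ℝ, ContinuousOn P (Icc 0 1) ∧ P 0 = L₀ ∧ P 1 = L₁ ∧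
    ∀ s ∈ Icc (0:ℝ) 1, TransverseLine γ (P s)

/-- The type of lines transverse to `γ`. -/
def TLine (γ : ℝ → ℝ × ℝ) := {L : ℝ × ℝ × ℝ // TransverseLine γ L}

def lineRel (γ : ℝ → ℝ × ℝ) : TLine γ → TLine γ → Prop :=
  fun L₀ L₁ => LineHomotopic γ L₀.val L₁.val

/-- Equivalence classes of lines transverse to `γ`. -/
def LineClasses (γ : ℝ → ℝ × ℝ) := Quot (lineRel γ)

/-- The 2-width of a closed plane curve: the sum, over the equivalence classes of transverse
lines, of the width of a representative line. -/
def w₂ (γ : ℝ → ℝ × ℝ) : ℕ := ∑ᶠ C : LineClasses γ, lineWidth γ (Quot.out C).val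

/-! ### Space curves -/

/-- Vertical projection `π : ℝ³ → ℝ²` applied to a space curve. -/
def proj (γ : ℝ → ℝ × ℝ × ℝ) : ℝ → ℝ × ℝ := fun t => ((γ t).1, (γ t).2.1)

/-- A smooth embedded closed curve in `ℝ³`, parametrized with period one. -/
def SmoothClosedCurve (γ : ℝ → ℝ × ℝ × ℝ) : Prop :=
  ContDiff ℝ (⊤ : ℕ∞) γ ∧ Function.Periodic γ 1 ∧ (∀ t, deriv γ t ≠ 0) ∧
    Set.InjOn γ (Ico (0:ℝ) 1)

/-- A generic smooth closed curve in `ℝ³`: smooth, embedded, no tangent line parallel to the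
`z`-axis, and the vertical projection is a generic plane curve. -/
def GenericSpace (γ : ℝ → ℝ × ℝ × ℝ) : Prop :=
  SmoothClosedCurve γ ∧ (∀ t, deriv (proj γ) t ≠ 0) ∧ GenericPlane (proj γ)

/-- A vertical plane `{a x + b y = c}` in `ℝ³` meets the curve `γ` exactly where the line
`{a x + b y = c}` in `ℝ²` meets `π(γ)`, and transversality/width agree; so the 2-width of a
space curve is the 2-width of its projection computed with lines in `ℝ²`. -/
def w₂Space (γ : ℝ → ℝ × ℝ × ℝ) : ℕ := w₂ (proj γ)

/-! ### Isotopy and knots -/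

/-- Smooth closed curves `γ₀, γ₁` in `ℝ³` are isotopic: one deforms to the other through smooth
embedded closed curves. -/
def Isotopic (γ₀ γ₁ : ℝ → ℝ × ℝ × ℝ) : Prop :=
  ∃ F : ℝ → ℝ → ℝ × ℝ × ℝ, Continuous (Function.uncurry F) ∧
    (∀ s ∈ Icc (0:ℝ) 1, SmoothClosedCurve (F s)) ∧ F 0 = γ₀ ∧ F 1 = γ₁

/-- The round unit circle in the `xy`-plane. -/
def roundCircle : ℝ → ℝ × ℝ × ℝ := fun t => (Real.cos (2 * π * t), Real.sin (2 * π * t), 0)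

/-- A curve is unknotted if it is isotopic to a round circle. -/
def Unknot (γ : ℝ → ℝ × ℝ × ℝ) : Prop := Isotopic γ roundCircle

/-- The `(p,q)`-torus curve on the standardly embedded torus in `ℝ³`, winding `p` times around
one generating circle and `q` times around the other. -/
def torusKnot (p q : ℤ) : ℝ → ℝ × ℝ × ℝ := fun t =>
  ((2 + Real.cos (2 * π * (q : ℝ) * t)) * Real.cos (2 * π * (p : ℝ) * t),
   (2 + Real.cos (2 * π * (q : ℝ) * t)) * Real.sin (2 * π * (p : ℝ) * t),
   Real.sin (2 * π * (q : ℝ) * t))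

/-- The 2-width of the knot (isotopy class) represented by `γ₀`: the minimum of the 2-widths of
its generic representatives. -/
def knotW2 (γ₀ : ℝ → ℝ × ℝ × ℝ) : ℕ :=
  sInf {w : ℕ | ∃ γ, GenericSpace γ ∧ Isotopic γ γ₀ ∧ w₂Space γ = w}

/-- Braid position: in cylindrical coordinates `γ(s) = (r(s), θ(s), z(s))` with `r > 0` and
`θ' > 0`. -/
def BraidPosition (γ : ℝ → ℝ × ℝ × ℝ) : Prop :=
  ∃ r θ z : ℝ → ℝ, ContDiff ℝ (⊤ : ℕ∞) r ∧ ContDiff ℝ (⊤ : ℕ∞) θ ∧ ContDiff ℝ (⊤ : ℕ∞) z ∧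
    (∀ t, 0 < r t) ∧ (∀ t, 0 < deriv θ t) ∧
    ∀ t, γ t = (r t * Real.cos (θ t), r t * Real.sin (θ t), z t)


/-! ### The space `X₂` as a topological space, the graphic, and the Möbius band -/

/-- Two parameter triples represent the same line iff they are proportional. -/
def lineSetoid : Setoid {L : ℝ × ℝ × ℝ // IsLine L} where
  r L L' := ∃ c : ℝ, c ≠ 0 ∧ L'.val = c • L.val
  iseqv := by
    refine ⟨fun L => ⟨1, one_ne_zero, (one_smul _ _).symm⟩, ?_, ?_⟩
    · rintro L M ⟨c, hc, h⟩
      exact ⟨c⁻¹, inv_ne_zero hc, by rw [h, smul_smul, inv_mul_cancel₀ hc, one_smul]⟩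
    · rintro L M N ⟨c, hc, h⟩ ⟨d, hd, h'⟩
      exact ⟨d * c, mul_ne_zero hd hc, by rw [h', h, smul_smul]⟩

/-- The space `X₂` of lines in the plane (equivalently, of planes in `ℝ³` perpendicular to the
`xy`-plane), an open Möbius band, with the quotient topology. -/
def X₂sp := Quotient lineSetoid

instance : TopologicalSpace X₂sp := instTopologicalSpaceQuotient

/-- The graphic of a curve: the set of all its tangent lines, as a subset of `X₂`. -/
def graphic (γ : ℝ → ℝ × ℝ) : Set X₂sp :=
  {x | ∃ L : {L : ℝ × ℝ × ℝ // IsLine L}, Quotient.mk lineSetoid L = x ∧ ∃ t : ℝ, TangentAt γ L.val t}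

/-- The set of lines (as points of `X₂`) that are *not* transverse to `γ`. -/
def nonTransverse (γ : ℝ → ℝ × ℝ) : Set X₂sp :=
  {x | ∃ L : {L : ℝ × ℝ × ℝ // IsLine L}, Quotient.mk lineSetoid L = x ∧ ¬ TransverseLine γ L.val}

/-- The standard open Möbius band: the quotient of `ℝ²` by `(x, y) ∼ (x + 1, -y)`. -/
def mobiusSetoid : Setoid (ℝ × ℝ) where
  r p q := ∃ k : ℤ, q.1 = p.1 + k ∧ q.2 = (-1 : ℝ) ^ k * p.2
  iseqv := by
    have hne : (-1 : ℝ) ≠ 0 := by norm_num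
    refine ⟨fun p => ⟨0, by simp⟩, ?_, ?_⟩
    · rintro p q ⟨k, h1, h2⟩
      refine ⟨-k, by rw [h1]; push_cast; ring, ?_⟩
      rw [h2, ← mul_assoc, ← zpow_add₀ hne]
      simp
    · rintro p q s ⟨k, h1, h2⟩ ⟨l, h3, h4⟩
      refine ⟨k + l, by rw [h3, h1]; push_cast; ring, ?_⟩
      rw [h4, h2, ← mul_assoc, ← zpow_add₀ hne, add_comm l k]

def MobiusBand := Quotient mobiusSetoid

instance : TopologicalSpace MobiusBand := instTopologicalSpaceQuotient

section

open Topology Filter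

section

section Band

variable {J : Type*}

/-- Fibrewise strictly increasing surjections straighten an open subset of `J × ℝ`. -/
theorem fiber_openMap [TopologicalSpace J] {E : Set (J × ℝ)} (hE : IsOpen E) {f : J × ℝ → ℝ}
    (hf : ContinuousOn f E) (hmono : ∀ j, StrictMonoOn (fun p => f (j, p)) {p | (j, p) ∈ E})
    (hsurj : ∀ j y, ∃ p, (j, p) ∈ E ∧ f (j, p) = y) :
    IsOpenMap (fun x : E => ((x : J × ℝ).1, f x)) := by
  rw [IsOpenMap.eq_1]
  have key : ∀ j0 p0, (j0, p0) ∈ E → ∀ V ∈ 𝓝 (j0, p0),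
      {z : J × ℝ | ∃ p, (z.1, p) ∈ E ∧ (z.1, p) ∈ V ∧ f (z.1, p) = z.2} ∈ 𝓝 (j0, f (j0, p0)) := by
    intro j0 p0 h0 V hV
    have hVE : V ∩ E ∈ 𝓝 (j0, p0) := inter_mem hV (hE.mem_nhds h0)
    rw [nhds_prod_eq, mem_prod_iff] at hVE
    obtain ⟨N, hN, M, hM, hNM⟩ := hVE
    obtain ⟨ε, hε, hM'⟩ := Metric.mem_nhds_iff.1 hM
    have hin : ∀ j ∈ N, ∀ p, |p - p0| < ε → (j, p) ∈ V ∩ E := fun j hj p hp =>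
      hNM ⟨hj, hM' (by simpa [Real.dist_eq] using hp)⟩
    have hj0 := mem_of_mem_nhds hN
    have e1 : (j0, p0 - ε / 2) ∈ E := (hin j0 hj0 _ (by rw [abs_lt]; constructor <;> linarith)).2
    have e2 : (j0, p0 + ε / 2) ∈ E := (hin j0 hj0 _ (by rw [abs_lt]; constructor <;> linarith)).2
    have l1 : f (j0, p0 - ε / 2) < f (j0, p0) := hmono j0 e1 h0 (by linarith)
    have l2 : f (j0, p0) < f (j0, p0 + ε / 2) := hmono j0 h0 e2 (by linarith)
    obtain ⟨c1, hc1, hc1'⟩ := exists_between l1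
    obtain ⟨c2, hc2, hc2'⟩ := exists_between l2
    have n1 : ∀ᶠ j in 𝓝 j0, f (j, p0 - ε / 2) < c1 := by
      have := (hf.continuousAt (hE.mem_nhds e1)).comp (f := fun j => (j, p0 - ε / 2)) (x := j0)
        (by fun_prop)
      exact this.eventually_lt_const hc1
    have n2 : ∀ᶠ j in 𝓝 j0, c2 < f (j, p0 + ε / 2) := by
      have := (hf.continuousAt (hE.mem_nhds e2)).comp (f := fun j => (j, p0 + ε / 2)) (x := j0)
        (by fun_prop)
      exact this.eventually_const_lt hc2'
    rw [nhds_prod_eq]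
    have := ((n1.and n2).and hN).prod_mk (Ioo_mem_nhds hc1' hc2)
    filter_upwards [this] with z hz
    obtain ⟨⟨⟨h1, h2⟩, h3⟩, h4, h5⟩ := hz
    obtain ⟨p, hp, hpy⟩ := hsurj z.1 z.2
    have m1 : p0 - ε / 2 < p := by
      by_contra hh
      have := (hmono z.1).monotoneOn hp (hin _ h3 (p0 - ε / 2)
        (by rw [abs_lt]; constructor <;> linarith)).2 (not_lt.1 hh)
      linarith
    have m2 : p < p0 + ε / 2 := by
      by_contra hh
      have := (hmono z.1).monotoneOn (hin _ h3 (p0 + ε / 2)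
        (by rw [abs_lt]; constructor <;> linarith)).2 hp (not_lt.1 hh)
      linarith
    exact ⟨p, hp, (hin _ h3 p (by rw [abs_lt]; constructor <;> linarith)).1, hpy⟩
  intro U hU
  obtain ⟨V, hV, rfl⟩ := isOpen_induced_iff.1 hU
  rw [isOpen_iff_mem_nhds]
  rintro _ ⟨⟨⟨j0, p0⟩, h0⟩, hxV, rfl⟩
  filter_upwards [key j0 p0 h0 V (hV.mem_nhds hxV)] with z hz
  obtain ⟨p, hp, hpV, hz⟩ := hz
  exact ⟨⟨(z.1, p), hp⟩, hpV, Prod.ext rfl hz⟩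

/-- The homeomorphism obtained from `fiber_openMap`. -/
def fiberHomeo [TopologicalSpace J] {E : Set (J × ℝ)} (hE : IsOpen E) {f : J × ℝ → ℝ}
    (hf : ContinuousOn f E) (hmono : ∀ j, StrictMonoOn (fun p => f (j, p)) {p | (j, p) ∈ E})
    (hsurj : ∀ j y, ∃ p, (j, p) ∈ E ∧ f (j, p) = y) : E ≃ₜ J × ℝ :=
  Equiv.toHomeomorphOfContinuousOpen
    (Equiv.ofBijective (fun x : E => ((x : J × ℝ).1, f x)) (by
      constructor
      · rintro ⟨⟨j, p⟩, h⟩ ⟨⟨j', p'⟩, h'⟩ he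
        simp only [Prod.mk.injEq] at he
        obtain ⟨rfl, he⟩ := he
        have := (hmono j).injOn h h' he
        simp [this]
      · rintro ⟨j, y⟩
        obtain ⟨p, hp, hy⟩ := hsurj j y
        exact ⟨⟨(j, p), hp⟩, by simp [hy]⟩))
    ((by fun_prop : Continuous fun x : E => (x : J × ℝ).1).prodMk
      (continuousOn_iff_continuous_domRestrict.1 hf))
    (fiber_openMap hE hf hmono hsurj)

/-- The distance to the complement, cut off at one. -/
def cutDist [MetricSpace J] (E : Set (J × ℝ)) (x : J × ℝ) : ℝ := (min 1 (Metric.infEDist x Eᶜ)).toReal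

theorem cutDist_continuous [MetricSpace J] (E : Set (J × ℝ)) : Continuous (cutDist E) := by
  have : Continuous fun x => min 1 (Metric.infEDist x Eᶜ) :=
    continuous_const.min Metric.continuous_infEDist
  exact ENNReal.continuousOn_toReal.comp_continuous this
    (fun x => (lt_of_le_of_lt (min_le_left _ _) ENNReal.one_lt_top).ne)

theorem cutDist_le_one [MetricSpace J] (E : Set (J × ℝ)) (x : J × ℝ) : cutDist E x ≤ 1 := by
  have := ENNReal.toReal_mono ENNReal.one_ne_top (min_le_left 1 (Metric.infEDist x Eᶜ))
  simpa [cutDist] using this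

theorem cutDist_nonneg [MetricSpace J] (E : Set (J × ℝ)) (x : J × ℝ) : 0 ≤ cutDist E x :=
  ENNReal.toReal_nonneg

theorem cutDist_pos [MetricSpace J] {E : Set (J × ℝ)} (hE : IsOpen E) {x : J × ℝ} (hx : x ∈ E) :
    0 < cutDist E x := by
  refine ENNReal.toReal_pos ?_ (lt_of_le_of_lt (min_le_left _ _) ENNReal.one_lt_top).ne
  have : 0 < Metric.infEDist x Eᶜ := by
    rw [Metric.infEDist_pos_iff_notMem_closure, hE.isClosed_compl.closure_eq]
    simpa using hx
  exact (lt_min one_pos this).ne'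

theorem cutDist_le [MetricSpace J] {E : Set (J × ℝ)} {j : J} {p u : ℝ} (hu : (j, u) ∉ E) :
    cutDist E (j, p) ≤ |p - u| := by
  have h1 : min 1 (Metric.infEDist (j, p) Eᶜ) ≤ edist (j, p) (j, u) :=
    (min_le_right _ _).trans (Metric.infEDist_le_edist_of_mem hu)
  have := ENNReal.toReal_mono (edist_ne_top _ _) h1
  have h2 : (edist (j, p) (j, u)).toReal = |p - u| := by
    rw [← dist_edist, Prod.dist_eq]
    simp [Real.dist_eq]
  rwa [h2] at this

/-- An open subset of `J × ℝ` with nonempty interval fibres admits a fibrewise increasing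
coordinate with range all of `ℝ`. -/
theorem exists_band [MetricSpace J] {E : Set (J × ℝ)} (hE : IsOpen E)
    (hord : ∀ j, OrdConnected {p | (j, p) ∈ E}) (hne : ∀ j, ∃ p, (j, p) ∈ E) :
    ∃ f : J × ℝ → ℝ, ContinuousOn f E ∧
      (∀ j, StrictMonoOn (fun p => f (j, p)) {p | (j, p) ∈ E}) ∧
      ∀ j y, ∃ p, (j, p) ∈ E ∧ f (j, p) = y := by
  obtain ⟨s, hs⟩ : ∃ s : C(J, ℝ), ∀ j, s j ∈ {p | (j, p) ∈ E} := by
    refine exists_continuous_forall_mem_convex_of_local_const (fun j => (hord j).convex) ?_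
    intro j
    obtain ⟨p, hp⟩ := hne j
    refine ⟨p, ?_⟩
    have : ContinuousAt (fun j => (j, p)) j := by fun_prop
    exact this.preimage_mem_nhds (hE.mem_nhds hp)
  set δ : J × ℝ → ℝ := fun x =>
    sInf ((fun l : ℝ => cutDist E (x.1, s x.1 + l * (x.2 - s x.1))) '' Icc 0 1) with hδ
  have hδc : Continuous δ := by
    refine IsCompact.continuous_sInf
      (f := fun (x : J × ℝ) (l : ℝ) => cutDist E (x.1, s x.1 + l * (x.2 - s x.1)))
      isCompact_Icc ?_
    exact (cutDist_continuous E).comp (by fun_prop)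
  have hbdd : ∀ x : J × ℝ, BddBelow ((fun l : ℝ => cutDist E (x.1, s x.1 + l * (x.2 - s x.1))) ''
      Icc 0 1) := fun x => ⟨0, by rintro _ ⟨l, -, rfl⟩; exact cutDist_nonneg _ _⟩
  have hatt : ∀ x : J × ℝ, ∃ l ∈ Icc (0:ℝ) 1, δ x = cutDist E (x.1, s x.1 + l * (x.2 - s x.1)) := by
    intro x
    have hc : ContinuousOn (fun l : ℝ => cutDist E (x.1, s x.1 + l * (x.2 - s x.1))) (Icc 0 1) :=
      ((cutDist_continuous E).comp (by fun_prop)).continuousOn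
    have := (isCompact_Icc.image_of_continuousOn hc).sInf_mem
      (nonempty_Icc.2 zero_le_one |>.image _)
    obtain ⟨l, hl, h⟩ := this
    exact ⟨l, hl, h.symm⟩
  have hseg : ∀ j p, (j, p) ∈ E → ∀ l ∈ Icc (0:ℝ) 1, (j, s j + l * (p - s j)) ∈ E := by
    intro j p hp l hl
    have := (hord j).convex (hs j) hp (a := 1 - l) (b := l) (by linarith [hl.2]) hl.1 (by ring)
    simp only [smul_eq_mul, mem_ofPred_eq] at this
    convert this using 2
    ring
  have hpos : ∀ x ∈ E, 0 < δ x := by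
    rintro ⟨j, p⟩ hx
    obtain ⟨l, hl, h⟩ := hatt (j, p)
    rw [h]
    exact cutDist_pos hE (hseg j p hx l hl)
  have hle1 : ∀ x, δ x ≤ 1 := fun x => by
    obtain ⟨l, hl, h⟩ := hatt x
    rw [h]; exact cutDist_le_one _ _
  have hleu : ∀ j p u, (j, u) ∉ E → δ (j, p) ≤ |p - u| := fun j p u hu => by
    refine (csInf_le (hbdd (j, p)) ⟨1, ⟨zero_le_one, le_refl _⟩, rfl⟩).trans ?_
    simpa using cutDist_le (p := p) hu
  have hscale : ∀ j p t, t ∈ Icc (0:ℝ) 1 → δ (j, p) ≤ δ (j, s j + t * (p - s j)) := by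
    intro j p t ht
    obtain ⟨l, hl, h⟩ := hatt (j, s j + t * (p - s j))
    rw [h]
    refine csInf_le (hbdd (j, p)) ⟨l * t, ⟨mul_nonneg hl.1 ht.1, mul_le_one₀ hl.2 ht.1 ht.2⟩, ?_⟩
    simp only
    congr 2
    ring
  have hup : ∀ j p q, s j ≤ p → p ≤ q → δ (j, q) ≤ δ (j, p) := by
    intro j p q h1 h2
    rcases eq_or_lt_of_le (h1.trans h2) with h | h
    · have : p = q := le_antisymm h2 (by linarith)
      rw [this]
    · have := hscale j q ((p - s j) / (q - s j))
        ⟨div_nonneg (by linarith) (by linarith), (div_le_one (by linarith)).2 (by linarith)⟩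
      rwa [div_mul_cancel₀ _ (by linarith), add_sub_cancel] at this
  have hdn : ∀ j p q, p ≤ q → q ≤ s j → δ (j, p) ≤ δ (j, q) := by
    intro j p q h1 h2
    rcases eq_or_lt_of_le (h1.trans h2) with h | h
    · have : p = q := le_antisymm h1 (by linarith)
      rw [this]
    · have := hscale j p ((q - s j) / (p - s j))
        ⟨div_nonneg_of_nonpos (by linarith) (by linarith),
          (div_le_one_of_neg (by linarith)).2 (by linarith)⟩
      rwa [div_mul_cancel₀ _ (by linarith), add_sub_cancel] at this
  have hmono : ∀ j, StrictMonoOn (fun p => (p - s j) / δ (j, p)) {p | (j, p) ∈ E} := by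
    intro j p hp q hq hpq
    have hp' := hpos _ hp
    have hq' := hpos _ hq
    simp only
    rw [div_lt_div_iff₀ hp' hq']
    rcases le_total (s j) p with h | h
    · have := hup j p q h hpq.le
      nlinarith
    · rcases le_total q (s j) with h' | h'
      · have := hdn j p q hpq.le h'
        nlinarith
      · rcases eq_or_lt_of_le h with h | h
        · nlinarith
        · nlinarith
  have hfc : ContinuousOn (fun x : J × ℝ => (x.2 - s x.1) / δ x) E :=
    ContinuousOn.div (by fun_prop) hδc.continuousOn (fun x hx => (hpos x hx).ne')
  have hlarge : ∀ j (y : ℝ), 0 ≤ y → ∃ p, (j, p) ∈ E ∧ s j ≤ p ∧ y ≤ (p - s j) / δ (j, p) := by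
    intro j y hy
    by_cases hb : ∃ u, (j, u) ∉ E ∧ s j < u
    · obtain ⟨u, hu, hsu⟩ := hb
      by_contra hcon
      push Not at hcon
      have hcl : IsClosed ({p | (j, p) ∉ E} ∩ Icc (s j) u) := by
        refine IsClosed.inter ?_ isClosed_Icc
        exact hE.isClosed_compl.preimage (by fun_prop : Continuous fun p : ℝ => (j, p))
      have hcp : IsCompact ({p | (j, p) ∉ E} ∩ Icc (s j) u) :=
        isCompact_Icc.of_isClosed_subset hcl inter_subset_right
      obtain ⟨m, hm, hmin⟩ := hcp.exists_isLeast ⟨u, hu, hsu.le, le_refl _⟩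
      have hsm : s j < m := lt_of_le_of_ne hm.2.1 (fun h => hm.1 (h ▸ hs j))
      have hbelow : ∀ p, s j ≤ p → p < m → (j, p) ∈ E := by
        intro p h1 h2
        by_contra h3
        exact absurd (hmin ⟨h3, h1, (h2.trans_le hm.2.2).le⟩) (not_le.2 h2)
      set p := m - (m - s j) / (y + 2) with hp
      have hy2 : 0 < y + 2 := by linarith
      have hk : 0 < (m - s j) / (y + 2) := div_pos (by linarith) hy2
      have hk2 : (m - s j) / (y + 2) * (y + 2) = m - s j := div_mul_cancel₀ _ hy2.ne'
      have h1 : s j ≤ p := by rw [hp]; nlinarith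
      have h2 : p < m := by rw [hp]; linarith
      have hpE := hbelow p h1 h2
      have := hcon p hpE h1
      rw [div_lt_iff₀ (hpos _ hpE)] at this
      have h3 := hleu j p m hm.1
      rw [abs_of_nonpos (by linarith)] at h3
      have h4 : p - s j < y * (m - p) := lt_of_lt_of_le this (by nlinarith)
      rw [hp] at h4
      nlinarith
    · push Not at hb
      have hpE : (j, s j + y) ∈ E := by
        by_contra h
        have := hb _ h
        have hy0 : y = 0 := by linarith
        exact h (by simpa [hy0] using hs j)
      refine ⟨s j + y, hpE, by linarith, ?_⟩
      rw [le_div_iff₀ (hpos _ hpE)]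
      have := hle1 (j, s j + y)
      nlinarith
  have hsmall : ∀ j (y : ℝ), y ≤ 0 → ∃ p, (j, p) ∈ E ∧ p ≤ s j ∧ (p - s j) / δ (j, p) ≤ y := by
    intro j y hy
    by_cases hb : ∃ u, (j, u) ∉ E ∧ u < s j
    · obtain ⟨u, hu, hsu⟩ := hb
      by_contra hcon
      push Not at hcon
      have hcl : IsClosed ({p | (j, p) ∉ E} ∩ Icc u (s j)) := by
        refine IsClosed.inter ?_ isClosed_Icc
        exact hE.isClosed_compl.preimage (by fun_prop : Continuous fun p : ℝ => (j, p))
      have hcp : IsCompact ({p | (j, p) ∉ E} ∩ Icc u (s j)) :=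
        isCompact_Icc.of_isClosed_subset hcl inter_subset_right
      obtain ⟨m, hm, hmax⟩ := hcp.exists_isGreatest ⟨u, hu, le_refl _, hsu.le⟩
      have hsm : m < s j := lt_of_le_of_ne hm.2.2 (fun h => hm.1 (h ▸ hs j))
      have hbelow : ∀ p, p ≤ s j → m < p → (j, p) ∈ E := by
        intro p h1 h2
        by_contra h3
        exact absurd (hmax ⟨h3, (hm.2.1.trans_lt h2).le, h1⟩) (not_le.2 h2)
      set p := m + (s j - m) / (2 - y) with hp
      have hy2 : 0 < 2 - y := by linarith
      have hk : 0 < (s j - m) / (2 - y) := div_pos (by linarith) hy2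
      have hk2 : (s j - m) / (2 - y) * (2 - y) = s j - m := div_mul_cancel₀ _ hy2.ne'
      have h1 : p ≤ s j := by rw [hp]; nlinarith
      have h2 : m < p := by rw [hp]; linarith
      have hpE := hbelow p h1 h2
      have := hcon p hpE h1
      rw [lt_div_iff₀ (hpos _ hpE)] at this
      have h3 := hleu j p m hm.1
      rw [abs_of_nonneg (by linarith)] at h3
      have h4 : y * (p - m) < p - s j := lt_of_le_of_lt (by nlinarith) this
      rw [hp] at h4
      nlinarith
    · push Not at hb
      have hpE : (j, s j + y) ∈ E := by
        by_contra h
        have := hb _ h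
        have hy0 : y = 0 := by linarith
        exact h (by simpa [hy0] using hs j)
      refine ⟨s j + y, hpE, by linarith, ?_⟩
      rw [div_le_iff₀ (hpos _ hpE)]
      have := hle1 (j, s j + y)
      nlinarith
  refine ⟨fun x => (x.2 - s x.1) / δ x, hfc, hmono, ?_⟩
  intro j y
  have hzero : (s j - s j) / δ (j, s j) = 0 := by simp
  have hcj : ContinuousOn (fun p => (p - s j) / δ (j, p)) {p | (j, p) ∈ E} :=
    hfc.comp (f := fun p => (j, p)) (by fun_prop) (fun p hp => hp)
  rcases le_total 0 y with hy | hy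
  · obtain ⟨p, hp, hsp, hyp⟩ := hlarge j y hy
    have hsub : Icc (s j) p ⊆ {p | (j, p) ∈ E} := (hord j).out (hs j) hp
    obtain ⟨q, hq, h⟩ := intermediate_value_Icc hsp (hcj.mono hsub)
      (show y ∈ Icc _ _ from ⟨by simpa using hy, hyp⟩)
    exact ⟨q, hsub hq, h⟩
  · obtain ⟨p, hp, hsp, hyp⟩ := hsmall j y hy
    have hsub : Icc p (s j) ⊆ {p | (j, p) ∈ E} := (hord j).out hp (hs j)
    obtain ⟨q, hq, h⟩ := intermediate_value_Icc hsp (hcj.mono hsub)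
      (show y ∈ Icc _ _ from ⟨hyp, by simpa using hy⟩)
    exact ⟨q, hsub hq, h⟩

end Band

end

section

/-- Continuity on the union of two relatively closed pieces. -/
theorem continuousOn_union_rel {X Y : Type*} [TopologicalSpace X] [TopologicalSpace Y] {f : X → Y}
    {A B : Set X} (hA : ContinuousOn f A) (hB : ContinuousOn f B) (h1 : closure A ∩ B ⊆ A)
    (h2 : closure B ∩ A ⊆ B) : ContinuousOn f (A ∪ B) := by
  rintro x (hx | hx)
  · by_cases hxB : x ∈ closure B
    · exact (hA x hx).union (hB x (h2 ⟨hxB, hx⟩))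
    · exact (hA x hx).union (continuousWithinAt_of_notMem_closure hxB)
  · by_cases hxA : x ∈ closure A
    · exact (hA x (h1 ⟨hxA, hx⟩)).union (hB x hx)
    · exact (continuousWithinAt_of_notMem_closure hxA).union (hB x hx)

section Prune

variable {X : Type*} [MetricSpace X] {e : ℝ × ℝ → X}

theorem exists_collar (he : IsOpenEmbedding e) :
    ∃ δ : C(ℝ, ℝ), ∀ y, 0 < δ y ∧ ∀ s ∈ Icc 0 (δ y), dist (e (-s, y)) (e (0, y)) < 1 / (1 + |y|) := by
  obtain ⟨δ, hδ⟩ := exists_continuous_forall_mem_convex_of_local_const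
    (t := fun y : ℝ => {d : ℝ | 0 < d ∧ ∀ s ∈ Icc 0 d, dist (e (-s, y)) (e (0, y)) < 1 / (1 + |y|)})
    (fun y => by
      refine OrdConnected.convex ⟨?_⟩
      rintro a ⟨ha, -⟩ b ⟨-, hb⟩ c hc
      exact ⟨ha.trans_le hc.1, fun s hs => hb s ⟨hs.1, hs.2.trans hc.2⟩⟩)
    (fun y => by
      have hec := he.continuous
      have hc : ContinuousAt (fun q : ℝ × ℝ => dist (e (-q.2, q.1)) (e (0, q.1)) - 1 / (1 + |q.1|))
          (y, 0) := by
        refine ContinuousAt.sub (by fun_prop) (ContinuousAt.div (by fun_prop) (by fun_prop) ?_)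
        positivity
      have hneg : (fun q : ℝ × ℝ => dist (e (-q.2, q.1)) (e (0, q.1)) - 1 / (1 + |q.1|)) (y, 0) < 0 := by
        simp; positivity
      have := hc.eventually_lt_const hneg
      rw [nhds_prod_eq, eventually_prod_iff] at this
      obtain ⟨P, hP, R, hR, h⟩ := this
      obtain ⟨d, hd, hdR⟩ := Metric.eventually_nhds_iff.1 hR
      refine ⟨d / 2, ?_⟩
      filter_upwards [hP] with z hz
      refine ⟨by linarith, fun s hs => ?_⟩
      have := h hz (hdR (y := s) (by
        rw [Real.dist_eq, abs_lt]; constructor <;> linarith [hs.1, hs.2]))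
      simp only at this
      linarith)
  exact ⟨δ, hδ⟩

theorem isClosed_collar (he : IsOpenEmbedding e) (hT : IsClosed (e '' {z | 0 ≤ z.1})) (δ : C(ℝ, ℝ))
    (hδ : ∀ y, 0 < δ y ∧ ∀ s ∈ Icc 0 (δ y), dist (e (-s, y)) (e (0, y)) < 1 / (1 + |y|)) :
    IsClosed (e '' {z | -δ z.2 ≤ z.1}) := by
  have hT0 : IsClosed (e '' {z | z.1 = 0}) := by
    have : e '' {z | z.1 = 0} = e '' {z | 0 ≤ z.1} \ e '' {z | 0 < z.1} := by
      rw [← image_sdiff he.injective]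
      congr 1
      ext z
      simp [le_antisymm_iff, and_comm]
    rw [this]
    exact hT.sdiff (he.isOpenMap _ (isOpen_lt continuous_const continuous_fst))
  refine IsSeqClosed.isClosed ?_
  intro u x hu hux
  choose z hz hzu using hu
  by_contra hx
  have hxT : x ∉ e '' {z | 0 ≤ z.1} := fun ⟨w, hw, h⟩ => hx ⟨w, by
    have := (hδ w.2).1
    simp only [mem_ofPred_eq] at hw ⊢
    linarith, h⟩
  have hev : ∀ᶠ n in atTop, u n ∉ e '' {z | 0 ≤ z.1} :=
    hux.eventually (hT.isOpen_compl.mem_nhds hxT)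
  have hneg : ∀ᶠ n in atTop, (z n).1 < 0 := by
    filter_upwards [hev] with n hn
    by_contra h
    exact hn ⟨z n, not_lt.1 h, hzu n⟩
  -- either the heights are bounded along a subsequence or they escape
  by_cases hb : ∃ R, ∃ᶠ n in atTop, |(z n).2| ≤ R
  · obtain ⟨R, hR⟩ := hb
    obtain ⟨M, hM⟩ := (isCompact_Icc (a := -R) (b := R)).bddAbove_image (f := δ) δ.continuous.continuousOn
    have hfr : ∃ᶠ n in atTop, z n ∈ Icc (-M) 0 ×ˢ Icc (-R) R := by
      refine (hR.and_eventually hneg).mono ?_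
      rintro n ⟨h1, h2⟩
      have h3 := abs_le.1 h1
      have h4 : δ (z n).2 ≤ M := hM ⟨_, h3, rfl⟩
      have h5 := hz n
      simp only [mem_ofPred_eq] at h5
      exact ⟨⟨by linarith, h2.le⟩, h3⟩
    have hcomp : IsCompact (Icc (-M) 0 ×ˢ Icc (-R) R) := isCompact_Icc.prod isCompact_Icc
    obtain ⟨a, ha, φ, hφ, hlim⟩ := hcomp.tendsto_subseq' hfr
    have h1 : Tendsto (fun n => u (φ n)) atTop (𝓝 (e a)) := by
      have := (he.continuous.tendsto a).comp hlim
      refine this.congr (fun n => ?_)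
      simp [hzu]
    have h2 := tendsto_nhds_unique h1 (hux.comp hφ.tendsto_atTop)
    refine hx ⟨a, ?_, h2⟩
    have hcl : IsClosed {z : ℝ × ℝ | -δ z.2 ≤ z.1} :=
      isClosed_le (by fun_prop) continuous_fst
    exact hcl.mem_of_tendsto hlim (Eventually.of_forall fun n => hz _)
  · push Not at hb
    have hesc : Tendsto (fun n => |(z n).2|) atTop atTop := by
      rw [tendsto_atTop]
      intro R
      filter_upwards [hb R] with n hn
      exact hn.le
    have hd : Tendsto (fun n => dist (u n) (e (0, (z n).2))) atTop (𝓝 0) := by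
      have h0 : Tendsto (fun n => 1 / (1 + |(z n).2|)) atTop (𝓝 0) :=
        tendsto_const_nhds.div_atTop (tendsto_atTop_add_const_left _ _ hesc)
      refine squeeze_zero' (Eventually.of_forall fun _ => dist_nonneg) ?_ h0
      filter_upwards [hneg] with n hn
      have h5 := hz n
      simp only [mem_ofPred_eq] at h5
      have := (hδ (z n).2).2 (-(z n).1) ⟨by linarith, by linarith⟩
      rw [neg_neg, Prod.mk.eta, hzu] at this
      exact this.le
    have hlim0 : Tendsto (fun n => e (0, (z n).2)) atTop (𝓝 x) := by
      refine (tendsto_iff_of_dist ?_).1 hux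
      exact hd
    obtain ⟨w, hw, hwx⟩ := hT0.mem_of_tendsto hlim0 (Eventually.of_forall fun n => ⟨_, rfl, rfl⟩)
    rw [← hwx] at hlim0
    have h1 := (he.isInducing.tendsto_nhds_iff (f := fun n => ((0 : ℝ), (z n).2)) (y := w)).2 hlim0
    have h2 : Tendsto (fun n => |(z n).2|) atTop (𝓝 |w.2|) :=
      ((continuous_abs.comp continuous_snd).tendsto w).comp (f := fun n => ((0 : ℝ), (z n).2)) h1
    exact not_tendsto_nhds_of_tendsto_atTop hesc _ h2

/-- Removing a closed half plane attached along a line does not change the topology. -/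
theorem prune_homeo (he : IsOpenEmbedding e) (hT : IsClosed (e '' {z | 0 ≤ z.1})) :
    Nonempty (X ≃ₜ ↥(e '' {z | 0 ≤ z.1})ᶜ) := by
  obtain ⟨δ, hδ⟩ := exists_collar he
  have hK := isClosed_collar he hT δ hδ
  set T := e '' {z | 0 ≤ z.1} with hTdef
  set K := e '' {z | -δ z.2 ≤ z.1} with hKdef
  set L := (e '' {z | -δ z.2 < z.1})ᶜ with hLdef
  have hLc : IsClosed L := (he.isOpenMap _
    (isOpen_lt (by fun_prop) continuous_fst)).isClosed_compl
  have hKL : K ∪ L = univ := by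
    ext x
    simp only [mem_union, mem_univ, iff_true]
    by_cases h : x ∈ K
    · exact Or.inl h
    · refine Or.inr fun ⟨w, hw, hwx⟩ => h ⟨w, ?_, hwx⟩
      simp only [mem_ofPred_eq] at hw ⊢
      exact hw.le
  have hKLi : ∀ z, e z ∈ L → -δ z.2 ≤ z.1 → z.1 = -δ z.2 := by
    intro z hz h
    by_contra hne
    exact hz ⟨z, lt_of_le_of_ne h (Ne.symm hne), rfl⟩
  have hTL : L ⊆ Tᶜ := by
    rintro x hx ⟨w, hw, rfl⟩
    refine hx ⟨w, ?_, rfl⟩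
    have := (hδ w.2).1
    simp only [mem_ofPred_eq] at hw ⊢
    linarith
  obtain ⟨e', he', hec⟩ : ∃ e' : X → ℝ × ℝ, (∀ z, e' (e z) = z) ∧ ContinuousOn e' (range e) :=
    ⟨(he.toOpenPartialHomeomorph e).symm, fun z => he.toOpenPartialHomeomorph_left_inv,
      by simpa using (he.toOpenPartialHomeomorph e).continuousOn_symm⟩
  have hmemK : ∀ z, e z ∈ K ↔ -δ z.2 ≤ z.1 := fun z => he.injective.mem_set_image
  have hmemT : ∀ z, e z ∈ T ↔ 0 ≤ z.1 := fun z => he.injective.mem_set_image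
  have hKr : K ⊆ range e := image_subset_range _ _
  set φ : ℝ × ℝ → ℝ × ℝ := fun z => (-(δ z.2) ^ 2 / (z.1 + 2 * δ z.2), z.2) with hφ
  set ψ : ℝ × ℝ → ℝ × ℝ := fun z => (-(δ z.2) ^ 2 / z.1 - 2 * δ z.2, z.2) with hψ
  have hφm : ∀ z : ℝ × ℝ, -δ z.2 ≤ z.1 → -δ z.2 ≤ (φ z).1 ∧ (φ z).1 < 0 := by
    intro z hz
    have h0 := (hδ z.2).1
    have h1 : 0 < z.1 + 2 * δ z.2 := by linarith
    constructor
    · rw [hφ]; simp only; rw [le_div_iff₀ h1]; nlinarith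
    · rw [hφ]; simp only; rw [div_neg_iff]; right; exact ⟨by nlinarith, h1⟩
  have hψm : ∀ z : ℝ × ℝ, -δ z.2 ≤ z.1 → z.1 < 0 → -δ z.2 ≤ (ψ z).1 := by
    intro z hz hz0
    have h0 := (hδ z.2).1
    have : δ z.2 ≤ -(δ z.2) ^ 2 / z.1 := by
      rw [le_div_iff_of_neg hz0]; nlinarith
    rw [hψ]; simp only; linarith
  have hφψ : ∀ z : ℝ × ℝ, -δ z.2 ≤ z.1 → ψ (φ z) = z := by
    intro z hz
    have h0 := (hδ z.2).1
    have h1 : z.1 + 2 * δ z.2 ≠ 0 := by linarith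
    rw [hφ, hψ]
    refine Prod.ext ?_ rfl
    simp only
    field_simp
    ring
  have hψφ : ∀ z : ℝ × ℝ, -δ z.2 ≤ z.1 → z.1 < 0 → φ (ψ z) = z := by
    intro z hz hz0
    have h0 := (hδ z.2).1
    have h1 : z.1 ≠ 0 := hz0.ne
    have h2 : δ z.2 ≠ 0 := h0.ne'
    rw [hφ, hψ]
    refine Prod.ext ?_ rfl
    simp only
    rw [sub_add_cancel]
    field_simp
  have hφc : ContinuousOn φ {z | -δ z.2 ≤ z.1} := by
    refine ContinuousOn.prodMk (ContinuousOn.div (by fun_prop) (by fun_prop) ?_) (by fun_prop)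
    intro z hz
    have h0 := (hδ z.2).1
    simp only [mem_ofPred_eq] at hz
    linarith
  have hψc : ContinuousOn ψ {z | z.1 < 0} := by
    refine ContinuousOn.prodMk (ContinuousOn.sub (ContinuousOn.div (by fun_prop) (by fun_prop) ?_)
      (by fun_prop)) (by fun_prop)
    intro z hz
    exact ne_of_lt hz
  classical
  set Φ : X → X := fun x => if x ∈ L then x else e (φ (e' x)) with hΦ
  set Ψ : X → X := fun x => if x ∈ L then x else e (ψ (e' x)) with hΨ
  have hΦK : ∀ z, -δ z.2 ≤ z.1 → Φ (e z) = e (φ z) := by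
    intro z hz
    by_cases h : e z ∈ L
    · have hz' := hKLi z h hz
      have h0 := (hδ z.2).1
      simp only [hΦ, if_pos h]
      congr 1
      refine Prod.ext ?_ rfl
      simp only [hφ]
      rw [hz']
      field_simp
      ring
    · simp only [hΦ, if_neg h, he']
  have hΨK : ∀ z, -δ z.2 ≤ z.1 → Ψ (e z) = e (ψ z) := by
    intro z hz
    by_cases h : e z ∈ L
    · have hz' := hKLi z h hz
      have h0 := (hδ z.2).1
      simp only [hΨ, if_pos h]
      congr 1
      refine Prod.ext ?_ rfl
      simp only [hψ]
      rw [hz']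
      field_simp
      ring
    · simp only [hΨ, if_neg h, he']
  have hΦL : ∀ x ∈ L, Φ x = x := fun x hx => if_pos hx
  have hΨL : ∀ x ∈ L, Ψ x = x := fun x hx => if_pos hx
  have hΦc : Continuous Φ := by
    rw [← continuousOn_univ, ← hKL]
    refine ContinuousOn.union_of_isClosed ?_ ?_ hK hLc
    · have : ContinuousOn (fun x => e (φ (e' x))) K := by
        refine he.continuous.comp_continuousOn (hφc.comp (hec.mono hKr) ?_)
        rintro _ ⟨z, hz, rfl⟩
        rwa [he']
      refine this.congr ?_
      rintro _ ⟨z, hz, rfl⟩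
      simp only [he', hΦK z hz]
    · exact continuousOn_id.congr hΦL
  have hΨc : ContinuousOn Ψ Tᶜ := by
    have : Tᶜ = (K ∩ Tᶜ) ∪ L := by
      ext x
      have h1 : x ∈ K ∪ L := hKL ▸ mem_univ x
      have h2 : x ∈ L → x ∈ Tᶜ := fun h => hTL h
      simp only [mem_union, mem_inter_iff] at h1 ⊢
      tauto
    rw [this]
    refine continuousOn_union_rel ?_ (continuousOn_id.congr hΨL) ?_ ?_
    · have : ContinuousOn (fun x => e (ψ (e' x))) (K ∩ Tᶜ) := by
        refine he.continuous.comp_continuousOn (hψc.comp (hec.mono (inter_subset_left.trans hKr)) ?_)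
        rintro _ ⟨⟨z, hz, rfl⟩, hzT⟩
        rw [mem_compl_iff, hmemT] at hzT
        simpa [he'] using hzT
      refine this.congr ?_
      rintro _ ⟨⟨z, hz, rfl⟩, -⟩
      simp only [he', hΨK z hz]
    · rintro x ⟨h1, h2⟩
      exact ⟨(hK.closure_subset_iff.2 inter_subset_left) h1, hTL h2⟩
    · rintro x ⟨h1, -⟩
      exact hLc.closure_eq ▸ h1
  have hcases : ∀ x, (∃ z, -δ z.2 ≤ z.1 ∧ e z = x) ∨ x ∈ L := by
    intro x
    have : x ∈ K ∪ L := hKL ▸ mem_univ x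
    exact this
  refine ⟨{ toFun := fun x => ⟨Φ x, ?_⟩, invFun := fun x => Ψ x, left_inv := ?_, right_inv := ?_,
            continuous_toFun := ?_, continuous_invFun := ?_ }⟩
  · rcases hcases x with ⟨z, hz, rfl⟩ | hx
    · rw [hΦK z hz, mem_compl_iff, hmemT]
      exact not_le.2 (hφm z hz).2
    · rw [hΦL x hx]; exact hTL hx
  · intro x
    simp only
    rcases hcases x with ⟨z, hz, rfl⟩ | hx
    · rw [hΦK z hz, hΨK _ (hφm z hz).1, hφψ z hz]
    · rw [hΦL x hx, hΨL x hx]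
  · rintro ⟨x, hxT⟩
    apply Subtype.ext
    simp only
    rcases hcases x with ⟨z, hz, rfl⟩ | hx
    · rw [mem_compl_iff, hmemT, not_le] at hxT
      rw [hΨK z hz, hΦK _ (hψm z hz hxT), hψφ z hz hxT]
    · rw [hΨL x hx, hΦL x hx]
  · exact hΦc.subtype_mk _
  · exact continuousOn_iff_continuous_domRestrict.1 hΨc

/-- `prune_homeo` relative to a subset. -/
theorem prune_homeo_set {U V : Set X} (he : IsOpenEmbedding e) (heU : range e ⊆ U)
    (hV : V = U \ e '' {z | 0 ≤ z.1}) (hcl : U ∩ closure (e '' {z | 0 ≤ z.1}) ⊆ e '' {z | 0 ≤ z.1}) :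
    Nonempty (U ≃ₜ V) := by
  set e1 : ℝ × ℝ → U := fun z => ⟨e z, heU ⟨z, rfl⟩⟩ with he1
  have h1 : IsOpenEmbedding e1 := by
    refine ⟨⟨⟨?_⟩, ?_⟩, ?_⟩
    · rw [he.eq_induced]
      exact (induced_compose (f := e1) (g := Subtype.val) (tγ := inferInstance)).symm
    · intro a b h
      exact he.injective (Subtype.ext_iff.1 h)
    · have : range e1 = Subtype.val ⁻¹' range e := by
        ext x; simp [he1, Subtype.ext_iff]
      rw [this]
      exact he.isOpen_range.preimage continuous_subtype_val
  have h2 : e1 '' {z | 0 ≤ z.1} = Subtype.val ⁻¹' (e '' {z | 0 ≤ z.1}) := by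
    ext x; simp [he1, Subtype.ext_iff]
  have h3 : IsClosed (e1 '' {z | 0 ≤ z.1}) := by
    rw [h2, isClosed_induced_iff]
    refine ⟨closure (e '' {z | 0 ≤ z.1}), isClosed_closure, ?_⟩
    ext x
    exact ⟨fun h => hcl ⟨x.2, h⟩, fun h => subset_closure h⟩
  obtain ⟨Φ⟩ := prune_homeo h1 h3
  refine ⟨Φ.trans ?_⟩
  refine { toFun := fun x => ⟨x.1.1, ?_⟩, invFun := fun x => ⟨⟨x.1, ?_⟩, ?_⟩, left_inv := ?_,
           right_inv := ?_, continuous_toFun := ?_, continuous_invFun := ?_ }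
  · exact hV.ge ⟨x.1.2, fun h => x.2 (h2.ge h)⟩
  · exact (hV.le x.2).1
  · exact fun h => (hV.le x.2).2 (h2.le h)
  · intro x; rfl
  · intro x; rfl
  · fun_prop
  · fun_prop

end Prune

end

section

section Box

variable {X : Type*} [TopologicalSpace X]

/-- The model strip `[0,1] × ℝ`. -/
def slab : Set (ℝ × ℝ) := {z | z.1 ∈ Icc (0:ℝ) 1}

/-- The set `C` is a copy of `[0,1] × ℝ` whose boundary lines are parametrized by `w₀` and, up to
the sign `ε`, by `w₁`. -/
structure Box (C : Set X) (w₀ w₁ : ℝ → X) (ε : ℝ) where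
  toFun : ℝ × ℝ → X
  invFun : X → ℝ × ℝ
  cont : ContinuousOn toFun slab
  cont_inv : ContinuousOn invFun C
  maps : ∀ z ∈ slab, toFun z ∈ C
  maps_inv : ∀ x ∈ C, invFun x ∈ slab
  left_inv : ∀ z ∈ slab, invFun (toFun z) = z
  right_inv : ∀ x ∈ C, toFun (invFun x) = x
  zero : ∀ y, toFun (0, y) = w₀ y
  one : ∀ y, toFun (1, y) = w₁ (ε * y)
  sq : ε * ε = 1

namespace Box

variable {C C' : Set X} {w₀ w₁ w₂ : ℝ → X} {ε ε' : ℝ}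

theorem inv_zero (B : Box C w₀ w₁ ε) (y : ℝ) : B.invFun (w₀ y) = (0, y) := by
  rw [← B.zero y, B.left_inv _ ⟨le_refl _, zero_le_one⟩]

theorem inv_one (B : Box C w₀ w₁ ε) (y : ℝ) : B.invFun (w₁ y) = (1, ε * y) := by
  have := B.one (ε * y)
  rw [← mul_assoc, B.sq, one_mul] at this
  rw [← this, B.left_inv _ ⟨zero_le_one, le_refl _⟩]

theorem mem_one (B : Box C w₀ w₁ ε) (y : ℝ) : w₁ y ∈ C := by
  have := B.one (ε * y)
  rw [← mul_assoc, B.sq, one_mul] at this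
  exact this ▸ B.maps (1, ε * y) ⟨zero_le_one, le_refl _⟩

/-- Reversal of a box. -/
def symm (B : Box C w₀ w₁ ε) : Box C w₁ w₀ ε where
  toFun z := B.toFun (1 - z.1, ε * z.2)
  invFun x := (1 - (B.invFun x).1, ε * (B.invFun x).2)
  cont := B.cont.comp (by fun_prop) (fun z hz => ⟨by linarith [hz.2], by linarith [hz.1]⟩)
  cont_inv := by
    have := B.cont_inv
    fun_prop
  maps z hz := B.maps _ ⟨by linarith [hz.2], by linarith [hz.1]⟩
  maps_inv x hx := by
    have := B.maps_inv x hx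
    exact ⟨by linarith [this.2], by linarith [this.1]⟩
  left_inv z hz := by
    rw [B.left_inv _ ⟨by linarith [hz.2], by linarith [hz.1]⟩]
    simp [← mul_assoc, B.sq]
  right_inv x hx := by
    simp [← mul_assoc, B.sq, B.right_inv x hx]
  zero y := by simp [B.one, ← mul_assoc, B.sq]
  one y := by simp [B.zero]
  sq := B.sq

open Classical in
/-- Gluing two boxes along a common boundary line. -/
def glue (B : Box C w₀ w₁ ε) (B' : Box C' w₁ w₂ ε') (hC : C ∩ C' ⊆ range w₁)
    (h1 : closure C ∩ C' ⊆ C) (h2 : closure C' ∩ C ⊆ C') : Box (C ∪ C') w₀ w₂ (ε * ε') where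
  toFun z := if z.1 ≤ 1 / 2 then B.toFun (2 * z.1, z.2) else B'.toFun (2 * z.1 - 1, ε * z.2)
  invFun x := if x ∈ C then ((B.invFun x).1 / 2, (B.invFun x).2)
    else ((1 + (B'.invFun x).1) / 2, ε * (B'.invFun x).2)
  cont := by
    have h : slab = {z : ℝ × ℝ | z.1 ∈ Icc (0:ℝ) (1/2)} ∪ {z : ℝ × ℝ | z.1 ∈ Icc (1/2 : ℝ) 1} := by
      ext z
      simp only [slab, mem_ofPred_eq, mem_union, mem_Icc]
      constructor
      · rintro ⟨a, b⟩
        rcases le_total z.1 (1/2) with h | h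
        · exact Or.inl ⟨a, h⟩
        · exact Or.inr ⟨h, b⟩
      · rintro (⟨a, b⟩ | ⟨a, b⟩) <;> constructor <;> linarith
    rw [h]
    refine ContinuousOn.union_of_isClosed ?_ ?_ (isClosed_Icc.preimage continuous_fst)
      (isClosed_Icc.preimage continuous_fst)
    · refine ContinuousOn.congr (f := fun z => B.toFun (2 * z.1, z.2)) ?_ ?_
      · exact B.cont.comp (by fun_prop) (fun z hz => ⟨by linarith [hz.1], by linarith [hz.2]⟩)
      · intro z hz
        exact if_pos hz.2
    · refine ContinuousOn.congr (f := fun z => B'.toFun (2 * z.1 - 1, ε * z.2)) ?_ ?_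
      · exact B'.cont.comp (by fun_prop) (fun z hz => ⟨by linarith [hz.1], by linarith [hz.2]⟩)
      · intro z hz
        rcases eq_or_lt_of_le hz.1 with h | h
        · simp only [← h]
          norm_num
          rw [B.one, B'.zero]
        · exact if_neg (not_le.2 h)
  cont_inv := by
    refine continuousOn_union_rel ?_ ?_ h1 h2
    · refine ContinuousOn.congr (f := fun x => ((B.invFun x).1 / 2, (B.invFun x).2)) ?_ ?_
      · have := B.cont_inv
        fun_prop
      · intro x hx
        exact if_pos hx
    · refine ContinuousOn.congr
        (f := fun x => ((1 + (B'.invFun x).1) / 2, ε * (B'.invFun x).2)) ?_ ?_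
      · have := B'.cont_inv
        fun_prop
      · intro x hx
        by_cases h : x ∈ C
        · obtain ⟨t, rfl⟩ := hC ⟨h, hx⟩
          simp only [if_pos h, B.inv_one, B'.inv_zero]
          norm_num
        · exact if_neg h
  maps z hz := by
    by_cases h : z.1 ≤ 1 / 2
    · rw [if_pos h]
      exact Or.inl (B.maps _ ⟨by linarith [hz.1], by linarith [hz.2]⟩)
    · rw [if_neg h]
      exact Or.inr (B'.maps _ ⟨by linarith [hz.1], by linarith [hz.2]⟩)
  maps_inv x hx := by
    by_cases h : x ∈ C
    · rw [if_pos h]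
      have := B.maps_inv x h
      exact ⟨by linarith [this.1], by linarith [this.2]⟩
    · rw [if_neg h]
      have := B'.maps_inv x (hx.resolve_left h)
      exact ⟨by linarith [this.1], by linarith [this.2]⟩
  left_inv z hz := by
    by_cases h : z.1 ≤ 1 / 2
    · have hs : (2 * z.1, z.2) ∈ slab := ⟨by linarith [hz.1], by linarith [hz.2]⟩
      rw [if_pos h, if_pos (B.maps _ hs), B.left_inv _ hs]
      simp
    · have hs : (2 * z.1 - 1, ε * z.2) ∈ slab := ⟨by linarith [hz.1], by linarith [hz.2]⟩
      rw [if_neg h]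
      have hn : B'.toFun (2 * z.1 - 1, ε * z.2) ∉ C := by
        intro hc
        obtain ⟨t, ht⟩ := hC ⟨hc, B'.maps _ hs⟩
        have h3 := congrArg B'.invFun ht
        rw [B'.inv_zero, B'.left_inv _ hs] at h3
        have := congrArg Prod.fst h3
        simp only at this
        linarith
      rw [if_neg hn, B'.left_inv _ hs]
      simp [← mul_assoc, B.sq]
  right_inv x hx := by
    by_cases h : x ∈ C
    · have := B.maps_inv x h
      rw [if_pos h, if_pos (by linarith [this.2])]
      simp only
      rw [mul_div_cancel₀ _ two_ne_zero, Prod.mk.eta, B.right_inv x h]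
    · have hx' := hx.resolve_left h
      have h3 := B'.maps_inv x hx'
      have h4 : 0 < (B'.invFun x).1 := by
        refine lt_of_le_of_ne h3.1 (fun h5 => h ?_)
        have h6 : B'.invFun x = (0, (B'.invFun x).2) := Prod.ext h5.symm rfl
        have h7 := B'.right_inv x hx'
        rw [h6, B'.zero] at h7
        rw [← h7]
        exact B.mem_one _
      rw [if_neg h, if_neg (by simp only; linarith)]
      simp only
      rw [mul_div_cancel₀ _ two_ne_zero, add_sub_cancel_left, ← mul_assoc, B.sq, one_mul,
        Prod.mk.eta, B'.right_inv x hx']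
  zero y := by
    rw [if_pos (by norm_num)]
    simp [B.zero]
  one y := by
    rw [if_neg (by norm_num)]
    norm_num
    rw [B'.one]
    congr 1
    ring
  sq := by
    calc ε * ε' * (ε * ε') = (ε * ε) * (ε' * ε') := by ring
      _ = 1 := by rw [B.sq, B'.sq, one_mul]

end Box

/-- A homeomorphism onto `[0,1] × ℝ` that is monotone on the boundary lines can be normalized. -/
theorem Box.nonempty_of_homeo {C : Set X} {w₀ w₁ : ℝ → X} {ε : ℝ} (hε : ε * ε = 1)
    (φ : C ≃ₜ Icc (0:ℝ) 1 × ℝ) (h0 : ∀ y, w₀ y ∈ C) (h1 : ∀ y, w₁ y ∈ C)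
    (f0 : ∀ y, ((φ ⟨w₀ y, h0 y⟩).1 : ℝ) = 0) (f1 : ∀ y, ((φ ⟨w₁ y, h1 y⟩).1 : ℝ) = 1)
    (s0 : ∀ c : C, ((φ c).1 : ℝ) = 0 → (c : X) ∈ range w₀)
    (s1 : ∀ c : C, ((φ c).1 : ℝ) = 1 → (c : X) ∈ range w₁)
    (m0 : StrictMono fun y => (φ ⟨w₀ y, h0 y⟩).2)
    (m1 : StrictMono fun y => (φ ⟨w₁ (ε * y), h1 (ε * y)⟩).2) : Nonempty (Box C w₀ w₁ ε) := by
  set α : ℝ → ℝ := fun y => (φ ⟨w₀ y, h0 y⟩).2 with hα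
  set β : ℝ → ℝ := fun y => (φ ⟨w₁ (ε * y), h1 (ε * y)⟩).2 with hβ
  have hαs : Function.Surjective α := by
    intro y
    obtain ⟨t, ht⟩ := s0 (φ.symm (⟨0, by simp⟩, y)) (by simp)
    refine ⟨t, ?_⟩
    simp only [hα]
    have : (⟨w₀ t, h0 t⟩ : C) = φ.symm (⟨0, by simp⟩, y) := Subtype.ext ht
    rw [this]; simp
  have hβs : Function.Surjective β := by
    intro y
    obtain ⟨t, ht⟩ := s1 (φ.symm (⟨1, by simp⟩, y)) (by simp)
    refine ⟨ε * t, ?_⟩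
    simp only [hβ]
    have : (⟨w₁ (ε * (ε * t)), h1 _⟩ : C) = φ.symm (⟨1, by simp⟩, y) :=
      Subtype.ext (by rw [← mul_assoc, hε, one_mul]; exact ht)
    rw [this]; simp
  have hαc : Continuous α := m0.monotone.continuous_of_surjective hαs
  have hβc : Continuous β := m1.monotone.continuous_of_surjective hβs
  have ht_top : ∀ {g : ℝ → ℝ}, StrictMono g → Function.Surjective g → Tendsto g atTop atTop ∧
      Tendsto g atBot atBot := fun hm hs =>
    ⟨(hm.orderIsoOfSurjective _ hs).tendsto_atTop, (hm.orderIsoOfSurjective _ hs).tendsto_atBot⟩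
  set f : Icc (0:ℝ) 1 × ℝ → ℝ := fun z => (1 - (z.1 : ℝ)) * α z.2 + z.1 * β z.2 with hf
  have hfc : Continuous f := by fun_prop
  have hfm : ∀ j, StrictMonoOn (fun p => f (j, p)) {p | (j, p) ∈ (univ : Set (Icc (0:ℝ) 1 × ℝ))} := by
    intro j p _ q _ hpq
    have a1 := m0 hpq
    have a2 := m1 hpq
    have a3 := j.2.1
    have a4 := j.2.2
    simp only [hf]
    rcases eq_or_lt_of_le a3 with h | h
    · rw [← h]; simpa using a1
    · have := mul_lt_mul_of_pos_left a2 h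
      have := mul_le_mul_of_nonneg_left a1.le (sub_nonneg.2 a4)
      linarith
  have hfs : ∀ j y, ∃ p, (j, p) ∈ (univ : Set (Icc (0:ℝ) 1 × ℝ)) ∧ f (j, p) = y := by
    intro j y
    obtain ⟨p, hp⟩ := hαs y
    obtain ⟨q, hq⟩ := hβs y
    have a3 := j.2.1
    have a4 := j.2.2
    have hlo : f (j, min p q) ≤ y := by
      have b1 := hp ▸ m0.monotone (min_le_left p q)
      have b2 := hq ▸ m1.monotone (min_le_right p q)
      simp only [hf]
      nlinarith
    have hhi : y ≤ f (j, max p q) := by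
      have b1 := hp ▸ m0.monotone (le_max_left p q)
      have b2 := hq ▸ m1.monotone (le_max_right p q)
      simp only [hf]
      nlinarith
    obtain ⟨t, -, ht⟩ := intermediate_value_Icc (min_le_max (a := p) (b := q))
      (f := fun p => f (j, p)) (by fun_prop) ⟨hlo, hhi⟩
    exact ⟨t, mem_univ _, ht⟩
  set Φ : Icc (0:ℝ) 1 × ℝ ≃ₜ Icc (0:ℝ) 1 × ℝ :=
    (Homeomorph.Set.univ _).symm.trans (fiberHomeo isOpen_univ hfc.continuousOn hfm hfs) with hΦ
  have hΦa : ∀ z, Φ z = (z.1, f z) := fun z => rfl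
  set Ψ := Φ.trans φ.symm with hΨ
  have hpr : ∀ z ∈ slab, projIcc (0:ℝ) 1 zero_le_one z.1 = z.1 := fun z hz => by
    rw [projIcc_of_mem _ hz]
  classical
  refine ⟨{ toFun := fun z => Ψ (projIcc 0 1 zero_le_one z.1, z.2),
            invFun := fun x => if h : x ∈ C then
              (((Ψ.symm ⟨x, h⟩).1 : ℝ), (Ψ.symm ⟨x, h⟩).2) else (0, 0),
            cont := ?_, cont_inv := ?_, maps := ?_, maps_inv := ?_, left_inv := ?_,
            right_inv := ?_, zero := ?_, one := ?_, sq := ?_ }⟩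
  · refine Continuous.continuousOn (continuous_subtype_val.comp (Ψ.continuous.comp ?_))
    exact (continuous_projIcc.comp continuous_fst).prodMk continuous_snd
  · rw [continuousOn_iff_continuous_domRestrict]
    have : C.domRestrict (fun x => if h : x ∈ C then
              (((Ψ.symm ⟨x, h⟩).1 : ℝ), (Ψ.symm ⟨x, h⟩).2) else (0, 0)) =
        fun x : C => (((Ψ.symm x).1 : ℝ), (Ψ.symm x).2) := by
      ext x <;> simp
    rw [this]
    fun_prop
  · intro z hz; exact (Ψ _).2
  · intro x hx
    rw [dif_pos hx]
    exact (Ψ.symm ⟨x, hx⟩).1.2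
  · intro z hz
    rw [dif_pos (Ψ _).2]
    simp [hpr z hz]
  · intro x hx
    simp [dif_pos hx]
  · intro y
    have : (⟨w₀ y, h0 y⟩ : C) = Ψ (projIcc 0 1 zero_le_one (0:ℝ), y) := by
      rw [hΨ, Homeomorph.trans_apply, Homeomorph.eq_symm_apply, hΦa]
      refine Prod.ext (Subtype.ext ?_) ?_
      · rw [f0]; simp
      · simp [hf, hα]
    exact (congrArg Subtype.val this).symm
  · intro y
    have : (⟨w₁ (ε * y), h1 _⟩ : C) = Ψ (projIcc 0 1 zero_le_one (1:ℝ), y) := by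
      rw [hΨ, Homeomorph.trans_apply, Homeomorph.eq_symm_apply, hΦa]
      refine Prod.ext (Subtype.ext ?_) ?_
      · rw [f1]; simp
      · simp [hf, hβ]
    exact (congrArg Subtype.val this).symm
  · exact hε

end Box

end

section

/-- The projection to the Möbius band. -/
def mkM (z : ℝ × ℝ) : MobiusBand := Quotient.mk mobiusSetoid z

theorem mkM_continuous : Continuous mkM := continuous_quotient_mk'

theorem mkM_surjective : Function.Surjective mkM := Quotient.mk_surjective

theorem mkM_isQuotientMap : IsQuotientMap mkM := isQuotientMap_quotient_mk'

theorem mkM_eq {z w : ℝ × ℝ} : mkM z = mkM w ↔ ∃ k : ℤ, w.1 = z.1 + k ∧ w.2 = (-1 : ℝ) ^ k * z.2 :=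
  Quotient.eq

theorem exists_mkM (q : MobiusBand) : ∃ z : ℝ × ℝ, z.1 ∈ Ico (0:ℝ) 1 ∧ mkM z = q := by
  obtain ⟨z, rfl⟩ := mkM_surjective q
  refine ⟨(Int.fract z.1, (-1 : ℝ) ^ (-⌊z.1⌋) * z.2), ⟨Int.fract_nonneg _, Int.fract_lt_one _⟩, ?_⟩
  refine mkM_eq.2 ⟨⌊z.1⌋, (Int.fract_add_floor _).symm, ?_⟩
  rw [← mul_assoc, ← zpow_add₀ (by norm_num)]
  simp

theorem locallyFinite_slabs :
    LocallyFinite fun k : ℤ => {z : ℝ × ℝ | z.1 ∈ Icc (k : ℝ) (k + 1)} := by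
  intro z
  refine ⟨{w | w.1 ∈ Ioo (z.1 - 1) (z.1 + 1)}, (isOpen_Ioo.preimage continuous_fst).mem_nhds
    ⟨by simp, by simp⟩, (Set.finite_Icc (⌊z.1⌋ - 2) (⌊z.1⌋ + 2)).subset ?_⟩
  rintro k ⟨w, hw, hw'⟩
  have h1 := Int.floor_le z.1
  have h2 := Int.lt_floor_add_one z.1
  simp only [mem_ofPred_eq, mem_Icc, mem_Ioo] at hw hw'
  constructor
  · have : ((⌊z.1⌋ - 2 : ℤ) : ℝ) ≤ k := by push_cast; linarith
    exact_mod_cast this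
  · have : (k : ℝ) < ((⌊z.1⌋ + 2 : ℤ) : ℝ) := by push_cast; linarith
    exact_mod_cast this.le

section Close

variable {X : Type*} [TopologicalSpace X] {C C' : Set X} {w₀ w₁ : ℝ → X} {ε ε' : ℝ}

open Classical in
/-- Two boxes glued along both boundary lines with reversed orientation form a Möbius band. -/
theorem Box.mobius (B : Box C w₀ w₁ ε) (B' : Box C' w₁ w₀ ε') (hε : ε * ε' = -1)
    (hC : C ∩ C' ⊆ range w₀ ∪ range w₁)
    (h1 : closure C ∩ C' ⊆ C) (h2 : closure C' ∩ C ⊆ C') :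
    Nonempty (↥(C ∪ C') ≃ₜ MobiusBand) := by
  -- the parametrization over one period
  set Γ : ℝ × ℝ → X := fun z => if z.1 ≤ 1 / 2 then B.toFun (2 * z.1, z.2)
    else B'.toFun (2 * z.1 - 1, ε * z.2) with hΓ
  have hΓ1 : ∀ z : ℝ × ℝ, z.1 ∈ Icc (0:ℝ) (1/2) → Γ z = B.toFun (2 * z.1, z.2) :=
    fun z hz => if_pos hz.2
  have hΓ2 : ∀ z : ℝ × ℝ, z.1 ∈ Icc (1/2 : ℝ) 1 → Γ z = B'.toFun (2 * z.1 - 1, ε * z.2) := by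
    intro z hz
    rcases eq_or_lt_of_le hz.1 with h | h
    · simp only [hΓ, ← h]
      norm_num
      rw [B.one, B'.zero]
    · exact if_neg (not_le.2 h)
  have hΓc : ContinuousOn Γ slab := by
    have h : slab = {z : ℝ × ℝ | z.1 ∈ Icc (0:ℝ) (1/2)} ∪ {z : ℝ × ℝ | z.1 ∈ Icc (1/2 : ℝ) 1} := by
      ext z
      simp only [slab, mem_ofPred_eq, mem_union, mem_Icc]
      constructor
      · rintro ⟨a, b⟩
        rcases le_total z.1 (1/2) with h | h
        · exact Or.inl ⟨a, h⟩
        · exact Or.inr ⟨h, b⟩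
      · rintro (⟨a, b⟩ | ⟨a, b⟩) <;> constructor <;> linarith
    rw [h]
    refine ContinuousOn.union_of_isClosed ?_ ?_ (isClosed_Icc.preimage continuous_fst)
      (isClosed_Icc.preimage continuous_fst)
    · refine ContinuousOn.congr (f := fun z => B.toFun (2 * z.1, z.2)) ?_ (fun z hz => hΓ1 z hz)
      exact B.cont.comp (by fun_prop) (fun z hz => ⟨by linarith [hz.1], by linarith [hz.2]⟩)
    · refine ContinuousOn.congr (f := fun z => B'.toFun (2 * z.1 - 1, ε * z.2)) ?_
        (fun z hz => hΓ2 z hz)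
      exact B'.cont.comp (by fun_prop) (fun z hz => ⟨by linarith [hz.1], by linarith [hz.2]⟩)
  have hΓ0 : ∀ y, Γ (0, y) = w₀ y := fun y => by
    rw [hΓ1 _ ⟨le_refl _, by norm_num⟩]; simp [B.zero]
  have hΓe : ∀ y, Γ (1, y) = w₀ (-y) := fun y => by
    rw [hΓ2 _ ⟨by norm_num, le_refl _⟩]
    norm_num
    rw [B'.one, ← mul_assoc, mul_comm ε', hε, neg_one_mul]
  have hΓm : ∀ z ∈ slab, Γ z ∈ C ∪ C' := by
    intro z hz
    rcases le_total z.1 (1/2) with h | h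
    · rw [hΓ1 z ⟨hz.1, h⟩]
      exact Or.inl (B.maps _ ⟨by linarith [hz.1], by linarith [hz.2]⟩)
    · rw [hΓ2 z ⟨h, hz.2⟩]
      exact Or.inr (B'.maps _ ⟨by linarith [hz.1], by linarith [hz.2]⟩)
  have hfr : ∀ x : ℝ, Int.fract x ∈ Icc (0:ℝ) 1 := fun x =>
    ⟨Int.fract_nonneg _, (Int.fract_lt_one _).le⟩
  set P : ℝ × ℝ → X := fun z => Γ (Int.fract z.1, (-1 : ℝ) ^ ⌊z.1⌋ * z.2) with hP
  have hPk : ∀ (k : ℤ) (z : ℝ × ℝ), z.1 ∈ Icc (k : ℝ) (k + 1) →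
      P z = Γ (z.1 - k, (-1 : ℝ) ^ k * z.2) := by
    intro k z hz
    rcases eq_or_lt_of_le hz.2 with h | h
    · have hfl : ⌊z.1⌋ = k + 1 := by rw [h]; simp
      have hfr0 : Int.fract z.1 = 0 := by rw [Int.fract, hfl, h]; push_cast; ring
      simp only [hP]
      rw [hfr0, hfl, hΓ0, h, add_sub_cancel_left, hΓe, zpow_add_one₀ (by norm_num)]
      congr 1
      ring
    · have hfl : ⌊z.1⌋ = k := Int.floor_eq_iff.2 ⟨hz.1, h⟩
      simp only [hP]
      rw [Int.fract, hfl]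
  have hPc : Continuous P := by
    refine locallyFinite_slabs.continuous ?_ ?_ ?_
    · ext z
      simp only [mem_iUnion, mem_univ, iff_true]
      exact ⟨⌊z.1⌋, Int.floor_le _, (Int.lt_floor_add_one _).le⟩
    · exact fun k => isClosed_Icc.preimage continuous_fst
    · intro k
      refine ContinuousOn.congr (f := fun z => Γ (z.1 - k, (-1 : ℝ) ^ k * z.2)) ?_
        (fun z hz => hPk k z hz)
      exact hΓc.comp (by fun_prop) (fun z hz => ⟨by linarith [hz.1], by linarith [hz.2]⟩)
  have hPr : ∀ z w : ℝ × ℝ, mobiusSetoid.r z w → P z = P w := by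
    rintro z w ⟨k, h1, h2⟩
    simp only [hP]
    rw [h1, h2, Int.fract_add_intCast, Int.floor_add_intCast, ← mul_assoc,
      ← zpow_add₀ (by norm_num), add_assoc, zpow_add₀ (by norm_num), ← two_mul,
      (even_two_mul k).neg_one_zpow, mul_one]
  -- the inverse
  set A1 : X → MobiusBand := fun x => mkM ((B.invFun x).1 / 2, (B.invFun x).2) with hA1
  set A2 : X → MobiusBand := fun x => mkM ((1 + (B'.invFun x).1) / 2, ε * (B'.invFun x).2) with hA2
  have hA : ∀ x ∈ C, x ∈ C' → A1 x = A2 x := by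
    intro x hx hx'
    rcases hC ⟨hx, hx'⟩ with ⟨t, rfl⟩ | ⟨t, rfl⟩
    · simp only [hA1, hA2, B.inv_zero, B'.inv_one]
      rw [← mul_assoc, hε]
      refine mkM_eq.2 ⟨1, by norm_num, by norm_num⟩
    · simp only [hA1, hA2, B.inv_one, B'.inv_zero]
      norm_num
  set A : X → MobiusBand := fun x => if x ∈ C then A1 x else A2 x with hAd
  have hAC : ∀ x ∈ C, A x = A1 x := fun x hx => if_pos hx
  have hAC' : ∀ x ∈ C', A x = A2 x := by
    intro x hx
    by_cases h : x ∈ C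
    · rw [hAC x h, hA x h hx]
    · exact if_neg h
  have hAc : ContinuousOn A (C ∪ C') := by
    refine continuousOn_union_rel ?_ ?_ h1 h2
    · refine ContinuousOn.congr (f := A1) ?_ hAC
      have := B.cont_inv
      exact mkM_continuous.comp_continuousOn (by fun_prop)
    · refine ContinuousOn.congr (f := A2) ?_ hAC'
      have := B'.cont_inv
      exact mkM_continuous.comp_continuousOn (by fun_prop)
  have hPA : ∀ z : ℝ × ℝ, z.1 ∈ Ico (0:ℝ) 1 → A (P z) = mkM z := by
    intro z hz
    have h0 : P z = Γ z := by
      rw [hPk 0 z ⟨by simpa using hz.1, by simpa using hz.2.le⟩]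
      simp
    rw [h0]
    rcases le_total z.1 (1/2) with h | h
    · have hs : (2 * z.1, z.2) ∈ slab := ⟨by linarith [hz.1], by linarith⟩
      rw [hΓ1 z ⟨hz.1, h⟩, hAC _ (B.maps _ hs)]
      simp only [hA1, B.left_inv _ hs]
      rw [mul_div_cancel_left₀ _ two_ne_zero]
    · have hs : (2 * z.1 - 1, ε * z.2) ∈ slab := ⟨by linarith, by linarith [hz.2]⟩
      rw [hΓ2 z ⟨h, hz.2.le⟩, hAC' _ (B'.maps _ hs)]
      simp only [hA2, B'.left_inv _ hs]
      rw [add_sub_cancel, mul_div_cancel_left₀ _ two_ne_zero, ← mul_assoc, B.sq, one_mul]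
  have hAP : ∀ x ∈ C ∪ C', ∀ z, mkM z = A x → P z = x := by
    intro x hx z hz
    by_cases h : x ∈ C
    · rw [hAC x h] at hz
      have hm := B.maps_inv x h
      have := hPr _ _ (Quotient.eq.1 hz)
      rw [this, hPk 0 _ ⟨by simp only; push_cast; linarith [hm.1], by
        simp only; push_cast; linarith [hm.2]⟩, hΓ1 _ ⟨by simp only; push_cast; linarith [hm.1], by
        simp only; push_cast; linarith [hm.2]⟩]
      have : (2 * ((B.invFun x).1 / 2 - ((0:ℤ) : ℝ)), (-1 : ℝ) ^ (0:ℤ) * (B.invFun x).2) =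
          B.invFun x := by
        ext <;> simp
        ring
      simp only [this, B.right_inv x h]
    · have hx' := hx.resolve_left h
      rw [hAC' x hx'] at hz
      have hm := B'.maps_inv x hx'
      have := hPr _ _ (Quotient.eq.1 hz)
      rw [this, hPk 0 _ ⟨by simp only; push_cast; linarith [hm.1], by
        simp only; push_cast; linarith [hm.2]⟩, hΓ2 _ ⟨by simp only; push_cast; linarith [hm.1], by
        simp only; push_cast; linarith [hm.2]⟩]
      have : (2 * ((1 + (B'.invFun x).1) / 2 - ((0:ℤ) : ℝ)) - 1,
          ε * ((-1 : ℝ) ^ (0:ℤ) * (ε * (B'.invFun x).2))) = B'.invFun x := by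
        ext
        · simp
          ring
        · simp [← mul_assoc, B.sq]
      simp only [this, B'.right_inv x hx']
  have hPm : ∀ z, P z ∈ C ∪ C' := fun z => hΓm _ (hfr z.1)
  refine ⟨{ toFun := fun x => A x, invFun := Quotient.lift (fun z => ⟨P z, hPm z⟩)
              (fun z w h => Subtype.ext (hPr z w h)),
            left_inv := ?_, right_inv := ?_, continuous_toFun := ?_, continuous_invFun := ?_ }⟩
  · intro x
    simp only
    obtain ⟨z, hz⟩ := mkM_surjective (A x)
    rw [← hz]
    exact Subtype.ext (hAP x x.2 z hz)
  · intro q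
    obtain ⟨z, hz, rfl⟩ := exists_mkM q
    exact hPA z hz
  · exact continuousOn_iff_continuous_domRestrict.1 hAc
  · exact Continuous.quotient_lift (hPc.subtype_mk _) _

end Close

section NotSimplyConnected

/-- A space with a loop that a circle-valued map detects is not simply connected. -/
theorem not_simplyConnected_of_loop {Y : Type*} [TopologicalSpace Y] [LocallyPathConnectedSpace Y]
    (f : C(Y, AddCircle (1:ℝ))) (l : ℝ → Y) (hl : Continuous l) (hl1 : l 1 = l 0)
    (hfl : ∀ x, f (l x) = (x : AddCircle (1:ℝ))) : ¬ SimplyConnectedSpace Y := by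
  intro hY
  obtain ⟨e0, he0⟩ := QuotientAddGroup.mk_surjective (f (l 0))
  obtain ⟨F, ⟨-, hF⟩, -⟩ := (AddCircle.isCoveringMap_coe (1:ℝ)).existsUnique_continuousMap_lifts
    (f := f) (a₀ := l 0) (e₀ := e0) he0
  have hF' : ∀ y, ((F y : ℝ) : AddCircle (1:ℝ)) = f y := fun y => congrFun hF y
  have hinc : ∀ x, ∃ k : ℤ, F (l x) - x = k := by
    intro x
    have h1 : ((F (l x) - x : ℝ) : AddCircle (1:ℝ)) = 0 := by
      rw [AddCircle.coe_sub, hF', hfl, sub_self]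
    obtain ⟨k, hk⟩ := (AddCircle.coe_eq_zero_iff (1:ℝ)).1 h1
    exact ⟨k, by rw [← hk]; simp⟩
  have hc : Continuous fun x => F (l x) - x := by fun_prop
  choose k hk using hinc
  have hkc : Continuous k := by
    rw [Int.isClosedEmbedding_coe_real.isInducing.continuous_iff]
    exact hc.congr hk
  have h01 : k 0 = k 1 := PreconnectedSpace.constant inferInstance hkc
  have h2 := hk 0
  have h3 := hk 1
  rw [hl1, ← h01, ← h2] at h3
  linarith

instance : LocallyPathConnectedSpace MobiusBand := mkM_isQuotientMap.locallyPathConnectedSpace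

theorem mobius_not_simplyConnected : ¬ SimplyConnectedSpace MobiusBand := by
  have hc : Continuous (Quotient.lift (s := mobiusSetoid)
      (fun z : ℝ × ℝ => (z.1 : AddCircle (1:ℝ))) (by
        rintro z w ⟨k, hk, -⟩
        rw [hk, AddCircle.coe_add]
        have : ((k : ℝ) : AddCircle (1:ℝ)) = 0 :=
          (AddCircle.coe_eq_zero_iff (1:ℝ)).2 ⟨k, by simp⟩
        rw [this, add_zero])) :=
    Continuous.quotient_lift ((AddCircle.continuous_mk' (1:ℝ)).comp continuous_fst) _
  refine not_simplyConnected_of_loop ⟨_, hc⟩ (fun x => mkM (x, 0))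
    (mkM_continuous.comp (by fun_prop)) ?_ (fun x => rfl)
  exact (mkM_eq.2 ⟨1, by norm_num, by norm_num⟩).symm

theorem cylinder_not_simplyConnected : ¬ SimplyConnectedSpace (AddCircle (1:ℝ) × ℝ) := by
  have : LocallyPathConnectedSpace (AddCircle (1:ℝ)) :=
    (QuotientAddGroup.isQuotientMap_mk (N := AddSubgroup.zmultiples (1:ℝ))).locallyPathConnectedSpace
  have : LocallyPathConnectedSpace (AddCircle (1:ℝ) × ℝ) := inferInstance
  refine not_simplyConnected_of_loop ⟨Prod.fst, continuous_fst⟩ (fun x => ((x : AddCircle (1:ℝ)), 0))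
    ?_ ?_ (fun x => rfl)
  · exact (AddCircle.continuous_mk' (1:ℝ)).prodMk continuous_const
  · simp [AddCircle.coe_period]

end NotSimplyConnected

section Ends

/-- The complement of every compact set contains a connected complement of a compact set. -/
def OneEnded (Y : Type*) [TopologicalSpace Y] : Prop :=
  ∀ K : Set Y, IsCompact K → ∃ K', IsCompact K' ∧ K ⊆ K' ∧ IsPreconnected K'ᶜ

theorem OneEnded.of_homeo {Y Z : Type*} [TopologicalSpace Y] [TopologicalSpace Z] (h : Y ≃ₜ Z)
    (hY : OneEnded Y) : OneEnded Z := by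
  intro K hK
  obtain ⟨K', h1, h2, h3⟩ := hY (h ⁻¹' K) (h.isCompact_preimage.2 hK)
  refine ⟨h '' K', h1.image h.continuous, ?_, ?_⟩
  · intro z hz
    exact ⟨h.symm z, h2 (by simpa using hz), by simp⟩
  · rw [← image_compl_eq h.bijective]
    exact h3.image _ h.continuous.continuousOn

theorem mobius_oneEnded : OneEnded MobiusBand := by
  intro K hK
  have hl : ∀ z w : ℝ × ℝ, mobiusSetoid.r z w → |z.2| = |w.2| := by
    rintro z w ⟨k, -, hk⟩
    rw [hk, abs_mul, abs_zpow, abs_neg, abs_one, one_zpow, one_mul]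
  have hc : Continuous (Quotient.lift (s := mobiusSetoid) (fun z : ℝ × ℝ => |z.2|) hl) :=
    Continuous.quotient_lift (by fun_prop) _
  set a : MobiusBand → ℝ := Quotient.lift (s := mobiusSetoid) (fun z : ℝ × ℝ => |z.2|) hl with ha
  have haz : ∀ z, a (mkM z) = |z.2| := fun z => rfl
  obtain ⟨R, hR⟩ := hK.bddAbove_image hc.continuousOn
  refine ⟨mkM '' (Icc 0 1 ×ˢ Icc (-(max R 0)) (max R 0)),
    (isCompact_Icc.prod isCompact_Icc).image mkM_continuous, ?_, ?_⟩
  · intro q hq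
    obtain ⟨z, hz, rfl⟩ := exists_mkM q
    exact ⟨z, ⟨⟨hz.1, hz.2.le⟩, abs_le.1 ((hR ⟨_, hq, haz z⟩).trans (le_max_left _ _))⟩, rfl⟩
  · have : (mkM '' (Icc 0 1 ×ˢ Icc (-(max R 0)) (max R 0)))ᶜ = mkM '' {z | max R 0 < z.2} := by
      ext q
      constructor
      · intro hq
        obtain ⟨z, hz, rfl⟩ := exists_mkM q
        have h1 : max R 0 < |z.2| := by
          by_contra h
          exact hq ⟨z, ⟨⟨hz.1, hz.2.le⟩, abs_le.1 (not_lt.1 h)⟩, rfl⟩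
        rcases le_total 0 z.2 with h0 | h0
        · exact ⟨z, by rwa [abs_of_nonneg h0] at h1, rfl⟩
        · refine ⟨(z.1 + 1, -z.2), by rwa [abs_of_nonpos h0] at h1, ?_⟩
          exact (mkM_eq.2 ⟨1, by norm_num, by norm_num⟩).symm
      · rintro ⟨z, hz, rfl⟩ ⟨w, hw, hwz⟩
        have h1 := congrArg a hwz
        rw [haz, haz] at h1
        have h2 : |w.2| ≤ max R 0 := abs_le.2 hw.2
        have h3 : max R 0 < z.2 := hz
        linarith [le_abs_self z.2]
    rw [this]
    refine IsPreconnected.image ?_ _ mkM_continuous.continuousOn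
    exact ((convex_Ioi (max R 0)).linear_preimage (LinearMap.snd ℝ ℝ ℝ)).isPreconnected

theorem cylinder_not_oneEnded : ¬ OneEnded (AddCircle (1:ℝ) × ℝ) := by
  intro h
  have : Fact ((0:ℝ) < 1) := ⟨one_pos⟩
  obtain ⟨K, hK, h0, hc⟩ := h (univ ×ˢ {0}) (isCompact_univ.prod isCompact_singleton)
  obtain ⟨R, hR⟩ := (hK.image continuous_snd).isBounded.exists_norm_le
  have hz : ∀ y : ℝ, R < |y| → ((0 : AddCircle (1:ℝ)), y) ∈ Kᶜ := by
    intro y hy hk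
    exact absurd (hR y ⟨_, hk, rfl⟩) (not_le.2 hy)
  have h1 := (hc.image _ continuous_snd.continuousOn).ordConnected
  have hp : R < |(|R| + 1)| := by
    rw [abs_of_nonneg (by positivity)]
    linarith [le_abs_self R]
  obtain ⟨w, hw, hw0⟩ := h1.out ⟨_, hz (-(|R| + 1)) (by rwa [abs_neg]), rfl⟩ ⟨_, hz (|R| + 1) hp, rfl⟩
    (show (0:ℝ) ∈ Icc (-(|R| + 1)) (|R| + 1) from
      ⟨by linarith [abs_nonneg R], by linarith [abs_nonneg R]⟩)
  exact hw (h0 ⟨mem_univ _, hw0⟩)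

theorem cylinder_not_mobius (h : (AddCircle (1:ℝ) × ℝ) ≃ₜ MobiusBand) : False :=
  cylinder_not_oneEnded (mobius_oneEnded.of_homeo h.symm)

end Ends

end

section

/-- A decomposition of a part of a surface into open disks (strips) glued along lines (walls). -/
structure StripSystem (X : Type*) [TopologicalSpace X] (S W : Type*) where
  st : S → Set X
  wl : W → Set X
  a : W → S
  b : W → S
  ne : ∀ w, a w ≠ b w
  chart : W → ℝ × ℝ → X
  emb : ∀ w, IsOpenEmbedding (chart w)
  chart_wl : ∀ w, chart w '' {z | z.1 = 0} = wl w
  chart_a : ∀ w, chart w '' {z | z.1 < 0} = st (a w)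
  chart_b : ∀ w, chart w '' {z | 0 < z.1} = st (b w)
  open_st : ∀ s, IsOpen (st s)
  plane : ∀ s, Nonempty (st s ≃ₜ ℝ × ℝ)
  st_disj : ∀ {x s s'}, x ∈ st s → x ∈ st s' → s = s'
  wl_disj : ∀ {x w w'}, x ∈ wl w → x ∈ wl w' → w = w'
  st_wl : ∀ {x s w}, x ∈ st s → x ∈ wl w → False
  η : W → ℝ
  η_sq : ∀ w, η w * η w = 1

namespace StripSystem

variable {X S W : Type*} [TopologicalSpace X]

/-- Incidence of strips and walls. -/
def Inc (G : StripSystem X S W) (s : S) (w : W) : Prop := G.a w = s ∨ G.b w = s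

open Classical in
/-- The sign of a side of a wall. -/
def sgn (G : StripSystem X S W) (w : W) (s : S) : ℝ := if G.b w = s then 1 else - G.η w

/-- The union of a set of strips and a set of walls. -/
def carrier (G : StripSystem X S W) (A : Finset S) (B : Finset W) : Set X :=
  (⋃ s ∈ A, G.st s) ∪ ⋃ w ∈ B, G.wl w

variable (G : StripSystem X S W)

theorem range_chart (w : W) : range (G.chart w) = G.st (G.a w) ∪ G.wl w ∪ G.st (G.b w) := by
  rw [← G.chart_a, ← G.chart_b, ← G.chart_wl, ← image_union, ← image_union, ← image_univ]
  congr 1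
  ext z
  simpa [or_assoc] using lt_trichotomy z.1 0

theorem open_nbhd (w : W) : IsOpen (G.st (G.a w) ∪ G.wl w ∪ G.st (G.b w)) :=
  G.range_chart w ▸ (G.emb w).isOpen_range

theorem mem_carrier {A : Finset S} {B : Finset W} {x : X} :
    x ∈ G.carrier A B ↔ (∃ s ∈ A, x ∈ G.st s) ∨ ∃ w ∈ B, x ∈ G.wl w := by
  simp [carrier]

theorem st_carrier {A : Finset S} {B : Finset W} {x : X} {s : S} (hx : x ∈ G.st s) :
    x ∈ G.carrier A B ↔ s ∈ A := by
  rw [mem_carrier]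
  constructor
  · rintro (⟨t, ht, h⟩ | ⟨w, -, h⟩)
    · rwa [G.st_disj hx h]
    · exact (G.st_wl hx h).elim
  · exact fun h => Or.inl ⟨s, h, hx⟩

theorem wl_carrier {A : Finset S} {B : Finset W} {x : X} {w : W} (hx : x ∈ G.wl w) :
    x ∈ G.carrier A B ↔ w ∈ B := by
  rw [mem_carrier]
  constructor
  · rintro (⟨t, ht, h⟩ | ⟨w, hw, h⟩)
    · exact (G.st_wl h hx).elim
    · rwa [G.wl_disj hx h]
  · exact fun h => Or.inr ⟨w, h, hx⟩

theorem st_closure {A : Finset S} {B : Finset W} {x : X} {s : S} (hx : x ∈ G.st s)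
    (h : x ∈ closure (G.carrier A B)) : s ∈ A := by
  obtain ⟨y, hy, hy'⟩ := mem_closure_iff.1 h _ (G.open_st s) hx
  exact (G.st_carrier hy).1 hy'

theorem wl_closure {A : Finset S} {B : Finset W} {x : X} {w : W} (hx : x ∈ G.wl w)
    (h : x ∈ closure (G.carrier A B)) : w ∈ B ∨ ∃ s ∈ A, G.Inc s w := by
  obtain ⟨y, (hy | hy) | hy, hy'⟩ := mem_closure_iff.1 h _ (G.open_nbhd w) (Or.inl (Or.inr hx))
  · exact Or.inr ⟨_, (G.st_carrier hy).1 hy', Or.inl rfl⟩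
  · exact Or.inl ((G.wl_carrier hy).1 hy')
  · exact Or.inr ⟨_, (G.st_carrier hy).1 hy', Or.inr rfl⟩

theorem exists_other {s : S} {w : W} (h : G.Inc s w) : ∃ t, t ≠ s ∧ G.Inc t w ∧
    (∀ t', G.Inc t' w → t' = s ∨ t' = t) ∧ G.sgn w s * G.sgn w t = - G.η w := by
  rcases h with h | h
  · refine ⟨G.b w, fun h' => G.ne w (h.trans h'.symm), Or.inr rfl, ?_, ?_⟩
    · rintro t' (h' | h')
      · exact Or.inl (h'.symm.trans h)
      · exact Or.inr h'.symm
    · have : ¬ G.b w = s := fun h' => G.ne w (h.trans h'.symm)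
      simp [sgn, this]
  · refine ⟨G.a w, fun h' => G.ne w (h'.trans h.symm), Or.inl rfl, ?_, ?_⟩
    · rintro t' (h' | h')
      · exact Or.inr h'.symm
      · exact Or.inl (h'.symm.trans h)
    · have : s ≠ G.a w := fun h' => G.ne w (h'.symm.trans h.symm)
      simp [sgn, h, this]

/-- The strips in `A` and the walls in `B` form a union of pieces closed under taking ends. -/
def Closed (A : Finset S) (B : Finset W) : Prop := ∀ w ∈ B, G.a w ∈ A ∧ G.b w ∈ A

/-- No proper part of `A` is separated from the rest by the walls in `B`. -/
def Conn (A : Finset S) (B : Finset W) : Prop :=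
  A.Nonempty ∧ ∀ D ⊆ A, D.Nonempty → (∀ w ∈ B, (G.a w ∈ D ↔ G.b w ∈ D)) → D = A

open Classical in
/-- The walls in `B` incident to `s`. -/
def inc (B : Finset W) (s : S) : Finset W := B.filter (G.Inc s)

theorem mem_inc {B : Finset W} {s : S} {w : W} : w ∈ G.inc B s ↔ w ∈ B ∧ G.Inc s w := by
  simp [inc]

theorem Closed.inc_mem {G : StripSystem X S W} {A : Finset S} {B : Finset W} (h : G.Closed A B)
    {s : S} {w : W} (hw : w ∈ B) (hs : G.Inc s w) : s ∈ A := by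
  rcases hs with rfl | rfl
  · exact (h w hw).1
  · exact (h w hw).2

theorem sum_inc {M : Type*} [AddCommMonoid M] {A : Finset S} {B : Finset W} (h : G.Closed A B)
    (z : W → M) : ∑ s ∈ A, ∑ w ∈ G.inc B s, z w = ∑ w ∈ B, (z w + z w) := by
  classical
  simp only [inc, Finset.sum_filter]
  rw [Finset.sum_comm]
  refine Finset.sum_congr rfl fun w hw => ?_
  rw [← Finset.sum_filter]
  have : A.filter (fun s => G.Inc s w) = {G.a w, G.b w} := by
    ext s
    rw [Finset.mem_filter, Finset.mem_insert, Finset.mem_singleton]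
    constructor
    · rintro ⟨-, h | h⟩
      · exact Or.inl h.symm
      · exact Or.inr h.symm
    · rintro (rfl | rfl)
      · exact ⟨(h w hw).1, Or.inl rfl⟩
      · exact ⟨(h w hw).2, Or.inr rfl⟩
  rw [this, Finset.sum_pair (G.ne w)]

theorem Conn.erase {G : StripSystem X S W} [DecidableEq S] [DecidableEq W] {A : Finset S} {B : Finset W}
    (hcl : G.Closed A B) (hc : G.Conn A B) {s : S} {w : W}
    (hs : s ∈ A) (hw : G.inc B s = {w}) : G.Closed (A.erase s) (B.erase w) ∧
      G.Conn (A.erase s) (B.erase w) := by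
  have hws : w ∈ B ∧ G.Inc s w := G.mem_inc.1 (hw ▸ Finset.mem_singleton_self w)
  have huniq : ∀ w' ∈ B, w' ≠ w → ¬ G.Inc s w' := fun w' h1 h2 h3 =>
    h2 (Finset.mem_singleton.1 (hw ▸ G.mem_inc.2 ⟨h1, h3⟩))
  obtain ⟨t, hts, htw, huni, -⟩ := G.exists_other hws.2
  have htA : t ∈ A := hcl.inc_mem hws.1 htw
  refine ⟨?_, ⟨t, Finset.mem_erase.2 ⟨hts, htA⟩⟩, ?_⟩
  · intro w' hw'
    obtain ⟨h1, h2⟩ := Finset.mem_erase.1 hw'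
    have h3 := huniq w' h2 h1
    exact ⟨Finset.mem_erase.2 ⟨fun h => h3 (Or.inl h), (hcl w' h2).1⟩,
      Finset.mem_erase.2 ⟨fun h => h3 (Or.inr h), (hcl w' h2).2⟩⟩
  · intro D hD hDn hDc
    have hDs : s ∉ D := fun h => (Finset.mem_erase.1 (hD h)).1 rfl
    by_cases htD : t ∈ D
    · have : insert s D = A := by
        refine hc.2 _ ?_ ⟨s, Finset.mem_insert_self _ _⟩ ?_
        · exact Finset.insert_subset hs (hD.trans (Finset.erase_subset _ _))
        · intro w' hw'
          by_cases hww : w' = w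
          · have h1 := huni _ (Or.inl rfl : G.Inc (G.a w) w)
            have h2 := huni _ (Or.inr rfl : G.Inc (G.b w) w)
            subst hww
            constructor <;> intro _
            · rcases h2 with h | h <;> rw [h] <;> simp [htD]
            · rcases h1 with h | h <;> rw [h] <;> simp [htD]
          · have h3 := huniq w' hw' hww
            have ha : G.a w' ≠ s := fun h => h3 (Or.inl h)
            have hb : G.b w' ≠ s := fun h => h3 (Or.inr h)
            simpa [ha, hb] using hDc w' (Finset.mem_erase.2 ⟨hww, hw'⟩)
      rw [← this, Finset.erase_insert hDs]
    · have : D = A := by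
        refine hc.2 _ (hD.trans (Finset.erase_subset _ _)) hDn ?_
        intro w' hw'
        by_cases hww : w' = w
        · have h1 := huni _ (Or.inl rfl : G.Inc (G.a w) w)
          have h2 := huni _ (Or.inr rfl : G.Inc (G.b w) w)
          subst hww
          constructor <;> intro h <;> exfalso
          · rcases h1 with h' | h' <;> rw [h'] at h <;> contradiction
          · rcases h2 with h' | h' <;> rw [h'] at h <;> contradiction
        · exact hDc w' (Finset.mem_erase.2 ⟨hww, hw'⟩)
      exact (htD (this ▸ htA)).elim

theorem Conn.inc_nonempty {G : StripSystem X S W} {A : Finset S} {B : Finset W}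
    (hcl : G.Closed A B) (hc : G.Conn A B) {s : S} (hs : s ∈ A) (h0 : G.inc B s = ∅) :
    A = {s} ∧ B = ∅ := by
  have h1 : {s} = A := by
    refine hc.2 _ (by simpa using hs) ⟨s, by simp⟩ fun w hw => ?_
    have : ¬ G.Inc s w := fun h => by
      have := G.mem_inc.2 ⟨hw, h⟩
      simp [h0] at this
    simp only [Finset.mem_singleton]
    constructor
    · exact fun h => (this (Or.inl h)).elim
    · exact fun h => (this (Or.inr h)).elim
  refine ⟨h1.symm, Finset.eq_empty_of_forall_notMem fun w hw => ?_⟩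
  have h2 := hcl w hw
  rw [← h1] at h2
  simp only [Finset.mem_singleton] at h2
  exact G.ne w (h2.1.trans h2.2.symm)

end StripSystem

end

section

namespace StripSystem

variable {X S W : Type*} [TopologicalSpace X] [TopologicalSpace.MetrizableSpace X]
  {G : StripSystem X S W}

theorem prune_leaf [DecidableEq S] [DecidableEq W] {A : Finset S} {B : Finset W}
    (hcl : G.Closed A B) {s : S} {w : W} (hw : G.inc B s = {w}) :
    Nonempty (G.carrier A B ≃ₜ G.carrier (A.erase s) (B.erase w)) := by
  have hws : w ∈ B ∧ G.Inc s w := G.mem_inc.1 (hw ▸ Finset.mem_singleton_self w)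
  have huniq : ∀ w' ∈ B, w' ≠ w → ¬ G.Inc s w' := fun w' h1 h2 h3 =>
    h2 (Finset.mem_singleton.1 (hw ▸ G.mem_inc.2 ⟨h1, h3⟩))
  obtain ⟨e, he, her, hes⟩ : ∃ e : ℝ × ℝ → X, IsOpenEmbedding e ∧
      range e = G.st (G.a w) ∪ G.wl w ∪ G.st (G.b w) ∧
      e '' {z | 0 ≤ z.1} = G.st s ∪ G.wl w := by
    rcases hws.2 with h | h
    · let n : (ℝ × ℝ) ≃ₜ (ℝ × ℝ) := (Homeomorph.neg ℝ).prodCongr (Homeomorph.refl ℝ)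
      refine ⟨G.chart w ∘ n, (G.emb w).comp n.isOpenEmbedding, ?_, ?_⟩
      · rw [n.surjective.range_comp, G.range_chart]
      · rw [image_comp, ← h, ← G.chart_a, ← G.chart_wl, ← image_union]
        congr 1
        ext z
        simp only [mem_image, mem_ofPred_eq, mem_union]
        constructor
        · rintro ⟨y, hy, rfl⟩
          simpa [n, le_iff_lt_or_eq, eq_comm] using hy
        · intro hz
          refine ⟨(-z.1, z.2), ?_, by simp [n]⟩
          rcases hz with hz | hz <;> simp <;> linarith
    · refine ⟨G.chart w, G.emb w, G.range_chart w, ?_⟩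
      rw [← h, ← G.chart_b, ← G.chart_wl, ← image_union]
      congr 1
      ext z
      simp [le_iff_lt_or_eq, eq_comm]
  let _ := TopologicalSpace.metrizableSpaceMetric X
  refine prune_homeo_set he ?_ ?_ ?_
  · rw [her]
    rintro x ((hx | hx) | hx)
    · exact (G.st_carrier hx).2 (hcl w hws.1).1
    · exact (G.wl_carrier hx).2 hws.1
    · exact (G.st_carrier hx).2 (hcl w hws.1).2
  · rw [hes]
    ext x
    constructor
    · intro hx
      rcases G.mem_carrier.1 hx with ⟨t, ht, h⟩ | ⟨t, ht, h⟩
      · refine ⟨(G.st_carrier h).2 (Finset.mem_of_mem_erase ht), ?_⟩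
        rintro (h' | h')
        · exact (Finset.mem_erase.1 ht).1 (G.st_disj h h')
        · exact G.st_wl h h'
      · refine ⟨(G.wl_carrier h).2 (Finset.mem_of_mem_erase ht), ?_⟩
        rintro (h' | h')
        · exact G.st_wl h' h
        · exact (Finset.mem_erase.1 ht).1 (G.wl_disj h h')
    · rintro ⟨hx, hx'⟩
      rcases G.mem_carrier.1 hx with ⟨t, ht, h⟩ | ⟨t, ht, h⟩
      · refine (G.st_carrier h).2 (Finset.mem_erase.2 ⟨?_, ht⟩)
        rintro rfl
        exact hx' (Or.inl h)
      · refine (G.wl_carrier h).2 (Finset.mem_erase.2 ⟨?_, ht⟩)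
        rintro rfl
        exact hx' (Or.inr h)
  · rw [hes]
    have hc : G.st s ∪ G.wl w = G.carrier {s} {w} := by simp [carrier]
    rw [hc]
    rintro x ⟨hx, hx'⟩
    rcases G.mem_carrier.1 hx with ⟨t, ht, h⟩ | ⟨t, ht, h⟩
    · exact (G.st_carrier h).2 (G.st_closure h hx')
    · refine (G.wl_carrier h).2 ?_
      rcases G.wl_closure h hx' with h1 | ⟨s', h1, h2⟩
      · exact h1
      · rw [Finset.mem_singleton.1 h1] at h2
        by_contra h3
        exact huniq t ht (by simpa using h3) h2

theorem exists_core (n : ℕ) : ∀ {A : Finset S} {B : Finset W}, A.card = n →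
    G.Closed A B → G.Conn A B →
    ∃ A' ⊆ A, ∃ B' ⊆ B, G.Closed A' B' ∧ G.Conn A' B' ∧ A.card + B'.card = A'.card + B.card ∧
      Nonempty (G.carrier A B ≃ₜ G.carrier A' B') ∧
      (∀ z : W → ZMod 2, (∀ s ∈ A, ∑ w ∈ G.inc B s, z w = 0) →
        (∀ s ∈ A', ∑ w ∈ G.inc B' s, z w = 0) ∧ ∀ w ∈ B, w ∉ B' → z w = 0) ∧
      ((∀ s ∈ A', 2 ≤ (G.inc B' s).card) ∨ ∃ s, A' = {s} ∧ B' = ∅) := by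
  classical
  induction n using Nat.strong_induction_on with
  | _ n ih =>
  intro A B hn hcl hc
  by_cases hcore : ∀ s ∈ A, 2 ≤ (G.inc B s).card
  · exact ⟨A, subset_rfl, B, subset_rfl, hcl, hc, rfl, ⟨Homeomorph.refl _⟩,
      fun z hz => ⟨hz, fun w h h' => (h' h).elim⟩, Or.inl hcore⟩
  push Not at hcore
  obtain ⟨s, hs, hlt⟩ := hcore
  rcases Nat.lt_succ_iff.1 hlt |>.lt_or_eq with h0 | h1
  · obtain ⟨h2, h3⟩ := hc.inc_nonempty hcl hs (Finset.card_eq_zero.1 (by omega))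
    exact ⟨A, subset_rfl, B, subset_rfl, hcl, hc, rfl, ⟨Homeomorph.refl _⟩,
      fun z hz => ⟨hz, fun w h h' => (h' h).elim⟩, Or.inr ⟨s, h2, h3⟩⟩
  · obtain ⟨w, hw⟩ := Finset.card_eq_one.1 h1
    have hwB : w ∈ B := (G.mem_inc.1 (hw ▸ Finset.mem_singleton_self w)).1
    obtain ⟨hcl', hc'⟩ := hc.erase hcl hs hw
    have e1 := Finset.card_erase_add_one hs
    have e2 := Finset.card_erase_add_one hwB
    obtain ⟨A', hA, B', hB, k1, k2, k3, ⟨k4⟩, k5, k6⟩ := ih _ (by omega) rfl hcl' hc'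
    obtain ⟨k⟩ := prune_leaf hcl hw
    refine ⟨A', hA.trans (Finset.erase_subset _ _), B', hB.trans (Finset.erase_subset _ _), k1, k2,
      by omega, ⟨k.trans k4⟩, ?_, k6⟩
    intro z hz
    have hzw : z w = 0 := by simpa [hw] using hz s hs
    obtain ⟨m1, m2⟩ := k5 z (by
      intro t ht
      rw [← hz t (Finset.mem_of_mem_erase ht)]
      refine Finset.sum_subset ?_ ?_
      · intro w' hw'
        rw [mem_inc] at hw' ⊢
        exact ⟨Finset.mem_of_mem_erase hw'.1, hw'.2⟩
      · intro w' hw' hw''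
        rw [mem_inc] at hw' hw''
        by_cases h : w' = w
        · rwa [h]
        · exact (hw'' ⟨Finset.mem_erase.2 ⟨h, hw'.1⟩, hw'.2⟩).elim)
    refine ⟨m1, fun w' h h' => ?_⟩
    by_cases hww : w' = w
    · rwa [hww]
    · exact m2 w' (Finset.mem_erase.2 ⟨hww, h⟩) h'

theorem card_le_of_deg {A : Finset S} {B : Finset W} (hcl : G.Closed A B)
    (h : ∀ s ∈ A, 2 ≤ (G.inc B s).card) : A.card ≤ B.card ∧
      (A.card = B.card → ∀ s ∈ A, (G.inc B s).card = 2) := by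
  have h1 := G.sum_inc hcl (fun _ => 1)
  simp only [Finset.sum_const, smul_eq_mul, mul_one] at h1
  have h2 : ∑ s ∈ A, 2 ≤ ∑ s ∈ A, (G.inc B s).card := Finset.sum_le_sum h
  have h3 : ∑ s ∈ A, 2 = A.card * 2 := by simp
  refine ⟨by omega, fun he s hs => ?_⟩
  have h4 := (Finset.sum_eq_sum_iff_of_le h).1 (by omega)
  exact (h4 s hs).symm

/-- The Euler characteristic of a connected union of strips is at most one. -/
theorem card_le {A : Finset S} {B : Finset W} (hcl : G.Closed A B) (hc : G.Conn A B) :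
    A.card ≤ B.card + 1 := by
  obtain ⟨A', hA, B', hB, k1, k2, k3, -, -, k6 | ⟨s, k6, k7⟩⟩ := exists_core _ rfl hcl hc
  · have := (card_le_of_deg k1 k6).1
    omega
  · simp [k6, k7] at k3
    omega

/-- A connected union of strips with Euler characteristic one is a plane. -/
theorem plane_of_card {A : Finset S} {B : Finset W} (hcl : G.Closed A B) (hc : G.Conn A B)
    (h : A.card = B.card + 1) : Nonempty (G.carrier A B ≃ₜ ℝ × ℝ) := by
  obtain ⟨A', hA, B', hB, k1, k2, k3, ⟨k4⟩, -, k6 | ⟨s, k6, k7⟩⟩ := exists_core _ rfl hcl hc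
  · have := (card_le_of_deg k1 k6).1
    omega
  · obtain ⟨p⟩ := G.plane s
    have : G.carrier A' B' = G.st s := by simp [carrier, k6, k7]
    exact ⟨k4.trans ((Homeomorph.setCongr this).trans p)⟩

end StripSystem

end

section

namespace StripSystem

variable {X S W : Type*} [TopologicalSpace X] {G : StripSystem X S W}

/-- The line parametrizing a wall. -/
def line (G : StripSystem X S W) (w : W) (y : ℝ) : X := G.chart w (0, y)

theorem range_line (w : W) : range (G.line w) = G.wl w := by
  rw [← G.chart_wl]
  ext x
  constructor
  · rintro ⟨y, rfl⟩
    exact ⟨(0, y), rfl, rfl⟩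
  · rintro ⟨⟨x, y⟩, hz, rfl⟩
    obtain rfl : x = 0 := hz
    exact ⟨y, rfl⟩

/-- Any two walls of a strip bound a box whose sign is given by the sides. -/
def HasBoxes [DecidableEq W] (G : StripSystem X S W) : Prop :=
  ∀ s w w', w ≠ w' → G.Inc s w → G.Inc s w' →
    Nonempty (Box (G.carrier {s} {w, w'}) (G.line w) (G.line w') (-(G.sgn w s * G.sgn w' s)))

variable [DecidableEq S] [DecidableEq W]

theorem carrier_union (A A' : Finset S) (B B' : Finset W) :
    G.carrier A B ∪ G.carrier A' B' = G.carrier (A ∪ A') (B ∪ B') := by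
  ext x
  simp only [mem_union, mem_carrier, Finset.mem_union, or_and_right, exists_or]
  exact or_or_or_comm

theorem box_cast {C C' : Set X} {w₀ w₁ : ℝ → X} {ε ε' : ℝ} (h : C = C') (h' : ε = ε')
    (B : Box C w₀ w₁ ε) : Nonempty (Box C' w₀ w₁ ε') := by
  subst h h'
  exact ⟨B⟩

theorem walk (hG : G.HasBoxes) {A : Finset S} {B : Finset W} (hcl : G.Closed A B)
    (hc : G.Conn A B) (hreg : ∀ s ∈ A, (G.inc B s).card = 2) (hη : ∏ w ∈ B, G.η w = -1)
    (n : ℕ) : ∀ {P : Finset S} {V : Finset W} {w₀ u : W} {s₀ s₁ t₀ t₁ : S}, (A \ P).card = n →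
      P ⊆ A → V ⊆ B → w₀ ∈ B → u ∈ B → w₀ ≠ u → w₀ ∉ V → u ∉ V → s₀ ∈ P → s₁ ∈ P →
      G.Inc s₀ w₀ → G.Inc s₁ u → t₀ ∉ P → G.Inc t₀ w₀ → t₁ ∉ P → G.Inc t₁ u →
      (∀ w ∈ V, G.a w ∈ P ∧ G.b w ∈ P) →
      (∀ w ∈ B, w ∉ V → w ≠ w₀ → w ≠ u → G.a w ∉ P ∧ G.b w ∉ P) →
      Nonempty (Box (G.carrier P (insert w₀ (insert u V))) (G.line w₀) (G.line u)
        (-(G.sgn w₀ s₀ * G.sgn u s₁ * ∏ w ∈ V, G.η w))) →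
      Nonempty (G.carrier A B ≃ₜ MobiusBand) := by
  induction n using Nat.strong_induction_on with
  | _ n ih =>
  intro P V w₀ u s₀ s₁ t₀ t₁ hn hPA hVB hw₀ hu hwu hwV huV hs₀ hs₁ is₀ is₁ ht₀ it₀ ht₁ it₁ hV hB ⟨bx⟩
  have ht₁A : t₁ ∈ A := hcl.inc_mem hu it₁
  have hst₁ : s₁ ≠ t₁ := fun h => ht₁ (h ▸ hs₁)
  have hst₀ : s₀ ≠ t₀ := fun h => ht₀ (h ▸ hs₀)
  have hsg : ∀ {w : W} {s t : S}, G.Inc s w → G.Inc t w → s ≠ t →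
      G.sgn w s * G.sgn w t = - G.η w ∧ ∀ t', G.Inc t' w → t' = s ∨ t' = t := by
    intro w s t hs ht hst
    obtain ⟨t', h1, h2, h3, h4⟩ := G.exists_other hs
    rcases h3 t ht with rfl | rfl
    · exact (hst rfl).elim
    · exact ⟨h4, h3⟩
  obtain ⟨u', hu'u, hinc⟩ : ∃ u', u' ≠ u ∧ G.inc B t₁ = {u, u'} := by
    have hm : u ∈ G.inc B t₁ := G.mem_inc.2 ⟨hu, it₁⟩
    obtain ⟨x, y, hxy, h⟩ := Finset.card_eq_two.1 (hreg t₁ ht₁A)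
    rw [h] at hm
    rcases Finset.mem_insert.1 hm with h' | h'
    · exact ⟨y, h' ▸ hxy.symm, by rw [h, h']⟩
    · rw [Finset.mem_singleton] at h'
      exact ⟨x, h' ▸ hxy, by rw [h, h', Finset.pair_comm]⟩
  have hu' : u' ∈ B ∧ G.Inc t₁ u' := G.mem_inc.1 (by rw [hinc]; simp)
  have huni : ∀ w ∈ B, G.Inc t₁ w → w = u ∨ w = u' := by
    intro w h h'
    have := G.mem_inc.2 ⟨h, h'⟩
    rw [hinc] at this
    simpa using this
  obtain ⟨bt⟩ := hG t₁ u u' hu'u.symm it₁ hu'.2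
  -- walls of `t₁` other than `w₀`, `u` have no end in `P`
  have hcl1 : closure (G.carrier P (insert w₀ (insert u V))) ∩ G.carrier {t₁} {u, u'} ⊆
      G.carrier P (insert w₀ (insert u V)) := by
    rintro x ⟨hx, hx'⟩
    rcases G.mem_carrier.1 hx' with ⟨t, ht, h⟩ | ⟨t, ht, h⟩
    · exact (G.st_carrier h).2 (G.st_closure h hx)
    · refine (G.wl_carrier h).2 ?_
      rcases G.wl_closure h hx with h1 | ⟨s', h1, h2⟩
      · exact h1
      · simp only [Finset.mem_insert, Finset.mem_singleton] at ht ⊢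
        by_contra hcon
        push Not at hcon
        rcases ht with rfl | rfl
        · exact hcon.2.1 rfl
        · have := hB t hu'.1 hcon.2.2 hcon.1 hcon.2.1
          rcases h2 with rfl | rfl
          · exact this.1 h1
          · exact this.2 h1
  have hcl2 : closure (G.carrier {t₁} {u, u'}) ∩ G.carrier P (insert w₀ (insert u V)) ⊆
      G.carrier {t₁} {u, u'} := by
    rintro x ⟨hx, hx'⟩
    rcases G.mem_carrier.1 hx' with ⟨t, ht, h⟩ | ⟨t, ht, h⟩
    · exact (G.st_carrier h).2 (G.st_closure h hx)
    · refine (G.wl_carrier h).2 ?_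
      rcases G.wl_closure h hx with h1 | ⟨s', h1, h2⟩
      · exact h1
      · rw [Finset.mem_singleton] at h1
        subst h1
        have : t ∈ B := by
          simp only [Finset.mem_insert] at ht
          rcases ht with rfl | rfl | ht
          exacts [hw₀, hu, hVB ht]
        simpa using huni t this h2
  have hinc : ∀ x, x ∈ G.carrier P (insert w₀ (insert u V)) → x ∈ G.carrier {t₁} {u, u'} →
      ∃ w, (w = u ∨ w = u') ∧ (w = w₀ ∨ w = u ∨ w ∈ V) ∧ x ∈ G.wl w := by
    intro x hx hx'
    rcases G.mem_carrier.1 hx' with ⟨t, ht, h⟩ | ⟨t, ht, h⟩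
    · rw [Finset.mem_singleton] at ht
      exact (ht₁ (ht ▸ (G.st_carrier h).1 hx)).elim
    · exact ⟨t, by simpa using ht, by simpa using (G.wl_carrier h).1 hx, h⟩
  have huV' : u' ∉ V := by
    intro h
    rcases hu'.2 with h' | h'
    · exact ht₁ (h' ▸ (hV u' h).1)
    · exact ht₁ (h' ▸ (hV u' h).2)
  have ηu : G.sgn u s₁ * G.sgn u t₁ = - G.η u := (hsg is₁ it₁ hst₁).1
  have huends := (hsg is₁ it₁ hst₁).2
  by_cases hclose : u' = w₀
  · subst hclose
    have htt : t₀ = t₁ := by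
      rcases (hsg is₀ hu'.2 (fun h => ht₁ (h ▸ hs₀))).2 t₀ it₀ with h | h
      · exact (ht₀ (h ▸ hs₀)).elim
      · exact h
    subst htt
    have ηw := (hsg is₀ it₀ hst₀)
    have hA : insert t₀ P = A := by
      refine hc.2 _ (Finset.insert_subset ht₁A hPA) ⟨t₀, Finset.mem_insert_self _ _⟩ ?_
      have key : ∀ w ∈ B, (∀ s, G.Inc s w → s ∈ insert t₀ P) ∨ (∀ s, G.Inc s w → s ∉ insert t₀ P) := by
        intro w hw
        by_cases h1 : w ∈ V
        · left
          rintro s (rfl | rfl)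
          · exact Finset.mem_insert_of_mem (hV w h1).1
          · exact Finset.mem_insert_of_mem (hV w h1).2
        by_cases h2 : w = u'
        · subst h2
          left
          intro s hs
          rcases ηw.2 s hs with rfl | rfl
          · exact Finset.mem_insert_of_mem hs₀
          · exact Finset.mem_insert_self _ _
        by_cases h3 : w = u
        · subst h3
          left
          intro s hs
          rcases huends s hs with rfl | rfl
          · exact Finset.mem_insert_of_mem hs₁
          · exact Finset.mem_insert_self _ _
        right
        intro s hs hs'
        have hP := hB w hw h1 h2 h3
        rcases Finset.mem_insert.1 hs' with rfl | h
        · exact (huni w hw hs).elim h3 h2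
        · rcases hs with rfl | rfl
          · exact hP.1 h
          · exact hP.2 h
      intro w hw
      rcases key w hw with h | h
      · exact iff_of_true (h _ (Or.inl rfl)) (h _ (Or.inr rfl))
      · exact iff_of_false (h _ (Or.inl rfl)) (h _ (Or.inr rfl))
    have hBV : insert u' (insert u V) = B := by
      refine Finset.Subset.antisymm (Finset.insert_subset hw₀ (Finset.insert_subset hu hVB)) ?_
      intro w hw
      by_contra h
      simp only [Finset.mem_insert, not_or] at h
      have h1 := hB w hw h.2.2 h.1 h.2.1
      have h2 : ∀ s, G.Inc s w → s ∈ A → s = t₀ := by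
        intro s hs hsA
        rw [← hA] at hsA
        rcases Finset.mem_insert.1 hsA with h3 | h3
        · exact h3
        · rcases hs with rfl | rfl
          · exact (h1.1 h3).elim
          · exact (h1.2 h3).elim
      exact G.ne w ((h2 _ (Or.inl rfl) (hcl w hw).1).trans (h2 _ (Or.inr rfl) (hcl w hw).2).symm)
    have hsign : -(G.sgn u' s₀ * G.sgn u s₁ * ∏ w ∈ V, G.η w) * -(G.sgn u t₀ * G.sgn u' t₀) = -1 := by
      rw [← hη, ← hBV, Finset.prod_insert (by simp [hu'u, huV']), Finset.prod_insert huV]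
      linear_combination (G.sgn u s₁ * G.sgn u t₀ * ∏ w ∈ V, G.η w) * ηw.1 -
        (G.η u' * ∏ w ∈ V, G.η w) * ηu
    obtain ⟨h⟩ := bx.mobius bt hsign (by
      rintro x ⟨hx, hx'⟩
      obtain ⟨w, h1 | h1, -, h3⟩ := hinc x hx hx'
      · right; rwa [range_line, ← h1]
      · left; rwa [range_line, ← h1]) hcl1 hcl2
    refine ⟨(Homeomorph.setCongr ?_).trans h⟩
    rw [← hBV, ← hA, carrier_union]
    congr 1
    · ext w
      simp
    · ext w
      simp only [Finset.mem_union, Finset.mem_insert, Finset.mem_singleton]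
      tauto
  · have ht₁w₀ : ¬ G.Inc t₁ w₀ := fun h => (huni w₀ hw₀ h).elim hwu (fun h => hclose h.symm)
    have hu'P := hB u' hu'.1 huV' hclose hu'u
    obtain ⟨t₂, ht₂, it₂, -, -⟩ := G.exists_other hu'.2
    have hadd : (A \ insert t₁ P).card < n := by
      rw [← hn]
      refine Finset.card_lt_card ⟨?_, ?_⟩
      · exact Finset.sdiff_subset_sdiff subset_rfl (Finset.subset_insert _ _)
      · intro h
        have := h (Finset.mem_sdiff.2 ⟨ht₁A, ht₁⟩)
        simp at this
    refine ih _ hadd (P := insert t₁ P) (V := insert u V) (w₀ := w₀) (u := u') (s₀ := s₀) (s₁ := t₁)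
      (t₀ := t₀) (t₁ := t₂) rfl (Finset.insert_subset ht₁A hPA) (Finset.insert_subset hu hVB) hw₀ hu'.1
      (fun h => hclose h.symm) ?_ ?_ (Finset.mem_insert_of_mem hs₀) (Finset.mem_insert_self _ _)
      is₀ hu'.2 ?_ it₀ ?_ it₂ ?_ ?_ ?_
    · simp [hwu, hwV]
    · simp [hu'u, huV']
    · rw [Finset.mem_insert, not_or]
      exact ⟨fun h => ht₁w₀ (h ▸ it₀), ht₀⟩
    · rw [Finset.mem_insert, not_or]
      refine ⟨ht₂, ?_⟩
      rcases it₂ with h | h <;> rw [← h]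
      · exact hu'P.1
      · exact hu'P.2
    · intro w hw
      rcases Finset.mem_insert.1 hw with rfl | hw
      · constructor
        · rcases huends _ (Or.inl rfl) with h | h <;> rw [h] <;> simp [hs₁]
        · rcases huends _ (Or.inr rfl) with h | h <;> rw [h] <;> simp [hs₁]
      · exact ⟨Finset.mem_insert_of_mem (hV w hw).1, Finset.mem_insert_of_mem (hV w hw).2⟩
    · intro w hw hwV' hww hwu'
      have hwu2 : w ≠ u := fun h => hwV' (h ▸ Finset.mem_insert_self _ _)
      have h4 := hB w hw (fun h => hwV' (Finset.mem_insert_of_mem h)) hww hwu2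
      have h5 : ¬ G.Inc t₁ w := fun h => (huni w hw h).elim hwu2 hwu'
      simp only [Finset.mem_insert, not_or]
      exact ⟨⟨fun h => h5 (Or.inl h), h4.1⟩, ⟨fun h => h5 (Or.inr h), h4.2⟩⟩
    · refine box_cast ?_ ?_ (bx.glue bt ?_ hcl1 hcl2)
      · rw [carrier_union]
        congr 1
        · ext w
          simp
        · ext w
          simp only [Finset.mem_union, Finset.mem_insert, Finset.mem_singleton]
          tauto
      · rw [Finset.prod_insert huV]
        linear_combination (G.sgn w₀ s₀ * G.sgn u' t₁ * ∏ w ∈ V, G.η w) * ηu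
      · rintro x ⟨hx, hx'⟩
        obtain ⟨w, h1 | h1, h2, h3⟩ := hinc x hx hx'
        · rwa [range_line, ← h1]
        · subst h1
          rcases h2 with h | h | h
          · exact (hclose h).elim
          · exact (hu'u h).elim
          · exact (huV' h).elim

theorem mobius_of_regular (hG : G.HasBoxes) {A : Finset S} {B : Finset W} (hcl : G.Closed A B)
    (hc : G.Conn A B) (hreg : ∀ s ∈ A, (G.inc B s).card = 2) (hη : ∏ w ∈ B, G.η w = -1) :
    Nonempty (G.carrier A B ≃ₜ MobiusBand) := by
  obtain ⟨s, hs⟩ := hc.1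
  obtain ⟨w₀, u, hwu, hinc⟩ := Finset.card_eq_two.1 (hreg s hs)
  obtain ⟨h1, h2⟩ := G.mem_inc.1 (show w₀ ∈ G.inc B s by rw [hinc]; simp)
  obtain ⟨h3, h4⟩ := G.mem_inc.1 (show u ∈ G.inc B s by rw [hinc]; simp)
  obtain ⟨t₀, k1, k2, -⟩ := G.exists_other h2
  obtain ⟨t₁, k3, k4, -⟩ := G.exists_other h4
  obtain ⟨bx⟩ := hG s w₀ u hwu h2 h4
  refine walk hG hcl hc hreg hη _ (P := {s}) (V := ∅) (w₀ := w₀) (u := u) (s₀ := s) (s₁ := s)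
    (t₀ := t₀) (t₁ := t₁) rfl (by simpa using hs) (by simp) h1 h3 hwu (by simp) (by simp) (by simp)
    (by simp) h2 h4 (by simpa using k1) k2 (by simpa using k3) k4 (by simp) ?_ ?_
  · intro w hw _ hw0 hwu'
    have : ¬ G.Inc s w := fun h => by
      have := G.mem_inc.2 ⟨hw, h⟩
      rw [hinc] at this
      simp [hw0, hwu'] at this
    simp only [Finset.mem_singleton]
    exact ⟨fun h => this (Or.inl h), fun h => this (Or.inr h)⟩
  · exact box_cast (by simp) (by simp) bx

/-- A connected union of strips with Euler characteristic zero carrying a one-sided cycle is a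
Möbius band. -/
theorem mobius_of_cycle [TopologicalSpace.MetrizableSpace X] (hG : G.HasBoxes) {A : Finset S} {B : Finset W} (hcl : G.Closed A B)
    (hc : G.Conn A B) (hAB : A.card = B.card) (z : W → ZMod 2)
    (hz : ∀ s ∈ A, ∑ w ∈ G.inc B s, z w = 0) (hodd : ∑ w ∈ B with G.η w = -1, z w = 1) :
    Nonempty (G.carrier A B ≃ₜ MobiusBand) := by
  obtain ⟨A', hA, B', hB, k1, k2, k3, ⟨k4⟩, k5, k6 | ⟨s, k6, k7⟩⟩ := exists_core _ rfl hcl hc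
  swap
  · simp [k6, k7] at k3
    omega
  have hreg := (card_le_of_deg k1 k6).2 (by omega)
  obtain ⟨hz', hz0⟩ := k5 z hz
  have hodd' : ∑ w ∈ B' with G.η w = -1, z w = 1 := by
    rw [← hodd]
    refine Finset.sum_subset (Finset.filter_subset_filter _ hB) ?_
    intro w hw hw'
    simp only [Finset.mem_filter] at hw hw'
    exact hz0 w hw.1 fun h => hw' ⟨h, hw.2⟩
  have h01 : ∀ x : ZMod 2, x = 0 ∨ x = 1 := by decide
  have hone : ∀ w ∈ B', z w = 1 := by
    have hloc : ∀ s ∈ A', ∀ w ∈ G.inc B' s, ∀ w' ∈ G.inc B' s, z w = z w' := by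
      intro s hs w hw w' hw'
      obtain ⟨x, y, hxy, h⟩ := Finset.card_eq_two.1 (hreg s hs)
      have h1 := hz' s hs
      rw [h, Finset.sum_pair hxy] at h1
      have h2 : z x = z y := by
        rcases h01 (z x) with h | h <;> rcases h01 (z y) with h' | h' <;> rw [h, h'] at h1 ⊢ <;>
          revert h1 <;> decide
      rw [h] at hw hw'
      simp only [Finset.mem_insert, Finset.mem_singleton] at hw hw'
      rcases hw with rfl | rfl <;> rcases hw' with rfl | rfl <;> simp [h2]
    have hD : A'.filter (fun s => ∃ w ∈ G.inc B' s, z w = 1) = A' := by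
      refine k2.2 _ (Finset.filter_subset _ _) ?_ ?_
      · obtain ⟨w, hw, hw1⟩ := Finset.exists_ne_zero_of_sum_ne_zero
          (by rw [hodd']; decide : ∑ w ∈ B' with G.η w = -1, z w ≠ 0)
        rw [Finset.mem_filter] at hw
        exact ⟨G.a w, Finset.mem_filter.2 ⟨(k1 w hw.1).1, w, G.mem_inc.2 ⟨hw.1, Or.inl rfl⟩,
          (h01 _).resolve_left hw1⟩⟩
      · intro w hw
        have ha := G.mem_inc.2 ⟨hw, (Or.inl rfl : G.Inc (G.a w) w)⟩
        have hb := G.mem_inc.2 ⟨hw, (Or.inr rfl : G.Inc (G.b w) w)⟩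
        have e : ∀ s ∈ A', w ∈ G.inc B' s →
            (s ∈ A'.filter (fun s => ∃ w ∈ G.inc B' s, z w = 1) ↔ z w = 1) := by
          intro s hs hsw
          rw [Finset.mem_filter]
          constructor
          · rintro ⟨-, w', h1, h2⟩
            rw [hloc s hs w hsw w' h1, h2]
          · exact fun h => ⟨hs, w, hsw, h⟩
        rw [e _ (k1 w hw).1 ha, e _ (k1 w hw).2 hb]
    intro w hw
    have h1 := (k1 w hw).1
    rw [← hD, Finset.mem_filter] at h1
    obtain ⟨-, w', h2, h3⟩ := h1
    rw [hloc _ (k1 w hw).1 w (G.mem_inc.2 ⟨hw, Or.inl rfl⟩) w' h2, h3]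
  have hη : ∏ w ∈ B', G.η w = -1 := by
    have h1 : ∏ w ∈ B', G.η w = ∏ w ∈ B', if G.η w = -1 then (-1 : ℝ) else 1 := by
      refine Finset.prod_congr rfl fun w _ => ?_
      rcases mul_self_eq_one_iff.1 (G.η_sq w) with h | h <;> rw [h] <;> norm_num
    rw [h1, Finset.prod_ite, Finset.prod_const, Finset.prod_const_one, mul_one]
    rw [Finset.sum_congr rfl (fun w hw => hone w (Finset.mem_filter.1 hw).1), Finset.sum_const,
      nsmul_one] at hodd'
    refine Odd.neg_one_pow ?_
    exact (ZMod.natCast_eq_one_iff_odd).1 hodd'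
  obtain ⟨m⟩ := mobius_of_regular hG k1 k2 hreg hη
  exact ⟨k4.trans m⟩

end StripSystem

end

section

namespace StripSystem

section Components

variable {X S W : Type*} [TopologicalSpace X] (G : StripSystem X S W)

theorem isOpen_carrier {A : Finset S} {B : Finset W} (h : G.Closed A B) :
    IsOpen (G.carrier A B) := by
  have : G.carrier A B = (⋃ s ∈ A, G.st s) ∪
      ⋃ w ∈ B, (G.st (G.a w) ∪ G.wl w ∪ G.st (G.b w)) := by
    refine Subset.antisymm ?_ ?_
    · refine union_subset_union_right _ (iUnion₂_mono fun w _ x hx => Or.inl (Or.inr hx))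
    · refine union_subset subset_union_left (iUnion₂_subset fun w hw => ?_)
      rintro x ((hx | hx) | hx)
      · exact (G.st_carrier hx).2 (h w hw).1
      · exact (G.wl_carrier hx).2 hw
      · exact (G.st_carrier hx).2 (h w hw).2
  rw [this]
  exact (isOpen_biUnion fun s _ => G.open_st s).union (isOpen_biUnion fun w _ => G.open_nbhd w)

theorem isConnected_st (s : S) : IsConnected (G.st s) := by
  obtain ⟨h⟩ := G.plane s
  have := h.symm.surjective.connectedSpace h.symm.continuous
  exact isConnected_iff_connectedSpace.2 this

theorem isConnected_carrier {A : Finset S} {B : Finset W} (h : G.Closed A B) (hc : G.Conn A B) :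
    IsConnected (G.carrier A B) := by
  classical
  obtain ⟨s₀, hs₀⟩ := hc.1
  obtain ⟨x₀, hx₀⟩ := (G.isConnected_st s₀).1
  have hx₀c : x₀ ∈ G.carrier A B := (G.st_carrier hx₀).2 hs₀
  set C := connectedComponentIn (G.carrier A B) x₀ with hC
  have hmax : ∀ T : Set X, IsPreconnected T → T ⊆ G.carrier A B → (T ∩ C).Nonempty → T ⊆ C := by
    rintro T hT hTs ⟨y, hy, hyC⟩
    rw [hC, connectedComponentIn_eq hyC]
    exact hT.subset_connectedComponentIn hy hTs
  have hst : ∀ s ∈ A, G.st s ⊆ G.carrier A B := fun s hs x hx => (G.st_carrier hx).2 hs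
  have hD : A.filter (fun s => (G.st s ∩ C).Nonempty) = A := by
    refine hc.2 _ (Finset.filter_subset _ _) ⟨s₀, Finset.mem_filter.2 ⟨hs₀, x₀, hx₀,
      mem_connectedComponentIn hx₀c⟩⟩ ?_
    intro w hw
    have hr : IsPreconnected (range (G.chart w)) := isPreconnected_range (G.emb w).continuous
    have hrs : range (G.chart w) ⊆ G.carrier A B := by
      rw [G.range_chart]
      rintro x ((hx | hx) | hx)
      · exact (G.st_carrier hx).2 (h w hw).1
      · exact (G.wl_carrier hx).2 hw
      · exact (G.st_carrier hx).2 (h w hw).2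
    have key : ∀ s t, G.st s ⊆ range (G.chart w) → G.st t ⊆ range (G.chart w) →
        (G.st s ∩ C).Nonempty → (G.st t ∩ C).Nonempty := by
      rintro s t hs ht ⟨y, hy, hyC⟩
      have := hmax _ hr hrs ⟨y, hs hy, hyC⟩
      obtain ⟨x, hx⟩ := (G.isConnected_st t).1
      exact ⟨x, hx, this (ht hx)⟩
    have ha : G.st (G.a w) ⊆ range (G.chart w) := by
      rw [G.range_chart]; exact fun x hx => Or.inl (Or.inl hx)
    have hb : G.st (G.b w) ⊆ range (G.chart w) := by
      rw [G.range_chart]; exact fun x hx => Or.inr hx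
    simp only [Finset.mem_filter, (h w hw).1, (h w hw).2, true_and]
    exact ⟨key _ _ ha hb, key _ _ hb ha⟩
  have hstC : ∀ s ∈ A, G.st s ⊆ C := by
    intro s hs
    rw [← hD, Finset.mem_filter] at hs
    exact hmax _ (G.isConnected_st s).2 (hst s hs.1) hs.2
  have : G.carrier A B = C := by
    refine Subset.antisymm ?_ (connectedComponentIn_subset _ _)
    intro x hx
    rcases G.mem_carrier.1 hx with ⟨s, hs, h'⟩ | ⟨w, hw, h'⟩
    · exact hstC s hs h'
    · have hr : IsPreconnected (range (G.chart w)) := isPreconnected_range (G.emb w).continuous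
      refine hmax _ hr ?_ ?_ (by rw [G.range_chart]; exact Or.inl (Or.inr h'))
      · rw [G.range_chart]
        rintro x ((hx | hx) | hx)
        · exact (G.st_carrier hx).2 (h w hw).1
        · exact (G.wl_carrier hx).2 hw
        · exact (G.st_carrier hx).2 (h w hw).2
      · obtain ⟨y, hy⟩ := (G.isConnected_st (G.a w)).1
        refine ⟨y, ?_, hstC _ (h w hw).1 hy⟩
        rw [G.range_chart]
        exact Or.inl (Or.inl hy)
  rw [this]
  exact isConnected_connectedComponentIn_iff.2 hx₀c

/-- Combinatorial components: classes of strips joined by walls. -/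
def Cls (G : StripSystem X S W) : Type _ := Quot fun s t => ∃ w, G.a w = s ∧ G.b w = t

/-- The component of a strip. -/
def cls (s : S) : G.Cls := Quot.mk _ s

theorem cls_wall (w : W) : G.cls (G.a w) = G.cls (G.b w) := Quot.sound ⟨w, rfl, rfl⟩

theorem cls_surjective : Function.Surjective G.cls := Quot.mk_surjective

variable [Fintype S] [Fintype W]

instance : Finite G.Cls := Finite.of_surjective _ G.cls_surjective

open Classical in
/-- The strips of a component. -/
def clsA (k : G.Cls) : Finset S := Finset.univ.filter fun s => G.cls s = k

open Classical in
/-- The walls of a component. -/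
def clsB (k : G.Cls) : Finset W := Finset.univ.filter fun w => G.cls (G.a w) = k

theorem mem_clsA {k : G.Cls} {s : S} : s ∈ G.clsA k ↔ G.cls s = k := by simp [clsA]

theorem mem_clsB {k : G.Cls} {w : W} : w ∈ G.clsB k ↔ G.cls (G.a w) = k := by simp [clsB]

theorem cls_closed (k : G.Cls) : G.Closed (G.clsA k) (G.clsB k) := by
  intro w hw
  rw [mem_clsB] at hw
  exact ⟨G.mem_clsA.2 hw, G.mem_clsA.2 ((G.cls_wall w).symm.trans hw)⟩

theorem cls_conn (k : G.Cls) : G.Conn (G.clsA k) (G.clsB k) := by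
  obtain ⟨s, rfl⟩ := G.cls_surjective k
  refine ⟨⟨s, G.mem_clsA.2 rfl⟩, fun D hD ⟨t, ht⟩ hDc => Finset.Subset.antisymm hD ?_⟩
  have hresp : ∀ s t, (∃ w, G.a w = s ∧ G.b w = t) → (s ∈ D) = (t ∈ D) := by
    rintro _ _ ⟨w, rfl, rfl⟩
    by_cases hw : w ∈ G.clsB (G.cls s)
    · exact propext (hDc w hw)
    · have h1 : G.a w ∉ D := fun h => hw (G.mem_clsB.2 (G.mem_clsA.1 (hD h)))
      have h2 : G.b w ∉ D := fun h => hw (G.mem_clsB.2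
        ((G.cls_wall w).trans (G.mem_clsA.1 (hD h))))
      simp [h1, h2]
  set F : G.Cls → Prop := Quot.lift (fun s => s ∈ D) hresp
  intro t' ht'
  have h1 : F (G.cls t) := ht
  have h2 : G.cls t = G.cls t' := (G.mem_clsA.1 (hD ht)).trans (G.mem_clsA.1 ht').symm
  rw [h2] at h1
  exact h1

theorem carrier_cls {x : X} {k k' : G.Cls} (h : x ∈ G.carrier (G.clsA k) (G.clsB k))
    (h' : x ∈ G.carrier (G.clsA k') (G.clsB k')) : k = k' := by
  rcases G.mem_carrier.1 h with ⟨s, hs, hx⟩ | ⟨w, hw, hx⟩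
  · rw [G.st_carrier hx, mem_clsA] at h'
    rw [← h', G.mem_clsA.1 hs]
  · rw [G.wl_carrier hx, mem_clsB] at h'
    rw [← h', G.mem_clsB.1 hw]

variable {U : Set X}

theorem exists_cls (hU : U = G.carrier Finset.univ Finset.univ) {x : X} (hx : x ∈ U) : ∃ k, x ∈ G.carrier (G.clsA k) (G.clsB k) := by
  rw [hU] at hx
  rcases G.mem_carrier.1 hx with ⟨s, -, hx⟩ | ⟨w, -, hx⟩
  · exact ⟨G.cls s, (G.st_carrier hx).2 (G.mem_clsA.2 rfl)⟩
  · exact ⟨G.cls (G.a w), (G.wl_carrier hx).2 (G.mem_clsB.2 rfl)⟩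

theorem carrier_subset (hU : U = G.carrier Finset.univ Finset.univ)
    (A : Finset S) (B : Finset W) : G.carrier A B ⊆ U := by
  rw [hU]
  intro x hx
  rcases G.mem_carrier.1 hx with ⟨s, -, hx⟩ | ⟨w, -, hx⟩
  · exact (G.st_carrier hx).2 (Finset.mem_univ _)
  · exact (G.wl_carrier hx).2 (Finset.mem_univ _)

/-- Connected components of the union correspond to combinatorial components. -/
theorem exists_equiv (hU : U = G.carrier Finset.univ Finset.univ) :
    ∃ e : G.Cls ≃ ConnectedComponents U, ∀ k,
    Nonempty (↥(ConnectedComponents.mk ⁻¹' {e k} : Set U) ≃ₜ G.carrier (G.clsA k) (G.clsB k)) := by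
  classical
  have hsub : ∀ k, G.carrier (G.clsA k) (G.clsB k) ⊆ U := fun k => G.carrier_subset hU _ _
  have hcon : ∀ k, IsConnected (G.carrier (G.clsA k) (G.clsB k)) :=
    fun k => G.isConnected_carrier (G.cls_closed k) (G.cls_conn k)
  choose p hp using fun k => (hcon k).1
  set P : G.Cls → U := fun k => ⟨p k, hsub k (hp k)⟩ with hP
  set T : G.Cls → Set U := fun k => Subtype.val ⁻¹' G.carrier (G.clsA k) (G.clsB k) with hT
  have hTo : ∀ k, IsOpen (T k) := fun k =>
    (G.isOpen_carrier (G.cls_closed k)).preimage continuous_subtype_val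
  have hTc : ∀ k, IsClopen (T k) := by
    refine fun k => ⟨?_, hTo k⟩
    have : (T k)ᶜ = ⋃ k' ∈ ({k}ᶜ : Set G.Cls), T k' := by
      ext x
      simp only [mem_compl_iff, mem_iUnion, mem_singleton_iff, exists_prop]
      constructor
      · intro hx
        obtain ⟨k', hk'⟩ := G.exists_cls hU x.2
        exact ⟨k', fun h => hx (h ▸ hk'), hk'⟩
      · rintro ⟨k', h1, h2⟩ h3
        exact h1 (G.carrier_cls h2 h3)
    rw [← isOpen_compl_iff, this]
    exact isOpen_biUnion fun k' _ => hTo k'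
  have hTp : ∀ k, IsPreconnected (T k) := by
    intro k
    rw [← Topology.IsInducing.subtypeVal.isPreconnected_image, hT,
      Subtype.image_preimage_coe, inter_eq_self_of_subset_right (hsub k)]
    exact (hcon k).2
  have hmk : ∀ k (x : U), ConnectedComponents.mk x = ConnectedComponents.mk (P k) ↔ x ∈ T k := by
    intro k x
    rw [ConnectedComponents.coe_eq_coe']
    constructor
    · exact fun h => (hTc k).connectedComponent_subset (hp k) h
    · exact fun h => (hTp k).subset_connectedComponent (hp k) h
  refine ⟨Equiv.ofBijective (fun k => ConnectedComponents.mk (P k)) ⟨?_, ?_⟩, fun k => ?_⟩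
  · intro k k' h
    exact G.carrier_cls (hp k) ((hmk k' (P k)).1 h)
  · intro C
    obtain ⟨x, rfl⟩ := ConnectedComponents.surjective_coe C
    obtain ⟨k, hk⟩ := G.exists_cls hU x.2
    exact ⟨k, ((hmk k x).2 hk).symm⟩
  · have hfib : (ConnectedComponents.mk ⁻¹' {ConnectedComponents.mk (P k)} : Set U) = T k := by
      ext x
      exact hmk k x
    refine ⟨(Homeomorph.setCongr hfib).trans
      { toFun := fun x => ⟨x.1.1, x.2⟩
        invFun := fun x => ⟨⟨x.1, hsub k x.2⟩, x.2⟩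
        left_inv := fun x => rfl
        right_inv := fun x => rfl
        continuous_toFun := by fun_prop
        continuous_invFun := by fun_prop }⟩

end Components

end StripSystem

end

section

namespace StripSystem

section Count

variable {X S W : Type*} [TopologicalSpace X] (G : StripSystem X S W) [Fintype S] [Fintype W]

theorem inc_cls {k : G.Cls} {s : S} (hs : s ∈ G.clsA k) :
    G.inc Finset.univ s = G.inc (G.clsB k) s := by
  ext w
  simp only [mem_inc, Finset.mem_univ, true_and, mem_clsB, iff_and_self]
  rw [mem_clsA] at hs
  rintro (h | h)
  · rw [h, hs]
  · rw [G.cls_wall, h, hs]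

/-- A chain whose boundary vanishes on all but one strip of a component is a cycle there. -/
theorem boundary_rep {k : G.Cls} {s₀ : S} (hs₀ : s₀ ∈ G.clsA k) (z : W → ZMod 2)
    (hz : ∀ s ∈ G.clsA k, s ≠ s₀ → ∑ w ∈ G.inc Finset.univ s, z w = 0) :
    ∑ w ∈ G.inc Finset.univ s₀, z w = 0 := by
  have h1 := G.sum_inc (G.cls_closed k) z
  have h2 : ∑ w ∈ G.clsB k, (z w + z w) = 0 :=
    Finset.sum_eq_zero fun w _ => CharTwo.add_self_eq_zero _
  rw [h2] at h1
  rw [G.inc_cls hs₀, ← h1]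
  refine (Finset.sum_eq_single (f := fun s => ∑ w ∈ G.inc (G.clsB k) s, z w) s₀ ?_ ?_).symm
  · intro s hs hne
    rw [← G.inc_cls hs]
    exact hz s hs hne
  · exact fun h => (h hs₀).elim

open Classical in
/-- Extension of a chain by zero. -/
def ext0 {p : W → Prop} (z : {w // p w} → ZMod 2) (w : W) : ZMod 2 :=
  if h : p w then z ⟨w, h⟩ else 0

theorem ext0_of {p : W → Prop} (z : {w // p w} → ZMod 2) (w : {w // p w}) : ext0 z w = z w := by
  simp [ext0, w.2]

theorem ext0_not {p : W → Prop} (z : {w // p w} → ZMod 2) {w : W} (h : ¬ p w) : ext0 z w = 0 := by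
  simp [ext0, h]

theorem ext0_sub {p : W → Prop} (z z' : {w // p w} → ZMod 2) :
    ext0 (z - z') = ext0 z - ext0 z' := by
  ext w
  by_cases h : p w <;> simp [ext0, h]

theorem card_le_of_injective_zmod {α β : Type*} [Fintype α] [Fintype β]
    (f : (α → ZMod 2) → (β → ZMod 2)) (hf : Function.Injective f) :
    Fintype.card α ≤ Fintype.card β := by
  classical
  have := Fintype.card_le_of_injective f hf
  simp only [Fintype.card_fun, ZMod.card] at this
  exact (Nat.pow_le_pow_iff_right one_lt_two).1 this

theorem card_le_of_injective_zmod_prod {α β : Type*} [Fintype α] [Fintype β]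
    (f : (α → ZMod 2) → (β → ZMod 2) × ZMod 2) (hf : Function.Injective f) :
    Fintype.card α ≤ Fintype.card β + 1 := by
  classical
  have := Fintype.card_le_of_injective f hf
  simp only [Fintype.card_fun, ZMod.card, Fintype.card_prod, ← pow_succ] at this
  exact (Nat.pow_le_pow_iff_right one_lt_two).1 this

open Classical in
theorem exists_cycle (k : G.Cls) (hk : (G.clsA k).card = (G.clsB k).card) :
    ∃ z : W → ZMod 2, z ≠ 0 ∧ (∀ w, w ∉ G.clsB k → z w = 0) ∧
      ∀ s, ∑ w ∈ G.inc Finset.univ s, z w = 0 := by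
  obtain ⟨s₀, hs₀⟩ := (G.cls_conn k).1
  by_contra hcon
  push Not at hcon
  let f : ({w // w ∈ G.clsB k} → ZMod 2) → ({s // s ∈ (G.clsA k).erase s₀} → ZMod 2) :=
    fun z s => ∑ w ∈ G.inc Finset.univ s.1, ext0 z w
  have hf : Function.Injective f := by
    intro z z' h
    by_contra hne
    have h0 : ∀ w, w ∉ G.clsB k → ext0 (z - z') w = 0 := fun w hw => ext0_not _ hw
    obtain ⟨s, hs⟩ := hcon (ext0 (z - z')) (by
      intro h0
      apply hne
      ext w
      have := congrFun h0 w.1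
      rw [ext0_of] at this
      exact sub_eq_zero.1 this) h0
    have hnr : ∀ s ∈ G.clsA k, s ≠ s₀ → ∑ w ∈ G.inc Finset.univ s, ext0 (z - z') w = 0 := by
      intro s hs hss
      have := congrFun h ⟨s, Finset.mem_erase.2 ⟨hss, hs⟩⟩
      simp only [f] at this
      simp only [ext0_sub, Pi.sub_apply, Finset.sum_sub_distrib, this, sub_self]
    apply hs
    by_cases hsA : s ∈ G.clsA k
    · by_cases hss : s = s₀
      · rw [hss]
        exact G.boundary_rep hs₀ _ hnr
      · exact hnr s hsA hss
    · refine Finset.sum_eq_zero fun w hw => h0 w fun hw' => hsA ?_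
      exact (G.cls_closed k).inc_mem hw' (G.mem_inc.1 hw).2
  have := card_le_of_injective_zmod f hf
  simp only [Fintype.card_coe] at this
  have h1 := Finset.card_erase_add_one hs₀
  omega

open Classical in
/-- The number of components other than a given one, bounded by a parity argument. -/
theorem card_cls_le (k₀ : G.Cls) [Fintype G.Cls]
    (hpar : ∀ z : W → ZMod 2, (∀ w ∈ G.clsB k₀, z w = 0) →
      (∀ s, ∑ w ∈ G.inc Finset.univ s, z w = 0) → ∑ w with G.η w = -1, z w = 0 → z = 0) :
    Fintype.card W + (G.clsA k₀).card + Fintype.card G.Cls ≤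
      Fintype.card S + (G.clsB k₀).card + 2 := by
  let rep : G.Cls → S := Function.surjInv G.cls_surjective
  have hrep : ∀ k, G.cls (rep k) = k := Function.surjInv_eq G.cls_surjective
  let f : ({w // w ∉ G.clsB k₀} → ZMod 2) →
      ({s // s ∉ G.clsA k₀ ∧ s ∉ Finset.univ.image rep} → ZMod 2) × ZMod 2 :=
    fun z => (fun s => ∑ w ∈ G.inc Finset.univ s.1, ext0 z w, ∑ w with G.η w = -1, ext0 z w)
  have hf : Function.Injective f := by
    intro z z' h
    have h1 := congrArg Prod.fst h
    have h2 := congrArg Prod.snd h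
    simp only [f] at h1 h2
    have h0 : ∀ w ∈ G.clsB k₀, ext0 (z - z') w = 0 := fun w hw => ext0_not _ (by simpa using hw)
    have hnr : ∀ s, s ∉ Finset.univ.image rep → ∑ w ∈ G.inc Finset.univ s, ext0 (z - z') w = 0 := by
      intro s hs
      by_cases hk : s ∈ G.clsA k₀
      · refine Finset.sum_eq_zero fun w hw => h0 w ?_
        rw [G.inc_cls hk] at hw
        exact (G.mem_inc.1 hw).1
      · have := congrFun h1 ⟨s, hk, hs⟩
        simp only at this
        simp only [ext0_sub, Pi.sub_apply, Finset.sum_sub_distrib, this, sub_self]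
    have hz : ext0 (z - z') = 0 := by
      refine hpar _ h0 ?_ ?_
      · intro s
        by_cases hs : s ∈ Finset.univ.image rep
        · obtain ⟨k, -, rfl⟩ := Finset.mem_image.1 hs
          refine G.boundary_rep (k := k) (G.mem_clsA.2 (hrep k)) _ ?_
          intro s hs hss
          refine hnr s fun h => hss ?_
          obtain ⟨k', -, rfl⟩ := Finset.mem_image.1 h
          rw [mem_clsA, hrep] at hs
          rw [hs]
        · exact hnr s hs
      · simp only [ext0_sub, Pi.sub_apply, Finset.sum_sub_distrib, h2, sub_self]
    ext w
    have := congrFun hz w.1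
    rw [ext0_of] at this
    exact sub_eq_zero.1 this
  have h := card_le_of_injective_zmod_prod f hf
  rw [Fintype.card_subtype, Fintype.card_subtype] at h
  have e1 : (Finset.univ.filter fun w => w ∉ G.clsB k₀).card + (G.clsB k₀).card = Fintype.card W := by
    rw [Finset.filter_not, Finset.filter_mem_eq_inter, Finset.univ_inter, ← Finset.compl_eq_univ_sdiff,
      Finset.card_compl_add_card]
  have e2 : (Finset.univ.filter fun s => s ∉ G.clsA k₀ ∧ s ∉ Finset.univ.image rep) =
      (G.clsA k₀ ∪ Finset.univ.image rep)ᶜ := by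
    ext s
    simp
  rw [e2] at h
  have e3 := Finset.card_compl_add_card (G.clsA k₀ ∪ Finset.univ.image rep)
  have e4 := Finset.card_union_add_card_inter (G.clsA k₀) (Finset.univ.image rep)
  have e5 : (Finset.univ.image rep).card = Fintype.card G.Cls :=
    Finset.card_image_of_injective _ (Function.LeftInverse.injective hrep)
  have e6 : (G.clsA k₀ ∩ Finset.univ.image rep) = {rep k₀} := by
    ext s
    simp only [Finset.mem_inter, mem_clsA, Finset.mem_image, Finset.mem_univ, true_and,
      Finset.mem_singleton]
    constructor
    · rintro ⟨h1, k, rfl⟩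
      rw [hrep] at h1
      rw [h1]
    · rintro rfl
      exact ⟨hrep k₀, k₀, rfl⟩
  rw [e6, e5, Finset.card_singleton] at e4
  omega

theorem exists_outer {AO : Finset S} {BO : Finset W} (hO : ∀ w, (w ∈ BO ↔ G.a w ∈ AO) ∧
    (w ∈ BO ↔ G.b w ∈ AO)) (hcon : IsConnected (G.carrier AO BO)) :
    ∃ k, G.clsA k = AO ∧ G.clsB k = BO := by
  classical
  obtain ⟨x, hx⟩ := hcon.1
  obtain ⟨k, hk⟩ := G.exists_cls rfl (G.carrier_subset rfl AO BO hx)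
  have h1 : IsOpen (G.carrier (G.clsA k) (G.clsB k)) := G.isOpen_carrier (G.cls_closed k)
  have h2 : IsOpen (⋃ k' ∈ ({k}ᶜ : Set G.Cls), G.carrier (G.clsA k') (G.clsB k')) :=
    isOpen_biUnion fun k' _ => G.isOpen_carrier (G.cls_closed k')
  have h3 : G.carrier AO BO ⊆ G.carrier (G.clsA k) (G.clsB k) := by
    refine hcon.2.subset_left_of_subset_union h1 h2 ?_ ?_ ⟨x, hx, hk⟩
    · rw [Set.disjoint_left]
      intro y hy hy'
      simp only [mem_iUnion, mem_compl_iff, mem_singleton_iff, exists_prop] at hy'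
      obtain ⟨k', h4, h5⟩ := hy'
      exact h4 (G.carrier_cls h5 hy)
    · intro y hy
      obtain ⟨k', hk'⟩ := G.exists_cls rfl (G.carrier_subset rfl AO BO hy)
      by_cases h : k' = k
      · exact Or.inl (h ▸ hk')
      · refine Or.inr ?_
        simp only [mem_iUnion, mem_compl_iff, mem_singleton_iff, exists_prop]
        exact ⟨k', h, hk'⟩
  have hsub : AO ⊆ G.clsA k := by
    intro s hs
    obtain ⟨y, hy⟩ := (G.isConnected_st s).1
    exact (G.st_carrier hy).1 (h3 ((G.st_carrier hy).2 hs))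
  have hA : AO = G.clsA k := by
    refine (G.cls_conn k).2 AO hsub ?_ fun w _ => (hO w).1.symm.trans (hO w).2
    rcases G.mem_carrier.1 hx with ⟨s, hs, -⟩ | ⟨w, hw, -⟩
    · exact ⟨s, hs⟩
    · exact ⟨_, (hO w).1.1 hw⟩
  refine ⟨k, hA.symm, ?_⟩
  ext w
  rw [(hO w).1, hA, mem_clsA, mem_clsB]

end Count

section Main

theorem simplyConnected_of_homeo {Y Z : Type*} [TopologicalSpace Y] [TopologicalSpace Z]
    [SimplyConnectedSpace Z] (h : Y ≃ₜ Z) : SimplyConnectedSpace Y :=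
  h.toHomotopyEquiv.simplyConnectedSpace

variable {X S W : Type*} [TopologicalSpace X] [TopologicalSpace.MetrizableSpace X]
  (G : StripSystem X S W) [Fintype S] [Fintype W] [DecidableEq S] [DecidableEq W]

theorem mobius_of_class (hG : G.HasBoxes) (k₀ k : G.Cls) (hk : k ≠ k₀)
    (hpar : ∀ z : W → ZMod 2, (∀ w ∈ G.clsB k₀, z w = 0) →
      (∀ s, ∑ w ∈ G.inc Finset.univ s, z w = 0) → ∑ w with G.η w = -1, z w = 0 → z = 0)
    (h : (G.clsA k).card = (G.clsB k).card) :
    Nonempty (G.carrier (G.clsA k) (G.clsB k) ≃ₜ MobiusBand) := by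
  obtain ⟨z, hz, hz0, hz1⟩ := G.exists_cycle k h
  refine mobius_of_cycle hG (G.cls_closed k) (G.cls_conn k) h z ?_ ?_
  · intro s hs
    rw [← G.inc_cls hs]
    exact hz1 s
  · have h01 : ∀ x : ZMod 2, x = 0 ∨ x = 1 := by decide
    refine (h01 _).resolve_left fun h0 => hz (hpar z ?_ hz1 ?_)
    · intro w hw
      refine hz0 w fun hw' => hk ?_
      rw [← G.mem_clsB.1 hw, ← G.mem_clsB.1 hw']
    · rw [← h0]
      refine (Finset.sum_subset (Finset.filter_subset_filter _ (Finset.subset_univ _)) ?_).symm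
      intro w hw hw'
      simp only [Finset.mem_filter] at hw hw'
      exact hz0 w fun h => hw' ⟨h, hw.2⟩

theorem count (hG : G.HasBoxes) {U : Set X} (hU : U = G.carrier Finset.univ Finset.univ) {v : ℕ}
    (hv : Fintype.card S = Fintype.card W + v) {AO : Finset S} {BO : Finset W}
    (hO : ∀ w, (w ∈ BO ↔ G.a w ∈ AO) ∧ (w ∈ BO ↔ G.b w ∈ AO)) (hOc : AO.card = BO.card)
    (hcyl : Nonempty (G.carrier AO BO ≃ₜ AddCircle (1:ℝ) × ℝ))
    (hpar : ∀ z : W → ZMod 2, (∀ w ∈ BO, z w = 0) →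
      (∀ s, ∑ w ∈ G.inc Finset.univ s, z w = 0) → ∑ w with G.η w = -1, z w = 0 → z = 0) :
    Nat.card {C : ConnectedComponents U |
        SimplyConnectedSpace ↥(ConnectedComponents.mk ⁻¹' {C} : Set U)} = v ∧
      (Nat.card (ConnectedComponents U) = v + 1 ∨ Nat.card (ConnectedComponents U) = v + 2) ∧
      (Nat.card (ConnectedComponents U) = v + 2 ↔ ∃ C : ConnectedComponents U,
        Nonempty (↥(ConnectedComponents.mk ⁻¹' {C} : Set U) ≃ₜ MobiusBand)) := by
  classical
  obtain ⟨cy⟩ := hcyl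
  have hocon : IsConnected (G.carrier AO BO) := by
    have := (isConnected_iff_connectedSpace.2
      (cy.symm.surjective.connectedSpace cy.symm.continuous))
    exact this
  obtain ⟨k₀, rfl, rfl⟩ := G.exists_outer hO hocon
  obtain ⟨e, he⟩ := G.exists_equiv hU
  have : Fintype G.Cls := Fintype.ofFinite _
  have hK := G.card_cls_le k₀ hpar
  have hle : ∀ k, (G.clsA k).card ≤ (G.clsB k).card + 1 :=
    fun k => card_le (G.cls_closed k) (G.cls_conn k)
  have sumA : ∑ k, (G.clsA k).card = Fintype.card S := by
    rw [← Finset.card_univ, Finset.card_eq_sum_card_fiberwise (f := G.cls) (t := Finset.univ)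
      (by intro x _; simp)]
    exact Finset.sum_congr rfl fun k _ => by congr 1
  have sumB : ∑ k, (G.clsB k).card = Fintype.card W := by
    rw [← Finset.card_univ, Finset.card_eq_sum_card_fiberwise (f := fun w => G.cls (G.a w))
      (t := Finset.univ) (by intro x _; simp)]
    exact Finset.sum_congr rfl fun k _ => by congr 1
  -- the defects
  set d : G.Cls → ℕ := fun k => (G.clsB k).card + 1 - (G.clsA k).card with hd
  have hdk : ∀ k, d k + (G.clsA k).card = (G.clsB k).card + 1 := fun k =>
    Nat.sub_add_cancel (hle k)
  have hdsum : ∑ k, d k + Fintype.card S = Fintype.card W + Fintype.card G.Cls := by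
    rw [← sumA, ← sumB, ← Finset.sum_add_distrib, Finset.sum_congr rfl (fun k _ => hdk k),
      Finset.sum_add_distrib]
    simp
  have hd0 : d k₀ = 1 := by
    have := hdk k₀
    omega
  have hdsplit := Finset.add_sum_erase Finset.univ d (Finset.mem_univ k₀)
  have hrest : ∑ k ∈ Finset.univ.erase k₀, d k ≤ 1 := by omega
  -- types of components
  have hpl : ∀ k, d k = 0 → Nonempty (G.carrier (G.clsA k) (G.clsB k) ≃ₜ ℝ × ℝ) := fun k hk =>
    plane_of_card (G.cls_closed k) (G.cls_conn k) (by have := hdk k; omega)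
  have hmo : ∀ k, k ≠ k₀ → d k = 1 → Nonempty (G.carrier (G.clsA k) (G.clsB k) ≃ₜ MobiusBand) :=
    fun k hk hk1 => G.mobius_of_class hG k₀ k hk hpar (by have := hdk k; omega)
  have hd1 : ∀ k, k ≠ k₀ → d k = 0 ∨ d k = 1 := by
    intro k hk
    have := Finset.single_le_sum (f := d) (fun _ _ => Nat.zero_le _)
      (Finset.mem_erase.2 ⟨hk, Finset.mem_univ k⟩)
    omega
  have hsc : ∀ k, SimplyConnectedSpace ↥(ConnectedComponents.mk ⁻¹' {e k} : Set U) ↔ d k = 0 := by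
    intro k
    obtain ⟨hk⟩ := he k
    constructor
    · intro h
      by_contra hne
      by_cases hkk : k = k₀
      · subst hkk
        have h1 := simplyConnected_of_homeo (hk.trans cy).symm
        exact cylinder_not_simplyConnected h1
      · obtain ⟨m⟩ := hmo k hkk ((hd1 k hkk).resolve_left hne)
        exact mobius_not_simplyConnected (simplyConnected_of_homeo (hk.trans m).symm)
    · intro h
      obtain ⟨p⟩ := hpl k h
      exact simplyConnected_of_homeo (hk.trans p)
  have hmob : ∀ k, Nonempty (↥(ConnectedComponents.mk ⁻¹' {e k} : Set U) ≃ₜ MobiusBand) ↔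
      k ≠ k₀ ∧ d k = 1 := by
    intro k
    obtain ⟨hk⟩ := he k
    constructor
    · rintro ⟨m⟩
      have hkk : k ≠ k₀ := by
        rintro rfl
        exact cylinder_not_mobius ((hk.trans cy).symm.trans m)
      refine ⟨hkk, (hd1 k hkk).resolve_left fun h0 => ?_⟩
      have := (hsc k).2 h0
      exact mobius_not_simplyConnected (simplyConnected_of_homeo m.symm)
    · rintro ⟨h1, h2⟩
      obtain ⟨m⟩ := hmo k h1 h2
      exact ⟨hk.trans m⟩
  have hr : Nat.card (ConnectedComponents U) = Fintype.card G.Cls := by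
    rw [← Nat.card_congr e, Nat.card_eq_fintype_card]
  have hf : Nat.card {C : ConnectedComponents U |
        SimplyConnectedSpace ↥(ConnectedComponents.mk ⁻¹' {C} : Set U)} =
      (Finset.univ.filter fun k => d k = 0).card := by
    rw [← Fintype.card_subtype, ← Nat.card_eq_fintype_card]
    exact Nat.card_congr (e.subtypeEquiv fun k => (hsc k).symm).symm
  have hf2 : (Finset.univ.filter fun k => d k = 0).card + ∑ k ∈ Finset.univ.erase k₀, d k + 1 =
      Fintype.card G.Cls := by
    have h1 : ∀ k, (if d k = 0 then 1 else 0) + d k = 1 := by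
      intro k
      by_cases hk : k = k₀
      · rw [hk, hd0]; simp
      · rcases hd1 k hk with h | h <;> simp [h]
    rw [Finset.card_filter, ← Finset.card_univ, Finset.card_eq_sum_ones,
      ← Finset.sum_congr rfl (fun k _ => h1 k), Finset.sum_add_distrib, ← hdsplit, hd0]
    ring
  have hiff : (∃ C : ConnectedComponents U,
      Nonempty (↥(ConnectedComponents.mk ⁻¹' {C} : Set U) ≃ₜ MobiusBand)) ↔
      ∑ k ∈ Finset.univ.erase k₀, d k = 1 := by
    constructor
    · rintro ⟨C, hC⟩
      obtain ⟨k, rfl⟩ := e.surjective C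
      obtain ⟨h1, h2⟩ := (hmob k).1 hC
      have := Finset.single_le_sum (f := d) (fun _ _ => Nat.zero_le _)
        (Finset.mem_erase.2 ⟨h1, Finset.mem_univ k⟩)
      omega
    · intro h
      obtain ⟨k, hk, hk0⟩ := Finset.exists_ne_zero_of_sum_ne_zero
        (show ∑ k ∈ Finset.univ.erase k₀, d k ≠ 0 by omega)
      have hkk := (Finset.mem_erase.1 hk).1
      exact ⟨e k, (hmob k).2 ⟨hkk, (hd1 k hkk).resolve_left hk0⟩⟩
  rw [hf, hr, hiff]
  refine ⟨by omega, by omega, ?_⟩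
  omega

end Main

end StripSystem

end

/-- The line with unit normal at angle `z.1` and signed distance `z.2` from the origin. -/
def Q (z : ℝ × ℝ) : X₂sp :=
  Quotient.mk lineSetoid ⟨(cos z.1, sin z.1, z.2), by
    intro h
    simp only [Prod.mk.injEq] at h
    have := cos_sq_add_sin_sq z.1
    rw [h.1, h.2] at this
    norm_num at this⟩

theorem Q_continuous : Continuous Q :=
  continuous_quot_mk.comp (Continuous.subtype_mk (by fun_prop) _)

theorem mk_eq_mk {L L' : {L : ℝ × ℝ × ℝ // IsLine L}} :
    Quotient.mk lineSetoid L = Quotient.mk lineSetoid L' ↔ ∃ c : ℝ, c ≠ 0 ∧ L'.val = c • L.val :=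
  Quotient.eq (r := lineSetoid)

theorem Q_add_pi (x p : ℝ) : Q (x + π, -p) = Q (x, p) := by
  refine mk_eq_mk.2 ⟨-1, by norm_num, ?_⟩
  simp [cos_add_pi, sin_add_pi]

theorem Q_add_int (x p : ℝ) (k : ℤ) : Q (x + k * π, (-1) ^ k * p) = Q (x, p) := by
  induction k using Int.induction_on with
  | zero => simp
  | succ k ih =>
    rw [← ih, ← Q_add_pi (x + (k : ℤ) * π)]
    congr 2
    · push_cast; ring
    · rw [zpow_add₀ (by norm_num)]; simp
  | pred k ih =>
    rw [← ih, ← Q_add_pi (x + ((-(k : ℤ) - 1 : ℤ) : ℝ) * π)]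
    congr 2
    · push_cast; ring
    · rw [zpow_sub₀ (by norm_num)]; simp; ring

theorem Q_eq {x p x' p' : ℝ} (h : Q (x, p) = Q (x', p')) :
    ∃ k : ℤ, x' = x + k * π ∧ p' = (-1) ^ k * p := by
  obtain ⟨c, -, h⟩ := mk_eq_mk.1 h
  simp only [Prod.smul_mk, smul_eq_mul, Prod.mk.injEq] at h
  obtain ⟨h1, h2, h3⟩ := h
  have hs : sin (x' - x) = 0 := by rw [sin_sub, h1, h2]; ring
  obtain ⟨k, hk⟩ := sin_eq_zero_iff.1 hs
  have hx : x' = x + k * π := by linarith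
  refine ⟨k, hx, ?_⟩
  have hc : cos (x + k * π) = (-1) ^ k * cos x := cos_add_int_mul_pi x k
  have hs' : sin (x + k * π) = (-1) ^ k * sin x := sin_add_int_mul_pi x k
  rw [hx, hc] at h1
  rw [hx, hs'] at h2
  have : c = (-1) ^ k := by
    have e := cos_sq_add_sin_sq x
    calc c = c * cos x * cos x + c * sin x * sin x := by linear_combination -c * e
      _ = (-1) ^ k := by rw [← h1, ← h2]; linear_combination (-1) ^ k * e
  rw [h3, this]

theorem Q_injOn {a : ℝ} : InjOn Q {z | z.1 ∈ Ioo a (a + π)} := by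
  rintro ⟨x, p⟩ hx ⟨x', p'⟩ hx' h
  obtain ⟨k, h1, h2⟩ := Q_eq h
  have hx : x ∈ Ioo a (a + π) := hx
  have hx' : x' ∈ Ioo a (a + π) := hx'
  have hk : k = 0 := by
    have h3 : (k : ℝ) * π < 1 * π := by linarith [hx.1, hx'.2]
    have h4 : -1 * π < (k : ℝ) * π := by linarith [hx.2, hx'.1]
    have h3 := lt_of_mul_lt_mul_right h3 pi_pos.le
    have h4 := lt_of_mul_lt_mul_right h4 pi_pos.le
    have : k < 1 := by exact_mod_cast h3
    have : -1 < k := by exact_mod_cast h4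
    omega
  subst hk
  simp [h1, h2]

theorem Q_isOpenMap : IsOpenMap Q := by
  intro V hV
  refine isOpen_coinduced.2 ?_
  rw [isOpen_iff_mem_nhds]
  rintro L ⟨⟨m, p⟩, hz, hL⟩
  obtain ⟨c, hc, hL⟩ := mk_eq_mk.1 hL
  set f : {L : ℝ × ℝ × ℝ // IsLine L} → ℝ × ℝ := fun L =>
    (m + arctan ((-L.val.1 * sin m + L.val.2.1 * cos m) / (L.val.1 * cos m + L.val.2.1 * sin m)),
      L.val.2.2 / (L.val.1 * cos (m + arctan ((-L.val.1 * sin m + L.val.2.1 * cos m) /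
        (L.val.1 * cos m + L.val.2.1 * sin m))) + L.val.2.1 * sin (m + arctan ((-L.val.1 * sin m +
          L.val.2.1 * cos m) / (L.val.1 * cos m + L.val.2.1 * sin m))))) with hf
  have e := cos_sq_add_sin_sq m
  simp only [Prod.smul_mk, smul_eq_mul] at hL
  have h0 : L.val.1 * cos m + L.val.2.1 * sin m = c := by
    rw [hL]; linear_combination c * e
  have h1 : -L.val.1 * sin m + L.val.2.1 * cos m = 0 := by
    rw [hL]; ring
  have hfL : f L = (m, p) := by
    simp only [hf, h0, h1, zero_div, arctan_zero, add_zero]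
    rw [hL]
    simp only
    rw [mul_div_cancel_left₀ _ hc]
  have hd : ContinuousAt f L := by
    have hc1 : Continuous fun L : {L : ℝ × ℝ × ℝ // IsLine L} => L.val.1 := by fun_prop
    have hc2 : Continuous fun L : {L : ℝ × ℝ × ℝ // IsLine L} => L.val.2.1 := by fun_prop
    have hc3 : Continuous fun L : {L : ℝ × ℝ × ℝ // IsLine L} => L.val.2.2 := by fun_prop
    have hA : ContinuousAt (fun L : {L : ℝ × ℝ × ℝ // IsLine L} =>
        m + arctan ((-L.val.1 * sin m + L.val.2.1 * cos m) /
          (L.val.1 * cos m + L.val.2.1 * sin m))) L := by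
      refine continuousAt_const.add (continuous_arctan.continuousAt.comp ?_)
      refine ContinuousAt.div (by fun_prop) (by fun_prop) ?_
      rw [h0]; exact hc
    refine hA.prodMk (ContinuousAt.div (by fun_prop) ?_ ?_)
    · exact (hc1.continuousAt.mul (continuous_cos.continuousAt.comp hA)).add
        (hc2.continuousAt.mul (continuous_sin.continuousAt.comp hA))
    · simp only [h0, h1, zero_div, arctan_zero, add_zero]; exact hc
  have hpos : ∀ᶠ L' in 𝓝 L, L'.val.1 * cos m + L'.val.2.1 * sin m ≠ 0 := by
    have : ContinuousAt (fun L : {L : ℝ × ℝ × ℝ // IsLine L} =>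
      L.val.1 * cos m + L.val.2.1 * sin m) L := by fun_prop
    exact this.eventually_ne (by rw [h0]; exact hc)
  have hV' : ∀ᶠ L' in 𝓝 L, f L' ∈ V := hd (by rw [hfL]; exact hV.mem_nhds hz)
  filter_upwards [hpos, hV'] with L' hL' hm
  refine ⟨f L', hm, mk_eq_mk.2 ?_⟩
  obtain ⟨⟨A, B, C⟩, hl⟩ := L'
  simp only at hL' hf
  set X := A * cos m + B * sin m with hX
  set Y := -A * sin m + B * cos m with hY
  set τ := arctan (Y / X) with hτ
  have hA : A = X * cos m - Y * sin m := by rw [hX, hY]; linear_combination -A * e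
  have hB : B = X * sin m + Y * cos m := by rw [hX, hY]; linear_combination -B * e
  have hcτ : cos τ ≠ 0 := (cos_arctan_pos _).ne'
  have hYX : Y * cos τ = X * sin τ := by
    have := tan_arctan (Y / X)
    rw [← hτ, tan_eq_sin_div_cos] at this
    field_simp at this
    linear_combination -this
  have eτ := cos_sq_add_sin_sq τ
  set d := X / cos τ with hd'
  have hXd : X = d * cos τ := by rw [hd']; field_simp
  have hYd : Y = d * sin τ := by
    apply mul_right_cancel₀ hcτ
    rw [hYX, hXd]; ring
  have hAd : A = d * cos (m + τ) := by rw [hA, hXd, hYd, cos_add]; ring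
  have hBd : B = d * sin (m + τ) := by rw [hB, hXd, hYd, sin_add]; ring
  have hdd : A * cos (m + τ) + B * sin (m + τ) = d := by
    rw [hAd, hBd]; linear_combination d * cos_sq_add_sin_sq (m + τ)
  have hd0 : d ≠ 0 := div_ne_zero hL' hcτ
  refine ⟨d, hd0, ?_⟩
  simp only [hf, Prod.smul_mk, smul_eq_mul]
  rw [hdd, mul_div_cancel₀ _ hd0, ← hAd, ← hBd]

theorem Q_surjective : Function.Surjective Q := by
  intro x
  induction x using Quotient.inductionOn with | _ L => ?_
  obtain ⟨⟨A, B, C⟩, hL⟩ := L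
  set w : ℂ := ⟨A, B⟩ with hw
  have hw0 : w ≠ 0 := by
    intro h
    apply hL
    have h1 := congrArg Complex.re h
    have h2 := congrArg Complex.im h
    simp [hw] at h1 h2
    simp [h1, h2]
  have hn : ‖w‖ ≠ 0 := norm_ne_zero_iff.2 hw0
  refine ⟨(w.arg, C / ‖w‖), mk_eq_mk.2 ⟨‖w‖, hn, ?_⟩⟩
  simp only [Prod.smul_mk, smul_eq_mul, Prod.mk.injEq]
  refine ⟨?_, ?_, by field_simp⟩
  · rw [Complex.cos_arg hw0]; field_simp; simp [hw]
  · rw [Complex.sin_arg]; field_simp; simp [hw]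

/-- The coefficients of the projection onto the normal direction together with the foot point. -/
def lineCoord (L : ℝ × ℝ × ℝ) : ℝ × ℝ × ℝ × ℝ :=
  (L.1 ^ 2 / (L.1 ^ 2 + L.2.1 ^ 2), L.1 * L.2.1 / (L.1 ^ 2 + L.2.1 ^ 2),
    L.1 * L.2.2 / (L.1 ^ 2 + L.2.1 ^ 2), L.2.1 * L.2.2 / (L.1 ^ 2 + L.2.1 ^ 2))

instance : T2Space X₂sp := by
  have hpos : ∀ L : {L : ℝ × ℝ × ℝ // IsLine L}, L.val.1 ^ 2 + L.val.2.1 ^ 2 ≠ 0 := by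
    rintro ⟨⟨A, B, C⟩, hL⟩ h
    apply hL
    simp only at h
    have h1 : A = 0 := by nlinarith [sq_nonneg A, sq_nonneg B]
    have h2 : B = 0 := by nlinarith [sq_nonneg A, sq_nonneg B]
    simp [h1, h2]
  let F : X₂sp → ℝ × ℝ × ℝ × ℝ := Quotient.lift (fun L => lineCoord L.val) (by
    rintro L L' ⟨c, hc, h⟩
    have := hpos L
    simp only [lineCoord, h, Prod.smul_fst, Prod.smul_snd, smul_eq_mul]
    have e : (c * L.val.1) ^ 2 + (c * L.val.2.1) ^ 2 = c ^ 2 * (L.val.1 ^ 2 + L.val.2.1 ^ 2) := by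
      ring
    rw [e]
    simp only [Prod.mk.injEq]
    refine ⟨?_, ?_, ?_, ?_⟩ <;> field_simp)
  have hF : Continuous F := by
    refine continuous_quot_lift _ ?_
    have hc1 : Continuous fun L : {L : ℝ × ℝ × ℝ // IsLine L} => L.val.1 := by fun_prop
    have hc2 : Continuous fun L : {L : ℝ × ℝ × ℝ // IsLine L} => L.val.2.1 := by fun_prop
    have hc3 : Continuous fun L : {L : ℝ × ℝ × ℝ // IsLine L} => L.val.2.2 := by fun_prop
    have hd := (hc1.pow 2).add (hc2.pow 2)
    exact (((hc1.pow 2).div hd hpos).prodMk (((hc1.mul hc2).div hd hpos).prodMk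
      (((hc1.mul hc3).div hd hpos).prodMk ((hc2.mul hc3).div hd hpos))))
  refine T2Space.of_injective_continuous (f := F) ?_ hF
  intro x y
  obtain ⟨⟨s, p⟩, rfl⟩ := Q_surjective x
  obtain ⟨⟨t, q⟩, rfl⟩ := Q_surjective y
  intro h
  have h' : lineCoord (cos s, sin s, p) = lineCoord (cos t, sin t, q) := h
  simp only [lineCoord, cos_sq_add_sin_sq, div_one, Prod.mk.injEq] at h'
  obtain ⟨h1, h2, h3, h4⟩ := h'
  have es := cos_sq_add_sin_sq s
  have et := cos_sq_add_sin_sq t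
  have h5 : sin s ^ 2 = sin t ^ 2 := by linarith
  have hs : sin (t - s) = 0 := by
    have : sin (t - s) ^ 2 = 0 := by
      rw [sin_sub]
      linear_combination (2 * cos s * sin s) * h2 - sin s ^ 2 * h1 - cos s ^ 2 * h5
    exact pow_eq_zero_iff (two_ne_zero) |>.1 this
  obtain ⟨k, hk⟩ := sin_eq_zero_iff.1 hs
  have ht : t = s + k * π := by linarith
  rw [ht, ← Q_add_int s p k]
  congr 2
  have hc : cos (s + k * π) = (-1) ^ k * cos s := cos_add_int_mul_pi s k
  have hs' : sin (s + k * π) = (-1) ^ k * sin s := sin_add_int_mul_pi s k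
  rw [ht, hc] at h3
  rw [ht, hs'] at h4
  have hk2 : ((-1 : ℝ) ^ k) * (-1) ^ k = 1 := by
    rw [← mul_zpow]; norm_num
  have : p = (-1) ^ k * q := by
    linear_combination cos s * h3 + sin s * h4 - p * es + (-1) ^ k * q * es
  rw [this, ← mul_assoc, hk2, one_mul]

theorem Q_isOpenQuotientMap : IsOpenQuotientMap Q := ⟨Q_surjective, Q_continuous, Q_isOpenMap⟩

instance : TopologicalSpace.MetrizableSpace X₂sp := by
  have : SecondCountableTopology X₂sp :=
    Q_isOpenMap.isQuotientMap Q_continuous Q_surjective |>.secondCountableTopology Q_isOpenMap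
  have : LocallyCompactSpace X₂sp := Q_isOpenQuotientMap.locallyCompactSpace
  exact TopologicalSpace.metrizableSpace_of_t3_secondCountable X₂sp

theorem continuousOn_invFunOn {X Y : Type*} [TopologicalSpace X] [TopologicalSpace Y] [Nonempty X]
    {f : X → Y} (ho : IsOpenMap f) {V : Set X} (hV : IsOpen V) (hi : InjOn f V) :
    ContinuousOn (Function.invFunOn f V) (f '' V) := by
  rintro _ ⟨x, hx, rfl⟩
  refine ContinuousAt.continuousWithinAt ?_
  have hx' : Function.invFunOn f V (f x) = x := hi.leftInvOn_invFunOn hx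
  rw [ContinuousAt, hx', tendsto_nhds]
  intro U hU hxU
  refine mem_of_superset ((ho (U ∩ V) (hU.inter hV)).mem_nhds ⟨x, ⟨hxU, hx⟩, rfl⟩) ?_
  rintro _ ⟨y, ⟨hyU, hyV⟩, rfl⟩
  simpa [hi.leftInvOn_invFunOn hyV] using hyU

/-- The image of a box under an open embedding of a neighbourhood. -/
theorem Box.nonempty_map {X Y : Type*} [TopologicalSpace X] [TopologicalSpace Y] [Nonempty X]
    {f : X → Y} (hc : Continuous f) (ho : IsOpenMap f) {V : Set X} (hV : IsOpen V)
    (hi : InjOn f V) {D : Set X} (hD : D ⊆ V) {w₀ w₁ : ℝ → X} {ε : ℝ} (b : Box D w₀ w₁ ε) :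
    Nonempty (Box (f '' D) (fun y => f (w₀ y)) (fun y => f (w₁ y)) ε) := by
  have hl : ∀ x ∈ D, Function.invFunOn f V (f x) = x := fun x hx => hi.leftInvOn_invFunOn (hD hx)
  refine ⟨{
    toFun := fun z => f (b.toFun z)
    invFun := fun y => b.invFun (Function.invFunOn f V y)
    cont := hc.comp_continuousOn b.cont
    cont_inv := ?_
    maps := fun z hz => ⟨_, b.maps z hz, rfl⟩
    maps_inv := ?_
    left_inv := fun z hz => by rw [hl _ (b.maps z hz), b.left_inv z hz]
    right_inv := ?_
    zero := fun y => by rw [b.zero]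
    one := fun y => by rw [b.one]
    sq := b.sq }⟩
  · refine b.cont_inv.comp ((continuousOn_invFunOn ho hV hi).mono (image_mono hD)) ?_
    rintro _ ⟨x, hx, rfl⟩
    rwa [hl x hx]
  · rintro _ ⟨x, hx, rfl⟩
    rw [hl x hx]
    exact b.maps_inv x hx
  · rintro _ ⟨x, hx, rfl⟩
    rw [hl x hx, b.right_inv x hx]

/-- Reversing the parametrization of the second boundary line. -/
def Box.flip {X : Type*} [TopologicalSpace X] {C : Set X} {w₀ w₁ : ℝ → X} {ε : ℝ}
    (b : Box C w₀ (fun y => w₁ (-y)) ε) : Box C w₀ w₁ (-ε) :=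
  { b with
    one := fun y => by rw [b.one, neg_mul]
    sq := by rw [neg_mul_neg, b.sq] }

/-- The part of the open set `R` over the open interval `(x₀, x₁)`, together with parts of the
fibres over the ends. -/
def bandSet (x₀ x₁ : ℝ) (R : Set (ℝ × ℝ)) (K₀ K₁ : Set ℝ) : Set (ℝ × ℝ) :=
  {z | (x₀ < z.1 ∧ z.1 < x₁ ∧ z ∈ R) ∨ (z.1 = x₀ ∧ z.2 ∈ K₀) ∨ (z.1 = x₁ ∧ z.2 ∈ K₁)}

theorem bandSet_relOpen {x₀ x₁ : ℝ} {R : Set (ℝ × ℝ)} (hR : IsOpen R) {K₀ K₁ : Set ℝ}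
    (h01 : x₀ < x₁)
    (o₀ : IsOpen K₀) (o₁ : IsOpen K₁) (h₀ : ∀ p ∈ K₀, (x₀, p) ∈ R) (h₁ : ∀ p ∈ K₁, (x₁, p) ∈ R) :
    ∃ V, IsOpen V ∧ ∀ z, z.1 ∈ Icc x₀ x₁ → (z ∈ bandSet x₀ x₁ R K₀ K₁ ↔ z ∈ V) := by
  refine ⟨(R ∩ {z | x₀ < z.1 ∧ z.1 < x₁}) ∪ (R ∩ {z | z.1 < x₁ ∧ z.2 ∈ K₀}) ∩
      {z | x₀ < z.1 ∨ z.2 ∈ K₀} ∪ (R ∩ {z | x₀ < z.1 ∧ z.2 ∈ K₁}), ?_, ?_⟩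
  · have c1 : Continuous (Prod.fst : ℝ × ℝ → ℝ) := continuous_fst
    have c2 : Continuous (Prod.snd : ℝ × ℝ → ℝ) := continuous_snd
    refine ((hR.inter ?_).union ((hR.inter ?_).inter ?_)).union (hR.inter ?_)
    · exact (isOpen_lt continuous_const c1).inter (isOpen_lt c1 continuous_const)
    · exact (isOpen_lt c1 continuous_const).inter (o₀.preimage c2)
    · exact (isOpen_lt continuous_const c1).union (o₀.preimage c2)
    · exact (isOpen_lt continuous_const c1).inter (o₁.preimage c2)
  · rintro ⟨x, p⟩ ⟨hx0, hx1⟩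
    simp only [bandSet, mem_ofPred_eq, mem_union, mem_inter_iff] at hx0 hx1 ⊢
    constructor
    · rintro (⟨a, b, c⟩ | ⟨rfl, b⟩ | ⟨rfl, b⟩)
      · exact Or.inl (Or.inl ⟨c, a, b⟩)
      · exact Or.inl (Or.inr ⟨⟨h₀ p b, h01, b⟩, Or.inr b⟩)
      · exact Or.inr ⟨h₁ p b, h01, b⟩
    · rintro ((⟨a, b, c⟩ | ⟨⟨a, b, c⟩, -⟩) | ⟨a, b, c⟩)
      · exact Or.inl ⟨b, c, a⟩
      · rcases hx0.eq_or_lt with h | h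
        · exact Or.inr (Or.inl ⟨h.symm, c⟩)
        · exact Or.inl ⟨h, b, a⟩
      · rcases hx1.eq_or_lt with h | h
        · exact Or.inr (Or.inr ⟨h, c⟩)
        · exact Or.inl ⟨b, h, a⟩

/-- A band over a closed interval, ending in intervals at both ends, is a box. -/
theorem through_box {x₀ x₁ : ℝ} (h01 : x₀ < x₁) {R : Set (ℝ × ℝ)} (hR : IsOpen R)
    {σ₀ σ₁ : ℝ → ℝ} (m₀ : StrictMono σ₀) (m₁ : StrictMono σ₁) (o₀ : IsOpen (range σ₀))
    (o₁ : IsOpen (range σ₁)) (c₀ : OrdConnected (range σ₀)) (c₁ : OrdConnected (range σ₁))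
    (h₀ : ∀ y, (x₀, σ₀ y) ∈ R) (h₁ : ∀ y, (x₁, σ₁ y) ∈ R)
    (hord : ∀ x ∈ Ioo x₀ x₁, OrdConnected {p | (x, p) ∈ R})
    (hne : ∀ x ∈ Ioo x₀ x₁, ∃ p, (x, p) ∈ R) :
    Nonempty (Box (bandSet x₀ x₁ R (range σ₀) (range σ₁)) (fun y => (x₀, σ₀ y))
      (fun y => (x₁, σ₁ y)) 1) := by
  set D := bandSet x₀ x₁ R (range σ₀) (range σ₁) with hD
  obtain ⟨V, hVo, hV⟩ := bandSet_relOpen hR h01 o₀ o₁ (by rintro _ ⟨y, rfl⟩; exact h₀ y)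
    (by rintro _ ⟨y, rfl⟩; exact h₁ y)
  have hd : 0 < x₁ - x₀ := sub_pos.2 h01
  -- rescaled first coordinate
  set r : Icc (0:ℝ) 1 → ℝ := fun t => x₀ + t * (x₁ - x₀) with hr
  have hrc : Continuous r := by fun_prop
  have hrm : ∀ t, r t ∈ Icc x₀ x₁ := fun t =>
    ⟨by have := mul_nonneg t.2.1 hd.le; simp only [hr]; linarith,
     by have := mul_le_mul_of_nonneg_right t.2.2 hd.le; simp only [hr]; linarith⟩
  have hr0 : ∀ t, r t = x₀ ↔ (t : ℝ) = 0 := fun t => by simp [hr, hd.ne']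
  have hr1 : ∀ t, r t = x₁ ↔ (t : ℝ) = 1 := fun t => by
    constructor
    · intro h
      have : ((t : ℝ) - 1) * (x₁ - x₀) = 0 := by simp only [hr] at h; linarith
      rcases mul_eq_zero.1 this with h | h
      · linarith
      · exact absurd h hd.ne'
    · intro h; simp [hr, h]
  set E : Set (Icc (0:ℝ) 1 × ℝ) := {z | (r z.1, z.2) ∈ D} with hE
  have hEo : IsOpen E := by
    have : E = (fun z : Icc (0:ℝ) 1 × ℝ => (r z.1, z.2)) ⁻¹' V := by
      ext z
      exact hV _ (hrm z.1)
    rw [this]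
    exact hVo.preimage ((hrc.comp continuous_fst).prodMk continuous_snd)
  have hfib : ∀ j, {p | (j, p) ∈ E}.OrdConnected ∧ ∃ p, (j, p) ∈ E := by
    intro j
    rcases (hrm j).1.eq_or_lt with h | h
    · have : {p | (j, p) ∈ E} = range σ₀ := by
        ext p
        simp [hE, hD, bandSet, ← h, h01.ne]
      exact ⟨this ▸ c₀, σ₀ 0, by
        have h' : σ₀ 0 ∈ {p | (j, p) ∈ E} := this ▸ mem_range_self 0
        exact h'⟩
    rcases (hrm j).2.eq_or_lt with h' | h'
    · have : {p | (j, p) ∈ E} = range σ₁ := by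
        ext p
        simp [hE, hD, bandSet, h', h01.ne']
      exact ⟨this ▸ c₁, σ₁ 0, by
        have h' : σ₁ 0 ∈ {p | (j, p) ∈ E} := this ▸ mem_range_self 0
        exact h'⟩
    · have : {p | (j, p) ∈ E} = {p | (r j, p) ∈ R} := by
        ext p
        simp [hE, hD, bandSet, h, h', h.ne', h'.ne]
      obtain ⟨p, hp⟩ := hne _ ⟨h, h'⟩
      refine ⟨this ▸ hord _ ⟨h, h'⟩, p, ?_⟩
      have h' : p ∈ {p | (j, p) ∈ E} := this ▸ hp
      exact h'
  obtain ⟨f, hf, hmono, hsurj⟩ := exists_band hEo (fun j => (hfib j).1) (fun j => (hfib j).2)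
  -- the homeomorphism from `D` to `E`
  have hDI : ∀ z ∈ D, z.1 ∈ Icc x₀ x₁ := by
    rintro ⟨x, p⟩ (⟨a, b, -⟩ | ⟨a, -⟩ | ⟨a, -⟩)
    · exact ⟨a.le, b.le⟩
    · exact ⟨a.ge, a.le.trans h01.le⟩
    · exact ⟨h01.le.trans a.ge, a.le⟩
  have hq : ∀ z ∈ D, (z.1 - x₀) / (x₁ - x₀) ∈ Icc (0:ℝ) 1 := fun z hz =>
    ⟨div_nonneg (sub_nonneg.2 (hDI z hz).1) hd.le,
      (div_le_one hd).2 (by linarith [(hDI z hz).2])⟩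
  have hrq : ∀ z (hz : z ∈ D), r ⟨_, hq z hz⟩ = z.1 := fun z hz => by
    simp only [hr]; rw [div_mul_cancel₀ _ hd.ne']; ring
  let ψ : D ≃ₜ E :=
    { toFun := fun z => ⟨(⟨_, hq z.1 z.2⟩, z.1.2), by
        show (r _, z.1.2) ∈ D
        rw [hrq z.1 z.2]; exact z.2⟩
      invFun := fun z => ⟨(r z.1.1, z.1.2), z.2⟩
      left_inv := fun z => by
        apply Subtype.ext
        exact Prod.ext (hrq z.1 z.2) rfl
      right_inv := fun z => by
        apply Subtype.ext
        refine Prod.ext (Subtype.ext ?_) rfl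
        show (r z.1.1 - x₀) / (x₁ - x₀) = z.1.1
        simp only [hr]; field_simp; ring
      continuous_toFun := by fun_prop
      continuous_invFun := by fun_prop }
  let φ : D ≃ₜ Icc (0:ℝ) 1 × ℝ := ψ.trans (fiberHomeo hEo hf hmono hsurj)
  have hφ1 : ∀ z : D, ((φ z).1 : ℝ) = (z.1.1 - x₀) / (x₁ - x₀) := fun z => rfl
  have hφ2 : ∀ z : D, (φ z).2 = f (⟨_, hq z.1 z.2⟩, z.1.2) := fun z => rfl
  have hw0 : ∀ y, (x₀, σ₀ y) ∈ D := fun y => Or.inr (Or.inl ⟨rfl, mem_range_self y⟩)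
  have hw1 : ∀ y, (x₁, σ₁ y) ∈ D := fun y => Or.inr (Or.inr ⟨rfl, mem_range_self y⟩)
  refine Box.nonempty_of_homeo (by norm_num) φ hw0 hw1 ?_ ?_ ?_ ?_ ?_ ?_
  · intro y; rw [hφ1]; simp
  · intro y; rw [hφ1]; exact div_self hd.ne'
  · rintro ⟨⟨x, p⟩, hz⟩ h
    rw [hφ1] at h
    have hx : x = x₀ := by
      rcases div_eq_zero_iff.1 h with h | h
      · exact sub_eq_zero.1 h
      · exact absurd h hd.ne'
    subst hx
    rcases hz with ⟨a, -⟩ | ⟨-, y, hy⟩ | ⟨a, -⟩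
    · exact absurd a (lt_irrefl _)
    · exact ⟨y, Prod.ext rfl hy⟩
    · exact absurd a h01.ne
  · rintro ⟨⟨x, p⟩, hz⟩ h
    rw [hφ1] at h
    have hx : x = x₁ := by
      have := (div_eq_one_iff_eq hd.ne').1 h
      simp only at this; linarith
    subst hx
    rcases hz with ⟨-, a, -⟩ | ⟨a, -⟩ | ⟨-, y, hy⟩
    · exact absurd a (lt_irrefl _)
    · exact absurd a h01.ne'
    · exact ⟨y, Prod.ext rfl hy⟩
  · intro y y' hy
    exact hmono _ (ψ ⟨_, hw0 y⟩).2 (ψ ⟨_, hw0 y'⟩).2 (m₀ hy)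
  · intro y y' hy
    simp only [one_mul]
    exact hmono _ (ψ ⟨_, hw1 y⟩).2 (ψ ⟨_, hw1 y'⟩).2 (m₁ hy)

/-- Polar coordinates on a half plane with respect to the sum norm. -/
theorem half_polar {X Y : ℝ} (hX : 0 ≤ X) (h : 0 < X + |Y|) :
    (Y / (X + |Y|) + 1) / 2 ∈ Icc (0:ℝ) 1 ∧
      (X + |Y|) * (1 - |2 * ((Y / (X + |Y|) + 1) / 2) - 1|) = X ∧
      (X + |Y|) * (2 * ((Y / (X + |Y|) + 1) / 2) - 1) = Y := by
  have h1 := neg_abs_le Y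
  have h2 := le_abs_self Y
  have e : 2 * ((Y / (X + |Y|) + 1) / 2) - 1 = Y / (X + |Y|) := by ring
  refine ⟨⟨?_, ?_⟩, ?_, ?_⟩
  · have : -1 ≤ Y / (X + |Y|) := by rw [le_div_iff₀ h]; linarith
    linarith
  · have : Y / (X + |Y|) ≤ 1 := by rw [div_le_iff₀ h]; linarith
    linarith
  · rw [e, abs_div, abs_of_pos h]; field_simp; ring
  · rw [e]; field_simp

theorem half_polar_inv {t ρ : ℝ} (ht : t ∈ Icc (0:ℝ) 1) (hρ : 0 < ρ) :
    0 ≤ ρ * (1 - |2 * t - 1|) ∧ ρ * (1 - |2 * t - 1|) + |ρ * (2 * t - 1)| = ρ ∧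
      (ρ * (2 * t - 1) / (ρ * (1 - |2 * t - 1|) + |ρ * (2 * t - 1)|) + 1) / 2 = t := by
  have h2 : ρ * (1 - |2 * t - 1|) + |ρ * (2 * t - 1)| = ρ := by
    rw [abs_mul, abs_of_pos hρ]; ring
  refine ⟨mul_nonneg hρ.le ?_, h2, ?_⟩
  · rw [sub_nonneg, abs_le]; constructor <;> linarith [ht.1, ht.2]
  · rw [h2]; field_simp; ring

/-- A band over a half-open interval whose fibre over the end consists of two intervals is a
box with reversed orientation. -/
theorem fold_box_lt {x₀ x₁ : ℝ} (h01 : x₀ < x₁) {R : Set (ℝ × ℝ)} (hR : IsOpen R)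
    {σ σ' : ℝ → ℝ} (m₀ : StrictMono σ) (m₁ : StrictMono σ') (o₀ : IsOpen (range σ))
    (o₁ : IsOpen (range σ')) (c₀ : OrdConnected (range σ)) (c₁ : OrdConnected (range σ'))
    (h₀ : ∀ y, (x₀, σ y) ∈ R) (h₁ : ∀ y, (x₀, σ' y) ∈ R) (hlt : ∀ y y', σ y < σ' y')
    (hord : ∀ x ∈ Ico x₀ x₁, OrdConnected {p | (x, p) ∈ R})
    (hne : ∀ x ∈ Ioo x₀ x₁, ∃ p, (x, p) ∈ R) :
    Nonempty (Box (bandSet x₀ x₁ R (range σ ∪ range σ') ∅) (fun y => (x₀, σ y))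
      (fun y => (x₀, σ' y)) (-1)) := by
  set D := bandSet x₀ x₁ R (range σ ∪ range σ') ∅ with hD
  set K : Set ℝ := {p | ∃ y y', σ y < p ∧ p < σ' y'} with hK
  set D₁ := bandSet x₀ x₁ R K ∅ with hD₁
  have hKo : IsOpen K := by
    have : K = ⋃ y, ⋃ y', Ioo (σ y) (σ' y') := by ext; simp [hK]
    rw [this]
    exact isOpen_iUnion fun y => isOpen_iUnion fun y' => isOpen_Ioo
  have hKR : ∀ p ∈ K, (x₀, p) ∈ R := by
    rintro p ⟨y, y', h, h'⟩
    exact (hord x₀ ⟨le_rfl, h01⟩).out (h₀ y) (h₁ y') ⟨h.le, h'.le⟩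
  have hσK : ∀ y, σ y ∈ K := fun y => ⟨y - 1, 0, m₀ (by linarith), hlt _ _⟩
  have hσK' : ∀ y, σ' y ∈ K := fun y => ⟨0, y + 1, hlt _ _, m₁ (by linarith)⟩
  have hKc : OrdConnected K := ⟨by
    rintro p ⟨y, -, h, -⟩ q ⟨-, y', -, h'⟩ r ⟨hr, hr'⟩
    exact ⟨y, y', h.trans_le hr, hr'.trans_lt h'⟩⟩
  have hDD : D ⊆ D₁ := by
    rintro ⟨x, p⟩ (h | ⟨h, h'⟩ | h)
    · exact Or.inl h
    · refine Or.inr (Or.inl ⟨h, ?_⟩)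
      rcases h' with ⟨y, rfl⟩ | ⟨y, rfl⟩
      · exact hσK y
      · exact hσK' y
    · exact absurd h.2 (notMem_empty _)
  have hDI : ∀ z ∈ D₁, z.1 ∈ Ico x₀ x₁ := by
    rintro ⟨x, p⟩ (⟨a, b, -⟩ | ⟨a, -⟩ | ⟨-, a⟩)
    · exact ⟨a.le, b⟩
    · exact ⟨a.ge, a.trans_lt h01⟩
    · exact absurd a (notMem_empty _)
  obtain ⟨V₁, hV₁o, hV₁⟩ := bandSet_relOpen hR h01 hKo isOpen_empty hKR (by simp)
  obtain ⟨V, hVo, hV⟩ := bandSet_relOpen (K₀ := range σ ∪ range σ') hR h01 (o₀.union o₁)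
    isOpen_empty (by rintro _ (⟨y, rfl⟩ | ⟨y, rfl⟩); exacts [h₀ y, h₁ y]) (by simp)
  set E : Set (Ico x₀ x₁ × ℝ) := {z | ((z.1 : ℝ), z.2) ∈ D₁} with hE
  have hEo : IsOpen E := by
    have : E = (fun z : Ico x₀ x₁ × ℝ => ((z.1 : ℝ), z.2)) ⁻¹' V₁ := by
      ext z
      exact hV₁ _ ⟨z.1.2.1, z.1.2.2.le⟩
    rw [this]
    exact hV₁o.preimage (by fun_prop)
  have hfib : ∀ j, {p | (j, p) ∈ E}.OrdConnected ∧ ∃ p, (j, p) ∈ E := by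
    rintro ⟨x, hx⟩
    rcases hx.1.eq_or_lt with h | h
    · have : {p | ((⟨x, hx⟩ : Ico x₀ x₁), p) ∈ E} = K := by
        ext p
        simp [hE, hD₁, bandSet, ← h]
      exact ⟨this ▸ hKc, σ 0, by
        have h' : σ 0 ∈ {p | ((⟨x, hx⟩ : Ico x₀ x₁), p) ∈ E} := this ▸ hσK 0
        exact h'⟩
    · have : {p | ((⟨x, hx⟩ : Ico x₀ x₁), p) ∈ E} = {p | (x, p) ∈ R} := by
        ext p
        simp [hE, hD₁, bandSet, h, h.ne', hx.2]
      obtain ⟨p, hp⟩ := hne _ ⟨h, hx.2⟩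
      refine ⟨this ▸ hord _ hx, p, ?_⟩
      have h' : p ∈ {p | ((⟨x, hx⟩ : Ico x₀ x₁), p) ∈ E} := this ▸ hp
      exact h'
  obtain ⟨f, hf, hmono, hsurj⟩ := exists_band hEo (fun j => (hfib j).1) (fun j => (hfib j).2)
  set h := fiberHomeo hEo hf hmono hsurj with hh
  set j₀ : Ico x₀ x₁ := ⟨x₀, le_rfl, h01⟩ with hj₀
  have hE0 : ∀ p, (j₀, p) ∈ E ↔ p ∈ K := by
    intro p
    simp [hE, hD₁, bandSet, hj₀]
  have hf0 : ∀ p ∈ K, ∀ q ∈ K, p < q → f (j₀, p) < f (j₀, q) := fun p hp q hq hpq =>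
    hmono j₀ ((hE0 p).2 hp) ((hE0 q).2 hq) hpq
  obtain ⟨m, hm, hm'⟩ : ∃ m, (∀ y, f (j₀, σ y) < m) ∧ ∀ y, m < f (j₀, σ' y) := by
    have hb : BddAbove (range fun y => f (j₀, σ y)) :=
      ⟨f (j₀, σ' 0), by rintro _ ⟨y, rfl⟩; exact (hf0 _ (hσK y) _ (hσK' 0) (hlt _ _)).le⟩
    refine ⟨sSup (range fun y => f (j₀, σ y)), fun y => ?_, fun y => ?_⟩
    · exact (hf0 _ (hσK y) _ (hσK (y + 1)) (m₀ (by linarith))).trans_le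
        (le_csSup hb ⟨y + 1, rfl⟩)
    · refine (csSup_le (range_nonempty _) ?_).trans_lt
        (hf0 _ (hσK' (y - 1)) _ (hσK' y) (m₁ (by linarith)))
      rintro _ ⟨y', rfl⟩
      exact (hf0 _ (hσK y') _ (hσK' _) (hlt _ _)).le
  -- `D` in the straightened coordinates
  set P : Set (Ico x₀ x₁ × ℝ) := {z | (((h.symm (z.1, z.2 + m)).1.1 : ℝ),
    (h.symm (z.1, z.2 + m)).1.2) ∈ D} with hP
  have hs1 : ∀ z, (h.symm z).1.1 = z.1 := fun z => by
    have := congrArg Prod.fst (h.apply_symm_apply z)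
    exact this
  have hs2 : ∀ z, f (h.symm z).1 = z.2 := fun z => by
    have := congrArg Prod.snd (h.apply_symm_apply z)
    exact this
  have hPo : IsOpen P := by
    have : P = (fun z : Ico x₀ x₁ × ℝ => (((h.symm (z.1, z.2 + m)).1.1 : ℝ),
        (h.symm (z.1, z.2 + m)).1.2)) ⁻¹' V := by
      ext z
      exact hV _ ⟨(h.symm (z.1, z.2 + m)).1.1.2.1, (h.symm (z.1, z.2 + m)).1.1.2.2.le⟩
    rw [this]
    refine hVo.preimage ?_
    have : Continuous fun z : Ico x₀ x₁ × ℝ => h.symm (z.1, z.2 + m) :=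
      h.symm.continuous.comp (by fun_prop)
    fun_prop
  have hPgt : ∀ (j : Ico x₀ x₁) (Y : ℝ), x₀ < j → (j, Y) ∈ P := by
    intro j Y hj
    have hd : ((h.symm (j, Y + m)).1.1, (h.symm (j, Y + m)).1.2) ∈ E := (h.symm (j, Y + m)).2
    have h1 := hs1 (j, Y + m)
    rcases hd with hd | hd | hd
    · exact Or.inl hd
    · rw [h1] at hd
      exact absurd hd.1 hj.ne'
    · exact absurd hd.2 (notMem_empty _)
  have hP0 : ∀ Y, (j₀, Y) ∈ P ↔ ∃ p, (p ∈ range σ ∪ range σ') ∧ f (j₀, p) - m = Y := by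
    intro Y
    have h1 := hs1 (j₀, Y + m)
    have h2 := hs2 (j₀, Y + m)
    constructor
    · intro hd
      have hd : (((h.symm (j₀, Y + m)).1.1 : ℝ), (h.symm (j₀, Y + m)).1.2) ∈ D := hd
      refine ⟨(h.symm (j₀, Y + m)).1.2, ?_, ?_⟩
      · rcases hd with hd | hd | hd
        · rw [h1] at hd
          exact absurd hd.1 (lt_irrefl _)
        · exact hd.2
        · exact absurd hd.2 (notMem_empty _)
      · have e : (h.symm (j₀, Y + m)).1 = (j₀, (h.symm (j₀, Y + m)).1.2) := Prod.ext h1 rfl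
        rw [e] at h2
        simp only at h2
        linarith
    · rintro ⟨p, hp, rfl⟩
      have hpE : (j₀, p) ∈ E := (hE0 p).2 (by
        rcases hp with ⟨y, rfl⟩ | ⟨y, rfl⟩
        exacts [hσK y, hσK' y])
      have e : h.symm (j₀, f (j₀, p)) = ⟨(j₀, p), hpE⟩ := by
        rw [Homeomorph.symm_apply_eq]; rfl
      show (((h.symm (j₀, f (j₀, p) - m + m)).1.1 : ℝ), (h.symm (j₀, f (j₀, p) - m + m)).1.2) ∈ D
      rw [sub_add_cancel, e]
      exact Or.inr (Or.inl ⟨rfl, hp⟩)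
  -- polar coordinates
  have hcap : ∀ t : Icc (0:ℝ) 1, ∀ ρ : ℝ, 0 < ρ → x₀ ≤ x₀ + ρ * (1 - |2 * (t:ℝ) - 1|) :=
    fun t ρ hρ => by linarith [(half_polar_inv t.2 hρ).1]
  obtain ⟨P', hP'o, hP'⟩ : ∃ P' : Set (ℝ × ℝ), IsOpen P' ∧
      ∀ (j : Ico x₀ x₁) (Y : ℝ), (j, Y) ∈ P ↔ ((j : ℝ), Y) ∈ P' := by
    have hind : IsInducing fun z : Ico x₀ x₁ × ℝ => ((z.1 : ℝ), z.2) :=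
      IsInducing.subtypeVal.prodMap IsInducing.id
    obtain ⟨P', h1, h2⟩ := hind.isOpen_iff.1 hPo
    exact ⟨P', h1, fun j Y => by rw [← h2]; rfl⟩
  set E₂ : Set (Icc (0:ℝ) 1 × ℝ) := {z | 0 < z.2 ∧ x₀ + z.2 * (1 - |2 * (z.1:ℝ) - 1|) < x₁ ∧
    (x₀ + z.2 * (1 - |2 * (z.1:ℝ) - 1|), z.2 * (2 * (z.1 : ℝ) - 1)) ∈ P'} with hE₂
  have hE₂o : IsOpen E₂ := by
    have k1 : Continuous fun z : Icc (0:ℝ) 1 × ℝ => x₀ + z.2 * (1 - |2 * (z.1:ℝ) - 1|) := by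
      fun_prop
    have k2 : Continuous fun z : Icc (0:ℝ) 1 × ℝ => z.2 * (2 * (z.1 : ℝ) - 1) := by fun_prop
    exact (isOpen_lt continuous_const continuous_snd).inter ((isOpen_lt k1
      continuous_const).inter (hP'o.preimage (k1.prodMk k2)))
  set aD : D → Ico x₀ x₁ × ℝ := fun z =>
    h ⟨(⟨z.1.1, hDI _ (hDD z.2)⟩, z.1.2), hDD z.2⟩ with haD
  have haDc : Continuous aD := h.continuous.comp (by fun_prop)
  have haD1 : ∀ z, ((aD z).1 : ℝ) = z.1.1 := fun z => rfl
  have haDP : ∀ z, ((aD z).1, (aD z).2 - m) ∈ P := by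
    intro z
    show (((h.symm ((aD z).1, (aD z).2 - m + m)).1.1 : ℝ),
      (h.symm ((aD z).1, (aD z).2 - m + m)).1.2) ∈ D
    rw [sub_add_cancel, Prod.mk.eta, haD, h.symm_apply_apply]
    exact z.2
  have hX : ∀ z, 0 ≤ ((aD z).1 : ℝ) - x₀ := fun z => sub_nonneg.2 (aD z).1.2.1
  have hρ : ∀ z, 0 < ((aD z).1 : ℝ) - x₀ + |(aD z).2 - m| := by
    intro z
    rcases (hX z).eq_or_lt with h0 | h0
    · have hj : (aD z).1 = j₀ := Subtype.ext (by simp only [hj₀]; linarith)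
      have := haDP z
      rw [hj, hP0] at this
      obtain ⟨p, hp, he⟩ := this
      have : (aD z).2 - m ≠ 0 := by
        rw [← he]
        rcases hp with ⟨y, rfl⟩ | ⟨y, rfl⟩
        · exact (sub_neg.2 (hm y)).ne
        · exact (sub_pos.2 (hm' y)).ne'
      rw [← h0, zero_add]
      exact abs_pos.2 this
    · exact add_pos_of_pos_of_nonneg h0 (abs_nonneg _)
  set bE : E₂ → Ico x₀ x₁ × ℝ := fun z =>
    (⟨x₀ + z.1.2 * (1 - |2 * (z.1.1:ℝ) - 1|), hcap _ _ z.2.1, z.2.2.1⟩,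
      z.1.2 * (2 * (z.1.1 : ℝ) - 1) + m) with hbE
  have hbEc : Continuous bE := by fun_prop
  have hbEP : ∀ z, ((bE z).1, (bE z).2 - m) ∈ P := by
    intro z
    rw [hP', hbE]
    simp only [add_sub_cancel_right]
    exact z.2.2.2
  have hbED : ∀ z, (((h.symm (bE z)).1.1 : ℝ), (h.symm (bE z)).1.2) ∈ D := by
    intro z
    have h1 : (((h.symm ((bE z).1, (bE z).2 - m + m)).1.1 : ℝ),
      (h.symm ((bE z).1, (bE z).2 - m + m)).1.2) ∈ D := hbEP z
    rwa [sub_add_cancel, Prod.mk.eta] at h1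
  let ψ : D ≃ₜ E₂ :=
    { toFun := fun z => ⟨(⟨_, (half_polar (hX z) (hρ z)).1⟩,
          ((aD z).1 : ℝ) - x₀ + |(aD z).2 - m|), by
        obtain ⟨h1, h2, h3⟩ := half_polar (hX z) (hρ z)
        refine ⟨hρ z, ?_, ?_⟩
        · simp only [h2, add_sub_cancel]
          exact (aD z).1.2.2
        · simp only [h2, add_sub_cancel, h3]
          exact (hP' _ _).1 (haDP z)⟩
      invFun := fun z => ⟨_, hbED z⟩
      left_inv := by
        intro z
        obtain ⟨h1, h2, h3⟩ := half_polar (hX z) (hρ z)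
        have key : ∀ w : E₂, bE w = aD z →
            (((h.symm (bE w)).1.1 : ℝ), (h.symm (bE w)).1.2) = z.1 := by
          intro w hw
          rw [hw, haD, h.symm_apply_apply]
        apply Subtype.ext
        apply key
        refine Prod.ext (Subtype.ext ?_) ?_
        · simp only [hbE, h2, add_sub_cancel]
        · simp only [hbE, h3, sub_add_cancel]
      right_inv := by
        intro w
        have hab : aD ⟨_, hbED w⟩ = bE w := by
          show h _ = bE w
          rw [← Homeomorph.eq_symm_apply]
        obtain ⟨h1, h2, h3⟩ := half_polar_inv w.1.1.2 w.2.1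
        apply Subtype.ext
        refine Prod.ext (Subtype.ext ?_) ?_
        · simp only [hab]
          simp only [hbE, add_sub_cancel_left, add_sub_cancel_right]
          exact h3
        · simp only [hab]
          simp only [hbE, add_sub_cancel_left, add_sub_cancel_right]
          exact h2
      continuous_toFun := by
        refine Continuous.subtype_mk ((Continuous.subtype_mk ?_ _).prodMk (by fun_prop)) _
        refine Continuous.div_const (Continuous.add (Continuous.div (by fun_prop) (by fun_prop)
          fun z => (hρ z).ne') continuous_const) _
      continuous_invFun := by
        have : Continuous fun z => h.symm (bE z) := h.symm.continuous.comp hbEc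
        fun_prop }
  have hψ1 : ∀ z, ((ψ z).1.1 : ℝ) = (((aD z).2 - m) / (((aD z).1 : ℝ) - x₀ + |(aD z).2 - m|) + 1) / 2 :=
    fun z => rfl
  have hψ2 : ∀ z, (ψ z).1.2 = ((aD z).1 : ℝ) - x₀ + |(aD z).2 - m| := fun z => rfl
  -- the fibres of the polar region
  have hmid : ∀ t : Icc (0:ℝ) 1, 0 < (t : ℝ) → (t : ℝ) < 1 → ∀ ρ, (t, ρ) ∈ E₂ ↔
      0 < ρ ∧ x₀ + ρ * (1 - |2 * (t:ℝ) - 1|) < x₁ := by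
    intro t h0 h1 ρ
    have hk : 0 < 1 - |2 * (t:ℝ) - 1| := by
      rw [sub_pos, abs_lt]; constructor <;> linarith
    constructor
    · exact fun h => ⟨h.1, h.2.1⟩
    · rintro ⟨h2, h3⟩
      have hgt : x₀ < x₀ + ρ * (1 - |2 * (t:ℝ) - 1|) := by
        have := mul_pos h2 hk
        linarith
      exact ⟨h2, h3, (hP' ⟨_, hgt.le, h3⟩ _).1 (hPgt _ _ hgt)⟩
  have hend0 : ∀ t : Icc (0:ℝ) 1, (t : ℝ) = 0 → ∀ ρ, (t, ρ) ∈ E₂ ↔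
      ∃ y, m - f (j₀, σ y) = ρ := by
    intro t ht ρ
    have e : ∀ ρ, x₀ + ρ * (1 - |2 * (t:ℝ) - 1|) = x₀ := fun ρ => by rw [ht]; norm_num
    show (0 < ρ ∧ x₀ + ρ * (1 - |2 * (t:ℝ) - 1|) < x₁ ∧
      (x₀ + ρ * (1 - |2 * (t:ℝ) - 1|), ρ * (2 * (t : ℝ) - 1)) ∈ P') ↔ _
    rw [e, ht, show (x₀, ρ * _) = ((j₀ : ℝ), _) from rfl, ← hP' j₀, hP0]
    constructor
    · rintro ⟨h1, -, p, ⟨y, rfl⟩ | ⟨y, rfl⟩, hp⟩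
      · exact ⟨y, by linarith⟩
      · linarith [hm' y]
    · rintro ⟨y, rfl⟩
      exact ⟨by linarith [hm y], h01, σ y, Or.inl ⟨y, rfl⟩, by ring⟩
  have hend1 : ∀ t : Icc (0:ℝ) 1, (t : ℝ) = 1 → ∀ ρ, (t, ρ) ∈ E₂ ↔
      ∃ y, f (j₀, σ' y) - m = ρ := by
    intro t ht ρ
    have e : ∀ ρ, x₀ + ρ * (1 - |2 * (t:ℝ) - 1|) = x₀ := fun ρ => by rw [ht]; norm_num
    show (0 < ρ ∧ x₀ + ρ * (1 - |2 * (t:ℝ) - 1|) < x₁ ∧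
      (x₀ + ρ * (1 - |2 * (t:ℝ) - 1|), ρ * (2 * (t : ℝ) - 1)) ∈ P') ↔ _
    rw [e, ht, show (x₀, ρ * _) = ((j₀ : ℝ), _) from rfl, ← hP' j₀, hP0]
    constructor
    · rintro ⟨h1, -, p, ⟨y, rfl⟩ | ⟨y, rfl⟩, hp⟩
      · linarith [hm y]
      · exact ⟨y, by linarith⟩
    · rintro ⟨y, rfl⟩
      exact ⟨by linarith [hm' y], h01, σ' y, Or.inr ⟨y, rfl⟩, by ring⟩
  have hord_img : ∀ τ : ℝ → ℝ, (∀ y, τ y ∈ K) → OrdConnected (range τ) →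
      ∀ y₁ y₂ r, f (j₀, τ y₁) ≤ r → r ≤ f (j₀, τ y₂) → ∃ y, f (j₀, τ y) = r := by
    intro τ hτ hc y₁ y₂ r h1 h2
    obtain ⟨p, hp, rfl⟩ := hsurj j₀ r
    have hpK := (hE0 p).1 hp
    have : p ∈ range τ := by
      refine hc.out (mem_range_self y₁) (mem_range_self y₂) ⟨?_, ?_⟩
      · by_contra! hlt
        exact absurd (hf0 _ hpK _ (hτ _) hlt) (not_lt.2 h1)
      · by_contra! hlt
        exact absurd (hf0 _ (hτ _) _ hpK hlt) (not_lt.2 h2)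
    obtain ⟨y, rfl⟩ := this
    exact ⟨y, rfl⟩
  have hfib₂ : ∀ t, {ρ | (t, ρ) ∈ E₂}.OrdConnected ∧ ∃ ρ, (t, ρ) ∈ E₂ := by
    intro t
    rcases t.2.1.eq_or_lt with h0 | h0
    · refine ⟨⟨?_⟩, _, (hend0 t h0.symm _).2 ⟨0, rfl⟩⟩
      intro ρ₁ h1 ρ₂ h2 r hr
      obtain ⟨y₁, rfl⟩ := (hend0 t h0.symm _).1 h1
      obtain ⟨y₂, rfl⟩ := (hend0 t h0.symm _).1 h2
      obtain ⟨y, hy⟩ := hord_img σ hσK c₀ y₂ y₁ (m - r) (by linarith [hr.2]) (by linarith [hr.1])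
      exact (hend0 t h0.symm _).2 ⟨y, by linarith⟩
    rcases t.2.2.eq_or_lt with h1 | h1
    · refine ⟨⟨?_⟩, _, (hend1 t h1 _).2 ⟨0, rfl⟩⟩
      intro ρ₁ h1' ρ₂ h2 r hr
      obtain ⟨y₁, rfl⟩ := (hend1 t h1 _).1 h1'
      obtain ⟨y₂, rfl⟩ := (hend1 t h1 _).1 h2
      obtain ⟨y, hy⟩ := hord_img σ' hσK' c₁ y₁ y₂ (r + m) (by linarith [hr.1]) (by linarith [hr.2])
      exact (hend1 t h1 _).2 ⟨y, by linarith⟩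
    · have hk : 0 < 1 - |2 * (t:ℝ) - 1| := by
        rw [sub_pos, abs_lt]; constructor <;> linarith
      refine ⟨⟨?_⟩, (x₁ - x₀) / (1 - |2 * (t:ℝ) - 1|) / 2, (hmid t h0 h1 _).2 ⟨?_, ?_⟩⟩
      · intro ρ₁ h1' ρ₂ h2 r hr
        have h1' := (hmid t h0 h1 _).1 h1'
        have h2 := (hmid t h0 h1 _).1 h2
        refine (hmid t h0 h1 _).2 ⟨h1'.1.trans_le hr.1, ?_⟩
        have := mul_le_mul_of_nonneg_right hr.2 hk.le
        linarith [h2.2]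
      · have := sub_pos.2 h01
        positivity
      · have : (x₁ - x₀) / (1 - |2 * (t:ℝ) - 1|) / 2 * (1 - |2 * (t:ℝ) - 1|) = (x₁ - x₀) / 2 := by
          field_simp
        rw [this]; linarith
  obtain ⟨F, hF, hFm, hFs⟩ := exists_band hE₂o (fun j => (hfib₂ j).1) (fun j => (hfib₂ j).2)
  let φ : D ≃ₜ Icc (0:ℝ) 1 × ℝ := ψ.trans (fiberHomeo hE₂o hF hFm hFs)
  have hφ1 : ∀ z : D, (φ z).1 = (ψ z).1.1 := fun z => rfl
  have hφ2 : ∀ z : D, (φ z).2 = F ((ψ z).1.1, (ψ z).1.2) := fun z => rfl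
  have hw0 : ∀ y, (x₀, σ y) ∈ D := fun y => Or.inr (Or.inl ⟨rfl, Or.inl (mem_range_self y)⟩)
  have hw1 : ∀ y, (x₀, σ' y) ∈ D := fun y => Or.inr (Or.inl ⟨rfl, Or.inr (mem_range_self y)⟩)
  have ha0 : ∀ y, aD ⟨_, hw0 y⟩ = (j₀, f (j₀, σ y)) := fun y => rfl
  have ha1 : ∀ y, aD ⟨_, hw1 y⟩ = (j₀, f (j₀, σ' y)) := fun y => rfl
  have hp0 : ∀ y, (ψ ⟨_, hw0 y⟩).1.1 = ⟨0, by simp⟩ ∧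
      (ψ ⟨_, hw0 y⟩).1.2 = m - f (j₀, σ y) := by
    intro y
    have hlt := hm y
    have e : |f (j₀, σ y) - m| = m - f (j₀, σ y) := by
      rw [abs_of_neg (by linarith)]; ring
    refine ⟨Subtype.ext ?_, ?_⟩
    · rw [hψ1, ha0]
      have : m - f (j₀, σ y) ≠ 0 := by linarith
      simp only [hj₀, sub_self, zero_add]
      rw [show (⟨x₀, le_rfl, h01⟩ : Ico x₀ x₁) = j₀ from rfl, e]
      field_simp
      ring
    · rw [hψ2, ha0]
      simp [hj₀]
      rw [← e]
  have hp1 : ∀ y, (ψ ⟨_, hw1 y⟩).1.1 = ⟨1, by simp⟩ ∧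
      (ψ ⟨_, hw1 y⟩).1.2 = f (j₀, σ' y) - m := by
    intro y
    have hlt := hm' y
    have e : |f (j₀, σ' y) - m| = f (j₀, σ' y) - m := abs_of_pos (by linarith)
    refine ⟨Subtype.ext ?_, ?_⟩
    · rw [hψ1, ha1]
      have : f (j₀, σ' y) - m ≠ 0 := by linarith
      simp only [hj₀, sub_self, zero_add]
      rw [show (⟨x₀, le_rfl, h01⟩ : Ico x₀ x₁) = j₀ from rfl, e]
      field_simp
      ring
    · rw [hψ2, ha1]
      simp [hj₀]
      exact hlt.le
  obtain ⟨b⟩ : Nonempty (Box D (fun y => (x₀, σ (-y))) (fun y => (x₀, σ' y)) 1) := by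
    refine Box.nonempty_of_homeo (by norm_num) φ (fun y => hw0 (-y)) hw1 ?_ ?_ ?_ ?_ ?_ ?_
    · intro y; rw [hφ1, (hp0 _).1]
    · intro y; rw [hφ1, (hp1 _).1]
    · intro c hc
      rw [hφ1] at hc
      obtain ⟨y, hy⟩ := (hend0 _ hc _).1 (ψ c).2
      refine ⟨-y, ?_⟩
      have : ψ ⟨_, hw0 y⟩ = ψ c :=
        Subtype.ext (Prod.ext ((hp0 y).1.trans (Subtype.ext hc.symm)) ((hp0 y).2.trans hy))
      simp only [neg_neg]
      exact congrArg Subtype.val (ψ.injective this)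
    · intro c hc
      rw [hφ1] at hc
      obtain ⟨y, hy⟩ := (hend1 _ hc _).1 (ψ c).2
      refine ⟨y, ?_⟩
      have : ψ ⟨_, hw1 y⟩ = ψ c :=
        Subtype.ext (Prod.ext ((hp1 y).1.trans (Subtype.ext hc.symm)) ((hp1 y).2.trans hy))
      exact congrArg Subtype.val (ψ.injective this)
    · intro y y' hy
      have e1 : (⟨0, by simp⟩, (ψ ⟨_, hw0 (-y)⟩).1.2) ∈ E₂ := (hp0 (-y)).1 ▸ (ψ ⟨_, hw0 (-y)⟩).2
      have e2 : (⟨0, by simp⟩, (ψ ⟨_, hw0 (-y')⟩).1.2) ∈ E₂ :=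
        (hp0 (-y')).1 ▸ (ψ ⟨_, hw0 (-y')⟩).2
      simp only [hφ2, (hp0 _).1]
      refine hFm _ e1 e2 ?_
      rw [(hp0 _).2, (hp0 _).2]
      have := hf0 _ (hσK _) _ (hσK _) (m₀ (neg_lt_neg hy))
      linarith
    · intro y y' hy
      simp only [one_mul]
      have e1 : (⟨1, by simp⟩, (ψ ⟨_, hw1 y⟩).1.2) ∈ E₂ := (hp1 y).1 ▸ (ψ ⟨_, hw1 y⟩).2
      have e2 : (⟨1, by simp⟩, (ψ ⟨_, hw1 y'⟩).1.2) ∈ E₂ := (hp1 y').1 ▸ (ψ ⟨_, hw1 y'⟩).2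
      simp only [hφ2, (hp1 _).1]
      refine hFm _ e1 e2 ?_
      rw [(hp1 _).2, (hp1 _).2]
      have := hf0 _ (hσK' _) _ (hσK' _) (m₁ hy)
      linarith
  exact ⟨(Box.flip (w₁ := fun y => (x₀, σ y)) b.symm).symm⟩

theorem forall_lt_of_disjoint {σ σ' : ℝ → ℝ} (c₀ : OrdConnected (range σ))
    (c₁ : OrdConnected (range σ')) (hd : ∀ y y', σ y ≠ σ' y') (h : σ 0 < σ' 0) (y y' : ℝ) :
    σ y < σ' y' := by
  by_contra! h'
  rcases le_or_gt (σ' y') (σ 0) with h1 | h1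
  · obtain ⟨u, hu⟩ := c₁.out (mem_range_self y') (mem_range_self 0) ⟨h1, h.le⟩
    exact hd _ _ hu.symm
  · obtain ⟨u, hu⟩ := c₀.out (mem_range_self 0) (mem_range_self y) ⟨h1.le, h'⟩
    exact hd _ _ hu

theorem fold_box {x₀ x₁ : ℝ} (h01 : x₀ < x₁) {R : Set (ℝ × ℝ)} (hR : IsOpen R)
    {σ σ' : ℝ → ℝ} (m₀ : StrictMono σ) (m₁ : StrictMono σ') (o₀ : IsOpen (range σ))
    (o₁ : IsOpen (range σ')) (c₀ : OrdConnected (range σ)) (c₁ : OrdConnected (range σ'))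
    (h₀ : ∀ y, (x₀, σ y) ∈ R) (h₁ : ∀ y, (x₀, σ' y) ∈ R) (hd : ∀ y y', σ y ≠ σ' y')
    (hord : ∀ x ∈ Ico x₀ x₁, OrdConnected {p | (x, p) ∈ R})
    (hne : ∀ x ∈ Ioo x₀ x₁, ∃ p, (x, p) ∈ R) :
    Nonempty (Box (bandSet x₀ x₁ R (range σ ∪ range σ') ∅) (fun y => (x₀, σ y))
      (fun y => (x₀, σ' y)) (-1)) := by
  rcases (hd 0 0).lt_or_gt with h | h
  · exact fold_box_lt h01 hR m₀ m₁ o₀ o₁ c₀ c₁ h₀ h₁ (forall_lt_of_disjoint c₀ c₁ hd h) hord hne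
  · obtain ⟨b⟩ := fold_box_lt h01 hR m₁ m₀ o₁ o₀ c₁ c₀ h₁ h₀
      (forall_lt_of_disjoint c₁ c₀ (fun y y' => (hd y' y).symm) h) hord hne
    rw [union_comm]
    exact ⟨b.symm⟩

theorem fold_box_right {x₀ x₁ : ℝ} (h01 : x₀ < x₁) {R : Set (ℝ × ℝ)} (hR : IsOpen R)
    {σ σ' : ℝ → ℝ} (m₀ : StrictMono σ) (m₁ : StrictMono σ') (o₀ : IsOpen (range σ))
    (o₁ : IsOpen (range σ')) (c₀ : OrdConnected (range σ)) (c₁ : OrdConnected (range σ'))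
    (h₀ : ∀ y, (x₁, σ y) ∈ R) (h₁ : ∀ y, (x₁, σ' y) ∈ R) (hd : ∀ y y', σ y ≠ σ' y')
    (hord : ∀ x ∈ Ioc x₀ x₁, OrdConnected {p | (x, p) ∈ R})
    (hne : ∀ x ∈ Ioo x₀ x₁, ∃ p, (x, p) ∈ R) :
    Nonempty (Box (bandSet x₀ x₁ R ∅ (range σ ∪ range σ')) (fun y => (x₁, σ y))
      (fun y => (x₁, σ' y)) (-1)) := by
  have hm : Continuous fun z : ℝ × ℝ => (-z.1, z.2) := by fun_prop
  let μ : (ℝ × ℝ) ≃ₜ (ℝ × ℝ) :=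
    { toFun := fun z => (-z.1, z.2)
      invFun := fun z => (-z.1, z.2)
      left_inv := fun z => by simp
      right_inv := fun z => by simp
      continuous_toFun := hm
      continuous_invFun := hm }
  obtain ⟨b⟩ := fold_box (neg_lt_neg h01) (hR.preimage hm) m₀ m₁ o₀ o₁ c₀ c₁ (x₀ := -x₁) (x₁ := -x₀)
    (fun y => by simpa using h₀ y) (fun y => by simpa using h₁ y) hd
    (fun x hx => hord (-x) ⟨by linarith [hx.2], by linarith [hx.1]⟩)
    (fun x hx => hne (-x) ⟨by linarith [hx.2], by linarith [hx.1]⟩)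
  obtain ⟨b'⟩ := b.nonempty_map μ.continuous μ.isOpenMap isOpen_univ μ.injective.injOn
    (subset_univ _)
  have e : μ '' bandSet (-x₁) (-x₀) ((fun z : ℝ × ℝ => (-z.1, z.2)) ⁻¹' R)
      (range σ ∪ range σ') ∅ = bandSet x₀ x₁ R ∅ (range σ ∪ range σ') := by
    ext ⟨x, p⟩
    rw [← μ.coe_toEquiv, Equiv.image_eq_preimage_symm]
    show (-x, p) ∈ bandSet _ _ _ _ _ ↔ _
    simp only [bandSet, mem_ofPred_eq, mem_preimage, neg_neg, neg_lt_neg_iff, neg_inj,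
      mem_empty_iff_false, and_false, false_or, or_false]
    rw [← and_assoc, and_comm (a := x < x₁), and_assoc]
  rw [e] at b'
  have e' : ∀ τ : ℝ → ℝ, (fun y => μ (-x₁, τ y)) = fun y => (x₁, τ y) := by
    intro τ
    funext y
    show ((- -x₁, τ y) : ℝ × ℝ) = _
    rw [neg_neg]
  rw [e', e'] at b'
  exact ⟨b'⟩

/-- The numbers above the first `m` and below the remaining of the numbers `f 0, …, f (M - 1)`. -/
def gap (M : ℕ) (f : ℕ → ℝ) (m : ℕ) : Set ℝ :=
  {p | (∀ k < m, f k < p) ∧ ∀ k, m ≤ k → k < M → p < f k}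

theorem isOpen_gap_comp {X : Type*} [TopologicalSpace X] {M m : ℕ} {G : ℕ → X → ℝ} {u : X → ℝ}
    (hG : ∀ k, Continuous (G k)) (hu : Continuous u) :
    IsOpen {z | u z ∈ gap M (fun k => G k z) m} := by
  have : {z | u z ∈ gap M (fun k => G k z) m} =
      (⋂ k ∈ Finset.range m, {z | G k z < u z}) ∩
        ⋂ k ∈ Finset.Ico m M, {z | u z < G k z} := by
    ext z
    simp [gap]
  rw [this]
  exact (isOpen_biInter_finset fun k _ => isOpen_lt (hG k) hu).inter
    (isOpen_biInter_finset fun k _ => isOpen_lt hu (hG k))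

theorem isOpen_gap {M m : ℕ} {f : ℕ → ℝ} : IsOpen (gap M f m) :=
  isOpen_gap_comp (G := fun k _ => f k) (fun _ => continuous_const) continuous_id

theorem gap_ordConnected {M m : ℕ} {f : ℕ → ℝ} : OrdConnected (gap M f m) :=
  ⟨fun _ hp _ hq _ hr => ⟨fun k hk => (hp.1 k hk).trans_le hr.1,
    fun k hk hk' => hr.2.trans_lt (hq.2 k hk hk')⟩⟩

theorem gap_lt_iff {M m k : ℕ} {f : ℕ → ℝ} {p : ℝ} (hp : p ∈ gap M f m) (hk : k < M) :
    f k < p ↔ k < m := by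
  constructor
  · intro h
    by_contra! hm
    exact absurd (hp.2 k hm hk) h.not_gt
  · exact fun h => hp.1 k h

theorem gap_ne {M m k : ℕ} {f : ℕ → ℝ} {p : ℝ} (hp : p ∈ gap M f m) (hk : k < M) : p ≠ f k := by
  rcases lt_or_ge k m with h | h
  · exact (hp.1 k h).ne'
  · exact (hp.2 k h hk).ne

theorem gap_disjoint {M m m' : ℕ} {f : ℕ → ℝ} {p : ℝ} (hp : p ∈ gap M f m) (hp' : p ∈ gap M f m')
    (hm : m ≤ M) (hm' : m' ≤ M) : m = m' := by
  by_contra hne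
  rcases lt_or_gt_of_ne hne with h | h
  · exact absurd ((gap_lt_iff hp (h.trans_le hm')).1 ((gap_lt_iff hp' (h.trans_le hm')).2 h))
      (lt_irrefl _)
  · exact absurd ((gap_lt_iff hp' (h.trans_le hm)).1 ((gap_lt_iff hp (h.trans_le hm)).2 h))
      (lt_irrefl _)

theorem exists_gap {M : ℕ} {f : ℕ → ℝ} (hf : ∀ k k', k < k' → k' < M → f k ≤ f k') {p : ℝ}
    (hp : ∀ k < M, p ≠ f k) : ∃ m ≤ M, p ∈ gap M f m := by
  classical
  have hex : ∃ m, M ≤ m ∨ p < f m := ⟨M, Or.inl le_rfl⟩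
  refine ⟨Nat.find hex, Nat.find_min' hex (Or.inl le_rfl), fun k hk => ?_, fun k hk hk' => ?_⟩
  · have := Nat.find_min hex hk
    push Not at this
    exact lt_of_le_of_ne this.2 (hp k this.1).symm
  · rcases Nat.find_spec hex with h | h
    · omega
    · rcases hk.eq_or_lt with e | e
      · rwa [← e]
      · exact h.trans_le (hf _ _ e hk')

theorem gap_nonempty {M m : ℕ} {f : ℕ → ℝ} (hf : ∀ k k', k < k' → k' < M → f k < f k')
    (hm : m ≤ M) : (gap M f m).Nonempty := by
  have hle : ∀ k k', k ≤ k' → k' < M → f k ≤ f k' := fun k k' h h' => by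
    rcases h.eq_or_lt with rfl | h
    · exact le_rfl
    · exact (hf k k' h h').le
  rcases Nat.eq_zero_or_pos m with rfl | h0
  · refine ⟨f 0 - 1, fun k hk => absurd hk (by omega), fun k _ hk => ?_⟩
    linarith [hle 0 k (by omega) hk]
  rcases hm.eq_or_lt with rfl | h1
  · refine ⟨f (m - 1) + 1, fun k hk => ?_, fun k hk hk' => absurd hk (by omega)⟩
    linarith [hle k (m - 1) (by omega) (by omega)]
  · have := hf (m - 1) m (by omega) h1
    refine ⟨(f (m - 1) + f m) / 2, fun k hk => ?_, fun k hk hk' => ?_⟩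
    · linarith [hle k (m - 1) (by omega) (by omega)]
    · linarith [hle m k hk hk']

theorem gap_subset {N l : ℕ} {f : ℕ → ℝ} {K : Set ℝ} (hK : OrdConnected K)
    (hne : ∀ p ∈ K, ∀ k < N, p ≠ f k) {p : ℝ} (hp : p ∈ K) (hpl : p ∈ gap N f l) (hl : l ≤ N) :
    K ⊆ gap N f l := by
  intro q hq
  refine ⟨fun k hk => ?_, fun k hk hk' => ?_⟩
  · by_contra! h
    exact hne _ (hK.out hq hp ⟨h, (hpl.1 k hk).le⟩) k (by omega) rfl
  · by_contra! h
    exact hne _ (hK.out hp hq ⟨(hpl.2 k hk hk').le, h⟩) k hk' rfl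

theorem exists_param {a c b : ℝ} (hac : a < c) (hcb : c < b) :
    ∃ u : ℝ → ℝ, IsOpenEmbedding u ∧ StrictMono u ∧ range u = Ioo a b ∧ u 0 = c := by
  have hd : 0 < b - a := by linarith
  have hpi := pi_pos
  set s : ℝ → ℝ := fun x => tan (π * ((x - a) / (b - a)) - π / 2) with hs
  set u : ℝ → ℝ := fun t => a + (b - a) * ((arctan (t + s c) + π / 2) / π) with hu
  have hm : StrictMono u := by
    intro t t' h
    have := arctan_strictMono (add_lt_add_left h (s c))
    simp only [hu]
    gcongr
  have hc : Continuous u := by fun_prop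
  have hsu : ∀ x ∈ Ioo a b, u (s x - s c) = x := by
    intro x hx
    have h1 : 0 < (x - a) / (b - a) := div_pos (by linarith [hx.1]) hd
    have h2 : (x - a) / (b - a) < 1 := (div_lt_one hd).2 (by linarith [hx.2])
    have h3 : 0 < π * ((x - a) / (b - a)) := mul_pos hpi h1
    have h4 : π * ((x - a) / (b - a)) < π := by
      have := mul_lt_mul_of_pos_left h2 hpi
      linarith
    simp only [hu, sub_add_cancel]
    simp only [hs]
    rw [arctan_tan (by linarith) (by linarith)]
    field_simp
    ring
  have hr : range u = Ioo a b := by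
    ext x
    constructor
    · rintro ⟨t, rfl⟩
      have h1 : 0 < (arctan (t + s c) + π / 2) / π :=
        div_pos (by linarith [neg_pi_div_two_lt_arctan (t + s c)]) hpi
      have h2 : (arctan (t + s c) + π / 2) / π < 1 :=
        (div_lt_one hpi).2 (by linarith [arctan_lt_pi_div_two (t + s c)])
      have h3 := mul_pos hd h1
      have h4 := mul_lt_mul_of_pos_left h2 hd
      simp only [hu]
      constructor <;> linarith
    · exact fun hx => ⟨_, hsu x hx⟩
  refine ⟨u, ⟨hm.isEmbedding_of_ordConnected (hr ▸ ordConnected_Ioo), hr ▸ isOpen_Ioo⟩, hm, hr, ?_⟩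
  have := hsu c ⟨hac, hcb⟩
  rwa [sub_self] at this

/-- A chart around a vertical wall between two bands. -/
theorem exists_wall_chart {x₀ c x₁ : ℝ} (h0 : x₀ < c) (h1 : c < x₁) {A B : Set (ℝ × ℝ)} {K : Set ℝ}
    (hA : IsOpen A) (hB : IsOpen B) (hK : IsOpen K) (hKA : ∀ p ∈ K, (c, p) ∈ A)
    (hKB : ∀ p ∈ K, (c, p) ∈ B) (oA : ∀ x ∈ Ioo x₀ c, OrdConnected {p | (x, p) ∈ A})
    (oB : ∀ x ∈ Ioo c x₁, OrdConnected {p | (x, p) ∈ B}) (oK : OrdConnected K)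
    (nA : ∀ x ∈ Ioo x₀ c, ∃ p, (x, p) ∈ A) (nB : ∀ x ∈ Ioo c x₁, ∃ p, (x, p) ∈ B)
    (nK : K.Nonempty) :
    ∃ (χ : ℝ × ℝ → ℝ × ℝ) (σ : ℝ → ℝ), IsOpenEmbedding χ ∧
      χ '' {z | z.1 < 0} = {z | z.1 ∈ Ioo x₀ c ∧ z ∈ A} ∧
      χ '' {z | z.1 = 0} = {z | z.1 = c ∧ z.2 ∈ K} ∧
      χ '' {z | 0 < z.1} = {z | z.1 ∈ Ioo c x₁ ∧ z ∈ B} ∧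
      StrictMono σ ∧ range σ = K ∧ ∀ y, χ (0, y) = (c, σ y) := by
  obtain ⟨u, hu, hum, hur, hu0⟩ := exists_param h0 h1
  set T : Set (ℝ × ℝ) := {z | z.1 ∈ Ioo x₀ x₁ ∧ ((z.1 < c ∧ z ∈ A) ∨ (z.1 = c ∧ z.2 ∈ K) ∨
    (c < z.1 ∧ z ∈ B))} with hT
  have hTo : IsOpen T := by
    have : T = {z | z.1 ∈ Ioo x₀ x₁} ∩ ((({z | z.1 < c} ∩ A) ∪ (A ∩ B ∩ {z | z.2 ∈ K})) ∪
        ({z | c < z.1} ∩ B)) := by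
      ext ⟨x, p⟩
      simp only [hT, mem_ofPred_eq, mem_inter_iff, mem_union]
      refine and_congr_right fun hx => ?_
      rcases lt_trichotomy x c with h | rfl | h
      · simp [h, h.not_gt, h.ne]; tauto
      · have := hKA p; have := hKB p; simp; tauto
      · simp [h, h.not_gt, h.ne']; tauto
    rw [this]
    have c1 : Continuous (Prod.fst : ℝ × ℝ → ℝ) := continuous_fst
    refine (isOpen_Ioo.preimage c1).inter ((((isOpen_lt c1 continuous_const).inter hA).union
      ((hA.inter hB).inter (hK.preimage continuous_snd))).union
      ((isOpen_lt continuous_const c1).inter hB))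
  set ι : ℝ × ℝ → ℝ × ℝ := fun z => (u z.1, z.2) with hι
  have hιe : IsOpenEmbedding ι := hu.prodMap IsOpenEmbedding.id
  set E : Set (ℝ × ℝ) := ι ⁻¹' T with hE
  have hEo : IsOpen E := hTo.preimage hιe.continuous
  have huI : ∀ t, u t ∈ Ioo x₀ x₁ := fun t => hur ▸ mem_range_self t
  have hult : ∀ t, u t < c ↔ t < 0 := fun t => by rw [← hu0, hum.lt_iff_lt]
  have hugt : ∀ t, c < u t ↔ 0 < t := fun t => by rw [← hu0, hum.lt_iff_lt]
  have hueq : ∀ t, u t = c ↔ t = 0 := fun t => by rw [← hu0, hum.injective.eq_iff]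
  have hmemE : ∀ t p, (t, p) ∈ E ↔ ((t < 0 ∧ (u t, p) ∈ A) ∨ (t = 0 ∧ p ∈ K) ∨
      (0 < t ∧ (u t, p) ∈ B)) := by
    intro t p
    simp only [hE, hT, hι, mem_preimage, mem_ofPred_eq, hult, hugt, hueq]
    exact and_iff_right (huI t)
  have hfib : ∀ t, {p | (t, p) ∈ E}.OrdConnected ∧ ∃ p, (t, p) ∈ E := by
    intro t
    rcases lt_trichotomy t 0 with h | h | h
    · have e : {p | (t, p) ∈ E} = {p | (u t, p) ∈ A} := by
        ext p; simp [hmemE, h, h.not_gt, h.ne]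
      have hI : u t ∈ Ioo x₀ c := ⟨(huI t).1, (hult t).2 h⟩
      obtain ⟨p, hp⟩ := nA _ hI
      exact ⟨e ▸ oA _ hI, p, (hmemE t p).2 (Or.inl ⟨h, hp⟩)⟩
    · have e : {p | (t, p) ∈ E} = K := by
        ext p; simp [hmemE, h]
      obtain ⟨p, hp⟩ := nK
      exact ⟨e ▸ oK, p, (hmemE t p).2 (Or.inr (Or.inl ⟨h, hp⟩))⟩
    · have e : {p | (t, p) ∈ E} = {p | (u t, p) ∈ B} := by
        ext p; simp [hmemE, h, h.not_gt, h.ne']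
      have hI : u t ∈ Ioo c x₁ := ⟨(hugt t).2 h, (huI t).2⟩
      obtain ⟨p, hp⟩ := nB _ hI
      exact ⟨e ▸ oB _ hI, p, (hmemE t p).2 (Or.inr (Or.inr ⟨h, hp⟩))⟩
  obtain ⟨f, hf, hmono, hsurj⟩ := exists_band hEo (fun j => (hfib j).1) (fun j => (hfib j).2)
  set h := fiberHomeo hEo hf hmono hsurj with hh
  have hs1 : ∀ z, (h.symm z).1.1 = z.1 := fun z => by
    have := congrArg Prod.fst (h.apply_symm_apply z)
    exact this
  have hs2 : ∀ z, f (h.symm z).1 = z.2 := fun z => by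
    have := congrArg Prod.snd (h.apply_symm_apply z)
    exact this
  set χ : ℝ × ℝ → ℝ × ℝ := fun z => ι (h.symm z).1 with hχ
  have hχ1 : ∀ z, (χ z).1 = u z.1 := fun z => by simp only [hχ, hι, hs1]
  have hχT : ∀ z, χ z ∈ T := fun z => (h.symm z).2
  have hχs : ∀ z ∈ T, ∃ y, χ y = z ∧ u y.1 = z.1 := by
    rintro ⟨x, p⟩ hz
    obtain ⟨t, rfl⟩ : x ∈ range u := hur ▸ hz.1
    refine ⟨h ⟨(t, p), hz⟩, ?_, rfl⟩
    simp only [hχ, h.symm_apply_apply, hι]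
  have hzero : ∀ y, h.symm (0, y) = ⟨(0, (h.symm (0, y)).1.2), by
      have := (h.symm (0, y)).2
      rwa [show (h.symm (0, y)).1 = (0, (h.symm (0, y)).1.2) from Prod.ext (hs1 _) rfl] at this⟩ :=
    fun y => Subtype.ext (Prod.ext (hs1 _) rfl)
  refine ⟨χ, fun y => (h.symm (0, y)).1.2,
    hιe.comp (hEo.isOpenEmbedding_subtypeVal.comp h.symm.isOpenEmbedding), ?_, ?_, ?_, ?_, ?_, ?_⟩
  · ext z
    constructor
    · rintro ⟨y, hy, rfl⟩
      have h3 : (χ y).1 < c := by rw [hχ1, hult]; exact hy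
      obtain ⟨h2, ⟨-, h4⟩ | ⟨h4, -⟩ | ⟨h4, -⟩⟩ := hχT y
      · exact ⟨⟨h2.1, h3⟩, h4⟩
      · exact absurd h4 h3.ne
      · exact absurd h4 h3.not_gt
    · rintro ⟨hz, hzA⟩
      obtain ⟨y, rfl, hy⟩ := hχs z ⟨⟨hz.1, hz.2.trans h1⟩, Or.inl ⟨hz.2, hzA⟩⟩
      refine ⟨y, (hult _).1 (hy ▸ hz.2), rfl⟩
  · ext z
    constructor
    · rintro ⟨y, hy, rfl⟩
      have h3 : (χ y).1 = c := by rw [hχ1, hueq]; exact hy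
      obtain ⟨h2, ⟨h4, -⟩ | ⟨-, h4⟩ | ⟨h4, -⟩⟩ := hχT y
      · exact absurd h3 h4.ne
      · exact ⟨h3, h4⟩
      · exact absurd h3 h4.ne'
    · rintro ⟨hz, hzK⟩
      obtain ⟨y, rfl, hy⟩ := hχs z ⟨by rw [hz]; exact ⟨h0, h1⟩, Or.inr (Or.inl ⟨hz, hzK⟩)⟩
      refine ⟨y, (hueq _).1 (hy.trans hz), rfl⟩
  · ext z
    constructor
    · rintro ⟨y, hy, rfl⟩
      have h3 : c < (χ y).1 := by rw [hχ1, hugt]; exact hy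
      obtain ⟨h2, ⟨h4, -⟩ | ⟨h4, -⟩ | ⟨-, h4⟩⟩ := hχT y
      · exact absurd h4 h3.not_gt
      · exact absurd h4 h3.ne'
      · exact ⟨⟨h3, h2.2⟩, h4⟩
    · rintro ⟨hz, hzA⟩
      obtain ⟨y, rfl, hy⟩ := hχs z ⟨⟨h0.trans hz.1, hz.2⟩, Or.inr (Or.inr ⟨hz.1, hzA⟩)⟩
      refine ⟨y, (hugt _).1 (hy ▸ hz.1), rfl⟩
  · intro y y' hy
    have e1 := hs2 (0, y)
    have e2 := hs2 (0, y')
    rw [hzero y] at e1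
    rw [hzero y'] at e2
    refine ((hmono 0).lt_iff_lt ?_ ?_).1 ?_
    · exact (hzero y ▸ (h.symm (0, y)).2 : _)
    · exact (hzero y' ▸ (h.symm (0, y')).2 : _)
    · simp only at e1 e2 ⊢
      rw [e1, e2]; exact hy
  · ext p
    constructor
    · rintro ⟨y, rfl⟩
      have := (h.symm (0, y)).2
      rw [hzero y] at this
      rcases (hmemE _ _).1 this with h' | h' | h'
      · exact absurd h'.1 (lt_irrefl _)
      · exact h'.2
      · exact absurd h'.1 (lt_irrefl _)
    · intro hp
      have hpE : (0, p) ∈ E := (hmemE _ _).2 (Or.inr (Or.inl ⟨rfl, hp⟩))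
      refine ⟨f (0, p), ?_⟩
      have : h.symm (0, f (0, p)) = ⟨(0, p), hpE⟩ := by rw [Homeomorph.symm_apply_eq]; rfl
      simp only [this]
  · intro y
    refine Prod.ext ?_ rfl
    rw [hχ1, hu0]

section

/-- A description of a subset of `X₂` by finitely many ordered strands over consecutive intervals
of directions. -/
structure Front (α : Set X₂sp) (v : ℕ) where
  n : ℕ
  two_le : 2 ≤ n
  θ : ℕ → ℝ
  θ_zero : θ 0 = 0
  θ_last : θ n = π
  θ_lt : ∀ i < n, θ i < θ (i + 1)
  N : ℕ → ℕ
  M : ℕ → ℕ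
  g : ℕ → ℕ → ℝ → ℝ
  f : ℕ → ℕ → ℝ
  g_cont : ∀ i k, Continuous (g i k)
  g_lt : ∀ i < n, ∀ x ∈ Ioo (θ i) (θ (i + 1)), ∀ k k', k < k' → k' < N i → g i k x < g i k' x
  f_lt : ∀ i < n, ∀ k k', k < k' → k' < M i → f i k < f i k'
  mem_g : ∀ i < n, ∀ x ∈ Ioo (θ i) (θ (i + 1)), ∀ p, Q (x, p) ∈ α ↔ ∃ k < N i, g i k x = p
  mem_f : ∀ i < n, ∀ p, Q (θ i, p) ∈ α ↔ ∃ k < M i, f i k = p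
  g_left : ∀ i < n, ∀ k < N i, Q (θ i, g i k (θ i)) ∈ α
  g_right : ∀ i < n, ∀ k < N i, Q (θ (i + 1), g i k (θ (i + 1))) ∈ α
  H : ℝ → ℝ
  H_cont : Continuous H
  H_per : ∀ x, H (x + 2 * π) = H x
  le_H : ∀ x p, Q (x, p) ∈ α → p ≤ H x
  H_mem : ∀ x, Q (x, H x) ∈ α
  conn : ∀ P : ℕ → ℝ → ZMod 2, (∀ q, P n q = P 0 (-q)) →
    (∀ i < n, ∀ k < N i, P i (g i k (θ i)) = P (i + 1) (g i k (θ (i + 1)))) →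
    ∃ c, ∀ i < n, ∀ k < M i, P i (f i k) = c
  total : ∑ i ∈ Finset.range n, N i = ∑ i ∈ Finset.range n, M i + v

namespace Front

variable {α : Set X₂sp} {v : ℕ} (F : Front α v)

theorem θ_mono {i j : ℕ} (h : i ≤ j) (hj : j ≤ F.n) : F.θ i ≤ F.θ j := by
  induction j, h using Nat.le_induction with
  | base => exact le_rfl
  | succ j _ ih => exact (ih (by omega)).trans (F.θ_lt j (by omega)).le

theorem θ_strict {i j : ℕ} (h : i < j) (hj : j ≤ F.n) : F.θ i < F.θ j :=
  (F.θ_lt i (by omega)).trans_le (F.θ_mono h hj)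

theorem θ_nonneg {i : ℕ} (h : i ≤ F.n) : 0 ≤ F.θ i := F.θ_zero ▸ F.θ_mono (Nat.zero_le i) h

theorem θ_le {i : ℕ} (h : i ≤ F.n) : F.θ i ≤ π := F.θ_last ▸ F.θ_mono h le_rfl

theorem θ_lt_pi {i : ℕ} (h : i < F.n) : F.θ i < π := F.θ_last ▸ F.θ_strict h le_rfl

theorem g_le {i : ℕ} (hi : i < F.n) {x : ℝ} (hx : x ∈ Icc (F.θ i) (F.θ (i + 1))) {k k' : ℕ}
    (h : k < k') (hk : k' < F.N i) : F.g i k x ≤ F.g i k' x := by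
  rw [← closure_Ioo (F.θ_lt i hi).ne] at hx
  exact closure_minimal (fun y hy => (F.g_lt i hi y hy k k' h hk).le)
    (isClosed_le (F.g_cont i k) (F.g_cont i k')) hx

/-- The predecessor of an interval. -/
def prev (i : ℕ) : ℕ := if i = 0 then F.n - 1 else i - 1

theorem prev_lt {i : ℕ} (hi : i < F.n) : F.prev i < F.n := by
  have := F.two_le
  unfold prev
  split_ifs <;> omega

/-- A strip, in the plane covering `X₂`. -/
def strip (i l : ℕ) : Set (ℝ × ℝ) :=
  {z | z.1 ∈ Ioo (F.θ i) (F.θ (i + 1)) ∧ z.2 ∈ gap (F.N i) (fun k => F.g i k z.1) l}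

theorem isOpen_strip (i l : ℕ) : IsOpen (F.strip i l) :=
  (isOpen_Ioo.preimage continuous_fst).inter
    (isOpen_gap_comp (fun k => (F.g_cont i k).comp continuous_fst) continuous_snd)

theorem exists_strip {i : ℕ} (hi : i < F.n) {x p : ℝ} (hx : x ∈ Ioo (F.θ i) (F.θ (i + 1)))
    (hp : Q (x, p) ∉ α) : ∃ l ≤ F.N i, (x, p) ∈ F.strip i l := by
  obtain ⟨l, hl, h⟩ := exists_gap (M := F.N i) (f := fun k => F.g i k x) (p := p)
    (fun k k' h h' => (F.g_lt i hi x hx k k' h h').le)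
    (fun k hk h => hp ((F.mem_g i hi x hx p).2 ⟨k, hk, h.symm⟩))
  exact ⟨l, hl, hx, h⟩

theorem strip_notMem {i l : ℕ} (hi : i < F.n) {z : ℝ × ℝ} (hz : z ∈ F.strip i l) : Q z ∉ α := by
  intro h
  obtain ⟨k, hk, h⟩ := (F.mem_g i hi z.1 hz.1 z.2).1 h
  exact gap_ne hz.2 hk h.symm

theorem wall_notMem {i m : ℕ} (hi : i < F.n) {p : ℝ} (hp : p ∈ gap (F.M i) (F.f i) m) :
    Q (F.θ i, p) ∉ α := by
  intro h
  obtain ⟨k, hk, h⟩ := (F.mem_f i hi p).1 h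
  exact gap_ne hp hk h.symm

theorem exists_right {i m : ℕ} (hi : i < F.n) (hm : m ≤ F.M i) :
    ∃ l ≤ F.N i, gap (F.M i) (F.f i) m ⊆ gap (F.N i) (fun k => F.g i k (F.θ i)) l := by
  obtain ⟨p, hp⟩ := gap_nonempty (F.f_lt i hi) hm
  have hne : ∀ p ∈ gap (F.M i) (F.f i) m, ∀ k < F.N i, p ≠ F.g i k (F.θ i) := fun p hp k hk h =>
    F.wall_notMem hi hp (h ▸ F.g_left i hi k hk)
  obtain ⟨l, hl, h⟩ := exists_gap (M := F.N i) (f := fun k => F.g i k (F.θ i)) (p := p)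
    (fun k k' h h' => F.g_le hi ⟨le_rfl, (F.θ_lt i hi).le⟩ h h') (hne p hp)
  exact ⟨l, hl, gap_subset gap_ordConnected hne hp h hl⟩

/-- The wall `m` over `θ i` in the coordinates of the strip to its left. -/
def flip (i : ℕ) (p : ℝ) : ℝ := if i = 0 then -p else p

theorem Q_flip {i : ℕ} (hi : i < F.n) (p : ℝ) :
    Q (F.θ (F.prev i + 1), flip i p) = Q (F.θ i, p) := by
  have := F.two_le
  unfold prev flip
  split_ifs with h
  · subst h
    rw [show F.n - 1 + 1 = F.n by omega, F.θ_last, F.θ_zero, ← Q_add_pi 0 p, zero_add]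
  · rw [show i - 1 + 1 = i by omega]

theorem exists_left {i m : ℕ} (hi : i < F.n) (hm : m ≤ F.M i) :
    ∃ l ≤ F.N (F.prev i), ∀ p ∈ gap (F.M i) (F.f i) m,
      flip i p ∈ gap (F.N (F.prev i)) (fun k => F.g (F.prev i) k (F.θ (F.prev i + 1))) l := by
  obtain ⟨p, hp⟩ := gap_nonempty (F.f_lt i hi) hm
  have hj := F.prev_lt hi
  have hne : ∀ q ∈ flip i '' gap (F.M i) (F.f i) m, ∀ k < F.N (F.prev i),
      q ≠ F.g (F.prev i) k (F.θ (F.prev i + 1)) := by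
    rintro _ ⟨q, hq, rfl⟩ k hk h
    apply F.wall_notMem hi hq
    rw [← F.Q_flip hi, h]
    exact F.g_right _ hj k hk
  obtain ⟨l, hl, h⟩ := exists_gap (M := F.N (F.prev i))
    (f := fun k => F.g (F.prev i) k (F.θ (F.prev i + 1))) (p := flip i p)
    (fun k k' h h' => F.g_le hj ⟨(F.θ_lt _ hj).le, le_rfl⟩ h h') (hne _ ⟨p, hp, rfl⟩)
  refine ⟨l, hl, fun q hq => gap_subset ?_ hne ⟨p, hp, rfl⟩ h hl ⟨q, hq, rfl⟩⟩
  have h1 : OrdConnected (gap (F.M i) (F.f i) m) := gap_ordConnected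
  by_cases hi0 : i = 0
  · have : flip i = Neg.neg := by
      funext p
      simp [flip, hi0]
    rw [this, image_neg_eq_neg]
    exact ⟨fun a ha b hb c hc => h1.out hb ha ⟨neg_le_neg hc.2, neg_le_neg hc.1⟩⟩
  · have : flip i = id := by
      funext p
      simp [flip, hi0]
    rwa [this, image_id]

theorem exists_left_strip {i m : ℕ} (hi : i < F.n) (hm : m ≤ F.M i) :
    ∃ (x₀ : ℝ) (A : Set (ℝ × ℝ)) (l : ℕ), x₀ < F.θ i ∧ F.θ (i + 1) ≤ x₀ + π ∧ l ≤ F.N (F.prev i) ∧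
      (∀ p ∈ gap (F.M i) (F.f i) m,
        flip i p ∈ gap (F.N (F.prev i)) (fun k => F.g (F.prev i) k (F.θ (F.prev i + 1))) l) ∧
      IsOpen A ∧ (∀ p ∈ gap (F.M i) (F.f i) m, (F.θ i, p) ∈ A) ∧
      (∀ x ∈ Ioo x₀ (F.θ i), OrdConnected {p | (x, p) ∈ A}) ∧
      (∀ x ∈ Ioo x₀ (F.θ i), ∃ p, (x, p) ∈ A) ∧
      Q '' {z | z.1 ∈ Ioo x₀ (F.θ i) ∧ z ∈ A} = Q '' F.strip (F.prev i) l := by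
  obtain ⟨l, hl, h⟩ := F.exists_left hi hm
  have h2 := F.two_le
  have hj := F.prev_lt hi
  by_cases hi0 : i = 0
  · subst hi0
    have hp : F.prev 0 = F.n - 1 := by simp [prev]
    rw [hp] at hl h hj ⊢
    have hn1 : F.n - 1 + 1 = F.n := by omega
    have hn1' : F.θ (F.n - 1 + 1) = π := by rw [hn1, F.θ_last]
    refine ⟨F.θ (F.n - 1) - π,
      {z | -z.2 ∈ gap (F.N (F.n - 1)) (fun k => F.g (F.n - 1) k (z.1 + π)) l}, l, ?_, ?_, hl, h,
      ?_, ?_, ?_, ?_, ?_⟩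
    · rw [F.θ_zero]
      linarith [F.θ_lt_pi hj]
    · have := F.θ_mono (show 0 + 1 ≤ F.n - 1 by omega) hj.le
      linarith
    · have := fun k => F.g_cont (F.n - 1) k
      exact isOpen_gap_comp (G := fun k (z : ℝ × ℝ) => F.g (F.n - 1) k (z.1 + π))
        (u := fun z : ℝ × ℝ => -z.2) (fun k => by fun_prop) (by fun_prop)
    · intro p hp
      have := h p hp
      rw [hn1'] at this
      simp only [flip, if_true] at this
      simpa [F.θ_zero] using this
    · intro x _
      have h1 := gap_ordConnected (M := F.N (F.n - 1)) (f := fun k => F.g (F.n - 1) k (x + π))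
        (m := l)
      exact ⟨fun a ha b hb c hc => h1.out hb ha ⟨neg_le_neg hc.2, neg_le_neg hc.1⟩⟩
    · intro x hx
      rw [F.θ_zero] at hx
      obtain ⟨p, hp⟩ := gap_nonempty (f := fun k => F.g (F.n - 1) k (x + π))
        (F.g_lt (F.n - 1) hj (x + π) ⟨by linarith [hx.1], by rw [hn1']; linarith [hx.2]⟩) hl
      exact ⟨-p, by simpa using hp⟩
    · ext y
      constructor
      · rintro ⟨⟨x, p⟩, ⟨hx, hz⟩, rfl⟩
        rw [F.θ_zero] at hx
        refine ⟨(x + π, -p), ⟨⟨?_, ?_⟩, hz⟩, Q_add_pi x p⟩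
        · have := hx.1; simp only at this ⊢; linarith
        · have := hx.2; simp only [hn1'] at this ⊢; linarith
      · rintro ⟨⟨x, p⟩, ⟨hx, hz⟩, rfl⟩
        rw [hn1'] at hx
        refine ⟨(x - π, -p), ⟨⟨?_, ?_⟩, ?_⟩, ?_⟩
        · have := hx.1; simp only at this ⊢; linarith
        · have := hx.2; simp only [F.θ_zero] at this ⊢; linarith
        · simpa using hz
        · rw [← Q_add_pi]; simp
  · have hp : F.prev i = i - 1 := by simp [prev, hi0]
    rw [hp] at hl h hj ⊢
    have hi1 : i - 1 + 1 = i := by omega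
    refine ⟨F.θ (i - 1), {z | z.2 ∈ gap (F.N (i - 1)) (fun k => F.g (i - 1) k z.1) l}, l, ?_, ?_,
      hl, h, ?_, ?_, ?_, ?_, ?_⟩
    · exact F.θ_strict (by omega) hi.le
    · linarith [F.θ_nonneg hj.le, F.θ_le (show i + 1 ≤ F.n from hi)]
    · exact isOpen_gap_comp (fun k => (F.g_cont (i - 1) k).comp continuous_fst) continuous_snd
    · intro p hp
      have := h p hp
      rw [hi1] at this
      simpa [flip, hi0] using this
    · exact fun x _ => gap_ordConnected (f := fun k => F.g (i - 1) k x)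
    · intro x hx
      exact gap_nonempty (F.g_lt (i - 1) hj x (by rwa [hi1])) hl
    · unfold strip
      rw [hi1]
      rfl

theorem exists_chart {i m : ℕ} (hi : i < F.n) (hm : m ≤ F.M i) :
    ∃ (la lb : ℕ) (χ : ℝ × ℝ → X₂sp) (σ : ℝ → ℝ), la ≤ F.N (F.prev i) ∧ lb ≤ F.N i ∧
      (∀ p ∈ gap (F.M i) (F.f i) m,
        flip i p ∈ gap (F.N (F.prev i)) (fun k => F.g (F.prev i) k (F.θ (F.prev i + 1))) la) ∧
      (gap (F.M i) (F.f i) m ⊆ gap (F.N i) (fun k => F.g i k (F.θ i)) lb) ∧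
      IsOpenEmbedding χ ∧
      χ '' {z | z.1 = 0} = (fun p => Q (F.θ i, p)) '' gap (F.M i) (F.f i) m ∧
      χ '' {z | z.1 < 0} = Q '' F.strip (F.prev i) la ∧ χ '' {z | 0 < z.1} = Q '' F.strip i lb ∧
      StrictMono σ ∧ range σ = gap (F.M i) (F.f i) m ∧ ∀ y, χ (0, y) = Q (F.θ i, σ y) := by
  obtain ⟨x₀, A, la, h0, hpi, hla, hA1, hA, hKA, oA, nA, hQA⟩ := F.exists_left_strip hi hm
  obtain ⟨lb, hlb, hB1⟩ := F.exists_right hi hm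
  obtain ⟨χ, σ, e, cA, cK, cB, mσ, rσ, hσ⟩ := exists_wall_chart (x₁ := F.θ (i + 1)) h0 (F.θ_lt i hi)
    (B := {z | z.2 ∈ gap (F.N i) (fun k => F.g i k z.1) lb}) (K := gap (F.M i) (F.f i) m)
    hA (isOpen_gap_comp (fun k => (F.g_cont i k).comp continuous_fst) continuous_snd) isOpen_gap
    hKA (fun p hp => hB1 hp) oA (fun x _ => gap_ordConnected (f := fun k => F.g i k x)) gap_ordConnected nA
    (fun x hx => gap_nonempty (F.g_lt i hi x hx) hlb) (gap_nonempty (F.f_lt i hi) hm)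
  have hr : range χ ⊆ {z | z.1 ∈ Ioo x₀ (x₀ + π)} := by
    rintro _ ⟨z, rfl⟩
    have h1 := F.θ_lt i hi
    rcases lt_trichotomy z.1 0 with h | h | h
    · have : χ z ∈ χ '' {z | z.1 < 0} := ⟨z, h, rfl⟩
      rw [cA] at this
      exact ⟨this.1.1, this.1.2.trans_le (by linarith)⟩
    · have : χ z ∈ χ '' {z | z.1 = 0} := ⟨z, h, rfl⟩
      rw [cK] at this
      have : (χ z).1 = F.θ i := this.1
      exact ⟨by rw [this]; exact h0, by rw [this]; linarith⟩
    · have : χ z ∈ χ '' {z | 0 < z.1} := ⟨z, h, rfl⟩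
      rw [cB] at this
      exact ⟨h0.trans this.1.1, this.1.2.trans_le (by linarith)⟩
  refine ⟨la, lb, Q ∘ χ, σ, hla, hlb, hA1, hB1, ?_, ?_, ?_, ?_, mσ, rσ, fun y => ?_⟩
  · exact IsOpenEmbedding.of_continuous_injective_isOpenMap (Q_continuous.comp e.continuous)
      (fun z z' h => e.injective (Q_injOn (hr ⟨z, rfl⟩) (hr ⟨z', rfl⟩) h))
      (Q_isOpenMap.comp e.isOpenMap)
  · rw [image_comp, cK]
    ext y
    constructor
    · rintro ⟨⟨x, p⟩, ⟨rfl, hz⟩, rfl⟩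
      exact ⟨p, hz, rfl⟩
    · rintro ⟨p, hp, rfl⟩
      exact ⟨(F.θ i, p), ⟨rfl, hp⟩, rfl⟩
  · rw [image_comp, cA, hQA]
  · rw [image_comp, cB]
    rfl
  · rw [Function.comp_apply, hσ]

end Front

end

section

theorem Q_inj_Ico {x x' p p' : ℝ} (hx : x ∈ Ico 0 π) (hx' : x' ∈ Ico 0 π)
    (h : Q (x, p) = Q (x', p')) : x = x' ∧ p = p' := by
  obtain ⟨k, hk, hp⟩ := Q_eq h
  have hpi := pi_pos
  have h1 : (k : ℝ) < 1 := by
    by_contra! h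
    nlinarith [hx.1, hx'.2]
  have h2 : (-1 : ℝ) < k := by
    by_contra! h
    nlinarith [hx'.1, hx.2]
  have h3 : k = 0 := by
    have h1 : k < 1 := by exact_mod_cast h1
    have h2 : -1 < k := by exact_mod_cast h2
    omega
  subst h3
  simp at hk hp
  exact ⟨hk.symm, hp.symm⟩

namespace Front

variable {α : Set X₂sp} {v : ℕ} (F : Front α v)

/-- The index set of the strips. -/
abbrev S := Σ i : Fin F.n, Fin (F.N i + 1)

/-- The index set of the walls. -/
abbrev W := Σ i : Fin F.n, Fin (F.M i + 1)

theorem Ico_of_mem {i : ℕ} (hi : i < F.n) {x : ℝ} (hx : x ∈ Ioo (F.θ i) (F.θ (i + 1))) :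
    x ∈ Ico 0 π :=
  ⟨(F.θ_nonneg hi.le).trans hx.1.le, hx.2.trans_le (F.θ_le hi)⟩

theorem Ico_θ {i : ℕ} (hi : i < F.n) : F.θ i ∈ Ico 0 π := ⟨F.θ_nonneg hi.le, F.θ_lt_pi hi⟩

theorem idx_unique {i j : ℕ} (hi : i < F.n) (hj : j < F.n) {x : ℝ}
    (hx : x ∈ Ico (F.θ i) (F.θ (i + 1))) (hx' : x ∈ Ico (F.θ j) (F.θ (j + 1))) : i = j := by
  rcases lt_trichotomy i j with h | h | h
  · linarith [F.θ_mono (show i + 1 ≤ j from h) hj.le, hx.2, hx'.1]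
  · exact h
  · linarith [F.θ_mono (show j + 1 ≤ i from h) hi.le, hx'.2, hx.1]

theorem plane {i l : ℕ} (hi : i < F.n) (hl : l ≤ F.N i) :
    Nonempty (Q '' F.strip i l ≃ₜ ℝ × ℝ) := by
  have hlt := F.θ_lt i hi
  set c := (F.θ i + F.θ (i + 1)) / 2 with hc
  have h0 : F.θ i < c := by linarith
  have h1 : c < F.θ (i + 1) := by linarith
  have hA : IsOpen {z : ℝ × ℝ | z.2 ∈ gap (F.N i) (fun k => F.g i k z.1) l} :=
    isOpen_gap_comp (fun k => (F.g_cont i k).comp continuous_fst) continuous_snd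
  have ho : ∀ x, OrdConnected {p | (x, p) ∈
      {z : ℝ × ℝ | z.2 ∈ gap (F.N i) (fun k => F.g i k z.1) l}} :=
    fun x => gap_ordConnected (f := fun k => F.g i k x)
  have hn : ∀ x ∈ Ioo (F.θ i) (F.θ (i + 1)), ∃ p, (x, p) ∈
      {z : ℝ × ℝ | z.2 ∈ gap (F.N i) (fun k => F.g i k z.1) l} :=
    fun x hx => gap_nonempty (F.g_lt i hi x hx) hl
  obtain ⟨χ, σ, e, cA, cK, cB, -, -, -⟩ := exists_wall_chart h0 h1 hA hA
    (K := gap (F.N i) (fun k => F.g i k c) l) isOpen_gap (fun p hp => hp) (fun p hp => hp)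
    (fun x _ => ho x) (fun x _ => ho x) gap_ordConnected
    (fun x hx => hn x ⟨hx.1, hx.2.trans h1⟩) (fun x hx => hn x ⟨h0.trans hx.1, hx.2⟩)
    (gap_nonempty (F.g_lt i hi c ⟨h0, h1⟩) hl)
  have hr : range χ = F.strip i l := by
    have : (univ : Set (ℝ × ℝ)) = {z | z.1 < 0} ∪ {z | z.1 = 0} ∪ {z | 0 < z.1} := by
      ext z
      simpa [or_assoc] using lt_trichotomy z.1 0
    rw [← image_univ, this, image_union, image_union, cA, cK, cB]
    ext ⟨x, p⟩
    constructor
    · rintro ((⟨hx, hp⟩ | ⟨hx, hp⟩) | ⟨hx, hp⟩)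
      · exact ⟨⟨hx.1, hx.2.trans h1⟩, hp⟩
      · simp only at hx
        subst hx
        exact ⟨⟨h0, h1⟩, hp⟩
      · exact ⟨⟨h0.trans hx.1, hx.2⟩, hp⟩
    · rintro ⟨hx, hp⟩
      simp only at hx
      rcases lt_trichotomy x c with h | h | h
      · exact Or.inl (Or.inl ⟨⟨hx.1, h⟩, hp⟩)
      · subst h
        exact Or.inl (Or.inr ⟨rfl, hp⟩)
      · exact Or.inr ⟨⟨h, hx.2⟩, hp⟩
  have hs : ∀ z, (χ z).1 ∈ Ioo 0 (0 + π) := fun z => by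
    have : χ z ∈ F.strip i l := hr ▸ ⟨z, rfl⟩
    exact ⟨(F.θ_nonneg hi.le).trans_lt this.1.1, by linarith [this.1.2, F.θ_le hi]⟩
  have he : IsOpenEmbedding (Q ∘ χ) :=
    IsOpenEmbedding.of_continuous_injective_isOpenMap (Q_continuous.comp e.continuous)
      (fun z z' h => e.injective (Q_injOn (hs z) (hs z') h)) (Q_isOpenMap.comp e.isOpenMap)
  have hr' : range (Q ∘ χ) = Q '' F.strip i l := by rw [range_comp, hr]
  exact ⟨((he.isEmbedding.toHomeomorph).trans (Homeomorph.setCongr hr')).symm⟩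

/-- A strip system adapted to a front. -/
structure Adapted (G : StripSystem X₂sp F.S F.W) : Prop where
  st : ∀ s : F.S, G.st s = Q '' F.strip s.1 s.2
  wl : ∀ w : F.W, G.wl w = (fun p => Q (F.θ w.1, p)) '' gap (F.M w.1) (F.f w.1) w.2
  η : ∀ w : F.W, G.η w = if (w.1 : ℕ) = 0 then -1 else 1
  a_fst : ∀ w : F.W, ((G.a w).1 : ℕ) = F.prev w.1
  a_gap : ∀ w : F.W, ∀ p ∈ gap (F.M w.1) (F.f w.1) w.2, Front.flip w.1 p ∈
    gap (F.N (G.a w).1) (fun k => F.g (G.a w).1 k (F.θ ((G.a w).1 + 1))) (G.a w).2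
  b_fst : ∀ w : F.W, (G.b w).1 = w.1
  b_gap : ∀ w : F.W, gap (F.M w.1) (F.f w.1) w.2 ⊆
    gap (F.N (G.b w).1) (fun k => F.g (G.b w).1 k (F.θ (G.b w).1)) (G.b w).2
  line : ∀ w : F.W, ∃ σ : ℝ → ℝ, StrictMono σ ∧ range σ = gap (F.M w.1) (F.f w.1) w.2 ∧
    ∀ y, G.line w y = Q (F.θ w.1, σ y)

theorem exists_adapted : ∃ G : StripSystem X₂sp F.S F.W, F.Adapted G := by
  have h := fun w : F.W => F.exists_chart w.1.2 (Nat.lt_succ_iff.1 w.2.2)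
  choose la lb χ σ hla hlb ha hb he c0 ca cb mσ rσ hσ using h
  refine ⟨{ st := fun s => Q '' F.strip s.1 s.2
            wl := fun w => (fun p => Q (F.θ w.1, p)) '' gap (F.M w.1) (F.f w.1) w.2
            a := fun w => ⟨⟨F.prev w.1, F.prev_lt w.1.2⟩, ⟨la w, Nat.lt_succ_iff.2 (hla w)⟩⟩
            b := fun w => ⟨w.1, ⟨lb w, Nat.lt_succ_iff.2 (hlb w)⟩⟩
            ne := ?_
            chart := χ
            emb := he
            chart_wl := c0
            chart_a := ca
            chart_b := cb
            open_st := fun s => Q_isOpenMap _ (F.isOpen_strip _ _)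
            plane := fun s => F.plane s.1.2 (Nat.lt_succ_iff.1 s.2.2)
            st_disj := ?_
            wl_disj := ?_
            st_wl := ?_
            η := fun w => if (w.1 : ℕ) = 0 then -1 else 1
            η_sq := ?_ }, ?_⟩
  · intro w h
    have h1 : F.prev w.1 = w.1 := congrArg (fun s : F.S => (s.1 : ℕ)) h
    have := F.two_le
    unfold prev at h1
    split_ifs at h1 <;> omega
  · rintro x ⟨⟨i, hi⟩, ⟨l, hl⟩⟩ ⟨⟨i', hi'⟩, ⟨l', hl'⟩⟩ ⟨⟨x₁, p₁⟩, hz, rfl⟩ ⟨⟨x₂, p₂⟩, hz', h⟩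
    simp only at hz hz'
    obtain ⟨rfl, rfl⟩ := Q_inj_Ico (F.Ico_of_mem hi' hz'.1) (F.Ico_of_mem hi hz.1) h
    obtain rfl := F.idx_unique hi hi' (Ioo_subset_Ico_self hz.1) (Ioo_subset_Ico_self hz'.1)
    obtain rfl := gap_disjoint hz.2 hz'.2 (Nat.lt_succ_iff.1 hl) (Nat.lt_succ_iff.1 hl')
    rfl
  · rintro x ⟨⟨i, hi⟩, ⟨l, hl⟩⟩ ⟨⟨i', hi'⟩, ⟨l', hl'⟩⟩ ⟨p₁, hz, rfl⟩ ⟨p₂, hz', h⟩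
    simp only at hz hz' h
    obtain ⟨h1, rfl⟩ := Q_inj_Ico (F.Ico_θ hi') (F.Ico_θ hi) h
    obtain rfl := F.idx_unique hi hi' ⟨le_rfl, F.θ_lt i hi⟩ (h1 ▸ ⟨le_rfl, F.θ_lt i' hi'⟩)
    obtain rfl := gap_disjoint hz hz' (Nat.lt_succ_iff.1 hl) (Nat.lt_succ_iff.1 hl')
    rfl
  · rintro x ⟨⟨i, hi⟩, ⟨l, hl⟩⟩ ⟨⟨i', hi'⟩, ⟨l', hl'⟩⟩ ⟨⟨x₁, p₁⟩, hz, rfl⟩ ⟨p₂, hz', h⟩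
    simp only at hz hz' h
    obtain ⟨rfl, rfl⟩ := Q_inj_Ico (F.Ico_θ hi') (F.Ico_of_mem hi hz.1) h
    obtain rfl := F.idx_unique hi hi' (Ioo_subset_Ico_self hz.1) ⟨le_rfl, F.θ_lt i' hi'⟩
    exact lt_irrefl _ hz.1.1
  · intro w
    split_ifs <;> norm_num
  · exact { st := fun _ => rfl
            wl := fun _ => rfl
            η := fun _ => rfl
            a_fst := fun _ => rfl
            a_gap := ha
            b_fst := fun _ => rfl
            b_gap := hb
            line := fun w => ⟨σ w, mσ w, rσ w, hσ w⟩ }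

theorem compl_eq {G : StripSystem X₂sp F.S F.W} (hG : F.Adapted G) :
    αᶜ = G.carrier Finset.univ Finset.univ := by
  ext y
  rw [StripSystem.mem_carrier]
  constructor
  · intro hy
    obtain ⟨⟨x, p⟩, rfl⟩ := Q_surjective y
    obtain ⟨k, hk⟩ : ∃ k : ℤ, x + k * π ∈ Ico 0 π := by
      obtain ⟨k, hk, -⟩ := existsUnique_add_zsmul_mem_Ico pi_pos x 0
      exact ⟨k, by simpa using hk⟩
    rw [← Q_add_int x p k] at hy ⊢
    generalize x + k * π = x at *
    generalize (-1 : ℝ) ^ k * p = p at *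
    obtain ⟨i, hi, hx⟩ : ∃ i < F.n, x ∈ Ico (F.θ i) (F.θ (i + 1)) := by
      by_contra! hne
      have : ∀ i ≤ F.n, F.θ i ≤ x := by
        intro i
        induction i with
        | zero => exact fun _ => F.θ_zero ▸ hk.1
        | succ i ih =>
          intro hi
          by_contra! h
          exact hne i hi ⟨ih (by omega), h⟩
      linarith [this F.n le_rfl, F.θ_last, hk.2]
    rcases hx.1.eq_or_lt with h | h
    · subst h
      right
      obtain ⟨m, hm, h⟩ := exists_gap (M := F.M i) (f := F.f i) (p := p)
        (fun k k' h h' => (F.f_lt i hi k k' h h').le)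
        (fun k hk h => hy ((F.mem_f i hi p).2 ⟨k, hk, h.symm⟩))
      refine ⟨⟨⟨i, hi⟩, ⟨m, Nat.lt_succ_iff.2 hm⟩⟩, Finset.mem_univ _, ?_⟩
      rw [hG.wl]
      exact ⟨p, h, rfl⟩
    · left
      obtain ⟨l, hl, h⟩ := F.exists_strip hi ⟨h, hx.2⟩ hy
      refine ⟨⟨⟨i, hi⟩, ⟨l, Nat.lt_succ_iff.2 hl⟩⟩, Finset.mem_univ _, ?_⟩
      rw [hG.st]
      exact ⟨_, h, rfl⟩
  · rintro (⟨s, -, hs⟩ | ⟨w, -, hw⟩)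
    · rw [hG.st] at hs
      obtain ⟨z, hz, rfl⟩ := hs
      exact F.strip_notMem s.1.2 hz
    · rw [hG.wl] at hw
      obtain ⟨p, hp, rfl⟩ := hw
      exact F.wall_notMem w.1.2 hp

theorem card_eq : Fintype.card F.S = Fintype.card F.W + v := by
  have h := F.total
  simp only [Fintype.card_sigma, Fintype.card_fin, Finset.sum_add_distrib]
  rw [Fin.sum_univ_eq_sum_range (fun i => F.N i), Fin.sum_univ_eq_sum_range (fun i => F.M i)]
  omega

end Front

end

section

theorem Box.nonempty_scale {X : Type*} [TopologicalSpace X] {C : Set X} {w₀ w₁ : ℝ → X} {ε e : ℝ}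
    (b : Box C w₀ w₁ ε) (he : e * e = 1) : Nonempty (Box C w₀ (fun y => w₁ (e * y)) (ε * e)) := by
  rcases mul_self_eq_one_iff.1 he with rfl | rfl
  · simpa using ⟨b⟩
  · have b' : Box C w₀ (fun y => (fun y => w₁ (-1 * y)) (-y)) ε := by simpa using b
    have := Box.flip (w₁ := fun y => w₁ (-1 * y)) b'
    rw [show ε * -1 = -ε by ring]
    exact ⟨this⟩

theorem Box.nonempty_scale₂ {X : Type*} [TopologicalSpace X] {C : Set X} {w₀ w₁ : ℝ → X}
    {ε e e' : ℝ} (b : Nonempty (Box C w₀ w₁ ε)) (he : e * e = 1) (he' : e' * e' = 1) :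
    Nonempty (Box C (fun y => w₀ (e * y)) (fun y => w₁ (e' * y)) (e * ε * e')) := by
  obtain ⟨b⟩ := b
  obtain ⟨b₁⟩ := b.symm.nonempty_scale he
  obtain ⟨b₂⟩ := b₁.symm.nonempty_scale he'
  rw [mul_comm e ε]
  exact ⟨b₂⟩

namespace Front

variable {α : Set X₂sp} {v : ℕ} (F : Front α v)

theorem θ_diff {j : ℕ} (hj : j < F.n) : F.θ (j + 1) - F.θ j < π := by
  rcases Nat.eq_zero_or_pos j with rfl | h
  · have := F.θ_lt_pi (show 0 + 1 < F.n by have := F.two_le; omega)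
    rw [F.θ_zero]
    linarith
  · have := F.θ_strict h hj.le
    rw [F.θ_zero] at this
    linarith [F.θ_le (show j + 1 ≤ F.n from hj)]

/-- The points of the plane at the height of a strip. -/
def region (s : F.S) : Set (ℝ × ℝ) := {z | z.2 ∈ gap (F.N s.1) (fun k => F.g s.1 k z.1) s.2}

theorem isOpen_region (s : F.S) : IsOpen (F.region s) :=
  isOpen_gap_comp (fun k => (F.g_cont s.1 k).comp continuous_fst) continuous_snd

theorem region_ordConnected (s : F.S) (x : ℝ) : OrdConnected {p | (x, p) ∈ F.region s} :=
  gap_ordConnected (f := fun k => F.g s.1 k x)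

theorem region_nonempty (s : F.S) {x : ℝ} (hx : x ∈ Ioo (F.θ s.1) (F.θ (s.1 + 1))) :
    ∃ p, (x, p) ∈ F.region s :=
  gap_nonempty (F.g_lt s.1 s.1.2 x hx) (Nat.lt_succ_iff.1 s.2.2)

variable {F}

/-- A wall over the abscissa `x` on the boundary of a strip. -/
structure Side (G : StripSystem X₂sp F.S F.W) (s : F.S) (w : F.W) (x : ℝ) (τ : ℝ → ℝ) (e : ℝ) :
    Prop where
  sq : e * e = 1
  mono : StrictMono τ
  isOpen : IsOpen (range τ)
  ord : OrdConnected (range τ)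
  mem : ∀ y, (x, τ y) ∈ F.region s
  line : ∀ y, G.line w y = Q (x, τ (e * y))

theorem Side.wl_eq {G : StripSystem X₂sp F.S F.W} {s : F.S} {w : F.W} {x : ℝ} {τ : ℝ → ℝ} {e : ℝ}
    (h : Side G s w x τ e) : G.wl w = (fun p => Q (x, p)) '' range τ := by
  rw [← G.chart_wl]
  ext u
  constructor
  · rintro ⟨⟨z, y⟩, hz, rfl⟩
    have hz : z = 0 := hz
    subst hz
    exact ⟨_, ⟨e * y, rfl⟩, (h.line y).symm⟩
  · rintro ⟨_, ⟨y, rfl⟩, rfl⟩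
    refine ⟨(0, e * y), rfl, ?_⟩
    have := h.line (e * y)
    rw [← mul_assoc, h.sq, one_mul] at this
    exact this

theorem Adapted.side {G : StripSystem X₂sp F.S F.W} (hG : F.Adapted G) {s : F.S} {w : F.W}
    (h : G.Inc s w) : (∃ τ, Side G s w (F.θ s.1) τ 1 ∧ G.sgn w s = 1) ∨
      ∃ τ, Side G s w (F.θ (s.1 + 1)) τ (G.η w) ∧ G.sgn w s = - G.η w := by
  obtain ⟨σ, mσ, rσ, hσ⟩ := hG.line w
  have hmem : ∀ y, σ y ∈ gap (F.M w.1) (F.f w.1) w.2 := fun y => rσ ▸ ⟨y, rfl⟩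
  by_cases hb : G.b w = s
  · subst hb
    refine Or.inl ⟨σ, ⟨by norm_num, mσ, rσ ▸ isOpen_gap, rσ ▸ gap_ordConnected, ?_, ?_⟩, by
      simp [StripSystem.sgn]⟩
    · exact fun y => hG.b_gap w (hmem y)
    · intro y
      rw [hσ, hG.b_fst, one_mul]
  · have ha : G.a w = s := h.resolve_right hb
    subst ha
    have hmem' := fun y => hG.a_gap w _ (hmem y)
    have hfst := hG.a_fst w
    have hQ : ∀ y, G.line w y = Q (F.θ ((G.a w).1 + 1), Front.flip w.1 (σ y)) := by
      intro y
      rw [hσ, hfst, F.Q_flip w.1.2]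
    right
    by_cases h0 : (w.1 : ℕ) = 0
    · have hη : G.η w = -1 := by rw [hG.η, if_pos h0]
      have hfl : ∀ p, Front.flip w.1 p = -p := fun p => by simp [Front.flip, h0]
      have hr : range (fun y => -σ (-y)) = -range σ := by
        ext p
        constructor
        · rintro ⟨y, rfl⟩
          exact ⟨-y, by simp⟩
        · rintro ⟨y, hy⟩
          exact ⟨-y, by simp [hy]⟩
      have hso : OrdConnected (range σ) := rσ ▸ gap_ordConnected
      refine ⟨fun y => -σ (-y), ⟨G.η_sq w, ?_, ?_, ?_, ?_, ?_⟩, by simp [StripSystem.sgn, hb]⟩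
      · intro y y' h
        have := mσ (neg_lt_neg h)
        simpa using this
      · rw [hr]
        exact (rσ ▸ isOpen_gap : IsOpen (range σ)).neg
      · rw [hr]
        exact ⟨fun a ha b hb c hc => hso.out hb ha ⟨neg_le_neg hc.2, neg_le_neg hc.1⟩⟩
      · intro y
        have := hmem' (-y)
        rw [hfl] at this
        exact this
      · intro y
        rw [hQ, hfl, hη]
        simp
    · have hη : G.η w = 1 := by rw [hG.η, if_neg h0]
      have hfl : ∀ p, Front.flip w.1 p = p := fun p => by simp [Front.flip, h0]
      refine ⟨σ, ⟨G.η_sq w, mσ, rσ ▸ isOpen_gap, rσ ▸ gap_ordConnected, ?_, ?_⟩, by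
        simp [StripSystem.sgn, hb]⟩
      · intro y
        have := hmem' y
        rw [hfl] at this
        exact this
      · intro y
        rw [hQ, hfl, hη, one_mul]

theorem Adapted.carrier_eq [DecidableEq F.W] {G : StripSystem X₂sp F.S F.W} (hG : F.Adapted G) {s : F.S} {w w' : F.W}
    {K₀ K₁ : Set ℝ} (h : G.wl w ∪ G.wl w' =
      (fun p => Q (F.θ s.1, p)) '' K₀ ∪ (fun p => Q (F.θ (s.1 + 1), p)) '' K₁) :
    G.carrier {s} {w, w'} = Q '' bandSet (F.θ s.1) (F.θ (s.1 + 1)) (F.region s) K₀ K₁ := by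
  have : G.carrier {s} {w, w'} = G.st s ∪ (G.wl w ∪ G.wl w') := by
    ext u
    rw [StripSystem.mem_carrier]
    simp
  rw [this, h, hG.st]
  ext u
  constructor
  · rintro (⟨z, hz, rfl⟩ | ⟨p, hp, rfl⟩ | ⟨p, hp, rfl⟩)
    · exact ⟨z, Or.inl ⟨hz.1.1, hz.1.2, hz.2⟩, rfl⟩
    · exact ⟨_, Or.inr (Or.inl ⟨rfl, hp⟩), rfl⟩
    · exact ⟨_, Or.inr (Or.inr ⟨rfl, hp⟩), rfl⟩
  · rintro ⟨⟨x, p⟩, ⟨h1, h2, h3⟩ | ⟨rfl, hp⟩ | ⟨rfl, hp⟩, rfl⟩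
    · exact Or.inl ⟨_, ⟨⟨h1, h2⟩, h3⟩, rfl⟩
    · exact Or.inr (Or.inl ⟨p, hp, rfl⟩)
    · exact Or.inr (Or.inr ⟨p, hp, rfl⟩)

theorem nonempty_box_image {s : F.S} {K₀ K₁ : Set ℝ} {w₀ w₁ : ℝ → ℝ × ℝ} {ε : ℝ}
    (b : Nonempty (Box (bandSet (F.θ s.1) (F.θ (s.1 + 1)) (F.region s) K₀ K₁) w₀ w₁ ε)) :
    Nonempty (Box (Q '' bandSet (F.θ s.1) (F.θ (s.1 + 1)) (F.region s) K₀ K₁)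
      (fun y => Q (w₀ y)) (fun y => Q (w₁ y)) ε) := by
  obtain ⟨b⟩ := b
  have h1 := F.θ_diff s.1.2
  have h2 := F.θ_lt s.1 s.1.2
  refine b.nonempty_map Q_continuous Q_isOpenMap (isOpen_Ioo.preimage continuous_fst)
    (Q_injOn (a := (F.θ (s.1 + 1) + F.θ s.1 - π) / 2)) ?_
  rintro ⟨x, p⟩ (⟨h3, h4, -⟩ | ⟨rfl, -⟩ | ⟨rfl, -⟩)
  · simp only at h3 h4
    exact ⟨by simp only; linarith, by simp only; linarith⟩
  · exact ⟨by simp only; linarith, by simp only; linarith⟩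
  · exact ⟨by simp only; linarith, by simp only; linarith⟩

theorem Side.ne {G : StripSystem X₂sp F.S F.W} {s : F.S} {w w' : F.W} {x : ℝ} {τ τ' : ℝ → ℝ}
    {e e' : ℝ} (h : Side G s w x τ e) (h' : Side G s w' x τ' e') (hne : w ≠ w') (y y' : ℝ) :
    τ y ≠ τ' y' := by
  intro heq
  refine hne (G.wl_disj (x := Q (x, τ y)) ?_ ?_)
  · rw [h.wl_eq]
    exact ⟨_, ⟨y, rfl⟩, rfl⟩
  · rw [h'.wl_eq, heq]
    exact ⟨_, ⟨y', rfl⟩, rfl⟩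

theorem Adapted.box_through [DecidableEq F.W] {G : StripSystem X₂sp F.S F.W} (hG : F.Adapted G) {s : F.S}
    {w w' : F.W} {τ τ' : ℝ → ℝ} {e e' : ℝ} (h : Side G s w (F.θ s.1) τ e)
    (h' : Side G s w' (F.θ (s.1 + 1)) τ' e') :
    Nonempty (Box (G.carrier {s} {w, w'}) (G.line w) (G.line w') (e * e')) := by
  have hb := nonempty_box_image (through_box (F.θ_lt s.1 s.1.2) (F.isOpen_region s) h.mono h'.mono
    h.isOpen h'.isOpen h.ord h'.ord h.mem h'.mem (fun x _ => F.region_ordConnected s x)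
    (fun x hx => F.region_nonempty s hx))
  have hb' := Box.nonempty_scale₂ hb h.sq h'.sq
  rw [hG.carrier_eq (by rw [h.wl_eq, h'.wl_eq]), funext h.line, funext h'.line]
  simpa using hb'

theorem Adapted.hasBoxes [DecidableEq F.W] {G : StripSystem X₂sp F.S F.W} (hG : F.Adapted G) :
    G.HasBoxes := by
  intro s w w' hne hw hw'
  rcases hG.side hw with ⟨τ, h, hs⟩ | ⟨τ, h, hs⟩ <;>
    rcases hG.side hw' with ⟨τ', h', hs'⟩ | ⟨τ', h', hs'⟩ <;> rw [hs, hs']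
  · have hb := nonempty_box_image (fold_box (F.θ_lt s.1 s.1.2) (F.isOpen_region s) h.mono h'.mono
      h.isOpen h'.isOpen h.ord h'.ord h.mem h'.mem (h.ne h' hne)
      (fun x _ => F.region_ordConnected s x) (fun x hx => F.region_nonempty s hx))
    have hb' := Box.nonempty_scale₂ hb h.sq h'.sq
    convert hb' using 2
    · convert hG.carrier_eq (s := s) (w := w) (w' := w') ?_
      rw [h.wl_eq, h'.wl_eq, image_union, image_empty, union_empty]
    · exact funext h.line
    · exact funext h'.line
    · ring
  · convert hG.box_through h h' using 2
    ring
  · obtain ⟨b⟩ := hG.box_through h' h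
    rw [Finset.pair_comm]
    have := b.symm
    convert Nonempty.intro this using 2
    ring
  · have hb := nonempty_box_image (fold_box_right (F.θ_lt s.1 s.1.2) (F.isOpen_region s) h.mono
      h'.mono h.isOpen h'.isOpen h.ord h'.ord h.mem h'.mem (h.ne h' hne)
      (fun x _ => F.region_ordConnected s x) (fun x hx => F.region_nonempty s hx))
    have hb' := Box.nonempty_scale₂ hb h.sq h'.sq
    convert hb' using 2
    · convert hG.carrier_eq (s := s) (w := w) (w' := w') ?_
      rw [h.wl_eq, h'.wl_eq, image_union, image_empty, empty_union]
    · exact funext h.line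
    · exact funext h'.line
    · ring

end Front

end

section

theorem gap_lt_top {M m k : ℕ} {f : ℕ → ℝ} {p h : ℝ} (hp : p ∈ gap M f m) (hm : m ≤ M) (hk : k < M)
    (hh : ∀ k < M, f k ≤ h) (hk' : f k = h) : h < p ↔ m = M := by
  constructor
  · intro hlt
    by_contra hne
    have h1 := hp.2 m le_rfl (by omega)
    linarith [hh m (by omega)]
  · rintro rfl
    exact hk' ▸ hp.1 k hk

theorem gap_lt_bot {M m k : ℕ} {f : ℕ → ℝ} {p h : ℝ} (hp : p ∈ gap M f m) (hm : m ≤ M) (hk : k < M)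
    (hh : ∀ k < M, h ≤ f k) (hk' : f k = h) : p < h ↔ m = 0 := by
  constructor
  · intro hlt
    by_contra hne
    have h1 := hp.1 (m - 1) (by omega)
    linarith [hh (m - 1) (by omega)]
  · rintro rfl
    exact hk' ▸ hp.2 k (Nat.zero_le _) hk

theorem exists_homeomorph_range {X Y Z : Type*} [TopologicalSpace X] [TopologicalSpace Y]
    [TopologicalSpace Z] {a : Z → X} {b : Z → Y} (ha : IsOpenQuotientMap a) (hb : Continuous b)
    (hb' : IsOpenMap b) (h : ∀ z z', a z = a z' ↔ b z = b z') : Nonempty (range b ≃ₜ X) := by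
  set f : X → Y := fun x => b (Function.surjInv ha.surjective x) with hf
  have hfa : ∀ z, f (a z) = b z := fun z => (h _ _).1 (Function.surjInv_eq ha.surjective (a z))
  have hc : Continuous f := by
    rw [ha.isQuotientMap.continuous_iff]
    exact hb.congr fun z => (hfa z).symm
  have hi : Function.Injective f := by
    intro x x' hxx
    obtain ⟨z, rfl⟩ := ha.surjective x
    obtain ⟨z', rfl⟩ := ha.surjective x'
    rw [hfa, hfa] at hxx
    exact (h _ _).2 hxx
  have ho : IsOpenMap f := by
    intro V hV
    have : f '' V = b '' (a ⁻¹' V) := by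
      ext y
      constructor
      · rintro ⟨x, hx, rfl⟩
        obtain ⟨z, rfl⟩ := ha.surjective x
        exact ⟨z, hx, (hfa z).symm⟩
      · rintro ⟨z, hz, rfl⟩
        exact ⟨a z, hz, hfa z⟩
    rw [this]
    exact hb' _ (hV.preimage ha.continuous)
  have hr : range f = range b := by
    ext y
    constructor
    · rintro ⟨x, rfl⟩
      exact ⟨_, rfl⟩
    · rintro ⟨z, rfl⟩
      exact ⟨_, hfa z⟩
  have he := IsOpenEmbedding.of_continuous_injective_isOpenMap hc hi ho
  exact ⟨(he.isEmbedding.toHomeomorph.trans (Homeomorph.setCongr hr)).symm⟩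

namespace Front

variable {α : Set X₂sp} {v : ℕ} (F : Front α v)

theorem H_int (x : ℝ) (k : ℤ) : F.H (x + k * (2 * π)) = F.H x := by
  have : Function.Periodic F.H (2 * π) := F.H_per
  exact this.int_mul k x

theorem neg_H_mem (x : ℝ) : Q (x, -F.H (x + π)) ∈ α := by
  rw [← Q_add_pi, neg_neg]
  exact F.H_mem _

theorem neg_H_le {x p : ℝ} (h : Q (x, p) ∈ α) : -F.H (x + π) ≤ p := by
  rw [← Q_add_pi] at h
  linarith [F.le_H _ _ h]

theorem g_mem {i : ℕ} (hi : i < F.n) {x : ℝ} (hx : x ∈ Icc (F.θ i) (F.θ (i + 1))) {k : ℕ}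
    (hk : k < F.N i) : Q (x, F.g i k x) ∈ α := by
  rcases hx.1.eq_or_lt with rfl | h
  · exact F.g_left i hi k hk
  rcases hx.2.eq_or_lt with rfl | h'
  · exact F.g_right i hi k hk
  · exact (F.mem_g i hi x ⟨h, h'⟩ _).2 ⟨k, hk, rfl⟩

theorem N_pos {i : ℕ} (hi : i < F.n) : 0 < F.N i := by
  have h := F.θ_lt i hi
  obtain ⟨k, hk, -⟩ := (F.mem_g i hi ((F.θ i + F.θ (i + 1)) / 2) ⟨by linarith, by linarith⟩ _).1
    (F.H_mem _)
  omega

theorem M_pos {i : ℕ} (hi : i < F.n) : 0 < F.M i := by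
  obtain ⟨k, hk, -⟩ := (F.mem_f i hi _).1 (F.H_mem _)
  omega

theorem g_last {i : ℕ} (hi : i < F.n) {x : ℝ} (hx : x ∈ Icc (F.θ i) (F.θ (i + 1))) :
    F.g i (F.N i - 1) x = F.H x := by
  have hN := F.N_pos hi
  have hx' := hx
  rw [← closure_Ioo (F.θ_lt i hi).ne] at hx
  refine closure_minimal (fun y hy => ?_) (isClosed_eq (F.g_cont i _) F.H_cont) hx
  refine le_antisymm (F.le_H _ _ (F.g_mem hi (Ioo_subset_Icc_self hy) (by omega))) ?_
  obtain ⟨k, hk, h⟩ := (F.mem_g i hi y hy _).1 (F.H_mem y)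
  rw [← h]
  rcases (show k ≤ F.N i - 1 by omega).eq_or_lt with rfl | h'
  · exact le_rfl
  · exact (F.g_lt i hi y hy _ _ h' (by omega)).le

theorem g_zero {i : ℕ} (hi : i < F.n) {x : ℝ} (hx : x ∈ Icc (F.θ i) (F.θ (i + 1))) :
    F.g i 0 x = -F.H (x + π) := by
  have hN := F.N_pos hi
  have hH := F.H_cont
  rw [← closure_Ioo (F.θ_lt i hi).ne] at hx
  refine closure_minimal (fun y hy => ?_) (isClosed_eq (F.g_cont i _)
    (show Continuous fun x => -F.H (x + π) by fun_prop)) hx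
  refine le_antisymm ?_ (F.neg_H_le (F.g_mem hi (Ioo_subset_Icc_self hy) hN))
  obtain ⟨k, hk, h⟩ := (F.mem_g i hi y hy _).1 (F.neg_H_mem y)
  change F.g i 0 y ≤ -F.H (y + π)
  rw [← h]
  rcases (Nat.zero_le k).eq_or_lt with rfl | h'
  · exact le_rfl
  · exact (F.g_lt i hi y hy _ _ h' hk).le

theorem strip_top {i l : ℕ} (hi : i < F.n) {x : ℝ} (hx : x ∈ Icc (F.θ i) (F.θ (i + 1)))
    (hl : l ≤ F.N i) {p : ℝ} (hp : p ∈ gap (F.N i) (fun k => F.g i k x) l) :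
    (F.H x < p ↔ l = F.N i) ∧ (p < -F.H (x + π) ↔ l = 0) := by
  have hN := F.N_pos hi
  exact ⟨gap_lt_top hp hl (show F.N i - 1 < F.N i by omega)
    (fun k hk => F.le_H _ _ (F.g_mem hi hx hk)) (F.g_last hi hx),
    gap_lt_bot hp hl hN (fun k hk => F.neg_H_le (F.g_mem hi hx hk)) (F.g_zero hi hx)⟩

theorem wall_top {i m : ℕ} (hi : i < F.n) (hm : m ≤ F.M i) {p : ℝ}
    (hp : p ∈ gap (F.M i) (F.f i) m) :
    (F.H (F.θ i) < p ↔ m = F.M i) ∧ (p < -F.H (F.θ i + π) ↔ m = 0) := by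
  obtain ⟨k, hk, h⟩ := (F.mem_f i hi _).1 (F.H_mem (F.θ i))
  obtain ⟨k', hk', h'⟩ := (F.mem_f i hi _).1 (F.neg_H_mem (F.θ i))
  exact ⟨gap_lt_top hp hm hk (fun k hk => F.le_H _ _ ((F.mem_f i hi _).2 ⟨k, hk, rfl⟩)) h,
    gap_lt_bot hp hm hk' (fun k hk => F.neg_H_le ((F.mem_f i hi _).2 ⟨k, hk, rfl⟩)) h'⟩

/-- The strips in the unbounded region. -/
def AO : Finset F.S := {s | (s.2 : ℕ) = F.N s.1 ∨ (s.2 : ℕ) = 0}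

/-- The walls in the unbounded region. -/
def BO : Finset F.W := {w | (w.2 : ℕ) = F.M w.1 ∨ (w.2 : ℕ) = 0}

theorem card_ends {n : ℕ} {N : ℕ → ℕ} (hN : ∀ i < n, 0 < N i) :
    (Finset.univ.filter fun s : (Σ i : Fin n, Fin (N i + 1)) =>
      (s.2 : ℕ) = N s.1 ∨ (s.2 : ℕ) = 0).card = n * 2 := by
  have : (Finset.univ.filter fun s : (Σ i : Fin n, Fin (N i + 1)) =>
      (s.2 : ℕ) = N s.1 ∨ (s.2 : ℕ) = 0) =
      (Finset.univ : Finset (Fin n)).sigma fun i => {Fin.last (N i), 0} := by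
    ext ⟨i, l⟩
    simp only [Finset.mem_filter, Finset.mem_univ, true_and, Finset.mem_sigma, Finset.mem_insert,
      Finset.mem_singleton]
    rw [Fin.ext_iff, Fin.ext_iff]
    rfl
  rw [this, Finset.card_sigma, Finset.sum_congr rfl (g := fun _ => 2)]
  · simp
  · intro i _
    refine Finset.card_pair ?_
    intro h
    have h1 : N i = 0 := congrArg Fin.val h
    exact absurd h1 (hN i i.2).ne'

theorem AO_card : F.AO.card = F.BO.card := by
  have h1 := card_ends (N := F.N) fun i hi => F.N_pos hi
  have h2 := card_ends (N := F.M) fun i hi => F.M_pos hi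
  exact h1.trans h2.symm

variable {F}

theorem Adapted.outer {G : StripSystem X₂sp F.S F.W} (hG : F.Adapted G) (w : F.W) :
    (w ∈ F.BO ↔ G.a w ∈ F.AO) ∧ (w ∈ F.BO ↔ G.b w ∈ F.AO) := by
  have hi := w.1.2
  obtain ⟨p, hp⟩ := gap_nonempty (F.f_lt w.1 hi) (Nat.lt_succ_iff.1 w.2.2)
  obtain ⟨h1, h2⟩ := F.wall_top hi (Nat.lt_succ_iff.1 w.2.2) hp
  have hB : w ∈ F.BO ↔ F.H (F.θ w.1) < p ∨ p < -F.H (F.θ w.1 + π) := by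
    rw [BO, Finset.mem_filter, h1, h2]
    simp
  constructor
  · have hj := (G.a w).1.2
    obtain ⟨h3, h4⟩ := F.strip_top hj ⟨(F.θ_lt _ hj).le, le_rfl⟩
      (Nat.lt_succ_iff.1 (G.a w).2.2) (hG.a_gap w p hp)
    have hA : G.a w ∈ F.AO ↔ F.H (F.θ ((G.a w).1 + 1)) < Front.flip w.1 p ∨
        Front.flip w.1 p < -F.H (F.θ ((G.a w).1 + 1) + π) := by
      rw [AO, Finset.mem_filter, h3, h4]
      simp
    rw [hA, hB, hG.a_fst]
    have h2 := F.two_le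
    by_cases h0 : (w.1 : ℕ) = 0
    · have h5 : F.θ (F.prev w.1 + 1) = π := by
        rw [prev, if_pos h0, show F.n - 1 + 1 = F.n by omega, F.θ_last]
      rw [h5, h0, F.θ_zero, flip, if_pos rfl, zero_add, show π + π = 0 + 2 * π by ring, F.H_per,
        or_comm]
      exact or_congr (lt_neg) (neg_lt_neg_iff.symm)
    · rw [prev, if_neg h0, show (w.1 : ℕ) - 1 + 1 = w.1 by omega, flip, if_neg h0]
  · have hj := (G.b w).1.2
    obtain ⟨h3, h4⟩ := F.strip_top hj ⟨le_rfl, (F.θ_lt _ hj).le⟩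
      (Nat.lt_succ_iff.1 (G.b w).2.2) (hG.b_gap w hp)
    have hA : G.b w ∈ F.AO ↔ F.H (F.θ (G.b w).1) < p ∨ p < -F.H (F.θ (G.b w).1 + π) := by
      rw [AO, Finset.mem_filter, h3, h4]
      simp
    rw [hA, hB, hG.b_fst]

theorem Adapted.carrier_outer {G : StripSystem X₂sp F.S F.W} (hG : F.Adapted G) :
    G.carrier F.AO F.BO = {y | ∃ x p, Q (x, p) = y ∧ F.H x < p} := by
  have key : ∀ {x p : ℝ}, F.H x < p ∨ p < -F.H (x + π) →
      ∃ x' p', Q (x', p') = Q (x, p) ∧ F.H x' < p' := by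
    rintro x p (h | h)
    · exact ⟨x, p, rfl, h⟩
    · exact ⟨x + π, -p, Q_add_pi x p, by linarith⟩
  have key' : ∀ {x p x' p' : ℝ}, Q (x, p) = Q (x', p') → F.H x < p →
      F.H x' < p' ∨ p' < -F.H (x' + π) := by
    intro x p x' p' h hp
    obtain ⟨k, rfl, rfl⟩ := Q_eq h
    obtain ⟨m, rfl⟩ | ⟨m, rfl⟩ := k.even_or_odd
    · left
      have h1 : x + ((m + m : ℤ) : ℝ) * π = x + m * (2 * π) := by push_cast; ring
      rw [h1, F.H_int, Even.neg_one_zpow ⟨m, rfl⟩, one_mul]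
      exact hp
    · right
      have h1 : x + ((2 * m + 1 : ℤ) : ℝ) * π + π = x + (m + 1 : ℤ) * (2 * π) := by push_cast; ring
      rw [h1, F.H_int, Odd.neg_one_zpow ⟨m, rfl⟩]
      linarith
  ext y
  rw [StripSystem.mem_carrier]
  constructor
  · rintro (⟨s, hs, h⟩ | ⟨w, hw, h⟩)
    · rw [hG.st] at h
      obtain ⟨⟨x, p⟩, ⟨hx, hp⟩, rfl⟩ := h
      rw [AO, Finset.mem_filter] at hs
      obtain ⟨h1, h2⟩ := F.strip_top s.1.2 (Ioo_subset_Icc_self hx) (Nat.lt_succ_iff.1 s.2.2) hp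
      exact key (hs.2.imp h1.2 h2.2)
    · rw [hG.wl] at h
      obtain ⟨p, hp, rfl⟩ := h
      rw [BO, Finset.mem_filter] at hw
      obtain ⟨h1, h2⟩ := F.wall_top w.1.2 (Nat.lt_succ_iff.1 w.2.2) hp
      exact key (hw.2.imp h1.2 h2.2)
  · rintro ⟨x, p, rfl, hp⟩
    have hα : Q (x, p) ∈ αᶜ := fun h => absurd (F.le_H _ _ h) hp.not_ge
    rw [F.compl_eq hG, StripSystem.mem_carrier] at hα
    rcases hα with ⟨s, -, hs⟩ | ⟨w, -, hw⟩
    · refine Or.inl ⟨s, ?_, hs⟩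
      rw [hG.st] at hs
      obtain ⟨⟨x', p'⟩, ⟨hx, hp'⟩, h⟩ := hs
      obtain ⟨h1, h2⟩ := F.strip_top s.1.2 (Ioo_subset_Icc_self hx) (Nat.lt_succ_iff.1 s.2.2) hp'
      rw [AO, Finset.mem_filter]
      exact ⟨Finset.mem_univ _, (key' h.symm hp).imp h1.1 h2.1⟩
    · refine Or.inr ⟨w, ?_, hw⟩
      rw [hG.wl] at hw
      obtain ⟨p', hp', h⟩ := hw
      obtain ⟨h1, h2⟩ := F.wall_top w.1.2 (Nat.lt_succ_iff.1 w.2.2) hp'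
      rw [BO, Finset.mem_filter]
      exact ⟨Finset.mem_univ _, (key' h.symm hp).imp h1.1 h2.1⟩

variable (F)

theorem exists_outer_homeo :
    Nonempty ({y | ∃ x p, Q (x, p) = y ∧ F.H x < p} ≃ₜ AddCircle (1 : ℝ) × ℝ) := by
  have hH := F.H_cont
  have hpi := pi_pos
  set e : ℝ × ℝ → ℝ × ℝ := fun z => (2 * π * z.1, F.H (2 * π * z.1) + exp z.2) with he
  have hec : Continuous e := by fun_prop
  have hb' : IsOpenMap e := by
    have h1 : IsOpenMap fun z : ℝ × ℝ => (z.1, exp z.2) :=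
      IsOpenMap.prodMap IsOpenMap.id Real.isOpenEmbedding_exp.isOpenMap
    have c1 : Continuous fun z : ℝ × ℝ => (2 * π * z.1, F.H (2 * π * z.1) + z.2) := by fun_prop
    have c2 : Continuous fun z : ℝ × ℝ => (z.1 / (2 * π), z.2 - F.H z.1) := by fun_prop
    let ψ : ℝ × ℝ ≃ₜ ℝ × ℝ :=
      { toFun := fun z => (2 * π * z.1, F.H (2 * π * z.1) + z.2)
        invFun := fun z => (z.1 / (2 * π), z.2 - F.H z.1)
        left_inv := fun z => by ext <;> simp
        right_inv := fun z => by
          have : 2 * π * (z.1 / (2 * π)) = z.1 := by field_simp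
          simp [this]
        continuous_toFun := c1
        continuous_invFun := c2 }
    exact ψ.isOpenMap.comp h1
  have ha : IsOpenQuotientMap (Prod.map ((↑) : ℝ → AddCircle (1 : ℝ)) (id : ℝ → ℝ)) :=
    (QuotientAddGroup.isOpenQuotientMap_mk).prodMap IsOpenQuotientMap.id
  have hr : range (fun z => Q (e z)) = {y | ∃ x p, Q (x, p) = y ∧ F.H x < p} := by
    ext y
    constructor
    · rintro ⟨z, rfl⟩
      exact ⟨_, _, rfl, by linarith [exp_pos z.2]⟩
    · rintro ⟨x, p, rfl, hp⟩
      refine ⟨(x / (2 * π), log (p - F.H x)), ?_⟩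
      have : 2 * π * (x / (2 * π)) = x := by field_simp
      simp [he, this, exp_log (sub_pos.2 hp)]
  obtain ⟨φ⟩ := exists_homeomorph_range ha (Q_continuous.comp hec) (Q_isOpenMap.comp hb') (by
    rintro ⟨u, y⟩ ⟨u', y'⟩
    simp only [Prod.map, Prod.mk.injEq, id, Function.comp, he]
    constructor
    · rintro ⟨h, rfl⟩
      rw [QuotientAddGroup.eq, AddSubgroup.mem_zmultiples_iff] at h
      obtain ⟨k, hk⟩ := h
      have hu : u' = u + k := by simp at hk; linarith
      subst hu
      rw [show 2 * π * (u + k) = 2 * π * u + k * (2 * π) by ring, F.H_int,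
        show 2 * π * u + k * (2 * π) = 2 * π * u + ((2 * k : ℤ) : ℝ) * π by push_cast; ring]
      have := Q_add_int (2 * π * u) (F.H (2 * π * u) + exp y) (2 * k)
      rw [Even.neg_one_zpow ⟨k, by ring⟩, one_mul] at this
      exact this.symm
    · intro h
      obtain ⟨k, h1, h2⟩ := Q_eq h
      obtain ⟨m, rfl⟩ | ⟨m, rfl⟩ := k.even_or_odd
      · have hu : u' = u + m := by
          have : 2 * π * u' = 2 * π * (u + m) := by rw [h1]; push_cast; ring
          exact mul_left_cancel₀ (by positivity) this
        subst hu
        rw [Even.neg_one_zpow ⟨m, rfl⟩, one_mul,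
          show 2 * π * (u + m) = 2 * π * u + m * (2 * π) by ring, F.H_int] at h2
        refine ⟨?_, (exp_injective (add_left_cancel h2)).symm⟩
        rw [QuotientAddGroup.eq, AddSubgroup.mem_zmultiples_iff]
        exact ⟨m, by simp⟩
      · exfalso
        have h3 : 2 * π * u' = 2 * π * u + π + m * (2 * π) := by rw [h1]; push_cast; ring
        rw [h3, F.H_int, Odd.neg_one_zpow ⟨m, rfl⟩] at h2
        have h4 := F.neg_H_le (F.H_mem (2 * π * u))
        linarith [exp_pos y, exp_pos y'])
  exact ⟨(Homeomorph.setCongr hr.symm).trans φ⟩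

end Front

end

section

namespace Front

variable {α : Set X₂sp} {v : ℕ} {F : Front α v}

open Classical in
theorem Adapted.sum_strips {G : StripSystem X₂sp F.S F.W} {z : F.W → ZMod 2}
    (hz : ∀ s, ∑ w ∈ G.inc Finset.univ s, z w = 0) (T : Finset F.S) :
    ∑ w, (if G.b w ∈ T then z w else 0) = ∑ w, (if G.a w ∈ T then z w else 0) := by
  have h1 : ∀ s, ∑ w ∈ G.inc Finset.univ s, z w =
      ∑ w, ((if G.b w = s then z w else 0) + if G.a w = s then z w else 0) := by
    intro s
    rw [StripSystem.inc, Finset.sum_filter]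
    refine Finset.sum_congr rfl fun w _ => ?_
    have := G.ne w
    unfold StripSystem.Inc
    by_cases ha : G.a w = s
    · have hb : G.b w ≠ s := fun h => this (ha.trans h.symm)
      simp [ha, hb]
    · simp [ha]
  have h2 : ∑ s ∈ T, ∑ w ∈ G.inc Finset.univ s, z w = 0 := Finset.sum_eq_zero fun s _ => hz s
  simp only [h1] at h2
  rw [Finset.sum_comm] at h2
  simp only [Finset.sum_add_distrib, Finset.sum_ite_eq] at h2
  exact CharTwo.add_eq_zero.1 h2

open Classical in
/-- The sum of the values at the walls over `θ i` above `q`. -/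
def above (z : F.W → ZMod 2) (i : ℕ) (q : ℝ) : ZMod 2 :=
  ∑ w : F.W, if (w.1 : ℕ) = i ∧ ∀ p ∈ gap (F.M w.1) (F.f w.1) w.2, q < p then z w else 0

theorem lt_gap_iff (w : F.W) {k : ℕ} (hk : k < F.M w.1) :
    (∀ p ∈ gap (F.M w.1) (F.f w.1) w.2, F.f w.1 k < p) ↔ k < w.2 := by
  obtain ⟨p, hp⟩ := gap_nonempty (F.f_lt w.1 w.1.2) (Nat.lt_succ_iff.1 w.2.2)
  exact ⟨fun h => (gap_lt_iff hp hk).1 (h p hp), fun h p hp => (gap_lt_iff hp hk).2 h⟩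

open Classical in
theorem Adapted.above_step {G : StripSystem X₂sp F.S F.W} (hG : F.Adapted G) {z : F.W → ZMod 2}
    (hz : ∀ s, ∑ w ∈ G.inc Finset.univ s, z w = 0) {i k : ℕ} (hi : i < F.n) (hk : k < F.N i) :
    above z i (F.g i k (F.θ i)) = ∑ w : F.W, if F.prev w.1 = i ∧
      ∀ p ∈ gap (F.M w.1) (F.f w.1) w.2, F.g i k (F.θ (i + 1)) < flip w.1 p then z w else 0 := by
  have h := sum_strips hz (Finset.univ.filter fun s : F.S => (s.1 : ℕ) = i ∧ k < s.2)
  have e1 : above z i (F.g i k (F.θ i)) = _ := (Finset.sum_congr rfl fun w _ => ?_ : _ = ∑ w,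
    (if G.b w ∈ Finset.univ.filter fun s : F.S => (s.1 : ℕ) = i ∧ k < s.2 then z w else 0))
  · rw [e1, h]
    refine Finset.sum_congr rfl fun w _ => ?_
    have hg := hG.a_gap w
    have hf := hG.a_fst w
    obtain ⟨p, hp⟩ := gap_nonempty (F.f_lt w.1 w.1.2) (Nat.lt_succ_iff.1 w.2.2)
    have : (G.a w ∈ Finset.univ.filter fun s : F.S => (s.1 : ℕ) = i ∧ k < s.2) ↔
        (F.prev w.1 = i ∧ ∀ p ∈ gap (F.M w.1) (F.f w.1) w.2,
          F.g i k (F.θ (i + 1)) < flip w.1 p) := by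
      rw [Finset.mem_filter]
      simp only [Finset.mem_univ, true_and, ← hf]
      refine and_congr_right fun h1 => ?_
      subst h1
      exact ⟨fun h p hp => (gap_lt_iff (hg p hp) hk).2 h,
        fun h => (gap_lt_iff (hg p hp) hk).1 (h p hp)⟩
    simp only [this]
  · have hg := hG.b_gap w
    have hf : ((G.b w).1 : ℕ) = w.1 := by rw [hG.b_fst]
    obtain ⟨p, hp⟩ := gap_nonempty (F.f_lt w.1 w.1.2) (Nat.lt_succ_iff.1 w.2.2)
    have : ((w.1 : ℕ) = i ∧ ∀ p ∈ gap (F.M w.1) (F.f w.1) w.2, F.g i k (F.θ i) < p) ↔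
        (G.b w ∈ Finset.univ.filter fun s : F.S => (s.1 : ℕ) = i ∧ k < s.2) := by
      rw [Finset.mem_filter]
      simp only [Finset.mem_univ, true_and, hf]
      refine and_congr_right fun h1 => ?_
      subst h1
      have key : ∀ p ∈ gap (F.M w.1) (F.f w.1) w.2, F.g w.1 k (F.θ w.1) < p ↔ k < (G.b w).2 := by
        intro p hp
        have := gap_lt_iff (hg hp) (k := k) (by rwa [hf])
        simpa only [hf] using this
      exact ⟨fun h => (key p hp).1 (h p hp), fun h p hp => (key p hp).2 h⟩
    simp only [this]

open Classical in
theorem Adapted.parity {G : StripSystem X₂sp F.S F.W} (hG : F.Adapted G) {z : F.W → ZMod 2}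
    (h0 : ∀ w ∈ F.BO, z w = 0) (hz : ∀ s, ∑ w ∈ G.inc Finset.univ s, z w = 0)
    (hN : (∑ w : F.W, if (w.1 : ℕ) = 0 then z w else 0) = 0) : z = 0 := by
  have hn := F.two_le
  obtain ⟨c, hc⟩ := F.conn (fun i q => if i = F.n then above z 0 (-q) else above z i q) (by
    intro q
    rw [if_pos rfl, if_neg (by omega)]) (by
    intro i hi k hk
    show (if i = F.n then above z 0 _ else above z i _) = if i + 1 = F.n then above z 0 _ else above z (i + 1) _
    rw [if_neg hi.ne, hG.above_step hz hi hk]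
    by_cases hi1 : i + 1 = F.n
    · rw [if_pos hi1]
      have hmem := F.g_right i hi k hk
      rw [hi1, F.θ_last, show π = 0 + π by ring, ← neg_neg (F.g i k (0 + π)), Q_add_pi,
        ← F.θ_zero] at hmem
      obtain ⟨k', hk', hf⟩ := (F.mem_f 0 (by omega) _).1 hmem
      have hg : F.g i k (F.θ (i + 1)) = -F.f 0 k' := by
        rw [hf, neg_neg, hi1, F.θ_last, F.θ_zero, zero_add]
      rw [hg, neg_neg]
      refine CharTwo.add_eq_zero.1 ?_
      rw [above, ← Finset.sum_add_distrib]
      refine Eq.trans (Finset.sum_congr rfl fun w _ => ?_) hN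
      by_cases hw : (w.1 : ℕ) = 0
      · have hpr : F.prev w.1 = i := by
          rw [prev, if_pos hw]
          omega
        obtain ⟨⟨j, hj⟩, m⟩ := w
        simp only at hw
        subst hw
        have e := lt_gap_iff (F := F) ⟨⟨0, hj⟩, m⟩ hk'
        simp only at e
        simp only [hpr, true_and, if_true, flip, neg_lt_neg_iff, e]
        obtain ⟨p, hp⟩ := gap_nonempty (F.f_lt 0 hj) (Nat.lt_succ_iff.1 m.2)
        have e' : (∀ p ∈ gap (F.M 0) (F.f 0) m, p < F.f 0 k') ↔ ¬ k' < (m : ℕ) := by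
          constructor
          · intro h hlt
            exact lt_asymm (h p hp) (hp.1 k' hlt)
          · intro h p hp
            exact hp.2 k' (by omega) hk'
        simp only [e']
        by_cases hm : k' < (m : ℕ) <;> simp [hm]
      · have hpr : F.prev w.1 ≠ i := by
          rw [prev, if_neg hw]
          have := w.1.2
          omega
        simp [hw, hpr]
    · rw [if_neg hi1, above]
      refine Finset.sum_congr rfl fun w _ => ?_
      by_cases hw : (w.1 : ℕ) = 0
      · have hpr : F.prev w.1 ≠ i := by
          rw [prev, if_pos hw]
          omega
        have : ¬ (w.1 : ℕ) = i + 1 := by omega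
        simp [hpr, this]
      · have hpr : F.prev w.1 = i ↔ (w.1 : ℕ) = i + 1 := by
          rw [prev, if_neg hw]
          omega
        have hfl : ∀ p, Front.flip w.1 p = p := fun p => by simp [Front.flip, hw]
        simp only [hpr, hfl])
  have hc' : ∀ i < F.n, ∀ k < F.M i,
      ∑ w : F.W, (if (w.1 : ℕ) = i ∧ k < (w.2 : ℕ) then z w else 0) = c := by
    intro i hi k hk
    rw [← hc i hi k hk, if_neg hi.ne, above]
    refine Finset.sum_congr rfl fun w _ => ?_
    by_cases hw : (w.1 : ℕ) = i
    · subst hw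
      simp only [lt_gap_iff w hk]
    · simp [hw]
  have hlast : ∀ i < F.n,
      ∑ w : F.W, (if (w.1 : ℕ) = i ∧ F.M i - 1 < (w.2 : ℕ) then z w else 0) = 0 := by
    intro i hi
    refine Finset.sum_eq_zero fun w _ => ?_
    split_ifs with h
    · obtain ⟨rfl, h⟩ := h
      refine h0 w ?_
      rw [BO, Finset.mem_filter]
      have := w.2.2
      exact ⟨Finset.mem_univ _, Or.inl (by omega)⟩
    · rfl
  have hc0 : c = 0 := by
    rw [← hc' 0 (by omega) (F.M 0 - 1) (by have := F.M_pos (show 0 < F.n by omega); omega),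
      hlast 0 (by omega)]
  subst hc0
  funext w
  by_cases hw : w ∈ F.BO
  · exact h0 w hw
  rw [BO, Finset.mem_filter] at hw
  push Not at hw
  obtain ⟨h1, h2⟩ := hw (Finset.mem_univ _)
  have hlt : (w.2 : ℕ) < F.M w.1 := by
    have := w.2.2
    omega
  have e1 := hc' w.1 w.1.2 w.2 hlt
  have e2 := hc' w.1 w.1.2 (w.2 - 1) (by omega)
  have : ∑ u : F.W, (if (u.1 : ℕ) = w.1 ∧ (w.2 : ℕ) - 1 < (u.2 : ℕ) then z u else 0) =
      ∑ u : F.W, (if (u.1 : ℕ) = w.1 ∧ (w.2 : ℕ) < (u.2 : ℕ) then z u else 0) +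
        ∑ u : F.W, (if u = w then z u else 0) := by
    rw [← Finset.sum_add_distrib]
    refine Finset.sum_congr rfl fun u _ => ?_
    by_cases huw : u = w
    · subst huw
      have : (u.2 : ℕ) - 1 < u.2 := by omega
      simp [this]
    · have : ((u.1 : ℕ) = w.1 ∧ (w.2 : ℕ) - 1 < (u.2 : ℕ)) ↔
          ((u.1 : ℕ) = w.1 ∧ (w.2 : ℕ) < (u.2 : ℕ)) := by
        refine and_congr_right fun h => ?_
        have hne : (u.2 : ℕ) ≠ w.2 := by
          intro h'
          apply huw
          obtain ⟨⟨i, hi⟩, ⟨m, hm⟩⟩ := u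
          obtain ⟨⟨i', hi'⟩, ⟨m', hm'⟩⟩ := w
          simp only at h h'
          subst h h'
          rfl
        omega
      simp only [this, huw, if_false, add_zero]
  rw [e1, e2, Finset.sum_ite_eq' Finset.univ w z] at this
  simpa using this.symm

theorem count (F : Front α v) :
    Nat.card {C : ConnectedComponents ↥αᶜ |
        SimplyConnectedSpace ↥(ConnectedComponents.mk ⁻¹' {C} : Set ↥αᶜ)} = v ∧
      (Nat.card (ConnectedComponents ↥αᶜ) = v + 1 ∨ Nat.card (ConnectedComponents ↥αᶜ) = v + 2) ∧
      (Nat.card (ConnectedComponents ↥αᶜ) = v + 2 ↔ ∃ C : ConnectedComponents ↥αᶜ,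
        Nonempty (↥(ConnectedComponents.mk ⁻¹' {C} : Set ↥αᶜ) ≃ₜ MobiusBand)) := by
  classical
  obtain ⟨G, hG⟩ := F.exists_adapted
  refine G.count hG.hasBoxes (F.compl_eq hG) F.card_eq hG.outer F.AO_card ?_ ?_
  · rw [hG.carrier_outer]
    exact F.exists_outer_homeo
  · intro z h0 hz hN
    refine hG.parity h0 hz ?_
    rw [Finset.sum_filter] at hN
    refine Eq.trans (Finset.sum_congr rfl fun w _ => ?_) hN
    have : G.η w = -1 ↔ (w.1 : ℕ) = 0 := by
      rw [hG.η]
      split_ifs with h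
      · simp [h]
      · simp [h]
        norm_num
    simp only [this]

end Front

end

section

/-- `e 0 < ⋯ < e n` are the points of `S` in `[a, b]`. -/
structure Subdiv (S : Set ℝ) (a b : ℝ) (n : ℕ) (e : ℕ → ℝ) : Prop where
  pos : 0 < n
  zero : e 0 = a
  last : e n = b
  lt : ∀ i < n, e i < e (i + 1)
  mem : ∀ i ≤ n, e i ∈ S
  notMem : ∀ i < n, ∀ x ∈ Ioo (e i) (e (i + 1)), x ∉ S

theorem exists_subdiv {S : Set ℝ} {a b : ℝ} (hab : a < b) (hS : (S ∩ Icc a b).Finite) (ha : a ∈ S)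
    (hb : b ∈ S) : ∃ n e, Subdiv S a b n e := by
  obtain ⟨N, hN⟩ : ∃ N, (S ∩ Ioo a b).ncard = N := ⟨_, rfl⟩
  induction N using Nat.strong_induction_on generalizing a with
  | _ N ih =>
    have hfin : (S ∩ Ioo a b).Finite :=
      hS.subset (inter_subset_inter_right _ Ioo_subset_Icc_self)
    by_cases hne : (S ∩ Ioo a b).Nonempty
    · obtain ⟨c, hc, hmin⟩ := hfin.exists_minimal hne
      have hmin' : ∀ x ∈ S, x ∈ Ioo a b → c ≤ x := by
        intro x hx hx'
        rcases le_total c x with h | h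
        · exact h
        · exact hmin ⟨hx, hx'⟩ h
      have hsub : S ∩ Ioo c b ⊂ S ∩ Ioo a b := by
        refine ⟨fun x hx => ⟨hx.1, hc.2.1.trans hx.2.1, hx.2.2⟩, fun h => ?_⟩
        exact lt_irrefl _ (h hc).2.1
      obtain ⟨n, e, he⟩ := ih _ (hN ▸ ncard_lt_ncard hsub hfin) hc.2.2
        (hS.subset fun x hx => ⟨hx.1, hc.2.1.le.trans hx.2.1, hx.2.2⟩) hc.1 rfl
      refine ⟨n + 1, fun i => if i = 0 then a else e (i - 1), n.succ_pos, by simp, by simp [he.last],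
        ?_, ?_, ?_⟩
      · rintro (_ | i) hi
        · simpa [he.zero] using hc.2.1
        · simpa using he.lt i (by omega)
      · rintro (_ | i) hi
        · simpa using ha
        · simpa using he.mem i (by omega)
      · rintro (_ | i) hi x hx
        · intro hxS
          simp [he.zero] at hx
          exact absurd (hmin' x hxS ⟨hx.1, hx.2.trans hc.2.2⟩) (not_le.2 hx.2)
        · exact he.notMem i (by omega) x (by simpa using hx)
    · rw [not_nonempty_iff_eq_empty] at hne
      refine ⟨1, fun i => if i = 0 then a else b, one_pos, by simp, by simp, ?_, ?_, ?_⟩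
      · intro i hi
        obtain rfl : i = 0 := by omega
        simpa using hab
      · intro i _
        by_cases h : i = 0 <;> simp [h, ha, hb]
      · intro i hi x hx hxS
        obtain rfl : i = 0 := by omega
        simp at hx
        exact (hne ▸ (⟨hxS, hx⟩ : x ∈ S ∩ Ioo a b) : x ∈ (∅ : Set ℝ))

namespace Subdiv

variable {S : Set ℝ} {a b : ℝ} {n : ℕ} {e : ℕ → ℝ}

theorem strict (h : Subdiv S a b n e) {i j : ℕ} (hij : i < j) (hj : j ≤ n) : e i < e j := by
  induction j, hij using Nat.le_induction with
  | base => exact h.lt i (by omega)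
  | succ j hij ih => exact (ih (by omega)).trans (h.lt j (by omega))

theorem mono (h : Subdiv S a b n e) {i j : ℕ} (hij : i ≤ j) (hj : j ≤ n) : e i ≤ e j := by
  rcases hij.eq_or_lt with rfl | hij
  · exact le_rfl
  · exact (h.strict hij hj).le

theorem cover (h : Subdiv S a b n e) {x : ℝ} (hx : x ∈ Ico a b) :
    ∃ i < n, x ∈ Ico (e i) (e (i + 1)) := by
  by_contra! hc
  have : ∀ i ≤ n, e i ≤ x := by
    intro i
    induction i with
    | zero => exact fun _ => h.zero ▸ hx.1
    | succ i ih =>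
      intro hi
      by_contra! hlt
      exact hc i (by omega) ⟨ih (by omega), hlt⟩
  exact absurd (this n le_rfl) (not_le.2 (h.last ▸ hx.2))

theorem cover' (h : Subdiv S a b n e) {x : ℝ} (hx : x ∈ Ico a b) (hS : x ∉ S) :
    ∃ i < n, x ∈ Ioo (e i) (e (i + 1)) := by
  obtain ⟨i, hi, hx⟩ := h.cover hx
  exact ⟨i, hi, lt_of_le_of_ne hx.1 fun he => hS (he ▸ h.mem i hi.le), hx.2⟩

theorem exists_eq (h : Subdiv S a b n e) {x : ℝ} (hx : x ∈ Ico a b) (hS : x ∈ S) :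
    ∃ i < n, e i = x := by
  obtain ⟨i, hi, hx⟩ := h.cover hx
  refine ⟨i, hi, by_contra fun hne => ?_⟩
  exact h.notMem i hi x ⟨lt_of_le_of_ne hx.1 hne, hx.2⟩ hS

theorem mem_Ico (h : Subdiv S a b n e) {i : ℕ} (hi : i < n) : e i ∈ Ico a b :=
  ⟨h.zero ▸ h.mono i.zero_le hi.le, h.last ▸ h.strict hi le_rfl⟩

theorem Ioo_subset (h : Subdiv S a b n e) {i : ℕ} (hi : i < n) :
    Ioo (e i) (e (i + 1)) ⊆ Ico a b := fun _ hx =>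
  ⟨(h.mem_Ico hi).1.trans hx.1.le, hx.2.trans_le (h.last ▸ h.mono hi le_rfl)⟩

theorem unique (h : Subdiv S a b n e) {i j : ℕ} (hi : i < n) (hj : j < n) {x : ℝ}
    (hxi : x ∈ Ioo (e i) (e (i + 1))) (hxj : x ∈ Ioo (e j) (e (j + 1))) : i = j := by
  rcases lt_trichotomy i j with hij | hij | hij
  · have := h.mono (show i + 1 ≤ j by omega) hj.le
    linarith [hxi.2, hxj.1]
  · exact hij
  · have := h.mono (show j + 1 ≤ i by omega) hi.le
    linarith [hxj.2, hxi.1]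

end Subdiv

theorem exists_sorted {ι : Type*} [Inhabited ι] (E : Finset ι) (q : ι → ℝ) (hq : InjOn q E) :
    ∃ e : ℕ → ι, (∀ k < E.card, e k ∈ E) ∧ (∀ j ∈ E, ∃ k < E.card, e k = j) ∧
      ∀ k k', k < k' → k' < E.card → q (e k) < q (e k') := by
  classical
  have hc : (E.image q).card = E.card := Finset.card_image_of_injOn hq
  set o := (E.image q).orderEmbOfFin hc
  have hmem : ∀ k : Fin E.card, ∃ j ∈ E, q j = o k := fun k => by
    have := (E.image q).orderEmbOfFin_mem hc k
    rwa [Finset.mem_image] at this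
  choose r hr hq' using hmem
  refine ⟨fun k => if h : k < E.card then r ⟨k, h⟩ else default, fun k hk => ?_, fun j hj => ?_,
    fun k k' h h' => ?_⟩
  · simp only [dif_pos hk]
    exact hr _
  · have : q j ∈ range o := by
      rw [Finset.range_orderEmbOfFin]
      exact Finset.mem_coe.2 (Finset.mem_image_of_mem q hj)
    obtain ⟨k, hk⟩ := this
    refine ⟨k, k.2, ?_⟩
    simp only [dif_pos k.2]
    exact hq (hr _) hj ((hq' _).trans hk)
  · simp only [dif_pos h', dif_pos (h.trans h'), hq']
    exact o.strictMono h

theorem exists_sorted_functions (E : Finset ℕ) {G : ℕ → ℝ → ℝ} (hG : ∀ j, Continuous (G j))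
    {a b : ℝ} (hab : a < b)
    (hne : ∀ j ∈ E, ∀ j' ∈ E, j ≠ j' → ∀ x ∈ Ioo a b, G j x ≠ G j' x) :
    ∃ e : ℕ → ℕ, (∀ k < E.card, e k ∈ E) ∧ (∀ j ∈ E, ∃ k < E.card, e k = j) ∧
      ∀ x ∈ Ioo a b, ∀ k k', k < k' → k' < E.card → G (e k) x < G (e k') x := by
  have hm : (a + b) / 2 ∈ Ioo a b := ⟨by linarith, by linarith⟩
  obtain ⟨e, h1, h2, h3⟩ := exists_sorted E (fun j => G j ((a + b) / 2)) (by
    intro j hj j' hj' h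
    by_contra hjj
    exact hne j hj j' hj' hjj _ hm h)
  refine ⟨e, h1, h2, fun x hx k k' hk hk' => ?_⟩
  have h0 := h3 k k' hk hk'
  have hkk : e k ≠ e k' := fun h => by rw [h] at h0; exact lt_irrefl _ h0
  by_contra! hle
  have hcon : ContinuousOn (fun x => G (e k') x - G (e k) x) (Ioo a b) :=
    ((hG _).sub (hG _)).continuousOn
  obtain ⟨y, hy, hy0⟩ := isPreconnected_Ioo.intermediate_value hx hm hcon
    (show (0 : ℝ) ∈ Icc _ _ from ⟨by linarith, by linarith⟩)
  exact hne _ (h1 k (hk.trans hk')) _ (h1 k' hk') hkk y hy (by linarith)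

theorem exists_inverse {ψ : ℝ → ℝ} {a b x y : ℝ} (hab : a ≤ b) (hxy : x ≤ y)
    (hc : Continuous ψ) (hi : InjOn ψ (Icc a b))
    (he : (ψ a = x ∧ ψ b = y) ∨ (ψ a = y ∧ ψ b = x)) :
    ∃ τ : ℝ → ℝ, Continuous τ ∧ (∀ u, τ u ∈ Icc a b) ∧ ∀ u ∈ Icc x y, ψ (τ u) = u := by
  set f : Icc a b → ℝ := fun t => ψ t with hf
  have hfc : Continuous f := hc.comp continuous_subtype_val
  have hfi : Function.Injective f := fun s t h => Subtype.ext (hi s.2 t.2 h)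
  have hemb : IsClosedEmbedding f := hfc.isClosedEmbedding hfi
  have hr : ∀ u ∈ Icc x y, u ∈ range f := by
    intro u hu
    have h1 : u ∈ uIcc (ψ a) (ψ b) := by
      rcases he with ⟨h1, h2⟩ | ⟨h1, h2⟩
      · rw [h1, h2, uIcc_of_le hxy]
        exact hu
      · rw [h1, h2, uIcc_comm, uIcc_of_le hxy]
        exact hu
    obtain ⟨t, ht, htu⟩ := intermediate_value_uIcc hc.continuousOn h1
    rw [uIcc_of_le hab] at ht
    exact ⟨⟨t, ht⟩, htu⟩
  set T := hemb.isEmbedding.toHomeomorph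
  refine ⟨fun u => T.symm ⟨projIcc x y hxy u, hr _ (projIcc x y hxy u).2⟩, ?_,
    fun u => Subtype.coe_prop _, fun u hu => ?_⟩
  · refine continuous_subtype_val.comp (T.symm.continuous.comp (Continuous.subtype_mk ?_ _))
    exact continuous_subtype_val.comp continuous_projIcc
  · have := congrArg Subtype.val (T.apply_symm_apply
      ⟨projIcc x y hxy u, hr _ (projIcc x y hxy u).2⟩)
    exact this.trans (congrArg Subtype.val (projIcc_of_mem hxy hu))

end

section

/-- A set of lines described by a closed path of lines, with its set `DT` of double points. -/
structure Leg (α : Set X₂sp) (DT : Finset X₂sp) where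
  φ : ℝ → ℝ
  h : ℝ → ℝ
  φ_cont : Continuous φ
  h_cont : Continuous h
  per : ∀ t, Q (φ (t + 1), h (t + 1)) = Q (φ t, h t)
  mem : ∀ z, z ∈ α ↔ ∃ t, Q (φ t, h t) = z
  Z : Set ℝ
  Z_fin : ∀ a b, (Z ∩ Icc a b).Finite
  Z_img : {z | ∃ t ∈ Z, Q (φ t, h t) = z}.Finite
  inj : ∀ a b, (∀ t ∈ Ioo a b, t ∉ Z) → InjOn φ (Icc a b)
  DT_sub : ∀ z ∈ DT, z ∈ α
  fib : ∀ a, ∀ z ∈ α, (z ∈ DT → {s | s ∈ Ico a (a + 1) ∧ Q (φ s, h s) = z}.ncard = 2) ∧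
    (z ∉ DT → {s | s ∈ Ico a (a + 1) ∧ Q (φ s, h s) = z}.ncard = 1)
  H : ℝ → ℝ
  H_cont : Continuous H
  H_per : ∀ x, H (x + 2 * π) = H x
  le_H : ∀ x p, Q (x, p) ∈ α → p ≤ H x
  H_mem : ∀ x, Q (x, H x) ∈ α

theorem finite_translates (y a b : ℝ) {c : ℝ} (hc : 0 < c) :
    {x | x ∈ Icc a b ∧ ∃ k : ℤ, x = y + k * c}.Finite := by
  refine ((Set.finite_Icc ⌊(a - y) / c⌋ ⌈(b - y) / c⌉).image fun k : ℤ => y + k * c).subset ?_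
  rintro x ⟨hx, k, rfl⟩
  refine ⟨k, ⟨Int.floor_le_iff.2 ?_, Int.le_ceil_iff.2 ?_⟩, rfl⟩
  · rw [div_lt_iff₀ hc]
    nlinarith [hx.1]
  · rw [lt_div_iff₀ hc]
    nlinarith [hx.2]

theorem neg_one_zpow_mul_self (k : ℤ) (p : ℝ) : (-1) ^ k * ((-1) ^ k * p) = p := by
  rw [← mul_assoc, ← mul_zpow]
  simp

theorem Q_sub_int (x p : ℝ) (k : ℤ) : Q (x, (-1) ^ k * p) = Q (x + k * π, p) := by
  rw [← Q_add_int x _ k, neg_one_zpow_mul_self]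

namespace Leg

variable {α : Set X₂sp} {DT : Finset X₂sp} (L : Leg α DT)

/-- The line with parameter `t`. -/
def T (t : ℝ) : X₂sp := Q (L.φ t, L.h t)

theorem T_add_int (t : ℝ) (k : ℤ) : L.T (t + k) = L.T t := by
  induction k using Int.induction_on with
  | zero => simp
  | succ k ih =>
    rw [← ih, Int.cast_add, Int.cast_one, ← add_assoc]
    exact L.per _
  | pred k ih =>
    rw [← ih]
    have := L.per (t + ((-(k : ℤ) - 1 : ℤ) : ℝ))
    rw [show t + ((-(k : ℤ) - 1 : ℤ) : ℝ) + 1 = t + ((-(k : ℤ) : ℤ) : ℝ) by push_cast; ring] at this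
    exact this.symm

theorem exists_T {z : X₂sp} (hz : z ∈ α) (a : ℝ) : ∃ t ∈ Ico a (a + 1), L.T t = z := by
  obtain ⟨t, ht⟩ := (L.mem z).1 hz
  refine ⟨t + (-⌊t - a⌋ : ℤ), ⟨?_, ?_⟩, (L.T_add_int _ _).trans ht⟩
  · push_cast
    linarith [Int.floor_le (t - a)]
  · push_cast
    linarith [Int.lt_floor_add_one (t - a)]

theorem T_mem (t : ℝ) : L.T t ∈ α := (L.mem _).2 ⟨t, rfl⟩

theorem T_inj {a s t : ℝ} (hs : s ∈ Ico a (a + 1)) (ht : t ∈ Ico a (a + 1)) (h : L.T s = L.T t)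
    (hd : L.T s ∉ DT) : s = t := by
  have := (L.fib a _ (L.T_mem s)).2 hd
  obtain ⟨u, hu⟩ := ncard_eq_one.1 this
  have h1 : s ∈ ({u} : Set ℝ) := hu ▸ (⟨hs, rfl⟩ : s ∈ {s' | s' ∈ Ico a (a + 1) ∧ L.T s' = L.T s})
  have h2 : t ∈ ({u} : Set ℝ) :=
    hu ▸ (⟨ht, h.symm⟩ : t ∈ {s' | s' ∈ Ico a (a + 1) ∧ L.T s' = L.T s})
  rw [mem_singleton_iff] at h1 h2
  rw [h1, h2]

/-- The directions of special lines. -/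
def D : Set ℝ :=
  {x | (∃ p, Q (x, p) ∈ (DT : Set X₂sp) ∪ {z | ∃ t ∈ L.Z, Q (L.φ t, L.h t) = z}) ∨ sin (2 * x) = 0}

theorem mem_D_add {x : ℝ} (k : ℤ) (hx : x ∈ L.D) : x + k * π ∈ L.D := by
  rcases hx with ⟨p, hp⟩ | hx
  · exact Or.inl ⟨(-1) ^ k * p, by rwa [Q_add_int]⟩
  · right
    rw [show 2 * (x + k * π) = 2 * x + k * (2 * π) by ring, sin_add_int_mul_two_pi]
    exact hx

theorem mem_D_add_iff {x : ℝ} (k : ℤ) : x + k * π ∈ L.D ↔ x ∈ L.D :=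
  ⟨fun h => by simpa using L.mem_D_add (-k) h, L.mem_D_add k⟩

theorem D_finite (a b : ℝ) : (L.D ∩ Icc a b).Finite := by
  set S : Set X₂sp := (DT : Set X₂sp) ∪ {z | ∃ t ∈ L.Z, Q (L.φ t, L.h t) = z} with hS
  have hSf : S.Finite := DT.finite_toSet.union L.Z_img
  have h1 : (⋃ z ∈ S, {x | x ∈ Icc a b ∧ ∃ p, Q (x, p) = z}).Finite := by
    refine hSf.biUnion fun z _ => ?_
    obtain ⟨⟨y, q⟩, rfl⟩ := Q_surjective z
    refine (finite_translates y a b pi_pos).subset ?_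
    rintro x ⟨hx, p, hp⟩
    obtain ⟨k, hk, -⟩ := Q_eq hp.symm
    exact ⟨hx, k, hk⟩
  refine (h1.union (finite_translates 0 a b (half_pos pi_pos))).subset ?_
  rintro x ⟨⟨p, hp⟩ | hx, hab⟩
  · exact Or.inl (mem_biUnion hp ⟨hab, p, rfl⟩)
  · obtain ⟨k, hk⟩ := sin_eq_zero_iff.1 hx
    exact Or.inr ⟨hab, k, by linarith⟩

/-- The parameters of lines in special directions. -/
def B : Set ℝ := {t | L.φ t ∈ L.D}

theorem Z_subset : L.Z ⊆ L.B := fun t ht => Or.inl ⟨L.h t, Or.inr ⟨t, ht, rfl⟩⟩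

theorem mem_B_of_DT {t : ℝ} (h : L.T t ∈ DT) : t ∈ L.B := Or.inl ⟨L.h t, Or.inl h⟩

theorem mem_B_congr {s t : ℝ} (h : L.T s = L.T t) (hs : s ∈ L.B) : t ∈ L.B := by
  obtain ⟨k, hk, -⟩ := Q_eq h
  rw [B, mem_ofPred_eq, hk]
  exact L.mem_D_add k hs

theorem B_finite {a b : ℝ} (hab : a < b) : (L.B ∩ Icc a b).Finite := by
  obtain ⟨n, e, he⟩ := exists_subdiv (S := L.Z ∪ {a, b}) hab
    (by
      rw [union_inter_distrib_right]
      exact (L.Z_fin a b).union ((toFinite {a, b}).inter_of_left _)) (by simp) (by simp)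
  have h1 : (⋃ i ∈ Finset.range n, L.B ∩ Icc (e i) (e (i + 1))).Finite := by
    refine (Finset.range n).finite_toSet.biUnion fun i hi => ?_
    have hi : i < n := by simpa using hi
    obtain ⟨R, hR⟩ := ((isCompact_Icc (a := e i) (b := e (i + 1))).image
      L.φ_cont).isBounded.subset_closedBall 0
    refine Finite.of_injOn (f := L.φ) (t := L.D ∩ Icc (0 - R) (0 + R)) ?_ ?_ (L.D_finite _ _)
    · rintro t ⟨ht, htI⟩
      rw [← Real.closedBall_eq_Icc]
      exact ⟨ht, hR (mem_image_of_mem _ htI)⟩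
    · exact (L.inj _ _ fun t ht hZ => he.notMem i hi t ht (Or.inl hZ)).mono inter_subset_right
  refine (h1.union (toFinite {b})).subset ?_
  rintro t ⟨ht, hta, htb⟩
  rcases htb.eq_or_lt with rfl | htb
  · exact Or.inr rfl
  · obtain ⟨i, hi, hti⟩ := he.cover ⟨hta, htb⟩
    exact Or.inl (mem_biUnion (Finset.mem_coe.2 (Finset.mem_range.2 hi))
      ⟨ht, Ico_subset_Icc_self hti⟩)

theorem exists_mem_B : ∃ t, t ∈ L.B := by
  obtain ⟨t, ht⟩ := (L.mem _).1 (L.H_mem 0)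
  obtain ⟨k, hk, -⟩ := Q_eq ht.symm
  refine ⟨t, ?_⟩
  rw [B, mem_ofPred_eq, hk]
  exact L.mem_D_add k (Or.inr (by simp))

theorem exists_angles : ∃ n θ, 2 ≤ n ∧ Subdiv L.D 0 π n θ := by
  obtain ⟨n, θ, h⟩ := exists_subdiv pi_pos (L.D_finite 0 π) (Or.inr (by simp))
    (Or.inr (by simp))
  refine ⟨n, θ, ?_, h⟩
  by_contra! hn
  have hn1 : n = 1 := by
    have := h.pos
    omega
  subst hn1
  refine h.notMem 0 one_pos (π / 2) ?_ (Or.inr ?_)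
  · rw [h.zero, h.last]
    constructor <;> linarith [pi_pos]
  · rw [mul_div_cancel₀ _ two_ne_zero, sin_pi]

theorem exists_arc {n m j : ℕ} {θ b : ℕ → ℝ} {a c : ℝ} (hθ : Subdiv L.D 0 π n θ)
    (hb : Subdiv L.B a c m b) (hj : j < m) :
    ∃ i < n, ∃ k : ℤ, ∃ τ : ℝ → ℝ, Continuous τ ∧
      (∀ u ∈ Icc (θ i) (θ (i + 1)), L.φ (τ u) = u + k * π) ∧
      (∀ t ∈ Ioo (b j) (b (j + 1)), L.φ t - k * π ∈ Ioo (θ i) (θ (i + 1))) ∧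
      (∀ u ∈ Icc (θ i) (θ (i + 1)), τ u ∈ Icc (b j) (b (j + 1))) ∧
      ((τ (θ i) = b j ∧ τ (θ (i + 1)) = b (j + 1)) ∨
        (τ (θ i) = b (j + 1) ∧ τ (θ (i + 1)) = b j)) := by
  have hlt := hb.lt j hj
  have hpi := pi_pos
  have hmid : (b j + b (j + 1)) / 2 ∈ Ioo (b j) (b (j + 1)) := ⟨by linarith, by linarith⟩
  set t₀ := (b j + b (j + 1)) / 2
  set k : ℤ := ⌊L.φ t₀ / π⌋
  have hsub : ∀ t, t ∈ Ioo (b j) (b (j + 1)) → L.φ t - k * π ∉ L.D := fun t ht hD => by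
    have := L.mem_D_add k hD
    rw [sub_add_cancel] at this
    exact hb.notMem j hj t ht this
  have h0 : L.φ t₀ - k * π ∈ Ico 0 π := by
    have h1 := Int.floor_le (L.φ t₀ / π)
    have h2 := Int.lt_floor_add_one (L.φ t₀ / π)
    rw [le_div_iff₀ hpi] at h1
    rw [div_lt_iff₀ hpi] at h2
    exact ⟨by linarith, by linarith⟩
  obtain ⟨i, hi, hI⟩ := hθ.cover' h0 (hsub _ hmid)
  have hcon : Continuous fun t => L.φ t - k * π := L.φ_cont.sub continuous_const
  have hIoo : ∀ t ∈ Ioo (b j) (b (j + 1)), L.φ t - k * π ∈ Ioo (θ i) (θ (i + 1)) := by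
    intro t ht
    by_contra hn
    rw [mem_Ioo, not_and_or, not_lt, not_lt] at hn
    rcases hn with hn | hn
    · obtain ⟨s, hs, hsv⟩ := isPreconnected_Ioo.intermediate_value ht hmid hcon.continuousOn
        (show θ i ∈ Icc _ _ from ⟨hn, hI.1.le⟩)
      exact hsub s hs ((show _ = _ from hsv : L.φ s - k * π = θ i) ▸ hθ.mem i hi.le)
    · obtain ⟨s, hs, hsv⟩ := isPreconnected_Ioo.intermediate_value hmid ht hcon.continuousOn
        (show θ (i + 1) ∈ Icc _ _ from ⟨hI.2.le, hn⟩)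
      exact hsub s hs ((show _ = _ from hsv : L.φ s - k * π = θ (i + 1)) ▸ hθ.mem (i + 1) hi)
  have hinj : InjOn (fun t => L.φ t - k * π) (Icc (b j) (b (j + 1))) := by
    intro s hs t ht hst
    exact L.inj _ _ (fun t ht hZ => hb.notMem j hj t ht (L.Z_subset hZ)) hs ht (by simpa using hst)
  have hIcc : MapsTo (fun t => L.φ t - k * π) (Icc (b j) (b (j + 1)))
      (Icc (θ i) (θ (i + 1))) := by
    rw [← closure_Ioo hlt.ne, ← closure_Ioo (hθ.lt i hi).ne]
    exact MapsTo.closure hIoo hcon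
  have hend : ∀ t ∈ Icc (b j) (b (j + 1)), t ∈ L.B →
      L.φ t - k * π = θ i ∨ L.φ t - k * π = θ (i + 1) := by
    intro t ht htB
    have hD : L.φ t - k * π ∈ L.D := by
      have := L.mem_D_add (-k) htB
      simpa [sub_eq_add_neg] using this
    by_contra! hn
    have := hIcc ht
    exact hθ.notMem i hi _ ⟨lt_of_le_of_ne this.1 hn.1.symm, lt_of_le_of_ne this.2 hn.2⟩ hD
  have hl : b j ∈ Icc (b j) (b (j + 1)) := left_mem_Icc.2 hlt.le
  have hr : b (j + 1) ∈ Icc (b j) (b (j + 1)) := right_mem_Icc.2 hlt.le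
  have hne : L.φ (b j) - k * π ≠ L.φ (b (j + 1)) - k * π := fun h => hlt.ne (hinj hl hr h)
  have he : (L.φ (b j) - k * π = θ i ∧ L.φ (b (j + 1)) - k * π = θ (i + 1)) ∨
      (L.φ (b j) - k * π = θ (i + 1) ∧ L.φ (b (j + 1)) - k * π = θ i) := by
    rcases hend _ hl (hb.mem j hj.le) with h1 | h1 <;>
      rcases hend _ hr (hb.mem (j + 1) hj) with h2 | h2
    · exact absurd (h1.trans h2.symm) hne
    · exact Or.inl ⟨h1, h2⟩
    · exact Or.inr ⟨h1, h2⟩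
    · exact absurd (h1.trans h2.symm) hne
  obtain ⟨τ, hτ, hτm, hτφ⟩ := exists_inverse hlt.le (hθ.lt i hi).le hcon hinj he
  have hθl : θ i ∈ Icc (θ i) (θ (i + 1)) := left_mem_Icc.2 (hθ.lt i hi).le
  have hθr : θ (i + 1) ∈ Icc (θ i) (θ (i + 1)) := right_mem_Icc.2 (hθ.lt i hi).le
  refine ⟨i, hi, k, τ, hτ, fun u hu => by linarith [hτφ u hu], hIoo, fun u _ => hτm u, ?_⟩
  rcases he with ⟨h1, h2⟩ | ⟨h1, h2⟩
  · exact Or.inl ⟨hinj (hτm _) hl ((hτφ _ hθl).trans h1.symm),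
      hinj (hτm _) hr ((hτφ _ hθr).trans h2.symm)⟩
  · exact Or.inr ⟨hinj (hτm _) hr ((hτφ _ hθl).trans h2.symm),
      hinj (hτm _) hl ((hτφ _ hθr).trans h1.symm)⟩

end Leg

end

section

theorem Subdiv.sheet_eq {S : Set ℝ} {n : ℕ} {θ : ℕ → ℝ} (hθ : Subdiv S 0 π n θ)
    {P : ℕ → ℝ → ZMod 2} (hP : ∀ q, P n q = P 0 (-q)) {i i' : ℕ} {k k' : ℤ} (hi : i ≤ n)
    (hi' : i' ≤ n) (hk : k ≤ k') (h : θ i + k * π = θ i' + k' * π) (q : ℝ) :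
    P i ((-1) ^ k * q) = P i' ((-1) ^ k' * q) := by
  have hpi := pi_pos
  rcases hk.eq_or_lt with rfl | hk
  · have : i = i' := by
      rcases lt_trichotomy i i' with h' | h' | h'
      · linarith [hθ.strict h' hi']
      · exact h'
      · linarith [hθ.strict h' hi]
    rw [this]
  · have h0 : 0 ≤ θ i' := hθ.zero ▸ hθ.mono i'.zero_le hi'
    have h1 : θ i ≤ π := hθ.last ▸ hθ.mono hi le_rfl
    have hk1 : k' = k + 1 := by
      by_contra hne
      have : k + 2 ≤ k' := by omega
      have : (k : ℝ) + 2 ≤ k' := by exact_mod_cast this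
      nlinarith
    subst hk1
    push_cast at h
    have hin : i = n := by
      by_contra hne
      have := hθ.strict (lt_of_le_of_ne hi hne) le_rfl
      rw [hθ.last] at this
      linarith
    have hi0 : i' = 0 := by
      by_contra hne
      have := hθ.strict (Nat.pos_of_ne_zero hne) hi'
      rw [hθ.zero] at this
      linarith
    subst hin hi0
    rw [hP, zpow_add_one₀ (by norm_num)]
    congr 1
    ring

theorem Subdiv.exists_sheet {S : Set ℝ} {n : ℕ} {θ : ℕ → ℝ} (hθ : Subdiv S 0 π n θ)
    (hS : ∀ x, ∀ k : ℤ, x ∈ S → x + k * π ∈ S) {y : ℝ} (hy : y ∈ S) :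
    ∃ i < n, ∃ k : ℤ, y = θ i + k * π := by
  have hpi := pi_pos
  have h1 := Int.floor_le (y / π)
  have h2 := Int.lt_floor_add_one (y / π)
  rw [le_div_iff₀ hpi] at h1
  rw [div_lt_iff₀ hpi] at h2
  obtain ⟨i, hi, h⟩ := hθ.exists_eq (x := y - ⌊y / π⌋ * π) ⟨by linarith, by linarith⟩ (by
    have := hS y (-⌊y / π⌋) hy
    simpa [sub_eq_add_neg] using this)
  exact ⟨i, hi, ⌊y / π⌋, by rw [h]; ring⟩

namespace Leg

variable {α : Set X₂sp} {DT : Finset X₂sp} (L : Leg α DT)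

theorem exists_break {n m : ℕ} {θ b : ℕ → ℝ} {a : ℝ} (hθ : Subdiv L.D 0 π n θ)
    (hb : Subdiv L.B a (a + 1) m b) {i : ℕ} (hi : i < n) {p : ℝ} (h : Q (θ i, p) ∈ α) :
    ∃ j < m, L.T (b j) = Q (θ i, p) := by
  obtain ⟨t, ht, hT⟩ := L.exists_T h a
  obtain ⟨k, hk, -⟩ := Q_eq hT.symm
  have htB : t ∈ L.B := by
    rw [B, mem_ofPred_eq, hk]
    exact L.mem_D_add k (hθ.mem i hi.le)
  obtain ⟨j, hj, rfl⟩ := hb.exists_eq ht htB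
  exact ⟨j, hj, hT⟩

theorem fibre_finite {n m : ℕ} {θ b : ℕ → ℝ} {a : ℝ} (hθ : Subdiv L.D 0 π n θ)
    (hb : Subdiv L.B a (a + 1) m b) {i : ℕ} (hi : i < n) : {p | Q (θ i, p) ∈ α}.Finite := by
  refine Finite.of_injOn (f := fun p => Q (θ i, p)) (t := (fun j => L.T (b j)) '' Iio m) ?_ ?_
    ((finite_Iio m).image _)
  · intro p hp
    obtain ⟨j, hj, h⟩ := L.exists_break hθ hb hi hp
    exact ⟨j, hj, h⟩
  · intro p _ q _ hpq
    exact (Q_inj_Ico (hθ.mem_Ico hi) (hθ.mem_Ico hi) hpq).2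

open Classical in
theorem card_breaks {m : ℕ} {b : ℕ → ℝ} {a : ℝ} (hb : Subdiv L.B a (a + 1) m b) :
    m = ((Finset.range m).image fun j => L.T (b j)).card + DT.card := by
  set A := (Finset.range m).image fun j => L.T (b j) with hA
  have h1 := Finset.card_eq_sum_card_image (fun j => L.T (b j)) (Finset.range m)
  rw [Finset.card_range, ← hA] at h1
  have hDT : DT ⊆ A := by
    intro z hz
    obtain ⟨t, ht, rfl⟩ := L.exists_T (L.DT_sub z hz) a
    obtain ⟨j, hj, rfl⟩ := hb.exists_eq ht (L.mem_B_of_DT hz)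
    exact Finset.mem_image.2 ⟨j, Finset.mem_range.2 hj, rfl⟩
  have h2 : ∀ z ∈ A, ((Finset.range m).filter fun j => L.T (b j) = z).card =
      1 + if z ∈ DT then 1 else 0 := by
    intro z hz
    obtain ⟨j, hj, hjz⟩ := Finset.mem_image.1 hz
    have hj := Finset.mem_range.1 hj
    have hinj : InjOn b (Iio m) := by
      intro i hi i' hi' h
      rcases lt_trichotomy i i' with h' | h' | h'
      · exact absurd h (hb.strict h' (le_of_lt hi')).ne
      · exact h'
      · exact absurd h (hb.strict h' (le_of_lt hi)).ne'
    have hset : {s | s ∈ Ico a (a + 1) ∧ L.T s = z} =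
        b '' ((Finset.range m).filter fun j => L.T (b j) = z : Finset ℕ) := by
      ext s
      constructor
      · rintro ⟨hs, hsz⟩
        have hsB : s ∈ L.B := L.mem_B_congr (hjz.trans hsz.symm) (hb.mem j hj.le)
        obtain ⟨j', hj', rfl⟩ := hb.exists_eq hs hsB
        exact ⟨j', by simpa using ⟨hj', hsz⟩, rfl⟩
      · rintro ⟨j', hj', rfl⟩
        rw [Finset.mem_coe, Finset.mem_filter, Finset.mem_range] at hj'
        exact ⟨hb.mem_Ico hj'.1, hj'.2⟩
    have hcard : {s | s ∈ Ico a (a + 1) ∧ L.T s = z}.ncard =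
        ((Finset.range m).filter fun j => L.T (b j) = z).card := by
      rw [hset, InjOn.ncard_image, ncard_coe_finset]
      refine hinj.mono fun j' hj' => ?_
      rw [Finset.mem_coe, Finset.mem_filter, Finset.mem_range] at hj'
      exact hj'.1
    have hfib := L.fib a z (hjz ▸ L.T_mem _)
    rw [← hcard]
    split_ifs with hd
    · exact hfib.1 hd
    · exact hfib.2 hd
  rw [Finset.sum_congr rfl h2, Finset.sum_add_distrib, Finset.sum_const, smul_eq_mul, mul_one,
    Finset.sum_ite_mem, Finset.inter_eq_right.2 hDT, Finset.sum_const, smul_eq_mul, mul_one] at h1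
  exact h1

open Classical in
theorem sum_fibres {n m : ℕ} {θ b : ℕ → ℝ} {a : ℝ} (hθ : Subdiv L.D 0 π n θ)
    (hb : Subdiv L.B a (a + 1) m b) {P : ℕ → Finset ℝ}
    (hP : ∀ i < n, ∀ p, p ∈ P i ↔ Q (θ i, p) ∈ α) :
    ∑ i ∈ Finset.range n, (P i).card =
      ((Finset.range m).image fun j => L.T (b j)).card := by
  rw [← Finset.card_sigma]
  refine Finset.card_bij (fun x _ => Q (θ x.1, x.2)) ?_ ?_ ?_
  · rintro ⟨i, p⟩ hx
    rw [Finset.mem_sigma, Finset.mem_range] at hx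
    obtain ⟨j, hj, h⟩ := L.exists_break hθ hb hx.1 ((hP i hx.1 p).1 hx.2)
    exact Finset.mem_image.2 ⟨j, Finset.mem_range.2 hj, h⟩
  · rintro ⟨i, p⟩ hx ⟨i', p'⟩ hx' h
    rw [Finset.mem_sigma, Finset.mem_range] at hx hx'
    obtain ⟨h1, rfl⟩ := Q_inj_Ico (hθ.mem_Ico hx.1) (hθ.mem_Ico hx'.1) h
    have : i = i' := by
      rcases lt_trichotomy i i' with h' | h' | h'
      · exact absurd h1 (hθ.strict h' hx'.1.le).ne
      · exact h'
      · exact absurd h1 (hθ.strict h' hx.1.le).ne'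
    rw [this]
  · intro z hz
    obtain ⟨j, hj, rfl⟩ := Finset.mem_image.1 hz
    obtain ⟨i, hi, k, hk⟩ := hθ.exists_sheet (fun x k hx => L.mem_D_add k hx)
      (hb.mem j (Finset.mem_range.1 hj).le)
    have : Q (θ i, (-1) ^ k * L.h (b j)) = L.T (b j) := by
      rw [Q_sub_int, T, hk]
    refine ⟨⟨i, (-1) ^ k * L.h (b j)⟩, ?_, this⟩
    rw [Finset.mem_sigma, Finset.mem_range]
    exact ⟨hi, (hP i hi _).2 (this ▸ L.T_mem _)⟩

theorem nonempty_front (L : Leg α DT) : Nonempty (Front α DT.card) := by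
  classical
  obtain ⟨n, θ, hn, hθ⟩ := L.exists_angles
  obtain ⟨a, ha⟩ := L.exists_mem_B
  have ha1 : a + 1 ∈ L.B := L.mem_B_congr (L.per a).symm ha
  obtain ⟨m, b, hb⟩ := exists_subdiv (lt_add_one a) (L.B_finite (lt_add_one a)) ha ha1
  have harc : ∀ j, ∃ (i : ℕ) (k : ℤ) (τ : ℝ → ℝ), Continuous τ ∧ (j < m → i < n ∧
      (∀ u ∈ Icc (θ i) (θ (i + 1)), L.φ (τ u) = u + k * π) ∧
      (∀ t ∈ Ioo (b j) (b (j + 1)), L.φ t - k * π ∈ Ioo (θ i) (θ (i + 1))) ∧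
      (∀ u ∈ Icc (θ i) (θ (i + 1)), τ u ∈ Icc (b j) (b (j + 1))) ∧
      ((τ (θ i) = b j ∧ τ (θ (i + 1)) = b (j + 1)) ∨
        (τ (θ i) = b (j + 1) ∧ τ (θ (i + 1)) = b j))) := by
    intro j
    by_cases hj : j < m
    · obtain ⟨i, hi, k, τ, h1, h2⟩ := L.exists_arc hθ hb hj
      exact ⟨i, k, τ, h1, fun _ => ⟨hi, h2⟩⟩
    · exact ⟨0, 0, id, continuous_id, fun h => absurd h hj⟩
  choose I K τ hτ harc using harc
  set G : ℕ → ℝ → ℝ := fun j x => (-1) ^ K j * L.h (τ j x) with hG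
  have hGc : ∀ j, Continuous (G j) := fun j => continuous_const.mul (L.h_cont.comp (hτ j))
  have hGT : ∀ j < m, ∀ u ∈ Icc (θ (I j)) (θ (I j + 1)), Q (u, G j u) = L.T (τ j u) := by
    intro j hj u hu
    rw [hG]
    show Q (u, (-1) ^ K j * L.h (τ j u)) = _
    rw [Q_sub_int, T, (harc j hj).2.1 u hu]
  set E : ℕ → Finset ℕ := fun i => (Finset.range m).filter fun j => I j = i with hE
  have hEm : ∀ i j, j ∈ E i ↔ j < m ∧ I j = i := by
    intro i j
    rw [hE, Finset.mem_filter, Finset.mem_range]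
  have hτI : ∀ j < m, ∀ u ∈ Ioo (θ (I j)) (θ (I j + 1)), τ j u ∈ Ioo (b j) (b (j + 1)) ∧
      τ j u ∉ L.B := by
    intro j hj u hu
    have huc := Ioo_subset_Icc_self hu
    have hB : τ j u ∉ L.B := by
      rw [B, mem_ofPred_eq, (harc j hj).2.1 u huc, L.mem_D_add_iff]
      exact hθ.notMem _ (harc j hj).1 u hu
    have := (harc j hj).2.2.2.1 u huc
    exact ⟨⟨lt_of_le_of_ne this.1 fun h => hB (h ▸ hb.mem j hj.le),
      lt_of_le_of_ne this.2 fun h => hB (h ▸ hb.mem (j + 1) hj)⟩, hB⟩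
  have hsort : ∀ i, ∃ e : ℕ → ℕ, i < n → (∀ k < (E i).card, e k ∈ E i) ∧
      (∀ j ∈ E i, ∃ k < (E i).card, e k = j) ∧
      ∀ x ∈ Ioo (θ i) (θ (i + 1)), ∀ k k', k < k' → k' < (E i).card →
        G (e k) x < G (e k') x := by
    intro i
    by_cases hi : i < n
    · obtain ⟨e, he⟩ := exists_sorted_functions (E i) hGc (hθ.lt i hi) (by
        intro j hj j' hj' hne x hx hGx
        replace hj := (hEm _ _).1 hj
        obtain ⟨hj, rfl⟩ := hj
        replace hj' := (hEm _ _).1 hj'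
        obtain ⟨hj', hI⟩ := hj'
        have hx' : x ∈ Ioo (θ (I j')) (θ (I j' + 1)) := by rwa [hI]
        have e1 := hGT j hj x (Ioo_subset_Icc_self hx)
        have e2 := hGT j' hj' x (Ioo_subset_Icc_self hx')
        obtain ⟨m1, hB⟩ := hτI j hj x hx
        obtain ⟨m2, -⟩ := hτI j' hj' x hx'
        have := L.T_inj (hb.Ioo_subset hj m1) (hb.Ioo_subset hj' m2)
          (e1.symm.trans ((congrArg (fun q => Q (x, q)) hGx).trans e2)) fun h => hB (L.mem_B_of_DT h)
        exact hne (hb.unique hj hj' m1 (this ▸ m2)))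
      exact ⟨e, fun _ => he⟩
    · exact ⟨id, fun h => absurd h hi⟩
  choose e he using hsort
  have hfib : ∀ i, ∃ (P : Finset ℝ) (f : ℕ → ℝ), i < n → (∀ p, p ∈ P ↔ Q (θ i, p) ∈ α) ∧
      (∀ k < P.card, f k ∈ P) ∧ (∀ p ∈ P, ∃ k < P.card, f k = p) ∧
      ∀ k k', k < k' → k' < P.card → f k < f k' := by
    intro i
    by_cases hi : i < n
    · set P := (L.fibre_finite hθ hb hi).toFinset with hP
      obtain ⟨f, hf⟩ := exists_sorted P id (injOn_id _)
      exact ⟨P, f, fun _ => ⟨fun p => by rw [hP, Finite.mem_toFinset]; rfl, hf⟩⟩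
    · exact ⟨∅, fun _ => 0, fun h => absurd h hi⟩
  choose P f hf using hfib
  have hsumN : ∑ i ∈ Finset.range n, (E i).card = m := by
    have := Finset.card_eq_sum_card_fiberwise (f := I) (s := Finset.range m)
      (t := Finset.range n) (by
        intro j hj
        rw [Finset.mem_coe, Finset.mem_range] at hj ⊢
        exact (harc j hj).1)
    rw [Finset.card_range] at this
    exact this.symm
  refine ⟨{
    n := n
    two_le := hn
    θ := θ
    θ_zero := hθ.zero
    θ_last := hθ.last
    θ_lt := hθ.lt
    N := fun i => (E i).card
    M := fun i => (P i).card
    g := fun i k => G (e i k)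
    f := f
    g_cont := fun i k => hGc _
    g_lt := fun i hi => (he i hi).2.2
    f_lt := fun i hi => (hf i hi).2.2.2
    mem_g := ?_
    mem_f := ?_
    g_left := ?_
    g_right := ?_
    H := L.H
    H_cont := L.H_cont
    H_per := L.H_per
    le_H := L.le_H
    H_mem := L.H_mem
    conn := ?_
    total := ?_ }⟩
  · intro i hi x hx p
    have hxc := Ioo_subset_Icc_self hx
    constructor
    · intro hp
      obtain ⟨t, ht, hT⟩ := L.exists_T hp a
      obtain ⟨k, hk, hh⟩ := Q_eq hT.symm
      have htB : t ∉ L.B := by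
        rw [B, mem_ofPred_eq, hk, L.mem_D_add_iff]
        exact hθ.notMem i hi x hx
      obtain ⟨j, hj, htj⟩ := hb.cover' ht htB
      have h1 := (harc j hj).2.2.1 t htj
      have hIj := (harc j hj).1
      have h2 : Q (L.φ t - K j * π, (-1) ^ K j * L.h t) = Q (x, p) := by
        rw [Q_sub_int, sub_add_cancel]
        exact hT
      obtain ⟨h3, h4⟩ := Q_inj_Ico (hθ.Ioo_subset hIj h1) (hθ.Ioo_subset hi hx) h2
      rw [h3] at h1
      have hij := hθ.unique hIj hi h1 hx
      subst hij
      obtain ⟨k', hk', hek⟩ := (he _ hi).2.1 j ((hEm _ _).2 ⟨hj, rfl⟩)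
      refine ⟨k', hk', ?_⟩
      show G (e (I j) k') x = p
      rw [hek, ← h4]
      have h5 : τ j x = t := by
        have m1 := (hτI j hj x h1).1
        refine L.inj _ _ (fun t ht hZ => hb.notMem j hj t ht (L.Z_subset hZ))
          (Ioo_subset_Icc_self m1) (Ioo_subset_Icc_self htj) ?_
        rw [(harc j hj).2.1 x hxc]
        linarith
      show (-1) ^ K j * L.h (τ j x) = _
      rw [h5]
    · rintro ⟨k, hk, rfl⟩
      obtain ⟨hj, hI⟩ := (hEm _ _).1 ((he i hi).1 k hk)
      show Q (x, G _ x) ∈ α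
      rw [hGT _ hj x (by rwa [hI])]
      exact L.T_mem _
  · intro i hi p
    rw [← (hf i hi).1 p]
    exact ⟨(hf i hi).2.2.1 p, by rintro ⟨k, hk, rfl⟩; exact (hf i hi).2.1 k hk⟩
  · intro i hi k hk
    obtain ⟨hj, hI⟩ := (hEm _ _).1 ((he i hi).1 k hk)
    show Q (θ i, G (e i k) (θ i)) ∈ α
    rw [hGT _ hj _ (by rw [hI]; exact left_mem_Icc.2 (hθ.lt i hi).le)]
    exact L.T_mem _
  · intro i hi k hk
    obtain ⟨hj, hI⟩ := (hEm _ _).1 ((he i hi).1 k hk)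
    show Q (θ (i + 1), G (e i k) (θ (i + 1))) ∈ α
    rw [hGT _ hj _ (by rw [hI]; exact right_mem_Icc.2 (hθ.lt i hi).le)]
    exact L.T_mem _
  · intro R hR0 hR
    have hU : ∀ (t : ℝ) (i : ℕ) (k : ℤ), i ≤ n → L.φ t = θ i + k * π →
        ∀ i' k', i' ≤ n → L.φ t = θ i' + ((k' : ℤ) : ℝ) * π →
          R i' ((-1) ^ k' * L.h t) = R i ((-1) ^ k * L.h t) := by
      intro t i k hi h i' k' hi' h'
      rcases le_total k k' with hk | hk
      · exact (hθ.sheet_eq hR0 hi hi' hk (h.symm.trans h') _).symm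
      · exact hθ.sheet_eq hR0 hi' hi hk (h'.symm.trans h) _
    obtain ⟨i₀, hi₀, k₀, hk₀⟩ := hθ.exists_sheet (fun x k hx => L.mem_D_add k hx)
      (hb.mem 0 m.zero_le)
    set c := R i₀ ((-1) ^ k₀ * L.h (b 0)) with hc
    have hind : ∀ j ≤ m, ∀ i k, i ≤ n → L.φ (b j) = θ i + ((k : ℤ) : ℝ) * π →
        R i ((-1) ^ k * L.h (b j)) = c := by
      intro j
      induction j with
      | zero => exact fun _ => hU (b 0) i₀ k₀ hi₀.le hk₀
      | succ j ih =>
        intro hj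
        have hj : j < m := hj
        obtain ⟨hIj, hφ, -, -, hends⟩ := harc j hj
        have h1 := hφ _ (left_mem_Icc.2 (hθ.lt _ hIj).le)
        have h2 := hφ _ (right_mem_Icc.2 (hθ.lt _ hIj).le)
        obtain ⟨k', hk', hek⟩ := (he _ hIj).2.1 j ((hEm _ _).2 ⟨hj, rfl⟩)
        have h3 : R (I j) (G (e (I j) k') (θ (I j))) =
          R (I j + 1) (G (e (I j) k') (θ (I j + 1))) := hR (I j) hIj k' hk'
        rw [hek] at h3
        have h3 : R (I j) ((-1) ^ K j * L.h (τ j (θ (I j)))) =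
          R (I j + 1) ((-1) ^ K j * L.h (τ j (θ (I j + 1)))) := h3
        rcases hends with ⟨e1, e2⟩ | ⟨e1, e2⟩
        · rw [e1] at h1 h3
          rw [e2] at h2 h3
          intro i k hi hk
          rw [hU _ _ _ hIj h2 i k hi hk, ← h3]
          exact ih hj.le _ _ hIj.le h1
        · rw [e1] at h1 h3
          rw [e2] at h2 h3
          intro i k hi hk
          rw [hU _ _ _ hIj.le h1 i k hi hk, h3]
          exact ih hj.le _ _ hIj h2
    refine ⟨c, fun i hi k hk => ?_⟩
    obtain ⟨j, hj, hT⟩ := L.exists_break hθ hb hi (((hf i hi).1 _).1 ((hf i hi).2.1 k hk))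
    obtain ⟨l, hl, hh⟩ := Q_eq hT.symm
    rw [← hind j hj.le i l hi.le hl, hh, neg_one_zpow_mul_self]
  · show ∑ i ∈ Finset.range n, (E i).card = ∑ i ∈ Finset.range n, (P i).card + DT.card
    rw [hsumN, L.sum_fibres hθ hb fun i hi => (hf i hi).1]
    exact L.card_breaks hb

end Leg

end

theorem exists_normal_angle {u v u' v' : ℝ → ℝ} (hu : ∀ t, HasDerivAt u (u' t) t)
    (hv : ∀ t, HasDerivAt v (v' t) t) (hu' : Continuous u') (hv' : Continuous v')
    (hne : ∀ t, 0 < u t ^ 2 + v t ^ 2) :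
    ∃ φ : ℝ → ℝ, (∀ t, HasDerivAt φ ((u t * v' t - v t * u' t) / (u t ^ 2 + v t ^ 2)) t) ∧
      ∀ t, cos (φ t) * u t + sin (φ t) * v t = 0 := by
  have huc : Continuous u := continuous_iff_continuousAt.2 fun t => (hu t).continuousAt
  have hvc : Continuous v := continuous_iff_continuousAt.2 fun t => (hv t).continuousAt
  set w : ℝ → ℝ := fun t => (u t * v' t - v t * u' t) / (u t ^ 2 + v t ^ 2) with hw
  have hwc : Continuous w := by
    refine Continuous.div (by fun_prop) (by fun_prop) fun t => (hne t).ne'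
  set ζ : ℂ := ⟨v 0, -u 0⟩ with hζ
  set φ : ℝ → ℝ := fun t => Complex.arg ζ + ∫ s in (0 : ℝ)..t, w s with hφ
  have hd : ∀ t, HasDerivAt φ (w t) t := fun t =>
    (hwc.integral_hasStrictDerivAt 0 t).hasDerivAt.const_add _
  refine ⟨φ, hd, ?_⟩
  set A : ℝ → ℝ := fun t => cos (φ t) * u t + sin (φ t) * v t with hA
  set C : ℝ → ℝ := fun t => -sin (φ t) * u t + cos (φ t) * v t with hC
  set r : ℝ → ℝ := fun t => √(u t ^ 2 + v t ^ 2) with hr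
  have hr0 : ∀ t, r t ≠ 0 := fun t => (sqrt_pos.2 (hne t)).ne'
  have hr2 : ∀ t, r t ^ 2 = u t ^ 2 + v t ^ 2 := fun t => sq_sqrt (hne t).le
  have hdA : ∀ t, HasDerivAt A (w t * C t + (cos (φ t) * u' t + sin (φ t) * v' t)) t := fun t => by
    refine (((hd t).cos.mul (hu t)).add ((hd t).sin.mul (hv t))).congr_deriv ?_
    rw [hC]
    ring
  have hdr : ∀ t, HasDerivAt r ((u t * u' t + v t * v' t) / r t) t := fun t => by
    refine ((((hu t).pow 2).add ((hv t).pow 2)).sqrt (hne t).ne').congr_deriv ?_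
    have := hr0 t
    show _ / (2 * r t) = _
    field_simp
    simp
    ring
  have hq : ∀ t, HasDerivAt (fun t => A t / r t) 0 t := fun t => by
    refine ((hdA t).div (hdr t) (hr0 t)).congr_deriv ?_
    have h0 := hr0 t
    have h2 := hr2 t
    have hn : u t ^ 2 + v t ^ 2 ≠ 0 := (hne t).ne'
    rw [div_eq_zero_iff]
    left
    have : (w t * C t + (cos (φ t) * u' t + sin (φ t) * v' t)) * r t ^ 2 -
        A t * (u t * u' t + v t * v' t) = 0 := by
      have hw' : w t * (u t ^ 2 + v t ^ 2) = u t * v' t - v t * u' t := by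
        rw [hw]
        field_simp
      rw [h2, hA, hC]
      linear_combination (-sin (φ t) * u t + cos (φ t) * v t) * hw'
    field_simp
    linear_combination this
  have hconst : ∀ t, A t / r t = A 0 / r 0 := fun t =>
    is_const_of_deriv_eq_zero (fun t => (hq t).differentiableAt) (fun t => (hq t).deriv) t 0
  have hφ0 : φ 0 = Complex.arg ζ := by rw [hφ]; simp
  have hζ0 : ζ ≠ 0 := by
    intro h
    have h1 := congrArg Complex.re h
    have h2 := congrArg Complex.im h
    simp [hζ] at h1 h2
    have := hne 0
    rw [h1, h2] at this
    norm_num at this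
  have hA0 : A 0 = 0 := by
    have hre : ‖ζ‖ * cos (φ 0) = v 0 := by rw [hφ0, Complex.norm_mul_cos_arg]
    have him : ‖ζ‖ * sin (φ 0) = -u 0 := by rw [hφ0, Complex.norm_mul_sin_arg]
    have hpos := norm_ne_zero_iff.2 hζ0
    refine (mul_eq_zero.1 (?_ : ‖ζ‖ * A 0 = 0)).resolve_left hpos
    rw [hA]
    linear_combination u 0 * hre + v 0 * him
  intro t
  have := hconst t
  rw [hA0, zero_div, div_eq_zero_iff] at this
  exact this.resolve_right (hr0 t)

section

/-- The line with normal angle `φ` through a point. -/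
def lineThrough (φ : ℝ) (p : ℝ × ℝ) : X₂sp := Q (φ, cos φ * p.1 + sin φ * p.2)

namespace GenericPlane

variable {c : ℝ → ℝ × ℝ}

theorem hasDerivAt (hc : GenericPlane c) (t : ℝ) : HasDerivAt c (deriv c t) t :=
  (hc.contDiff.differentiable (by norm_num) t).hasDerivAt

theorem hasDerivAt_fst (hc : GenericPlane c) (t : ℝ) :
    HasDerivAt (fun s => (c s).1) (deriv c t).1 t :=
  (hasFDerivAt_fst (𝕜 := ℝ) (p := c t)).comp_hasDerivAt t (hc.hasDerivAt t)

theorem hasDerivAt_snd (hc : GenericPlane c) (t : ℝ) :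
    HasDerivAt (fun s => (c s).2) (deriv c t).2 t :=
  (hasFDerivAt_snd (𝕜 := ℝ) (p := c t)).comp_hasDerivAt t (hc.hasDerivAt t)

theorem pos (hc : GenericPlane c) (t : ℝ) : 0 < (deriv c t).1 ^ 2 + (deriv c t).2 ^ 2 := by
  by_contra! h
  refine hc.immersed t (Prod.ext ?_ ?_)
  · exact pow_eq_zero_iff two_ne_zero |>.1
      (le_antisymm (by nlinarith [sq_nonneg (deriv c t).2]) (sq_nonneg _))
  · exact pow_eq_zero_iff two_ne_zero |>.1
      (le_antisymm (by nlinarith [sq_nonneg (deriv c t).1]) (sq_nonneg _))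

theorem deriv_hFun (hc : GenericPlane c) (L : ℝ × ℝ × ℝ) (t : ℝ) :
    deriv (hFun c L) t = L.1 * (deriv c t).1 + L.2.1 * (deriv c t).2 :=
  ((((hc.hasDerivAt_fst t).const_mul L.1).add ((hc.hasDerivAt_snd t).const_mul L.2.1)).sub_const
    L.2.2).deriv

theorem exists_angle (hc : GenericPlane c) : ∃ φ w : ℝ → ℝ, (∀ t, HasDerivAt φ (w t) t) ∧
    (∀ t, w t = 0 → signedCurv c t = 0) ∧
    ∀ t, cos (φ t) * (deriv c t).1 + sin (φ t) * (deriv c t).2 = 0 := by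
  have h1 : ContDiff ℝ 1 (deriv c) := by
    have := (contDiff_succ_iff_deriv (n := 1) (f := c)).1 (by rw [one_add_one_eq_two]; exact hc.contDiff)
    exact this.2.2
  have h2 : ∀ t, HasDerivAt (deriv c) (deriv (deriv c) t) t := fun t =>
    (h1.differentiable (by norm_num) t).hasDerivAt
  have h3 : Continuous (deriv (deriv c)) := h1.continuous_deriv le_rfl
  have e1 : (deriv fun s => (c s).1) = fun t => (deriv c t).1 :=
    funext fun t => (hc.hasDerivAt_fst t).deriv
  have e2 : (deriv fun s => (c s).2) = fun t => (deriv c t).2 :=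
    funext fun t => (hc.hasDerivAt_snd t).deriv
  have d1 : ∀ t, HasDerivAt (fun t => (deriv c t).1) (deriv (deriv c) t).1 t := fun t =>
    (hasFDerivAt_fst (𝕜 := ℝ) (p := deriv c t)).comp_hasDerivAt t (h2 t)
  have d2 : ∀ t, HasDerivAt (fun t => (deriv c t).2) (deriv (deriv c) t).2 t := fun t =>
    (hasFDerivAt_snd (𝕜 := ℝ) (p := deriv c t)).comp_hasDerivAt t (h2 t)
  obtain ⟨φ, hφ, ht⟩ := exists_normal_angle d1 d2 (by fun_prop) (by fun_prop) hc.pos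
  refine ⟨φ, _, hφ, fun t h => ?_, ht⟩
  rw [div_eq_zero_iff] at h
  rw [signedCurv, e1, e2, (d1 t).deriv, (d2 t).deriv, h.resolve_right (hc.pos t).ne', zero_div]

theorem periodic_deriv (hc : GenericPlane c) : Function.Periodic (deriv c) 1 := by
  intro t
  have h : (fun s => c (s + 1)) = c := funext hc.periodic
  rw [← deriv_comp_add_const, h]

theorem tangentAt_iff (hc : GenericPlane c) {φ t : ℝ}
    (hφ : cos φ * (deriv c t).1 + sin φ * (deriv c t).2 = 0) {L : {L : ℝ × ℝ × ℝ // IsLine L}} :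
    TangentAt c L.val t ↔ Quotient.mk lineSetoid L = lineThrough φ (c t) := by
  obtain ⟨⟨A, B, C⟩, hL⟩ := L
  have h1 := cos_sq_add_sin_sq φ
  have hpos := hc.pos t
  have key : Quotient.mk lineSetoid ⟨(A, B, C), hL⟩ = lineThrough φ (c t) ↔
      ∃ k : ℝ, k ≠ 0 ∧ (A, B, C) = k • (cos φ, sin φ, cos φ * (c t).1 + sin φ * (c t).2) :=
    eq_comm.trans mk_eq_mk
  refine Iff.trans ?_ key.symm
  unfold TangentAt
  rw [hc.deriv_hFun]
  simp only [lineSet, mem_ofPred_eq, Prod.smul_mk, smul_eq_mul, Prod.mk.injEq]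
  constructor
  · rintro ⟨-, h2, h3⟩
    have h4 : A * sin φ = B * cos φ := by
      have e1 : (A * sin φ - B * cos φ) * (deriv c t).1 = 0 := by
        linear_combination sin φ * h3 - B * hφ
      have e2 : (A * sin φ - B * cos φ) * (deriv c t).2 = 0 := by
        linear_combination A * hφ - cos φ * h3
      have : (A * sin φ - B * cos φ) * ((deriv c t).1 ^ 2 + (deriv c t).2 ^ 2) = 0 := by
        linear_combination (deriv c t).1 * e1 + (deriv c t).2 * e2
      linarith [(mul_eq_zero.1 this).resolve_right hpos.ne']
    have hA : A = (A * cos φ + B * sin φ) * cos φ := by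
      linear_combination (-A) * h1 + sin φ * h4
    have hB : B = (A * cos φ + B * sin φ) * sin φ := by
      linear_combination (-B) * h1 - cos φ * h4
    refine ⟨A * cos φ + B * sin φ, fun h0 => hL ?_, hA, hB, ?_⟩
    · rw [h0, zero_mul] at hA hB
      simp only [hA, hB]
    · linear_combination -h2 + (c t).1 * hA + (c t).2 * hB
  · rintro ⟨k, hk, rfl, rfl, rfl⟩
    exact ⟨hL, by ring, by linear_combination k * hφ⟩

end GenericPlane

theorem isLine_normal (φ p : ℝ) : IsLine (cos φ, sin φ, p) := by
  intro h
  simp only [Prod.mk.injEq] at h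
  have := cos_sq_add_sin_sq φ
  rw [h.1, h.2] at this
  norm_num at this

theorem lineSet_smul {k : ℝ} (hk : k ≠ 0) (L : ℝ × ℝ × ℝ) : lineSet (k • L) = lineSet L := by
  ext p
  simp only [lineSet, mem_ofPred_eq, Prod.smul_fst, Prod.smul_snd, smul_eq_mul]
  constructor
  · intro h
    exact mul_left_cancel₀ hk (by linear_combination h)
  · intro h
    linear_combination k * h

theorem lineSet_injective {L L' : {L : ℝ × ℝ × ℝ // IsLine L}}
    (h : lineSet L.val = lineSet L'.val) :
    Quotient.mk lineSetoid L = Quotient.mk lineSetoid L' := by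
  obtain ⟨⟨θ, p⟩, hθ⟩ := Q_surjective (Quotient.mk lineSetoid L)
  obtain ⟨k, hk, hL⟩ := mk_eq_mk.1 hθ
  rw [hL, lineSet_smul hk] at h
  rw [← hθ, Q, mk_eq_mk]
  obtain ⟨⟨A, B, C⟩, hL'⟩ := L'
  have h1 := cos_sq_add_sin_sq θ
  have e1 : (p * cos θ, p * sin θ) ∈ lineSet (A, B, C) := by
    rw [← h, lineSet, mem_ofPred_eq]
    linear_combination p * h1
  have e2 : (p * cos θ - sin θ, p * sin θ + cos θ) ∈ lineSet (A, B, C) := by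
    rw [← h, lineSet, mem_ofPred_eq]
    linear_combination p * h1
  simp only [lineSet, mem_ofPred_eq] at e1 e2
  have h4 : A * sin θ = B * cos θ := by linear_combination e1 - e2
  have hA : A = (A * cos θ + B * sin θ) * cos θ := by
    linear_combination (-A) * h1 + sin θ * h4
  have hB : B = (A * cos θ + B * sin θ) * sin θ := by
    linear_combination (-B) * h1 - cos θ * h4
  simp only [Prod.smul_mk, smul_eq_mul, Prod.mk.injEq]
  refine ⟨A * cos θ + B * sin θ, fun h0 => hL' ?_, hA, hB, ?_⟩
  · rw [h0, zero_mul] at hA hB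
    simp only [hA, hB]
  · linear_combination -e1

end

section

/-- The support function of a closed curve of period one. -/
def supportFun (c : ℝ → ℝ × ℝ) (x : ℝ) : ℝ :=
  sSup ((fun t => cos x * (c t).1 + sin x * (c t).2) '' Icc 0 1)

/-- The point of the space of lines represented by a triple. -/
def lineClass (L : {L : ℝ × ℝ × ℝ // IsLine L}) : X₂sp := Quotient.mk lineSetoid L

theorem periodic_fract {β : Type*} {f : ℝ → β} (hf : Function.Periodic f 1) (t : ℝ) :
    f (Int.fract t) = f t := by
  have := hf.sub_int_mul_eq (x := t) ⌊t⌋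
  rwa [mul_one] at this

namespace GenericPlane

variable {c : ℝ → ℝ × ℝ}

theorem lineThrough_mem_graphic (hc : GenericPlane c) {φ t : ℝ}
    (hφ : cos φ * (deriv c t).1 + sin φ * (deriv c t).2 = 0) :
    lineThrough φ (c t) ∈ graphic c :=
  ⟨⟨_, isLine_normal φ (cos φ * (c t).1 + sin φ * (c t).2)⟩, rfl, t,
    (hc.tangentAt_iff hφ).2 rfl⟩

theorem exists_tangentAt (hc : GenericPlane c) {L : {L : ℝ × ℝ × ℝ // IsLine L}}
    (hL : lineClass L ∈ graphic c) : ∃ t, TangentAt c L.val t := by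
  obtain ⟨L', h, t, ht⟩ := hL
  obtain ⟨k, hk, hk'⟩ := mk_eq_mk.1 h
  refine ⟨t, L.2, ?_, ?_⟩
  · rw [hk', lineSet_smul hk]
    exact ht.2.1
  · have := ht.2.2
    rw [hc.deriv_hFun] at this ⊢
    rw [hk']
    simp only [Prod.smul_fst, Prod.smul_snd, smul_eq_mul]
    linear_combination k * this

theorem continuous_supportFun (hc : GenericPlane c) : Continuous (supportFun c) := by
  have h := hc.contDiff.continuous
  exact isCompact_Icc.continuous_sSup
    (f := fun x t => cos x * (c t).1 + sin x * (c t).2) (by fun_prop)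

theorem fract_eq (hc : GenericPlane c) (t : ℝ) : c (Int.fract t) = c t :=
  periodic_fract hc.periodic t

theorem le_supportFun (hc : GenericPlane c) (x t : ℝ) :
    cos x * (c t).1 + sin x * (c t).2 ≤ supportFun c x := by
  have h := hc.contDiff.continuous
  have hb : BddAbove ((fun t => cos x * (c t).1 + sin x * (c t).2) '' Icc 0 1) :=
    (isCompact_Icc.image (by fun_prop)).bddAbove
  refine le_csSup hb ⟨Int.fract t, ⟨Int.fract_nonneg t, (Int.fract_lt_one t).le⟩, ?_⟩
  simp only [hc.fract_eq]

theorem supportFun_mem (hc : GenericPlane c) (x : ℝ) : Q (x, supportFun c x) ∈ graphic c := by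
  have h := hc.contDiff.continuous
  obtain ⟨t, -, ht⟩ := (isCompact_Icc (a := (0 : ℝ)) (b := 1)).exists_sSup_image_eq
    ⟨0, by simp⟩ (f := fun t => cos x * (c t).1 + sin x * (c t).2) (by fun_prop)
  have hd := ((hc.hasDerivAt_fst t).const_mul (cos x)).add
    ((hc.hasDerivAt_snd t).const_mul (sin x))
  have hmax : IsLocalMax (fun t => cos x * (c t).1 + sin x * (c t).2) t :=
    Eventually.of_forall fun s => (hc.le_supportFun x s).trans ht.le
  have := hc.lineThrough_mem_graphic (hmax.hasDerivAt_eq_zero hd)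
  rwa [lineThrough, ← show supportFun c x = _ from ht] at this

theorem periodic_signedCurv (hc : GenericPlane c) : Function.Periodic (signedCurv c) 1 := by
  have hd : ∀ f : ℝ → ℝ, Function.Periodic f 1 → Function.Periodic (deriv f) 1 := by
    intro f hf t
    have h : (fun s => f (s + 1)) = f := funext hf
    rw [← deriv_comp_add_const, h]
  have h1 := hd (fun s => (c s).1) fun t => by simp only [hc.periodic t]
  have h2 := hd (fun s => (c s).2) fun t => by simp only [hc.periodic t]
  intro t
  simp only [signedCurv, speed]
  rw [h1 t, h2 t, hd _ h1 t, hd _ h2 t]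

theorem signedCurv_fract (hc : GenericPlane c) (t : ℝ) :
    signedCurv c (Int.fract t) = signedCurv c t :=
  periodic_fract hc.periodic_signedCurv t

theorem finite_inflections (hc : GenericPlane c) (a b : ℝ) :
    ({t | signedCurv c t = 0} ∩ Icc a b).Finite := by
  refine (hc.inflections_finite.biUnion fun y _ => finite_translates y a b one_pos).subset ?_
  rintro t ⟨ht, hab⟩
  rw [mem_iUnion₂]
  refine ⟨Int.fract t, ⟨⟨Int.fract_nonneg t, Int.fract_lt_one t⟩, ?_⟩, hab, ⌊t⌋, ?_⟩
  · rw [hc.signedCurv_fract]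
    exact ht
  · rw [mul_one, Int.fract_add_floor]

variable {φ : ℝ → ℝ}

theorem periodic_lineThrough (hc : GenericPlane c)
    (hφ : ∀ t, cos (φ t) * (deriv c t).1 + sin (φ t) * (deriv c t).2 = 0) :
    Function.Periodic (fun t => lineThrough (φ t) (c t)) 1 := by
  intro t
  have h := hφ (t + 1)
  rw [hc.periodic_deriv t] at h
  simp only [hc.periodic t]
  exact (hc.tangentAt_iff (hφ t)).1 ((hc.tangentAt_iff h
    (L := ⟨_, isLine_normal _ (cos (φ (t + 1)) * (c t).1 + sin (φ (t + 1)) * (c t).2)⟩)).2 rfl)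

theorem lineThrough_fract (hc : GenericPlane c)
    (hφ : ∀ t, cos (φ t) * (deriv c t).1 + sin (φ t) * (deriv c t).2 = 0) (t : ℝ) :
    lineThrough (φ (Int.fract t)) (c (Int.fract t)) = lineThrough (φ t) (c t) :=
  periodic_fract (hc.periodic_lineThrough hφ) t

theorem injOn_fibre (hc : GenericPlane c)
    (hφ : ∀ t, cos (φ t) * (deriv c t).1 + sin (φ t) * (deriv c t).2 = 0) (z : X₂sp) :
    InjOn c {s | s ∈ Ico (0 : ℝ) 1 ∧ lineThrough (φ s) (c s) = z} := by
  rintro s ⟨hs, rfl⟩ t ⟨ht, h⟩ hst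
  by_contra hne
  refine hc.crossings_transverse s hs t ht hne hst ?_
  have h1 := ((hc.tangentAt_iff (hφ t)
    (L := ⟨_, isLine_normal _ (cos (φ s) * (c s).1 + sin (φ s) * (c s).2)⟩)).2 h.symm).2.2
  rw [hc.deriv_hFun] at h1
  have h2 := hφ s
  simp only at h1
  linear_combination (-((deriv c s).1 * (deriv c t).2 - (deriv c s).2 * (deriv c t).1)) *
    cos_sq_add_sin_sq (φ s) + (cos (φ s) * (deriv c t).2 - sin (φ s) * (deriv c t).1) * h2 -
    (cos (φ s) * (deriv c s).2 - sin (φ s) * (deriv c s).1) * h1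

theorem image_fibre (hc : GenericPlane c)
    (hφ : ∀ t, cos (φ t) * (deriv c t).1 + sin (φ t) * (deriv c t).2 = 0)
    (L : {L : ℝ × ℝ × ℝ // IsLine L}) :
    c '' {s | s ∈ Ico (0 : ℝ) 1 ∧ lineThrough (φ s) (c s) = lineClass L} =
      tangencyPts c L.val := by
  ext p
  simp only [mem_image, mem_ofPred_eq, tangencyPts, hc.tangentAt_iff (hφ _), and_assoc]
  exact exists_congr fun s => and_congr_right fun _ => and_congr_left fun _ => eq_comm

theorem ncard_fibre (hc : GenericPlane c)
    (hφ : ∀ t, cos (φ t) * (deriv c t).1 + sin (φ t) * (deriv c t).2 = 0)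
    (L : {L : ℝ × ℝ × ℝ // IsLine L}) (a : ℝ) :
    {s | s ∈ Ico a (a + 1) ∧ lineThrough (φ s) (c s) = lineClass L}.ncard =
      (tangencyPts c L.val).ncard := by
  rw [← hc.image_fibre hφ, (hc.injOn_fibre hφ _).ncard_image]
  have hinj : InjOn (Int.fract : ℝ → ℝ)
      {s | s ∈ Ico a (a + 1) ∧ lineThrough (φ s) (c s) = lineClass L} := by
    rintro s ⟨hs, -⟩ t ⟨ht, -⟩ hst
    obtain ⟨k, hk⟩ := Int.fract_eq_fract.1 hst
    have h1 : (k : ℝ) < 1 := by linarith [hs.2, ht.1]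
    have h2 : (-1 : ℝ) < k := by linarith [hs.1, ht.2]
    have hk0 : k = 0 := by
      have h1' : k < 1 := by exact_mod_cast h1
      have h2' : -1 < k := by exact_mod_cast h2
      omega
    rw [hk0, Int.cast_zero] at hk
    linarith
  rw [← hinj.ncard_image]
  congr 1
  ext s
  constructor
  · rintro ⟨t, ⟨-, ht⟩, rfl⟩
    exact ⟨⟨Int.fract_nonneg t, Int.fract_lt_one t⟩, (hc.lineThrough_fract hφ t).trans ht⟩
  · rintro ⟨hs, h⟩
    have hf : Int.fract (s + ⌈a - s⌉) = s := by
      rw [Int.fract_add_intCast, Int.fract_eq_self.2 hs]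
    refine ⟨s + ⌈a - s⌉, ⟨⟨?_, ?_⟩, ?_⟩, hf⟩
    · linarith [Int.le_ceil (a - s)]
    · linarith [Int.ceil_lt_add_one (a - s)]
    · rw [← hc.lineThrough_fract hφ, hf, h]

theorem isDoubleTangent_congr (hc : GenericPlane c) {L L' : {L : ℝ × ℝ × ℝ // IsLine L}}
    (h : lineClass L = lineClass L') :
    IsDoubleTangent c L.val ↔ IsDoubleTangent c L'.val := by
  obtain ⟨φ, w, -, -, hφ⟩ := hc.exists_angle
  have : tangencyPts c L.val = tangencyPts c L'.val := by
    rw [← hc.image_fibre hφ, ← hc.image_fibre hφ, h]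
  simp only [IsDoubleTangent, L.2, L'.2, this]

/-- The double tangent lines of a curve, as points of the space of lines. -/
def doubleTangents (c : ℝ → ℝ × ℝ) : Set X₂sp :=
  {z | ∃ L : {L : ℝ × ℝ × ℝ // IsLine L}, lineClass L = z ∧ IsDoubleTangent c L.val}

theorem injective_lineSet_out :
    Function.Injective fun z : X₂sp => lineSet (Quotient.out z).val := by
  intro z z' h
  exact (Quotient.out_eq z).symm.trans ((lineSet_injective h).trans (Quotient.out_eq z'))

theorem image_doubleTangents :
    (fun z : X₂sp => lineSet (Quotient.out z).val) '' doubleTangents c =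
      {ℓ | IsDoubleTangentLine c ℓ} := by
  have hout : ∀ L : {L : ℝ × ℝ × ℝ // IsLine L},
      lineSet (Quotient.out (lineClass L)).val = lineSet L.val := by
    intro L
    obtain ⟨k, hk, h⟩ := mk_eq_mk.1 (Quotient.out_eq (lineClass L))
    rw [h, lineSet_smul hk]
  ext ℓ
  constructor
  · rintro ⟨_, ⟨L, rfl, hL⟩, rfl⟩
    exact ⟨L.val, (hout L).symm, hL⟩
  · rintro ⟨L, rfl, hL⟩
    exact ⟨_, ⟨⟨L, hL.1⟩, rfl, hL⟩, hout ⟨L, hL.1⟩⟩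

theorem exists_leg (hc : GenericPlane c) : ∃ DT : Finset X₂sp,
    DT.card = Nat.card {ℓ : Set (ℝ × ℝ) | IsDoubleTangentLine c ℓ} ∧
      Nonempty (Leg (graphic c) DT) := by
  obtain ⟨φ, w, hd, hw, hφ⟩ := hc.exists_angle
  have hφc : Continuous φ := continuous_iff_continuousAt.2 fun t => (hd t).continuousAt
  have hcc := hc.contDiff.continuous
  have hfin : (doubleTangents c).Finite :=
    Finite.of_finite_image (by rw [image_doubleTangents]; exact hc.dbltangents_finite)
      injective_lineSet_out.injOn
  have hlift : ∀ z : X₂sp, ∃ L, lineClass L = z := fun z => Quotient.exists_rep z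
  refine ⟨hfin.toFinset, ?_, ⟨{
    φ := φ
    h := fun t => cos (φ t) * (c t).1 + sin (φ t) * (c t).2
    φ_cont := hφc
    h_cont := by fun_prop
    per := hc.periodic_lineThrough hφ
    mem := ?_
    Z := {t | signedCurv c t = 0}
    Z_fin := hc.finite_inflections
    Z_img := ?_
    inj := ?_
    DT_sub := ?_
    fib := ?_
    H := supportFun c
    H_cont := hc.continuous_supportFun
    H_per := ?_
    le_H := ?_
    H_mem := hc.supportFun_mem }⟩⟩
  · rw [← ncard_eq_toFinset_card _ hfin, ← image_doubleTangents]
    exact (ncard_image_of_injective _ injective_lineSet_out).symm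
  · intro z
    constructor
    · rintro ⟨L, rfl, t, ht⟩
      exact ⟨t, ((hc.tangentAt_iff (hφ t)).1 ht).symm⟩
    · rintro ⟨t, rfl⟩
      exact hc.lineThrough_mem_graphic (hφ t)
  · refine (hc.inflections_finite.image fun t => lineThrough (φ t) (c t)).subset ?_
    rintro z ⟨t, ht, rfl⟩
    exact ⟨Int.fract t, ⟨⟨Int.fract_nonneg t, Int.fract_lt_one t⟩,
      (hc.signedCurv_fract t).trans ht⟩, hc.lineThrough_fract hφ t⟩
  · intro a b hab s hs t ht hst
    have aux : ∀ s ∈ Icc a b, ∀ t ∈ Icc a b, φ s = φ t → ¬ s < t := by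
      intro s hs t ht hst hlt
      obtain ⟨u, hu, hu0⟩ := exists_hasDerivAt_eq_zero hlt hφc.continuousOn hst fun u _ => hd u
      exact hab u ⟨hs.1.trans_lt hu.1, hu.2.trans_le ht.2⟩ (hw u hu0)
    exact le_antisymm (not_lt.1 (aux t ht s hs hst.symm)) (not_lt.1 (aux s hs t ht hst))
  · intro z hz
    obtain ⟨L, rfl, -, p, q, -, hpq⟩ := hfin.mem_toFinset.1 hz
    have hp : p ∈ tangencyPts c L.val := by rw [hpq]; exact mem_insert _ _
    obtain ⟨t, -, ht, -⟩ := hp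
    exact ⟨L, rfl, t, ht⟩
  · intro a z hz
    obtain ⟨L, rfl⟩ := hlift z
    have hn := hc.ncard_fibre hφ L a
    have hmem : lineClass L ∈ hfin.toFinset ↔ IsDoubleTangent c L.val := by
      rw [hfin.mem_toFinset]
      constructor
      · rintro ⟨L', h, hL'⟩
        exact (hc.isDoubleTangent_congr h).1 hL'
      · exact fun h => ⟨L, rfl, h⟩
    constructor
    · intro h
      obtain ⟨-, p, q, hpq, he⟩ := hmem.1 h
      refine hn.trans ?_
      rw [he, ncard_pair hpq]
    · intro h
      refine hn.trans (ncard_eq_one.2 ?_)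
      obtain ⟨t, ht⟩ := hc.exists_tangentAt hz
      have hne : (tangencyPts c L.val).Nonempty := by
        rw [← hc.image_fibre hφ]
        refine ⟨_, Int.fract t, ⟨⟨Int.fract_nonneg t, Int.fract_lt_one t⟩, ?_⟩, rfl⟩
        exact (hc.lineThrough_fract hφ t).trans ((hc.tangentAt_iff (hφ t)).1 ht).symm
      obtain ⟨p, hp⟩ := hne
      refine ⟨p, Subset.antisymm (fun q hq => ?_) (singleton_subset_iff.2 hp)⟩
      by_contra hqp
      refine h (hmem.2 ⟨L.2, p, q, fun e => hqp e.symm, Subset.antisymm (fun r hr => ?_) ?_⟩)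
      · rcases hc.no_triple_tangent _ L.2 p hp q hq r hr with h | h | h
        · exact absurd h.symm hqp
        · exact Or.inr h.symm
        · exact Or.inl h.symm
      · exact insert_subset hp (singleton_subset_iff.2 hq)
  · intro x
    simp only [supportFun, cos_add_two_pi, sin_add_two_pi]
  · intro x p h
    obtain ⟨t, ht⟩ := hc.exists_tangentAt (L := ⟨_, isLine_normal x p⟩) h
    have h2 : cos x * (c t).1 + sin x * (c t).2 = p := ht.2.1
    exact h2 ▸ hc.le_supportFun x t

end GenericPlane

end

end

theorem graphic_regions_count (γ : ℝ → ℝ × ℝ × ℝ) (hγ : GenericSpace γ) (v r f : ℕ)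
    (hv : v = Nat.card {ℓ : Set (ℝ × ℝ) | IsDoubleTangentLine (proj γ) ℓ})
    (hr : r = Nat.card (ConnectedComponents ↥((graphic (proj γ))ᶜ)))
    (hf : f = Nat.card {C : ConnectedComponents ↥((graphic (proj γ))ᶜ) |
        SimplyConnectedSpace ↥(ConnectedComponents.mk ⁻¹' {C})}) :
    v = f ∧ (r = f + 1 ∨ r = f + 2) ∧
      (r = f + 2 ↔ ∃ C : ConnectedComponents ↥((graphic (proj γ))ᶜ),
        Nonempty (↥(ConnectedComponents.mk ⁻¹' {C}) ≃ₜ MobiusBand)) := by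
  obtain ⟨DT, hcard, ⟨L⟩⟩ := hγ.2.2.exists_leg
  obtain ⟨F⟩ := L.nonempty_front
  obtain ⟨h1, h2, h3⟩ := F.count
  rw [hcard, ← hv] at h1 h2 h3
  have hvf : v = f := hf.symm ▸ h1.symm
  rw [← hvf, hr]
  exact ⟨rfl, h2, h3⟩

end KWidth
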